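/- Let n ≥ 1 and let q > 1 satisfy (n−2)q < n. Then there is no positive bounded classical solution u of the half-space problem ∂ₜu = Δu in ℝⁿ₊×ℝ, −∂u/∂x₁ = u^q on ∂ℝⁿ₊×ℝ, which is axially symmetric, i.e. such that u(x₁,x̃,t) depends on x̃ = (x₂,…,xₙ) only through |x̃|. -/

import Mathlib

open scoped BigOperators
open Set

/-- The Laplacian of `f : ℝⁿ → ℝ` at `x`, as the sum of the second partial
derivatives in the coordinate directions. -/
noncomputable def lap {n : ℕ} (f : EuclideanSpace ℝ (Fin n) → ℝ)
    (x : EuclideanSpace ℝ (Fin n)) : ℝ :=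
  ∑ i : Fin n,
    fderiv ℝ (fun y => fderiv ℝ f y (EuclideanSpace.single i 1)) x
      (EuclideanSpace.single i 1)

/-- The open half-space `ℝⁿ₊ = {x : x₁ > 0}`. -/
def openHalf (n : ℕ) (hn : 0 < n) : Set (EuclideanSpace ℝ (Fin n)) :=
  {x | 0 < x ⟨0, hn⟩}

/-- The closed half-space `{x : x₁ ≥ 0}` (the closure of `ℝⁿ₊`). -/
def closedHalf (n : ℕ) (hn : 0 < n) : Set (EuclideanSpace ℝ (Fin n)) :=
  {x | 0 ≤ x ⟨0, hn⟩}

/-- `u` is a positive classical solution of the half-space problem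
`∂ₜu = Δu` in `ℝⁿ₊ × ℝ`, `-∂u/∂x₁ = u^q` on `∂ℝⁿ₊ × ℝ`: it is continuous together
with its spatial gradient up to the boundary, `C²` in `x` and `C¹` in `t` in the
open half-space, satisfies the heat equation inside and the nonlinear boundary
condition on the boundary, and is everywhere positive. -/
def IsHalfSpaceSol (n : ℕ) (hn : 0 < n) (q : ℝ)
    (u : EuclideanSpace ℝ (Fin n) × ℝ → ℝ) : Prop :=
  ContinuousOn u (closedHalf n hn ×ˢ (univ : Set ℝ)) ∧
  (∀ t, ContDiffOn ℝ 1 (fun x => u (x, t)) (closedHalf n hn)) ∧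
  (∀ t, ContinuousOn
    (fun x => fderivWithin ℝ (fun y => u (y, t)) (closedHalf n hn) x)
    (closedHalf n hn)) ∧
  (∀ t, ContDiffOn ℝ 2 (fun x => u (x, t)) (openHalf n hn)) ∧
  (∀ x ∈ openHalf n hn, ContDiff ℝ 1 fun s => u (x, s)) ∧
  (∀ x ∈ openHalf n hn, ∀ t : ℝ,
    deriv (fun s => u (x, s)) t = lap (fun y => u (y, t)) x) ∧
  (∀ x : EuclideanSpace ℝ (Fin n), x ⟨0, hn⟩ = 0 → ∀ t : ℝ,
    -(fderivWithin ℝ (fun y => u (y, t)) (closedHalf n hn) x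
        (EuclideanSpace.single ⟨0, hn⟩ 1)) = u (x, t) ^ q) ∧
  (∀ x ∈ closedHalf n hn, ∀ t : ℝ, 0 < u (x, t))

/-- `u` is axially symmetric: `u(x₁, x̃, t)` depends on `x̃ = (x₂,…,xₙ)` only
through `|x̃|`. -/
def AxiallySymmetric (n : ℕ) (hn : 0 < n)
    (u : EuclideanSpace ℝ (Fin n) × ℝ → ℝ) : Prop :=
  ∀ x y : EuclideanSpace ℝ (Fin n), x ⟨0, hn⟩ = y ⟨0, hn⟩ →
    (∑ i ∈ Finset.univ.erase ⟨0, hn⟩, (x i) ^ 2)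
      = (∑ i ∈ Finset.univ.erase ⟨0, hn⟩, (y i) ^ 2) →
    ∀ t : ℝ, u (x, t) = u (y, t)

open MeasureTheory Set Filter Topology

/-- The open quarter plane. -/
def quarter : Set (ℝ × ℝ) := Ioi 0 ×ˢ Ioi 0

/-- The Gaussian weight on the boundary half-line. -/
noncomputable def kap0 (a : ℕ) (r : ℝ) : ℝ := Real.exp (-(r ^ 2) / 4) * r ^ a

/-- The Gaussian weight on the quarter plane. -/
noncomputable def kap (a : ℕ) (x r : ℝ) : ℝ := Real.exp (-(x ^ 2) / 4) * kap0 a r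

/-- Continuous functions of polynomial growth on the quarter plane. -/
def PolyB (h : ℝ → ℝ → ℝ) : Prop :=
  ContinuousOn (Function.uncurry h) quarter ∧
    ∃ C : ℝ, ∃ N : ℕ, 0 ≤ C ∧ ∀ x, 0 < x → ∀ r, 0 < r → |h x r| ≤ C * (1 + x + r) ^ N

/-- Continuous functions of polynomial growth on the quarter plane, with a simple
singularity allowed at `x = 0`. -/
def PolyS (h : ℝ → ℝ → ℝ) : Prop := PolyB (fun x r => x / (1 + x) * h x r)

/-- Continuous functions of polynomial growth on the half-line. -/
def PolyZ (h : ℝ → ℝ) : Prop :=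
  ContinuousOn h (Ioi 0) ∧
    ∃ C : ℝ, ∃ N : ℕ, 0 ≤ C ∧ ∀ r, 0 < r → |h r| ≤ C * (1 + r) ^ N

/-- Weighted integral over the quarter plane. -/
noncomputable def wint (a : ℕ) (h : ℝ → ℝ → ℝ) : ℝ :=
  ∫ p in quarter, kap a p.1 p.2 * h p.1 p.2

/-- Weighted integral over the half-line. -/
noncomputable def bint (a : ℕ) (h : ℝ → ℝ) : ℝ :=
  ∫ r in Ioi (0 : ℝ), kap0 a r * h r

theorem measurableSet_quarter : MeasurableSet quarter :=
  measurableSet_Ioi.prod measurableSet_Ioi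

theorem kap0_pos (a : ℕ) {r : ℝ} (hr : 0 < r) : 0 < kap0 a r := by
  unfold kap0; positivity

theorem kap_pos (a : ℕ) (x : ℝ) {r : ℝ} (hr : 0 < r) : 0 < kap a x r := by
  unfold kap; have := kap0_pos a hr; positivity

theorem continuous_kap0 (a : ℕ) : Continuous (kap0 a) := by unfold kap0; fun_prop

theorem continuous_kap (a : ℕ) : Continuous (fun p : ℝ × ℝ => kap a p.1 p.2) := by
  unfold kap kap0; fun_prop

theorem pow_mul_kap_le (a N : ℕ) : ∃ C : ℝ, 0 < C ∧ ∀ x r : ℝ, 0 ≤ x → 0 ≤ r →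
    (1 + x + r) ^ N * kap a x r ≤ C * (Real.exp (-x) * Real.exp (-r)) := by
  refine ⟨(Nat.factorial (N + a) : ℝ) * Real.exp 9, by positivity, fun x r hx hr => ?_⟩
  have h1 : (1 + x + r) ^ (N + a) ≤ (Nat.factorial (N + a) : ℝ) * Real.exp (1 + x + r) := by
    have := Real.pow_div_factorial_le_exp (1 + x + r) (by positivity) (N + a)
    rwa [div_le_iff₀ (by positivity), mul_comm] at this
  have h2 : (1 + x + r) ^ N * r ^ a ≤ (1 + x + r) ^ (N + a) := by
    rw [pow_add]; gcongr; linarith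
  have h3 : Real.exp (1 + x + r) * (Real.exp (-(x ^ 2) / 4) * Real.exp (-(r ^ 2) / 4))
      ≤ Real.exp 9 * (Real.exp (-x) * Real.exp (-r)) := by
    rw [← Real.exp_add, ← Real.exp_add, ← Real.exp_add, ← Real.exp_add]
    apply Real.exp_le_exp.2
    nlinarith [sq_nonneg (x - 4), sq_nonneg (r - 4)]
  unfold kap kap0
  calc (1 + x + r) ^ N * (Real.exp (-(x ^ 2) / 4) * (Real.exp (-(r ^ 2) / 4) * r ^ a))
      = ((1 + x + r) ^ N * r ^ a) * (Real.exp (-(x ^ 2) / 4) * Real.exp (-(r ^ 2) / 4)) := by ring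
    _ ≤ ((Nat.factorial (N + a) : ℝ) * Real.exp (1 + x + r)) *
        (Real.exp (-(x ^ 2) / 4) * Real.exp (-(r ^ 2) / 4)) := by
        exact mul_le_mul_of_nonneg_right (h2.trans h1) (by positivity)
    _ = (Nat.factorial (N + a) : ℝ) * (Real.exp (1 + x + r) *
        (Real.exp (-(x ^ 2) / 4) * Real.exp (-(r ^ 2) / 4))) := by ring
    _ ≤ (Nat.factorial (N + a) : ℝ) * (Real.exp 9 * (Real.exp (-x) * Real.exp (-r))) := by gcongr
    _ = _ := by ring

theorem pow_mul_kap0_le (a N : ℕ) : ∃ C : ℝ, 0 < C ∧ ∀ r : ℝ, 0 ≤ r →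
    (1 + r) ^ N * kap0 a r ≤ C * Real.exp (-r) := by
  obtain ⟨C, hC, h⟩ := pow_mul_kap_le a N
  refine ⟨C, hC, fun r hr => ?_⟩
  have := h 0 r le_rfl hr
  simpa [kap] using this

theorem integrableOn_exp_prod : IntegrableOn
    (fun p : ℝ × ℝ => Real.exp (-p.1) * Real.exp (-p.2)) quarter := by
  have h := (integrableOn_exp_neg_Ioi 0)
  have := Integrable.mul_prod (μ := volume.restrict (Ioi (0:ℝ)))
    (ν := volume.restrict (Ioi (0:ℝ))) h h
  rw [Measure.prod_restrict] at this
  exact this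

/-- Weighted integrability from continuity and a polynomial bound. -/
theorem integrableOn_kap_mul (a : ℕ) {s : Set (ℝ × ℝ)} (hs : MeasurableSet s) (hsq : s ⊆ quarter)
    {h : ℝ → ℝ → ℝ} (hc : ContinuousOn (Function.uncurry h) s) {C : ℝ} {N : ℕ}
    (hb : ∀ p ∈ s, |h p.1 p.2| ≤ C * (1 + p.1 + p.2) ^ N) :
    IntegrableOn (fun p : ℝ × ℝ => kap a p.1 p.2 * h p.1 p.2) s := by
  obtain ⟨K, hK, hk⟩ := pow_mul_kap_le a N
  refine Integrable.mono' ((integrableOn_exp_prod.mono_set hsq).const_mul (|C| * K)) ?_ ?_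
  · exact ((continuous_kap a).continuousOn.mul hc).aestronglyMeasurable hs
  · refine (ae_restrict_mem hs).mono fun p hp => ?_
    obtain ⟨hx, hr⟩ : 0 < p.1 ∧ 0 < p.2 := hsq hp
    have h1 := hk p.1 p.2 hx.le hr.le
    have hkp := kap_pos a p.1 hr
    rw [Real.norm_eq_abs, abs_mul, abs_of_pos hkp]
    have hpw : 0 < (1 + p.1 + p.2) ^ N := by positivity
    calc kap a p.1 p.2 * |h p.1 p.2| ≤ kap a p.1 p.2 * (|C| * (1 + p.1 + p.2) ^ N) := by
          gcongr
          exact (hb p hp).trans (by gcongr; exact le_abs_self C)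
      _ = |C| * ((1 + p.1 + p.2) ^ N * kap a p.1 p.2) := by ring
      _ ≤ |C| * (K * (Real.exp (-p.1) * Real.exp (-p.2))) := by gcongr
      _ = _ := by ring

theorem PolyB.integrableOn {h : ℝ → ℝ → ℝ} (hh : PolyB h) (a : ℕ) :
    IntegrableOn (fun p : ℝ × ℝ => kap a p.1 p.2 * h p.1 p.2) quarter := by
  obtain ⟨hc, C, N, -, hb⟩ := hh
  exact integrableOn_kap_mul a measurableSet_quarter Subset.rfl hc
    (fun p hp => hb p.1 hp.1 p.2 hp.2)

theorem PolyZ.integrableOn {h : ℝ → ℝ} (hh : PolyZ h) (a : ℕ) :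
    IntegrableOn (fun r => kap0 a r * h r) (Ioi 0) := by
  obtain ⟨hc, C, N, hC, hb⟩ := hh
  obtain ⟨K, hK, hk⟩ := pow_mul_kap0_le a N
  refine Integrable.mono' ((integrableOn_exp_neg_Ioi 0).const_mul (C * K)) ?_ ?_
  · exact ((continuous_kap0 a).continuousOn.mul hc).aestronglyMeasurable measurableSet_Ioi
  · refine (ae_restrict_mem measurableSet_Ioi).mono fun r hr => ?_
    have hr : 0 < r := hr
    have h1 := hk r hr.le
    have hkp := kap0_pos a hr
    rw [Real.norm_eq_abs, abs_mul, abs_of_pos hkp]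
    calc kap0 a r * |h r| ≤ kap0 a r * (C * (1 + r) ^ N) := by gcongr; exact hb r hr
      _ = C * ((1 + r) ^ N * kap0 a r) := by ring
      _ ≤ C * (K * Real.exp (-r)) := by gcongr
      _ = _ := by ring

section closure

variable {f g : ℝ → ℝ → ℝ}

theorem PolyB.add (hf : PolyB f) (hg : PolyB g) : PolyB (fun x r => f x r + g x r) := by
  obtain ⟨hfc, C, N, hC, hfb⟩ := hf
  obtain ⟨hgc, D, K, hD, hgb⟩ := hg
  refine ⟨hfc.add hgc, C + D, N + K, by positivity, fun x hx r hr => ?_⟩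
  have h1 : 1 ≤ 1 + x + r := by linarith
  have h2 : (1 + x + r) ^ N ≤ (1 + x + r) ^ (N + K) := pow_le_pow_right₀ h1 (by omega)
  have h3 : (1 + x + r) ^ K ≤ (1 + x + r) ^ (N + K) := pow_le_pow_right₀ h1 (by omega)
  calc |f x r + g x r| ≤ |f x r| + |g x r| := abs_add_le _ _
    _ ≤ C * (1 + x + r) ^ N + D * (1 + x + r) ^ K := add_le_add (hfb x hx r hr) (hgb x hx r hr)
    _ ≤ C * (1 + x + r) ^ (N + K) + D * (1 + x + r) ^ (N + K) := by gcongr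
    _ = _ := by ring

theorem PolyB.mul (hf : PolyB f) (hg : PolyB g) : PolyB (fun x r => f x r * g x r) := by
  obtain ⟨hfc, C, N, hC, hfb⟩ := hf
  obtain ⟨hgc, D, K, hD, hgb⟩ := hg
  refine ⟨hfc.mul hgc, C * D, N + K, by positivity, fun x hx r hr => ?_⟩
  calc |f x r * g x r| = |f x r| * |g x r| := abs_mul _ _
    _ ≤ (C * (1 + x + r) ^ N) * (D * (1 + x + r) ^ K) := by
        gcongr
        · exact hfb x hx r hr
        · exact hgb x hx r hr
    _ = _ := by ring

theorem PolyB.congr (hf : PolyB f) (h : ∀ x, 0 < x → ∀ r, 0 < r → g x r = f x r) : PolyB g := by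
  obtain ⟨hfc, C, N, hC, hfb⟩ := hf
  refine ⟨hfc.congr fun p hp => h p.1 hp.1 p.2 hp.2, C, N, hC, fun x hx r hr => ?_⟩
  rw [h x hx r hr]; exact hfb x hx r hr

/-- A continuous function dominated by a function of polynomial growth. -/
theorem PolyB.const (c : ℝ) : PolyB (fun _ _ => c) :=
  ⟨continuousOn_const, |c|, 0, abs_nonneg c, fun x _ r _ => by simp⟩

theorem PolyB.fst : PolyB (fun x _ => x) :=
  ⟨continuous_fst.continuousOn, 1, 1, zero_le_one, fun x hx r hr => by
    rw [abs_of_pos hx]; linarith⟩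

theorem PolyB.snd : PolyB (fun _ r => r) :=
  ⟨continuous_snd.continuousOn, 1, 1, zero_le_one, fun x hx r hr => by
    rw [abs_of_pos hr]; linarith⟩

theorem PolyB.const_mul (c : ℝ) (hf : PolyB f) : PolyB (fun x r => c * f x r) :=
  (PolyB.const c).mul hf

theorem PolyB.neg (hf : PolyB f) : PolyB (fun x r => -f x r) :=
  (hf.const_mul (-1)).congr fun x _ r _ => by ring

theorem PolyB.sub (hf : PolyB f) (hg : PolyB g) : PolyB (fun x r => f x r - g x r) :=
  (hf.add hg.neg).congr fun x _ r _ => by ring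

theorem PolyB.pow (hf : PolyB f) (n : ℕ) : PolyB (fun x r => f x r ^ n) := by
  induction n with
  | zero => exact (PolyB.const 1).congr fun x _ r _ => by simp
  | succ n ih => exact (ih.mul hf).congr fun x _ r _ => by ring

theorem PolyS.congr (hf : PolyS f) (h : ∀ x, 0 < x → ∀ r, 0 < r → g x r = f x r) : PolyS g :=
  PolyB.congr (f := fun x r => x / (1 + x) * f x r) hf fun x hx r hr => by rw [h x hx r hr]

theorem PolyS.add (hf : PolyS f) (hg : PolyS g) : PolyS (fun x r => f x r + g x r) :=
  (PolyB.add hf hg).congr fun x _ r _ => by ring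

theorem PolyB.mulS (hf : PolyB f) (hg : PolyS g) : PolyS (fun x r => f x r * g x r) :=
  (PolyB.mul hf hg).congr fun x _ r _ => by ring

theorem PolyS.sub (hf : PolyS f) (hg : PolyS g) : PolyS (fun x r => f x r - g x r) :=
  (PolyB.sub hf hg).congr fun x _ r _ => by ring

theorem PolyS.const_mul (c : ℝ) (hf : PolyS f) : PolyS (fun x r => c * f x r) :=
  (PolyB.const c).mulS hf

theorem polyB_ratio : PolyB (fun x _ => x / (1 + x)) := by
  refine ⟨?_, 1, 0, zero_le_one, fun x hx r hr => ?_⟩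
  · refine ContinuousOn.div continuous_fst.continuousOn
      (continuous_const.add continuous_fst).continuousOn fun p hp => ?_
    have : 0 < p.1 := hp.1
    positivity
  · rw [abs_of_pos (by positivity), div_le_iff₀ (by positivity)]; simp

theorem PolyB.polyS (hf : PolyB f) : PolyS f := PolyB.mul polyB_ratio hf

theorem PolyS.continuousOn (hf : PolyS f) : ContinuousOn (Function.uncurry f) quarter := by
  have h1 : ContinuousOn (fun p : ℝ × ℝ => (1 + p.1) / p.1) quarter :=
    ContinuousOn.div (by fun_prop) (by fun_prop) fun p hp => (ne_of_gt hp.1)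
  refine (h1.mul hf.1).congr fun p hp => ?_
  have : 0 < p.1 := hp.1
  change f p.1 p.2 = (1 + p.1) / p.1 * (p.1 / (1 + p.1) * f p.1 p.2)
  field_simp

theorem PolyS.bound (hf : PolyS f) : ∃ C : ℝ, ∃ N : ℕ, 0 ≤ C ∧ ∀ x, 0 < x → ∀ r, 0 < r →
    |f x r| ≤ (1 + 1 / x) * (C * (1 + x + r) ^ N) := by
  obtain ⟨-, C, N, hC, hb⟩ := hf
  refine ⟨C, N, hC, fun x hx r hr => ?_⟩
  have h := hb x hx r hr
  rw [abs_mul, abs_of_pos (by positivity : 0 < x / (1 + x))] at h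
  calc |f x r| = (1 + 1 / x) * (x / (1 + x) * |f x r|) := by field_simp; ring
    _ ≤ _ := by gcongr

theorem wint_congr (a : ℕ) (h : ∀ x, 0 < x → ∀ r, 0 < r → f x r = g x r) :
    wint a f = wint a g :=
  setIntegral_congr_fun measurableSet_quarter fun p hp => by
    simp only [h p.1 hp.1 p.2 hp.2]

theorem wint_mono (a : ℕ) (hf : PolyB f) (hg : PolyB g)
    (h : ∀ x, 0 < x → ∀ r, 0 < r → f x r ≤ g x r) : wint a f ≤ wint a g :=
  setIntegral_mono_on (hf.integrableOn a) (hg.integrableOn a) measurableSet_quarter fun p hp =>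
    mul_le_mul_of_nonneg_left (h p.1 hp.1 p.2 hp.2) (kap_pos a p.1 hp.2).le

theorem wint_nonneg (a : ℕ) (h : ∀ x, 0 < x → ∀ r, 0 < r → 0 ≤ f x r) : 0 ≤ wint a f :=
  setIntegral_nonneg measurableSet_quarter fun p hp =>
    mul_nonneg (kap_pos a p.1 hp.2).le (h p.1 hp.1 p.2 hp.2)

theorem wint_add (a : ℕ) (hf : PolyB f) (hg : PolyB g) :
    wint a (fun x r => f x r + g x r) = wint a f + wint a g := by
  unfold wint
  rw [← integral_add (hf.integrableOn a) (hg.integrableOn a)]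
  congr 1; ext p; ring

theorem wint_const_mul (a : ℕ) (c : ℝ) (f : ℝ → ℝ → ℝ) :
    wint a (fun x r => c * f x r) = c * wint a f := by
  unfold wint
  rw [← integral_const_mul]
  congr 1; ext p; ring

theorem wint_sub (a : ℕ) (hf : PolyB f) (hg : PolyB g) :
    wint a (fun x r => f x r - g x r) = wint a f - wint a g := by
  unfold wint
  rw [← integral_sub (hf.integrableOn a) (hg.integrableOn a)]
  congr 1; ext p; ring

end closure

section closureZ

variable {f g : ℝ → ℝ}

theorem PolyB.of_snd (hf : PolyZ f) : PolyB (fun _ r => f r) := by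
  obtain ⟨hc, C, N, hC, hb⟩ := hf
  refine ⟨hc.comp continuousOn_snd fun p hp => hp.2, C, N, hC, fun x hx r hr =>
    (hb r hr).trans ?_⟩
  gcongr; linarith

theorem PolyZ.of_polyB (hf : PolyB (fun _ r => f r)) : PolyZ f := by
  obtain ⟨hc, C, N, hC, hb⟩ := hf
  refine ⟨?_, C * 2 ^ N, N, by positivity, fun r hr => (hb 1 one_pos r hr).trans ?_⟩
  · have : ContinuousOn (fun r : ℝ => ((1 : ℝ), r)) (Ioi 0) := by fun_prop
    exact hc.comp this fun r hr => ⟨show (0 : ℝ) < 1 from one_pos, hr⟩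
  · rw [mul_assoc, ← mul_pow]; gcongr; linarith

theorem PolyZ.add (hf : PolyZ f) (hg : PolyZ g) : PolyZ (fun r => f r + g r) :=
  .of_polyB ((PolyB.of_snd hf).add (PolyB.of_snd hg))

theorem PolyZ.sub (hf : PolyZ f) (hg : PolyZ g) : PolyZ (fun r => f r - g r) :=
  .of_polyB ((PolyB.of_snd hf).sub (PolyB.of_snd hg))

theorem PolyZ.mul (hf : PolyZ f) (hg : PolyZ g) : PolyZ (fun r => f r * g r) :=
  .of_polyB ((PolyB.of_snd hf).mul (PolyB.of_snd hg))

theorem PolyZ.const (c : ℝ) : PolyZ (fun _ => c) := .of_polyB (PolyB.const c)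

theorem PolyZ.id : PolyZ (fun r => r) := .of_polyB PolyB.snd

theorem PolyZ.const_mul (c : ℝ) (hf : PolyZ f) : PolyZ (fun r => c * f r) :=
  (PolyZ.const c).mul hf

theorem PolyZ.neg (hf : PolyZ f) : PolyZ (fun r => -f r) := .of_polyB (PolyB.of_snd hf).neg

theorem PolyZ.congr (hf : PolyZ f) (h : ∀ r, 0 < r → g r = f r) : PolyZ g :=
  .of_polyB ((PolyB.of_snd hf).congr fun _ _ r hr => h r hr)

theorem PolyZ.pow (hf : PolyZ f) (n : ℕ) : PolyZ (fun r => f r ^ n) :=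
  .of_polyB ((PolyB.of_snd hf).pow n)

theorem bint_congr (a : ℕ) (h : ∀ r, 0 < r → f r = g r) : bint a f = bint a g :=
  setIntegral_congr_fun measurableSet_Ioi fun r hr => by simp only [h r hr]

theorem bint_mono (a : ℕ) (hf : PolyZ f) (hg : PolyZ g) (h : ∀ r, 0 < r → f r ≤ g r) :
    bint a f ≤ bint a g :=
  setIntegral_mono_on (hf.integrableOn a) (hg.integrableOn a) measurableSet_Ioi fun r hr =>
    mul_le_mul_of_nonneg_left (h r hr) (kap0_pos a hr).le

theorem bint_nonneg (a : ℕ) (h : ∀ r, 0 < r → 0 ≤ f r) : 0 ≤ bint a f :=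
  setIntegral_nonneg measurableSet_Ioi fun r hr => mul_nonneg (kap0_pos a hr).le (h r hr)

theorem bint_add (a : ℕ) (hf : PolyZ f) (hg : PolyZ g) :
    bint a (fun r => f r + g r) = bint a f + bint a g := by
  unfold bint
  rw [← integral_add (hf.integrableOn a) (hg.integrableOn a)]
  congr 1; ext p; ring

theorem bint_sub (a : ℕ) (hf : PolyZ f) (hg : PolyZ g) :
    bint a (fun r => f r - g r) = bint a f - bint a g := by
  unfold bint
  rw [← integral_sub (hf.integrableOn a) (hg.integrableOn a)]
  congr 1; ext p; ring

theorem bint_const_mul (a : ℕ) (c : ℝ) (f : ℝ → ℝ) :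
    bint a (fun r => c * f r) = c * bint a f := by
  unfold bint
  rw [← integral_const_mul]
  congr 1; ext p; ring

end closureZ

theorem hasDerivAt_kap_fst (a : ℕ) (x r : ℝ) :
    HasDerivAt (fun y => kap a y r) (-(x / 2) * kap a x r) x := by
  have h : HasDerivAt (fun y : ℝ => -(y ^ 2) / 4) (-(x / 2)) x := by
    have := ((hasDerivAt_pow 2 x).neg).div_const 4
    refine this.congr_deriv ?_
    norm_num; ring
  refine (h.exp.mul_const (kap0 a r)).congr_deriv ?_
  unfold kap; ring

theorem hasDerivAt_kap0 (a : ℕ) {r : ℝ} (hr : 0 < r) :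
    HasDerivAt (kap0 a) ((a / r - r / 2) * kap0 a r) r := by
  have h : HasDerivAt (fun y : ℝ => -(y ^ 2) / 4) (-(r / 2)) r := by
    have := ((hasDerivAt_pow 2 r).neg).div_const 4
    refine this.congr_deriv ?_
    norm_num; ring
  refine (h.exp.mul (hasDerivAt_pow a r)).congr_deriv ?_
  unfold kap0
  rcases a with _ | a
  · simp; ring
  · simp only [Nat.add_sub_cancel]; field_simp; ring

theorem hasDerivAt_kap_snd (a : ℕ) (x : ℝ) {r : ℝ} (hr : 0 < r) :
    HasDerivAt (fun y => kap a x y) ((a / r - r / 2) * kap a x r) r := by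
  refine ((hasDerivAt_kap0 a hr).const_mul _).congr_deriv ?_
  unfold kap; ring

theorem tendsto_kap_mul_zero (a : ℕ) {r : ℝ} (hr : 0 < r) {φ : ℝ → ℝ} {C : ℝ} {N : ℕ}
    {ε : ℝ} (hε : 0 < ε) (hC : 0 ≤ C) (h : ∀ x, ε ≤ x → |φ x| ≤ C * (1 + x + r) ^ N) :
    Tendsto (fun x => kap a x r * φ x) atTop (𝓝 0) := by
  obtain ⟨K, hK, hk⟩ := pow_mul_kap_le a N
  have h0 : Tendsto (fun x : ℝ => C * (K * (Real.exp (-x) * Real.exp (-r)))) atTop (𝓝 0) := by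
    have := (((Real.tendsto_exp_neg_atTop_nhds_zero).mul_const (Real.exp (-r))).const_mul K).const_mul C
    simpa using this
  refine squeeze_zero_norm' ?_ h0
  filter_upwards [eventually_ge_atTop ε] with x hx
  have hx0 : 0 < x := hε.trans_le hx
  rw [Real.norm_eq_abs, abs_mul, abs_of_pos (kap_pos a x hr)]
  calc kap a x r * |φ x| ≤ kap a x r * (C * (1 + x + r) ^ N) :=
        mul_le_mul_of_nonneg_left (h x hx) (kap_pos a x hr).le
    _ = C * ((1 + x + r) ^ N * kap a x r) := by ring
    _ ≤ _ := mul_le_mul_of_nonneg_left (hk x r hx0.le hr.le) hC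

theorem tendsto_kap_mul_zero_snd (a : ℕ) {x : ℝ} (hx : 0 < x) {φ : ℝ → ℝ} {C : ℝ} {N : ℕ}
    (hC : 0 ≤ C) (h : ∀ r, 0 < r → |φ r| ≤ C * (1 + x + r) ^ N) :
    Tendsto (fun r => kap a x r * φ r) atTop (𝓝 0) := by
  obtain ⟨K, hK, hk⟩ := pow_mul_kap_le a N
  have h0 : Tendsto (fun r : ℝ => C * (K * (Real.exp (-x) * Real.exp (-r)))) atTop (𝓝 0) := by
    have := (((Real.tendsto_exp_neg_atTop_nhds_zero).const_mul (Real.exp (-x))).const_mul K).const_mul C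
    simpa using this
  refine squeeze_zero_norm' ?_ h0
  filter_upwards [eventually_gt_atTop 0] with r hr
  rw [Real.norm_eq_abs, abs_mul, abs_of_pos (kap_pos a x hr)]
  calc kap a x r * |φ r| ≤ kap a x r * (C * (1 + x + r) ^ N) :=
        mul_le_mul_of_nonneg_left (h r hr) (kap_pos a x hr).le
    _ = C * ((1 + x + r) ^ N * kap a x r) := by ring
    _ ≤ _ := mul_le_mul_of_nonneg_left (hk x r hx.le hr.le) hC

theorem PolyS.integrableOn_strip {h : ℝ → ℝ → ℝ} (hh : PolyS h) (a : ℕ) {ε : ℝ} (hε : 0 < ε) :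
    IntegrableOn (fun p : ℝ × ℝ => kap a p.1 p.2 * h p.1 p.2) (Ioi ε ×ˢ Ioi 0) := by
  obtain ⟨C, N, hC, hb⟩ := hh.bound
  have hsub : Ioi ε ×ˢ Ioi 0 ⊆ quarter := prod_mono (Ioi_subset_Ioi hε.le) Subset.rfl
  refine integrableOn_kap_mul a (measurableSet_Ioi.prod measurableSet_Ioi) hsub
    (hh.continuousOn.mono hsub) (C := (1 + 1 / ε) * C) (N := N) fun p hp => ?_
  have h1 : ε < p.1 := hp.1
  have h2 : 0 < p.2 := hp.2
  have h3 : 0 < p.1 := hε.trans h1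
  refine (hb p.1 h3 p.2 h2).trans ?_
  rw [← mul_assoc]
  gcongr

/-- The divergence theorem on the quarter plane for the Gaussian weight. -/
theorem wint_div (a : ℕ) {f1 f1x f2 f2r d : ℝ → ℝ → ℝ} {f0 : ℝ → ℝ}
    (h1 : PolyB f1) (h1x : PolyS f1x) (h2 : PolyS (fun x r => f2 x r / r)) (h2r : PolyS f2r)
    (hd : PolyB d)
    (hD1 : ∀ x, 0 < x → ∀ r, 0 < r → HasDerivAt (fun y => f1 y r) (f1x x r) x)
    (hD2 : ∀ x, 0 < x → ∀ r, 0 < r → HasDerivAt (fun y => f2 x y) (f2r x r) r)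
    (hdeq : ∀ x, 0 < x → ∀ r, 0 < r →
      d x r = f1x x r + f2r x r - x / 2 * f1 x r + (a / r - r / 2) * f2 x r)
    (hlim : ∀ r, 0 < r → Tendsto (fun x => f1 x r) (𝓝[>] 0) (𝓝 (f0 r))) :
    wint a d = - bint a f0 := by
  set p1 : ℝ → ℝ → ℝ := fun x r => f1x x r - x / 2 * f1 x r with hp1
  set p2 : ℝ → ℝ → ℝ := fun x r => f2r x r + (a - r ^ 2 / 2) * (f2 x r / r) with hp2
  have hp1S : PolyS p1 :=
    h1x.sub (((PolyB.fst.const_mul (1 / 2)).congr fun x _ r _ => by ring).mul h1).polyS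
  have hp2S : PolyS p2 :=
    h2r.add (((PolyB.const (a : ℝ)).sub ((PolyB.snd.pow 2).const_mul (1 / 2)) |>.congr
      fun x _ r _ => by ring).mulS h2)
  have key : ∀ ε : ℝ, 0 < ε → ∫ p in Ioi ε ×ˢ Ioi 0, kap a p.1 p.2 * d p.1 p.2
      = -∫ r in Ioi (0 : ℝ), kap a ε r * f1 ε r := by
    intro ε hε
    have hi1 := hp1S.integrableOn_strip a hε
    have hi2 := hp2S.integrableOn_strip a hε
    have e1 : ∫ p in Ioi ε ×ˢ Ioi 0, kap a p.1 p.2 * p1 p.1 p.2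
        = -∫ r in Ioi (0 : ℝ), kap a ε r * f1 ε r := by
      have hi1' := hi1
      rw [IntegrableOn, Measure.volume_eq_prod, ← Measure.prod_restrict] at hi1'
      rw [Measure.volume_eq_prod, ← Measure.prod_restrict, integral_prod_symm _ hi1',
        ← integral_neg]
      refine integral_congr_ae ?_
      filter_upwards [hi1'.prod_left_ae, ae_restrict_mem measurableSet_Ioi] with r hir hr
      have hr : 0 < r := hr
      obtain ⟨-, C, N, hC, hb⟩ := h1
      have := integral_Ioi_of_hasDerivAt_of_tendsto' (a := ε) (m := 0)
        (f := fun x => kap a x r * f1 x r) (f' := fun x => kap a x r * p1 x r)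
        (fun x hx => by
          have hx : 0 < x := hε.trans_le hx
          refine ((hasDerivAt_kap_fst a x r).mul (hD1 x hx r hr)).congr_deriv ?_
          simp only [hp1]; ring) hir
        (tendsto_kap_mul_zero a hr hε hC fun x hx => hb x (hε.trans_le hx) r hr)
      simpa using this
    have e2 : ∫ p in Ioi ε ×ˢ Ioi 0, kap a p.1 p.2 * p2 p.1 p.2 = 0 := by
      have hi2' := hi2
      rw [IntegrableOn, Measure.volume_eq_prod, ← Measure.prod_restrict] at hi2'
      rw [Measure.volume_eq_prod, ← Measure.prod_restrict, integral_prod _ hi2']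
      refine integral_eq_zero_of_ae ?_
      filter_upwards [hi2'.prod_right_ae, ae_restrict_mem measurableSet_Ioi] with x hix hx
      have hx : 0 < x := hε.trans hx
      obtain ⟨C, N, hC, hb⟩ := h2.bound
      have hb' : ∀ r, 0 < r → |r * (f2 x r / r)| ≤ ((1 + 1 / x) * C) * (1 + x + r) ^ (N + 1) := by
        intro r hr
        rw [abs_mul, abs_of_pos hr, pow_succ]
        calc r * |f2 x r / r| ≤ (1 + x + r) * ((1 + 1 / x) * (C * (1 + x + r) ^ N)) := by
              gcongr
              · linarith
              · exact hb x hx r hr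
          _ = _ := by ring
      have := integral_Ioi_of_hasDerivAt_of_tendsto (a := 0) (m := 0)
        (f := fun r => kap a x r * (r * (f2 x r / r))) (f' := fun r => kap a x r * p2 x r) ?_
        (fun r hr => by
          have hr : 0 < r := hr
          have e : HasDerivAt (fun r => kap a x r * f2 x r) (kap a x r * p2 x r) r := by
            refine ((hasDerivAt_kap_snd a x hr).mul (hD2 x hx r hr)).congr_deriv ?_
            simp only [hp2]; field_simp; ring
          refine e.congr_of_eventuallyEq ?_
          filter_upwards [lt_mem_nhds hr] with y hy
          field_simp) hix
        (tendsto_kap_mul_zero_snd a hx (by positivity) hb')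
      · simpa using this
      · rw [ContinuousWithinAt, zero_mul, mul_zero]
        have hK : ContinuousWithinAt (fun r => |kap a x r| * (|r| *
            ((1 + 1 / x) * (C * (1 + x + |r|) ^ N)))) (Ici 0) 0 := by
          refine Continuous.continuousWithinAt ?_
          unfold kap kap0; fun_prop
        rw [ContinuousWithinAt] at hK
        simp only [abs_zero, zero_mul, mul_zero] at hK
        refine squeeze_zero_norm' ?_ hK
        filter_upwards [self_mem_nhdsWithin] with r hr
        rw [Real.norm_eq_abs, abs_mul, abs_mul]
        rcases (mem_Ici.1 hr).eq_or_lt with rfl | hr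
        · simp
        · gcongr
          rw [abs_of_pos hr]
          exact hb x hx r hr
    have e3 := integral_add hi1 hi2
    rw [e2, add_zero, e1] at e3
    rw [← e3]
    refine setIntegral_congr_fun (measurableSet_Ioi.prod measurableSet_Ioi) fun p hp => ?_
    have h3 : 0 < p.1 := hε.trans hp.1
    have h4 : 0 < p.2 := hp.2
    simp only [hp1, hp2, hdeq p.1 h3 p.2 h4]
    field_simp
    ring
  have hun : (⋃ n : ℕ, Ioi (1 / ((n : ℝ) + 1)) ×ˢ Ioi (0 : ℝ)) = quarter := by
    ext p
    simp only [mem_iUnion, quarter, mem_prod, mem_Ioi]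
    constructor
    · rintro ⟨n, hn, hp⟩
      exact ⟨lt_trans (by positivity) hn, hp⟩
    · rintro ⟨h, hp⟩
      obtain ⟨n, hn⟩ := exists_nat_one_div_lt h
      exact ⟨n, hn, hp⟩
  have hl1 := tendsto_setIntegral_of_monotone (μ := volume)
    (s := fun n : ℕ => Ioi (1 / ((n : ℝ) + 1)) ×ˢ Ioi (0 : ℝ))
    (f := fun p : ℝ × ℝ => kap a p.1 p.2 * d p.1 p.2)
    (fun n => measurableSet_Ioi.prod measurableSet_Ioi)
    (fun m n hmn => prod_mono (Ioi_subset_Ioi (by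
      have : (m : ℝ) ≤ n := by exact_mod_cast hmn
      gcongr)) Subset.rfl) (by rw [hun]; exact hd.integrableOn a)
  rw [hun] at hl1
  have hseq : Tendsto (fun n : ℕ => 1 / ((n : ℝ) + 1)) atTop (𝓝[>] 0) :=
    tendsto_nhdsWithin_iff.2 ⟨tendsto_one_div_add_atTop_nhds_zero_nat,
      Eventually.of_forall fun n => by simp only [mem_Ioi]; positivity⟩
  have hl2 : Tendsto (fun n : ℕ => ∫ r in Ioi (0 : ℝ), kap a (1 / ((n : ℝ) + 1)) r *
      f1 (1 / ((n : ℝ) + 1)) r) atTop (𝓝 (bint a f0)) := by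
    obtain ⟨hc, C, N, hC, hb⟩ := h1
    obtain ⟨K, hK, hk⟩ := pow_mul_kap_le a N
    refine tendsto_integral_filter_of_dominated_convergence
      (fun r => C * K * Real.exp (-r)) ?_ ?_ ?_ ?_
    · refine Eventually.of_forall fun n => ?_
      refine ContinuousOn.aestronglyMeasurable ?_ measurableSet_Ioi
      have hn : 0 < 1 / ((n : ℝ) + 1) := by positivity
      refine ContinuousOn.mul (by unfold kap kap0; fun_prop) ?_
      have : ContinuousOn (fun r : ℝ => ((1 / ((n : ℝ) + 1)), r)) (Ioi 0) := by fun_prop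
      exact hc.comp this fun r hr => ⟨hn, hr⟩
    · refine Eventually.of_forall fun n => ?_
      filter_upwards [ae_restrict_mem measurableSet_Ioi] with r hr
      have hr : 0 < r := hr
      have hn : 0 < 1 / ((n : ℝ) + 1) := by positivity
      set x := 1 / ((n : ℝ) + 1)
      rw [Real.norm_eq_abs, abs_mul, abs_of_pos (kap_pos a x hr)]
      calc kap a x r * |f1 x r| ≤ kap a x r * (C * (1 + x + r) ^ N) :=
            mul_le_mul_of_nonneg_left (hb x hn r hr) (kap_pos a x hr).le
        _ = C * ((1 + x + r) ^ N * kap a x r) := by ring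
        _ ≤ C * (K * (Real.exp (-x) * Real.exp (-r))) :=
            mul_le_mul_of_nonneg_left (hk x r hn.le hr.le) hC
        _ ≤ C * (K * (1 * Real.exp (-r))) := by
            gcongr; exact Real.exp_le_one_iff.2 (by linarith)
        _ = _ := by ring
    · exact (integrableOn_exp_neg_Ioi 0).const_mul _
    · filter_upwards [ae_restrict_mem measurableSet_Ioi] with r hr
      have hk0 : Tendsto (fun x => kap a x r) (𝓝[>] 0) (𝓝 (kap0 a r)) := by
        have : Continuous (fun x => kap a x r) := by unfold kap; fun_prop
        have h := (this.tendsto 0).mono_left (nhdsWithin_le_nhds (s := Ioi 0))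
        simpa [kap] using h
      exact ((hk0.mul (hlim r hr)).comp hseq)
  refine tendsto_nhds_unique hl1 ?_
  refine (hl2.neg).congr fun n => ?_
  rw [key _ (by positivity)]

/-- A function on the quarter plane together with its derivatives up to order two, the value
`G` of the drift Laplacian, and the boundary values on `x = 0`. -/
structure Profile where
  (w wx wr wxx wxr wrr G : ℝ → ℝ → ℝ)
  (w0 w0r : ℝ → ℝ)

/-- The compatibility, growth and boundary conditions of a profile. -/
structure Profile.Snap (φ : Profile) (a : ℕ) (q : ℝ) : Prop where
  pos : ∀ x, 0 < x → ∀ r, 0 < r → 0 < φ.w x r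
  pos0 : ∀ r, 0 < r → 0 < φ.w0 r
  bdd : ∃ B : ℝ, (∀ x, 0 < x → ∀ r, 0 < r → φ.w x r ≤ B) ∧ ∀ r, 0 < r → φ.w0 r ≤ B
  polyW : PolyB φ.w
  polyX : PolyB φ.wx
  polyR : PolyB φ.wr
  polyRr : PolyS (fun x r => φ.wr x r / r)
  polyXX : PolyS φ.wxx
  polyXR : PolyS φ.wxr
  polyRR : PolyS φ.wrr
  polyG : PolyB φ.G
  polyW0 : PolyZ φ.w0
  polyW0r : PolyZ φ.w0r
  derivX : ∀ x, 0 < x → ∀ r, 0 < r → HasDerivAt (fun y => φ.w y r) (φ.wx x r) x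
  derivR : ∀ x, 0 < x → ∀ r, 0 < r → HasDerivAt (fun y => φ.w x y) (φ.wr x r) r
  derivXX : ∀ x, 0 < x → ∀ r, 0 < r → HasDerivAt (fun y => φ.wx y r) (φ.wxx x r) x
  derivXR : ∀ x, 0 < x → ∀ r, 0 < r → HasDerivAt (fun y => φ.wx x y) (φ.wxr x r) r
  derivRX : ∀ x, 0 < x → ∀ r, 0 < r → HasDerivAt (fun y => φ.wr y r) (φ.wxr x r) x
  derivRR : ∀ x, 0 < x → ∀ r, 0 < r → HasDerivAt (fun y => φ.wr x y) (φ.wrr x r) r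
  eqG : ∀ x, 0 < x → ∀ r, 0 < r → φ.G x r =
    φ.wxx x r + φ.wrr x r + a / r * φ.wr x r - (x * φ.wx x r + r * φ.wr x r) / 2
  limW : ∀ r, 0 < r → Tendsto (fun x => φ.w x r) (𝓝[>] 0) (𝓝 (φ.w0 r))
  limX : ∀ r, 0 < r → Tendsto (fun x => φ.wx x r) (𝓝[>] 0) (𝓝 (-(φ.w0 r ^ q)))
  limR : ∀ r, 0 < r → Tendsto (fun x => φ.wr x r) (𝓝[>] 0) (𝓝 (φ.w0r r))
  deriv0 : ∀ r, 0 < r → HasDerivAt φ.w0 (φ.w0r r) r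

namespace Profile

/-- The weighted Dirichlet integral. -/
noncomputable def dir (φ : Profile) (a : ℕ) : ℝ :=
  wint a (fun x r => φ.wx x r ^ 2 + φ.wr x r ^ 2)

/-- The weighted mass of the square. -/
noncomputable def mass (φ : Profile) (a : ℕ) : ℝ := wint a (fun x r => φ.w x r ^ 2)

/-- The weighted integral of the square of the drift Laplacian. -/
noncomputable def lapSq (φ : Profile) (a : ℕ) : ℝ := wint a (fun x r => φ.G x r ^ 2)

/-- Weighted boundary integrals of powers. -/
noncomputable def bdry (φ : Profile) (a : ℕ) (p : ℝ) : ℝ := bint a (fun r => φ.w0 r ^ p)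

namespace Snap

variable {φ : Profile} {a : ℕ} {q : ℝ}

theorem polyPow (h : φ.Snap a q) {p : ℝ} (hp : 0 ≤ p) : PolyZ (fun r => φ.w0 r ^ p) := by
  obtain ⟨B, -, hB⟩ := h.bdd
  have hB0 : 0 < B := (h.pos0 1 one_pos).trans_le (hB 1 one_pos)
  refine ⟨h.polyW0.1.rpow_const fun r hr => Or.inl (h.pos0 r hr).ne', B ^ p, 0, by positivity,
    fun r hr => ?_⟩
  have := h.pos0 r hr
  rw [abs_of_pos (by positivity), pow_zero, mul_one]
  exact Real.rpow_le_rpow this.le (hB r hr) hp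

theorem polyDir (h : φ.Snap a q) : PolyB (fun x r => φ.wx x r ^ 2 + φ.wr x r ^ 2) :=
  (h.polyX.pow 2).add (h.polyR.pow 2)

theorem dir_nonneg (φ : Profile) (a : ℕ) : 0 ≤ φ.dir a :=
  wint_nonneg a fun x _ r _ => by positivity

theorem mass_nonneg (φ : Profile) (a : ℕ) : 0 ≤ φ.mass a :=
  wint_nonneg a fun x _ r _ => by positivity

theorem lapSq_nonneg (φ : Profile) (a : ℕ) : 0 ≤ φ.lapSq a :=
  wint_nonneg a fun x _ r _ => by positivity

theorem bdry_nonneg (h : φ.Snap a q) (p : ℝ) : 0 ≤ φ.bdry a p :=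
  bint_nonneg a fun r hr => (Real.rpow_pos_of_pos (h.pos0 r hr) p).le

/-- Green's identity. -/
theorem green (h : φ.Snap a q) {ψ ψx ψr : ℝ → ℝ → ℝ} {ψ0 : ℝ → ℝ}
    (hψ : PolyB ψ) (hψx : PolyB ψx) (hψr : PolyB ψr)
    (dx : ∀ x, 0 < x → ∀ r, 0 < r → HasDerivAt (fun y => ψ y r) (ψx x r) x)
    (dr : ∀ x, 0 < x → ∀ r, 0 < r → HasDerivAt (fun y => ψ x y) (ψr x r) r)
    (h0 : ∀ r, 0 < r → Tendsto (fun x => ψ x r) (𝓝[>] 0) (𝓝 (ψ0 r))) :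
    wint a (fun x r => φ.G x r * ψ x r + (φ.wx x r * ψx x r + φ.wr x r * ψr x r))
      = bint a (fun r => φ.w0 r ^ q * ψ0 r) := by
  have := wint_div a (f1 := fun x r => ψ x r * φ.wx x r)
    (f1x := fun x r => ψx x r * φ.wx x r + ψ x r * φ.wxx x r)
    (f2 := fun x r => ψ x r * φ.wr x r)
    (f2r := fun x r => ψr x r * φ.wr x r + ψ x r * φ.wrr x r)
    (f0 := fun r => ψ0 r * -(φ.w0 r ^ q))
    (d := fun x r => φ.G x r * ψ x r + (φ.wx x r * ψx x r + φ.wr x r * ψr x r))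
    (hψ.mul h.polyX) ((hψx.mul h.polyX).polyS.add (hψ.mulS h.polyXX))
    ((hψ.mulS h.polyRr).congr fun x _ r _ => by ring)
    ((hψr.mul h.polyR).polyS.add (hψ.mulS h.polyRR))
    ((h.polyG.mul hψ).add ((h.polyX.mul hψx).add (h.polyR.mul hψr)))
    (fun x hx r hr => (dx x hx r hr).mul (h.derivXX x hx r hr))
    (fun x hx r hr => (dr x hx r hr).mul (h.derivRR x hx r hr))
    (fun x hx r hr => by rw [h.eqG x hx r hr]; ring)
    (fun r hr => (h0 r hr).mul (h.limX r hr))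
  rw [this, ← neg_one_mul, ← bint_const_mul]
  exact bint_congr a fun r _ => by ring

/-- The strip inequality controlling the mass by the boundary mass and the Dirichlet integral. -/
theorem mass_le (h : φ.Snap a q) : φ.mass a ≤ 8 * bint a (fun r => φ.w0 r ^ 2) + 64 * φ.dir a := by
  have hinv : PolyB (fun x _ => 1 / (1 + x)) := by
    refine ((PolyB.const 1).sub polyB_ratio).congr fun x hx r hr => ?_
    field_simp; ring
  have hd : PolyB (fun x r => 2 * (φ.w x r * φ.wx x r) * (1 / (1 + x))
      - φ.w x r ^ 2 * (1 / (1 + x)) ^ 2 - 1 / 2 * (x * (φ.w x r ^ 2 * (1 / (1 + x))))) :=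
    ((((h.polyW.mul h.polyX).const_mul 2).mul hinv).sub ((h.polyW.pow 2).mul (hinv.pow 2))).sub
      ((PolyB.fst.mul ((h.polyW.pow 2).mul hinv)).const_mul (1 / 2))
  have e := wint_div a (f1 := fun x r => φ.w x r ^ 2 * (1 / (1 + x)))
    (f1x := fun x r => 2 * (φ.w x r * φ.wx x r) * (1 / (1 + x))
      - φ.w x r ^ 2 * (1 / (1 + x)) ^ 2)
    (f2 := fun _ _ => 0) (f2r := fun _ _ => 0) (f0 := fun r => φ.w0 r ^ 2)
    ((h.polyW.pow 2).mul hinv)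
    ((((h.polyW.mul h.polyX).const_mul 2).mul hinv).sub
      ((h.polyW.pow 2).mul (hinv.pow 2))).polyS
    ((PolyB.const 0).polyS.congr fun x _ r _ => by simp) (PolyB.const 0).polyS hd
    (fun x hx r hr => by
      have h1 := (h.derivX x hx r hr).pow 2
      have h2 : HasDerivAt (fun y : ℝ => 1 / (1 + y)) (-(1 / (1 + x)) ^ 2) x := by
        have := ((hasDerivAt_id x).const_add 1).inv (by simp; positivity)
        simp only [id] at this
        refine (this.congr_deriv (by field_simp)).congr_of_eventuallyEq ?_
        exact Eventually.of_forall fun y => by simp [one_div]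
      refine (h1.mul h2).congr_deriv ?_
      simp; ring)
    (fun x hx r hr => hasDerivAt_const r 0)
    (fun x hx r hr => by ring)
    (fun r hr => by
      have h1 := (h.limW r hr).pow 2
      have h2 : Tendsto (fun x : ℝ => 1 / (1 + x)) (𝓝[>] 0) (𝓝 (1 / (1 + 0))) := by
        have : ContinuousAt (fun x : ℝ => 1 / (1 + x)) 0 := by
          apply ContinuousAt.div <;> first | fun_prop | simp
        exact this.tendsto.mono_left nhdsWithin_le_nhds
      simpa using h1.mul h2)
  have hm : PolyB (fun x r => -(1 / 8) * φ.w x r ^ 2 + 8 * (φ.wx x r ^ 2 + φ.wr x r ^ 2)) :=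
    ((h.polyW.pow 2).const_mul _).add (h.polyDir.const_mul 8)
  have hle := wint_mono a hd hm fun x hx r hr => by
    have hi : 0 < 1 / (1 + x) := by positivity
    have hi1 : 1 / (1 + x) ≤ 1 := by rw [div_le_one (by positivity)]; linarith
    have hxi : x = 1 / (1 / (1 + x)) - 1 := by field_simp; ring
    set i := 1 / (1 + x) with hidef
    have hxi' : x * i = 1 - i := by rw [hidef]; field_simp; ring
    have e1 : x * (φ.w x r ^ 2 * i) = φ.w x r ^ 2 * (1 - i) := by rw [← hxi']; ring
    rw [e1]
    have h1 : 2 * (φ.w x r * φ.wx x r) * i ≤ 1 / 8 * φ.w x r ^ 2 + 8 * φ.wx x r ^ 2 := by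
      nlinarith [sq_nonneg (φ.w x r * i - 8 * φ.wx x r), sq_nonneg (φ.w x r),
        mul_nonneg (sq_nonneg (φ.w x r)) (sub_nonneg.2 hi1),
        mul_nonneg (mul_nonneg (sq_nonneg (φ.w x r)) (sub_nonneg.2 hi1)) hi.le]
    have h2 : φ.w x r ^ 2 * (1 / 4) ≤ φ.w x r ^ 2 * (i ^ 2 + 1 / 2 * (1 - i)) := by
      apply mul_le_mul_of_nonneg_left _ (sq_nonneg _)
      nlinarith [sq_nonneg (i - 1 / 4)]
    nlinarith [sq_nonneg (φ.wr x r)]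
  rw [e, wint_add a ((h.polyW.pow 2).const_mul _) (h.polyDir.const_mul 8), wint_const_mul,
    wint_const_mul] at hle
  unfold mass dir
  linarith

/-- The second moment inequality. -/
theorem moment_le (h : φ.Snap a q) : wint a (fun x r => (x ^ 2 + r ^ 2) * φ.w x r ^ 2)
    ≤ 4 * (a + 2) * φ.mass a + 16 * φ.dir a := by
  have hσ : PolyB (fun x r => x ^ 2 + r ^ 2) := (PolyB.fst.pow 2).add (PolyB.snd.pow 2)
  have hY : PolyB (fun x r => x * φ.wx x r + r * φ.wr x r) :=
    (PolyB.fst.mul h.polyX).add (PolyB.snd.mul h.polyR)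
  have hd : PolyB (fun x r => (a + 2) * φ.w x r ^ 2 + (-(1 / 2)) * ((x ^ 2 + r ^ 2) * φ.w x r ^ 2)
      + 2 * (φ.w x r * (x * φ.wx x r + r * φ.wr x r))) :=
    (((h.polyW.pow 2).const_mul _).add ((hσ.mul (h.polyW.pow 2)).const_mul _)).add
      ((h.polyW.mul hY).const_mul 2)
  have e := wint_div a (f1 := fun x r => x * φ.w x r ^ 2)
    (f1x := fun x r => φ.w x r ^ 2 + x * (2 * (φ.w x r * φ.wx x r)))
    (f2 := fun x r => r * φ.w x r ^ 2)
    (f2r := fun x r => φ.w x r ^ 2 + r * (2 * (φ.w x r * φ.wr x r))) (f0 := fun r => 0)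
    (PolyB.fst.mul (h.polyW.pow 2))
    ((h.polyW.pow 2).add (PolyB.fst.mul ((h.polyW.mul h.polyX).const_mul 2))).polyS
    ((h.polyW.pow 2).polyS.congr fun x _ r hr => by field_simp)
    ((h.polyW.pow 2).add (PolyB.snd.mul ((h.polyW.mul h.polyR).const_mul 2))).polyS hd
    (fun x hx r hr => by
      refine ((hasDerivAt_id x).mul ((h.derivX x hx r hr).pow 2)).congr_deriv ?_
      simp; left; ring)
    (fun x hx r hr => by
      refine ((hasDerivAt_id r).mul ((h.derivR x hx r hr).pow 2)).congr_deriv ?_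
      simp; left; ring)
    (fun x hx r hr => by field_simp; ring)
    (fun r hr => by
      have h1 : Tendsto (fun x : ℝ => x) (𝓝[>] 0) (𝓝 0) := nhdsWithin_le_nhds
      simpa using h1.mul ((h.limW r hr).pow 2))
  have hm : PolyB (fun x r => (a + 2) * φ.w x r ^ 2 + (-(1 / 4)) * ((x ^ 2 + r ^ 2) * φ.w x r ^ 2)
      + 4 * (φ.wx x r ^ 2 + φ.wr x r ^ 2)) :=
    (((h.polyW.pow 2).const_mul _).add ((hσ.mul (h.polyW.pow 2)).const_mul _)).add
      (h.polyDir.const_mul 4)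
  have hle := wint_mono a hd hm fun x hx r hr => by
    nlinarith [sq_nonneg (φ.w x r * x - 4 * φ.wx x r), sq_nonneg (φ.w x r * r - 4 * φ.wr x r)]
  rw [e, wint_add a (((h.polyW.pow 2).const_mul _).add ((hσ.mul (h.polyW.pow 2)).const_mul _))
      (h.polyDir.const_mul 4), wint_add a ((h.polyW.pow 2).const_mul _)
      ((hσ.mul (h.polyW.pow 2)).const_mul _), wint_const_mul, wint_const_mul, wint_const_mul] at hle
  have h0 : bint a (fun _ => (0 : ℝ)) = 0 := by simp [bint]
  rw [h0] at hle
  unfold mass dir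
  linarith

end Snap
end Profile

/-- Integration by parts on the weighted half-line. -/
theorem bint_div (a : ℕ) {k h' : ℝ → ℝ} (hk : PolyZ k) (hh : PolyZ h')
    (hD : ∀ r, 0 < r → HasDerivAt (fun y => y * k y) (h' r) r) :
    bint a (fun r => h' r + (a - r ^ 2 / 2) * k r) = 0 := by
  have hp : PolyZ (fun r => h' r + (a - r ^ 2 / 2) * k r) :=
    hh.add (((PolyZ.const (a : ℝ)).sub (((PolyZ.id).pow 2).const_mul (1 / 2)) |>.congr
      fun r _ => by ring).mul hk)
  obtain ⟨-, C, N, hC, hb⟩ := hk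
  obtain ⟨K, hK, hKb⟩ := pow_mul_kap0_le a (N + 1)
  have hb' : ∀ r, 0 < r → |kap0 a r * (r * k r)| ≤ C * (K * Real.exp (-r)) := by
    intro r hr
    have hkp := kap0_pos a hr
    rw [abs_mul, abs_mul, abs_of_pos hr, abs_of_pos hkp]
    calc kap0 a r * (r * |k r|) ≤ kap0 a r * ((1 + r) * (C * (1 + r) ^ N)) := by
          gcongr
          · linarith
          · exact hb r hr
      _ = C * ((1 + r) ^ (N + 1) * kap0 a r) := by ring
      _ ≤ _ := mul_le_mul_of_nonneg_left (hKb r hr.le) hC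
  have := integral_Ioi_of_hasDerivAt_of_tendsto (a := 0) (m := 0)
    (f := fun r => kap0 a r * (r * k r))
    (f' := fun r => kap0 a r * (h' r + (a - r ^ 2 / 2) * k r)) ?_
    (fun r hr => by
      have hr : 0 < r := hr
      refine ((hasDerivAt_kap0 a hr).mul (hD r hr)).congr_deriv ?_
      field_simp; ring) (hp.integrableOn a) ?_
  · simpa [bint] using this
  · rw [ContinuousWithinAt, zero_mul, mul_zero]
    have hK : ContinuousWithinAt (fun r => |kap0 a r| * (|r| * (C * (1 + |r|) ^ N))) (Ici 0) 0 := by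
      refine Continuous.continuousWithinAt ?_
      unfold kap0; fun_prop
    rw [ContinuousWithinAt] at hK
    simp only [abs_zero, zero_mul, mul_zero] at hK
    refine squeeze_zero_norm' ?_ hK
    filter_upwards [self_mem_nhdsWithin] with r hr
    rw [Real.norm_eq_abs, abs_mul, abs_mul]
    rcases (mem_Ici.1 hr).eq_or_lt with rfl | hr
    · simp
    · gcongr
      rw [abs_of_pos hr]
      exact hb r hr
  · have h0 : Tendsto (fun r : ℝ => C * (K * Real.exp (-r))) atTop (𝓝 0) := by
      have := ((Real.tendsto_exp_neg_atTop_nhds_zero).const_mul K).const_mul C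
      simpa using this
    refine squeeze_zero_norm' ?_ h0
    filter_upwards [eventually_gt_atTop 0] with r hr
    exact hb' r hr

/-- The multiplier function and its first two derivatives. -/
noncomputable def om (A : ℝ) : ℝ := Real.log (1 + 1 / √A)
/-- First derivative of `om`. -/
noncomputable def om1 (A : ℝ) : ℝ := -1 / (2 * A * (1 + √A))
/-- Second derivative of `om`. -/
noncomputable def om2 (A : ℝ) : ℝ := (1 + 3 / 2 * √A) / (2 * A ^ 2 * (1 + √A) ^ 2)

theorem hasDerivAt_om {A : ℝ} (hA : 0 < A) : HasDerivAt om (om1 A) A := by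
  have hs := Real.hasDerivAt_sqrt hA.ne'
  have hS := Real.sqrt_pos.2 hA
  have h1 : HasDerivAt (fun y => 1 + (√y)⁻¹) (-(1 / (2 * √A)) / √A ^ 2) A :=
    (hs.inv hS.ne').const_add 1
  have h2 := h1.log (by positivity)
  have h3 : om = fun y => Real.log (1 + (√y)⁻¹) := by ext y; simp [om]
  rw [h3]
  refine h2.congr_deriv ?_
  unfold om1
  have : A = √A ^ 2 := (Real.sq_sqrt hA.le).symm
  set S := √A
  rw [this]
  field_simp
  ring

theorem hasDerivAt_om1 {A : ℝ} (hA : 0 < A) : HasDerivAt om1 (om2 A) A := by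
  have hs := Real.hasDerivAt_sqrt hA.ne'
  have hS := Real.sqrt_pos.2 hA
  have h1 : HasDerivAt (fun y => 2 * y * (1 + √y)) (2 * 1 * (1 + √A) + 2 * A * (1 / (2 * √A))) A :=
    ((hasDerivAt_id A).const_mul 2).mul (hs.const_add 1)
  have h2 := (hasDerivAt_const A (-1 : ℝ)).div h1 (by positivity)
  refine h2.congr_deriv ?_
  unfold om2
  have : A = √A ^ 2 := (Real.sq_sqrt hA.le).symm
  set S := √A
  rw [this]
  field_simp
  ring

theorem om_pos {A : ℝ} (hA : 0 < A) : 0 < om A :=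
  Real.log_pos (by have := Real.sqrt_pos.2 hA; simp; positivity)

theorem om_mul_sqrt_le {A : ℝ} (hA : 0 < A) : om A * √A ≤ 1 := by
  have hS := Real.sqrt_pos.2 hA
  have : om A ≤ 1 / √A := by
    have := Real.log_le_sub_one_of_pos (x := 1 + 1 / √A) (by positivity)
    unfold om; linarith
  calc om A * √A ≤ 1 / √A * √A := by gcongr
    _ = 1 := by field_simp

theorem mul_sq_om_le {A s : ℝ} (hA : 0 < A) (hsA : s ≤ A) : s * om A ^ 2 ≤ 1 := by
  have h1 := om_mul_sqrt_le hA
  have h2 := om_pos hA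
  have h3 : A * om A ^ 2 ≤ 1 := by
    calc A * om A ^ 2 = (om A * √A) ^ 2 := by rw [mul_pow, Real.sq_sqrt hA.le]; ring
      _ ≤ 1 := pow_le_one₀ (by positivity) h1
  nlinarith [sq_nonneg (om A)]

theorem inv_le_om {A : ℝ} (hA : 0 < A) : 1 / (1 + √A) ≤ om A := by
  have hS := Real.sqrt_pos.2 hA
  have := Real.one_sub_inv_le_log_of_pos (x := 1 + 1 / √A) (by positivity)
  refine le_trans (le_of_eq ?_) this
  field_simp
  ring

theorem om1_neg {A : ℝ} (hA : 0 < A) : om1 A < 0 := by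
  have hS := Real.sqrt_pos.2 hA
  unfold om1
  exact div_neg_of_neg_of_pos (by norm_num) (by positivity)

theorem neg_mul_om1_le {A s : ℝ} (hA : 0 < A) (hs : 0 ≤ s) (hsA : s ≤ A) :
    -(s * om1 A) ≤ 1 / 2 ∧ -(s * om1 A) ≤ om A := by
  have hS := Real.sqrt_pos.2 hA
  have h1 := om1_neg hA
  have h2 : -(A * om1 A) = 1 / 2 * (1 / (1 + √A)) := by unfold om1; field_simp
  have h3 : 1 / (1 + √A) ≤ 1 := by rw [div_le_one (by positivity)]; linarith
  have h4 := inv_le_om hA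
  have h5 : 0 < 1 / (1 + √A) := by positivity
  have h6 : -(s * om1 A) ≤ -(A * om1 A) := by nlinarith
  constructor <;> linarith

theorem om2_nonneg {A : ℝ} (hA : 0 < A) : 0 ≤ om2 A := by unfold om2; positivity

theorem mul_om2_le {A s : ℝ} (hA : 0 < A) (hsA : s ≤ A) : 2 * s * om2 A + 3 * om1 A ≤ 0 := by
  have hS := Real.sqrt_pos.2 hA
  have h1 : 2 * s * om2 A ≤ 2 * A * om2 A := by
    have := om2_nonneg hA; gcongr
  have h2 : 2 * A * om2 A + 3 * om1 A ≤ 0 := by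
    have e : 2 * A * om2 A + 3 * om1 A = -(1 / 2) / (A * (1 + √A) ^ 2) := by
      unfold om2 om1; field_simp; ring
    rw [e]
    exact div_nonpos_of_nonpos_of_nonneg (by norm_num) (by positivity)
  linarith

theorem polyB_comp_sq {g : ℝ → ℝ} {ε C : ℝ} (hc : ContinuousOn g (Ici ε))
    (hb : ∀ A, ε ≤ A → |g A| ≤ C) : PolyB (fun x r => g (x ^ 2 + r ^ 2 + ε)) := by
  refine ⟨hc.comp (f := fun p : ℝ × ℝ => p.1 ^ 2 + p.2 ^ 2 + ε) (by fun_prop) fun p _ => ?_,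
    C, 0, (abs_nonneg _).trans (hb ε le_rfl), fun x _ r _ => ?_⟩
  · simp only [mem_Ici]; nlinarith [sq_nonneg p.1, sq_nonneg p.2]
  · simpa using hb _ (by nlinarith [sq_nonneg x, sq_nonneg r])

theorem polyB_om {ε : ℝ} (hε : 0 < ε) : PolyB (fun x r => om (x ^ 2 + r ^ 2 + ε)) := by
  refine polyB_comp_sq (C := 1 / √ε) (fun A hA =>
    (hasDerivAt_om (hε.trans_le hA)).continuousAt.continuousWithinAt) fun A hA => ?_
  have h0 := hε.trans_le hA
  have := om_mul_sqrt_le h0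
  have hS := Real.sqrt_pos.2 hε
  rw [abs_of_pos (om_pos h0), le_div_iff₀ hS]
  refine le_trans ?_ this
  have := om_pos h0
  gcongr

theorem polyB_om1 {ε : ℝ} (hε : 0 < ε) : PolyB (fun x r => om1 (x ^ 2 + r ^ 2 + ε)) := by
  refine polyB_comp_sq (C := 1 / (2 * ε)) (fun A hA =>
    (hasDerivAt_om1 (hε.trans_le hA)).continuousAt.continuousWithinAt) fun A hA => ?_
  have h0 := hε.trans_le hA
  have := (neg_mul_om1_le h0 hε.le hA).1
  rw [abs_of_neg (om1_neg h0), le_div_iff₀ (by positivity)]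
  linarith

theorem continuousOn_om2 {ε : ℝ} (hε : 0 < ε) : ContinuousOn om2 (Ici ε) := by
  unfold om2
  refine ContinuousOn.div (by fun_prop) (by fun_prop) fun A hA => ?_
  have := hε.trans_le hA
  positivity

theorem polyB_om2 {ε : ℝ} (hε : 0 < ε) : PolyB (fun x r => om2 (x ^ 2 + r ^ 2 + ε)) := by
  refine polyB_comp_sq (C := 3 / (4 * ε ^ 2)) (continuousOn_om2 hε) fun A hA => ?_
  have h0 := hε.trans_le hA
  have h1 := mul_om2_le h0 hA
  have h2 := (neg_mul_om1_le h0 hε.le hA).1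
  rw [abs_of_nonneg (om2_nonneg h0), le_div_iff₀ (by positivity)]
  nlinarith

theorem hasDerivAt_sq_left {g : ℝ → ℝ} {g' x r ε : ℝ} (h : HasDerivAt g g' (x ^ 2 + r ^ 2 + ε)) :
    HasDerivAt (fun y => g (y ^ 2 + r ^ 2 + ε)) (g' * (2 * x)) x := by
  have h1 : HasDerivAt (fun y : ℝ => y ^ 2 + r ^ 2 + ε) (2 * x) x := by
    have := ((hasDerivAt_pow 2 x).add_const (r ^ 2)).add_const ε
    simpa using this
  exact h.comp x h1

theorem hasDerivAt_sq_right {g : ℝ → ℝ} {g' x r ε : ℝ} (h : HasDerivAt g g' (x ^ 2 + r ^ 2 + ε)) :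
    HasDerivAt (fun y => g (x ^ 2 + y ^ 2 + ε)) (g' * (2 * r)) r := by
  have h1 : HasDerivAt (fun y : ℝ => x ^ 2 + y ^ 2 + ε) (2 * r) r := by
    have := ((hasDerivAt_pow 2 r).const_add (x ^ 2)).add_const ε
    simpa using this
  exact h.comp r h1

namespace Profile
namespace Snap

variable {φ : Profile} {a : ℕ} {q : ℝ}

set_option maxHeartbeats 1000000 in
/-- A Hardy type estimate with logarithmic weight. -/
theorem wint_om_sq_le (h : φ.Snap a q) {ε : ℝ} (hε : 0 < ε) :
    wint a (fun x r => φ.w x r ^ 2 * om (x ^ 2 + r ^ 2 + ε) ^ 2)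
      ≤ 2 * φ.dir a + 5 / 2 * φ.mass a := by
  set o : ℝ → ℝ → ℝ := fun x r => om (x ^ 2 + r ^ 2 + ε) with ho
  set o1 : ℝ → ℝ → ℝ := fun x r => om1 (x ^ 2 + r ^ 2 + ε) with ho1
  have po : PolyB o := polyB_om hε
  have po1 : PolyB o1 := polyB_om1 hε
  have pw := h.polyW
  have px := h.polyX
  have pr := h.polyR
  have hA : ∀ x r : ℝ, 0 < x ^ 2 + r ^ 2 + ε := fun x r => by positivity
  have hd : PolyB (fun x r => (a + 2) * (φ.w x r ^ 2 * o x r ^ 2)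
      - 1 / 2 * ((x ^ 2 + r ^ 2) * (φ.w x r ^ 2 * o x r ^ 2))
      + 2 * (o x r ^ 2 * φ.w x r * (x * φ.wx x r + r * φ.wr x r))
      + 4 * (φ.w x r ^ 2 * (o x r * o1 x r) * (x ^ 2 + r ^ 2))) := by
    repeat' first
          | assumption | exact PolyB.fst | exact PolyB.snd | exact PolyB.const _
          | apply PolyB.sub | apply PolyB.add | apply PolyB.neg | apply PolyB.mul
  have e := wint_div a (f1 := fun x r => x * (φ.w x r ^ 2 * o x r ^ 2))
    (f1x := fun x r => φ.w x r ^ 2 * o x r ^ 2 + x * (2 * (φ.w x r * φ.wx x r) * o x r ^ 2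
      + φ.w x r ^ 2 * (2 * o x r * (o1 x r * (2 * x)))))
    (f2 := fun x r => r * (φ.w x r ^ 2 * o x r ^ 2))
    (f2r := fun x r => φ.w x r ^ 2 * o x r ^ 2 + r * (2 * (φ.w x r * φ.wr x r) * o x r ^ 2
      + φ.w x r ^ 2 * (2 * o x r * (o1 x r * (2 * r))))) (f0 := fun r => 0)
    (by repeat' first
          | assumption | exact PolyB.fst | exact PolyB.snd | exact PolyB.const _
          | apply PolyB.sub | apply PolyB.add | apply PolyB.neg | apply PolyB.mul)
    (PolyB.polyS (by repeat' first
          | assumption | exact PolyB.fst | exact PolyB.snd | exact PolyB.const _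
          | apply PolyB.sub | apply PolyB.add | apply PolyB.neg | apply PolyB.mul))
    (((pw.pow 2).mul (po.pow 2)).polyS.congr fun x _ r hr => by field_simp)
    (PolyB.polyS (by repeat' first
          | assumption | exact PolyB.fst | exact PolyB.snd | exact PolyB.const _
          | apply PolyB.sub | apply PolyB.add | apply PolyB.neg | apply PolyB.mul)) hd
    (fun x hx r hr => by
      refine ((hasDerivAt_id x).mul (((h.derivX x hx r hr).pow 2).mul
        ((hasDerivAt_sq_left (hasDerivAt_om (hA x r))).pow 2))).congr_deriv ?_
      simp only [ho, ho1, id, Nat.cast_ofNat, Pi.mul_apply, Pi.pow_apply]; ring)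
    (fun x hx r hr => by
      refine ((hasDerivAt_id r).mul (((h.derivR x hx r hr).pow 2).mul
        ((hasDerivAt_sq_right (hasDerivAt_om (hA x r))).pow 2))).congr_deriv ?_
      simp only [ho, ho1, id, Nat.cast_ofNat, Pi.mul_apply, Pi.pow_apply]; ring)
    (fun x hx r hr => by field_simp; ring)
    (fun r hr => by
      have h1 : Tendsto (fun x : ℝ => x) (𝓝[>] 0) (𝓝 0) := nhdsWithin_le_nhds
      have h2 : Tendsto (fun x : ℝ => om (x ^ 2 + r ^ 2 + ε)) (𝓝[>] 0)
          (𝓝 (om (0 ^ 2 + r ^ 2 + ε))) :=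
        ((hasDerivAt_sq_left (hasDerivAt_om (hA 0 r))).continuousAt.tendsto).mono_left
          nhdsWithin_le_nhds
      simpa using h1.mul (((h.limW r hr).pow 2).mul (h2.pow 2)))
  have p1 : PolyB (fun x r => φ.w x r ^ 2 * o x r ^ 2) := (pw.pow 2).mul (po.pow 2)
  have p2 : PolyB (fun x r => 5 / 2 * φ.w x r ^ 2) := (pw.pow 2).const_mul _
  have p3 : PolyB (fun x r => 2 * (φ.wx x r ^ 2 + φ.wr x r ^ 2)) := h.polyDir.const_mul _
  have hle := wint_mono a ((p1.sub p2).sub p3) hd fun x hx r hr => by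
    have hn1 := neg_mul_om1_le (s := x ^ 2 + r ^ 2) (hA x r) (by positivity) (by linarith)
    have hs := mul_sq_om_le (s := x ^ 2 + r ^ 2) (hA x r) (by linarith)
    have hop := om_pos (hA x r)
    change (x ^ 2 + r ^ 2) * o x r ^ 2 ≤ 1 at hs
    change 0 < o x r at hop
    have hn := hn1.1
    change -((x ^ 2 + r ^ 2) * o1 x r) ≤ 1 / 2 at hn
    generalize o x r = O at *
    generalize o1 x r = O1 at *
    generalize φ.w x r = W
    generalize φ.wx x r = X
    generalize φ.wr x r = R
    have t1 : (x ^ 2 + r ^ 2) * O ^ 2 * W ^ 2 ≤ W ^ 2 := by nlinarith [sq_nonneg W]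
    have t2 : -(4 * (W ^ 2 * (O * O1) * (x ^ 2 + r ^ 2))) ≤ 2 * (W ^ 2 * O) := by
      have : 0 ≤ W ^ 2 * O := by positivity
      nlinarith
    have t3 : 2 * (W ^ 2 * O) ≤ 1 / 2 * (W ^ 2 * O ^ 2) + 2 * W ^ 2 := by
      nlinarith [mul_nonneg (sq_nonneg W) (sq_nonneg (O - 2))]
    have t4 : O ^ 2 * (x * X + r * R) ^ 2 ≤ X ^ 2 + R ^ 2 := by
      have c : (x * X + r * R) ^ 2 ≤ (x ^ 2 + r ^ 2) * (X ^ 2 + R ^ 2) := by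
        nlinarith [sq_nonneg (x * R - r * X)]
      calc O ^ 2 * (x * X + r * R) ^ 2 ≤ O ^ 2 * ((x ^ 2 + r ^ 2) * (X ^ 2 + R ^ 2)) := by gcongr
        _ = ((x ^ 2 + r ^ 2) * O ^ 2) * (X ^ 2 + R ^ 2) := by ring
        _ ≤ 1 * (X ^ 2 + R ^ 2) := by gcongr
        _ = _ := one_mul _
    have t5 : -(2 * (O ^ 2 * W * (x * X + r * R))) ≤ 1 / 2 * (W ^ 2 * O ^ 2)
        + 2 * (O ^ 2 * (x * X + r * R) ^ 2) := by
      nlinarith [mul_nonneg (sq_nonneg O) (sq_nonneg (W + 2 * (x * X + r * R)))]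
    have t6 : 0 ≤ (a : ℝ) * (W ^ 2 * O ^ 2) := by positivity
    nlinarith
  rw [e, wint_sub a (p1.sub p2) p3, wint_sub a p1 p2, wint_const_mul, wint_const_mul] at hle
  have h0 : bint a (fun _ => (0 : ℝ)) = 0 := by simp [bint]
  rw [h0] at hle
  unfold mass dir
  linarith

/-- The Kaplan type identity with an exponential test function. -/
theorem kaplan (h : φ.Snap a q) (l : ℝ) (hl : 0 < l) :
    wint a (fun x r => φ.G x r * Real.exp (-(l * x))
      - φ.w x r * (l ^ 2 + l * x / 2) * Real.exp (-(l * x)))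
      = bint a (fun r => φ.w0 r ^ q - l * φ.w0 r) := by
  have pe : PolyB (fun x _ => Real.exp (-(l * x))) := by
    refine ⟨by fun_prop, 1, 0, zero_le_one, fun x hx r hr => ?_⟩
    rw [abs_of_pos (Real.exp_pos _), pow_zero, mul_one]
    exact Real.exp_le_one_iff.2 (by have := mul_pos hl hx; linarith)
  have pw := h.polyW
  have px := h.polyX
  have pr := h.polyR
  have pG := h.polyG
  have e := wint_div a (f1 := fun x r => φ.wx x r * Real.exp (-(l * x))
      + l * (φ.w x r * Real.exp (-(l * x))))
    (f1x := fun x r => Real.exp (-(l * x)) * φ.wxx x r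
      + (-1) * (l ^ 2 * (φ.w x r * Real.exp (-(l * x)))))
    (f2 := fun x r => Real.exp (-(l * x)) * φ.wr x r)
    (f2r := fun x r => Real.exp (-(l * x)) * φ.wrr x r)
    (f0 := fun r => -(φ.w0 r ^ q) * Real.exp (-(l * 0)) + l * (φ.w0 r * Real.exp (-(l * 0))))
    (d := fun x r => φ.G x r * Real.exp (-(l * x))
      - φ.w x r * (l ^ 2 + 1 / 2 * l * x) * Real.exp (-(l * x)))
    (by repeat' first
          | assumption | exact PolyB.fst | exact PolyB.snd | exact PolyB.const _
          | apply PolyB.sub | apply PolyB.add | apply PolyB.neg | apply PolyB.mul)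
    ((pe.mulS h.polyXX).add (((pw.mul pe).const_mul (l ^ 2)).const_mul (-1)).polyS)
    ((pe.mulS h.polyRr).congr fun x _ r _ => by ring)
    (pe.mulS h.polyRR)
    (by repeat' first
          | assumption | exact PolyB.fst | exact PolyB.snd | exact PolyB.const _
          | apply PolyB.sub | apply PolyB.add | apply PolyB.neg | apply PolyB.mul)
    (fun x hx r hr => by
      have he : HasDerivAt (fun y => Real.exp (-(l * y))) (Real.exp (-(l * x)) * (-(l * 1))) x :=
        (((hasDerivAt_id x).const_mul l).neg).exp
      refine (((h.derivXX x hx r hr).mul he).add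
        (((h.derivX x hx r hr).mul he).const_mul l)).congr_deriv ?_
      ring)
    (fun x hx r hr => (h.derivRR x hx r hr).const_mul _)
    (fun x hx r hr => by simp only [h.eqG x hx r hr]; ring)
    (fun r hr => by
      have h2 : Tendsto (fun x : ℝ => Real.exp (-(l * x))) (𝓝[>] 0) (𝓝 (Real.exp (-(l * 0)))) := by
        have : Continuous (fun x : ℝ => Real.exp (-(l * x))) := by fun_prop
        exact (this.tendsto 0).mono_left nhdsWithin_le_nhds
      exact ((h.limX r hr).mul h2).add (((h.limW r hr).mul h2).const_mul l))
  rw [← neg_one_mul, ← bint_const_mul] at e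
  refine Eq.trans (wint_congr a fun x _ r _ => ?_) (e.trans (bint_congr a fun r _ => ?_))
  · ring
  · simp; ring

end Snap
end Profile

namespace Profile
namespace Snap

variable {φ : Profile} {a : ℕ} {q : ℝ}

set_option maxHeartbeats 4000000 in
/-- The Morawetz identity in the interior, for a radial weight `o`. -/
theorem wint_morawetz (h : φ.Snap a q) {o o1 o2 : ℝ → ℝ → ℝ} {o0 : ℝ → ℝ}
    (po : PolyB o) (po1 : PolyB o1) (po2 : PolyB o2)
    (dox : ∀ x, 0 < x → ∀ r, 0 < r → HasDerivAt (fun y => o y r) (o1 x r * (2 * x)) x)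
    (dor : ∀ x, 0 < x → ∀ r, 0 < r → HasDerivAt (fun y => o x y) (o1 x r * (2 * r)) r)
    (do1x : ∀ x, 0 < x → ∀ r, 0 < r → HasDerivAt (fun y => o1 y r) (o2 x r * (2 * x)) x)
    (do1r : ∀ x, 0 < x → ∀ r, 0 < r → HasDerivAt (fun y => o1 x y) (o2 x r * (2 * r)) r)
    (lo : ∀ r, 0 < r → Tendsto (fun x => o x r) (𝓝[>] 0) (𝓝 (o0 r)))
    (lo1 : ∀ r, 0 < r → ∃ l, Tendsto (fun x => o1 x r) (𝓝[>] 0) (𝓝 l)) :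
    PolyB (fun x r => φ.G x r * (o x r * (x * φ.wx x r + r * φ.wr x r)
        + (a / 2 * o x r - (x ^ 2 + r ^ 2) * o x r * (1 / 4)) * φ.w x r)
      + 2 * o1 x r * (x * φ.wx x r + r * φ.wr x r) ^ 2
      - (x ^ 2 + r ^ 2) * o1 x r * (φ.wx x r ^ 2 + φ.wr x r ^ 2)
      - 1 / 2 * (o x r + (x ^ 2 + r ^ 2) * o1 x r) * φ.w x r * (x * φ.wx x r + r * φ.wr x r)
      - a / 2 * φ.w x r ^ 2 * ((a + 2) * o1 x r + 2 * (x ^ 2 + r ^ 2) * o2 x r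
        - (x ^ 2 + r ^ 2) * o1 x r * (1 / 2))) ∧
    wint a (fun x r => φ.G x r * (o x r * (x * φ.wx x r + r * φ.wr x r)
        + (a / 2 * o x r - (x ^ 2 + r ^ 2) * o x r * (1 / 4)) * φ.w x r)
      + 2 * o1 x r * (x * φ.wx x r + r * φ.wr x r) ^ 2
      - (x ^ 2 + r ^ 2) * o1 x r * (φ.wx x r ^ 2 + φ.wr x r ^ 2)
      - 1 / 2 * (o x r + (x ^ 2 + r ^ 2) * o1 x r) * φ.w x r * (x * φ.wx x r + r * φ.wr x r)
      - a / 2 * φ.w x r ^ 2 * ((a + 2) * o1 x r + 2 * (x ^ 2 + r ^ 2) * o2 x r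
        - (x ^ 2 + r ^ 2) * o1 x r * (1 / 2)))
      = - bint a (fun r => o0 r * (r * φ.w0r r) * -(φ.w0 r ^ q)
        + (a / 2 * o0 r - r ^ 2 * o0 r * (1 / 4)) * φ.w0 r * -(φ.w0 r ^ q)) := by
  have pw := h.polyW
  have px := h.polyX
  have pr := h.polyR
  have pG := h.polyG
  have hd : PolyB (fun x r => φ.G x r * (o x r * (x * φ.wx x r + r * φ.wr x r)
        + (a / 2 * o x r - (x ^ 2 + r ^ 2) * o x r * (1 / 4)) * φ.w x r)
      + 2 * o1 x r * (x * φ.wx x r + r * φ.wr x r) ^ 2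
      - (x ^ 2 + r ^ 2) * o1 x r * (φ.wx x r ^ 2 + φ.wr x r ^ 2)
      - 1 / 2 * (o x r + (x ^ 2 + r ^ 2) * o1 x r) * φ.w x r * (x * φ.wx x r + r * φ.wr x r)
      - a / 2 * φ.w x r ^ 2 * ((a + 2) * o1 x r + 2 * (x ^ 2 + r ^ 2) * o2 x r
        - (x ^ 2 + r ^ 2) * o1 x r * (1 / 2))) := by
    repeat' first
          | assumption | exact PolyB.fst | exact PolyB.snd | exact PolyB.const _
          | apply PolyB.sub | apply PolyB.add | apply PolyB.neg | apply PolyB.mul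
  refine ⟨hd, ?_⟩
  have dI : ∀ x : ℝ, HasDerivAt (fun y : ℝ => y) 1 x := fun x => hasDerivAt_id x
  refine wint_div a
    (f1 := fun x r => o x r * ((x * φ.wx x r + r * φ.wr x r) * φ.wx x r
        - 1 / 2 * ((φ.wx x r ^ 2 + φ.wr x r ^ 2) * x))
      + (a / 2 * o x r - (x ^ 2 + r ^ 2) * o x r * (1 / 4)) * (φ.w x r * φ.wx x r)
      - a / 2 * (φ.w x r ^ 2 * o1 x r * x))
    (f1x := fun x r => (o1 x r * (2 * x) * ((x * φ.wx x r + r * φ.wr x r) * φ.wx x r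
          - 1 / 2 * ((φ.wx x r ^ 2 + φ.wr x r ^ 2) * x))
        + o x r * (φ.wx x r ^ 2 - 1 / 2 * (φ.wx x r ^ 2 + φ.wr x r ^ 2))
        + (a / 2 * o1 x r - (o x r + (x ^ 2 + r ^ 2) * o1 x r) * (1 / 4)) * (2 * x)
          * (φ.w x r * φ.wx x r)
        + (a / 2 * o x r - (x ^ 2 + r ^ 2) * o x r * (1 / 4)) * φ.wx x r ^ 2
        - a / 2 * (2 * φ.w x r * φ.wx x r * o1 x r * x + φ.w x r ^ 2 * (o2 x r * (2 * x)) * x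
          + φ.w x r ^ 2 * o1 x r))
      + ((o x r * (x * φ.wx x r + r * φ.wr x r)
        + (a / 2 * o x r - (x ^ 2 + r ^ 2) * o x r * (1 / 4)) * φ.w x r) * φ.wxx x r
        + o x r * (r * φ.wx x r - φ.wr x r * x) * φ.wxr x r))
    (f2 := fun x r => o x r * ((x * φ.wx x r + r * φ.wr x r) * φ.wr x r
        - 1 / 2 * ((φ.wx x r ^ 2 + φ.wr x r ^ 2) * r))
      + (a / 2 * o x r - (x ^ 2 + r ^ 2) * o x r * (1 / 4)) * (φ.w x r * φ.wr x r)
      - a / 2 * (φ.w x r ^ 2 * o1 x r * r))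
    (f2r := fun x r => (o1 x r * (2 * r) * ((x * φ.wx x r + r * φ.wr x r) * φ.wr x r
          - 1 / 2 * ((φ.wx x r ^ 2 + φ.wr x r ^ 2) * r))
        + o x r * (φ.wr x r ^ 2 - 1 / 2 * (φ.wx x r ^ 2 + φ.wr x r ^ 2))
        + (a / 2 * o1 x r - (o x r + (x ^ 2 + r ^ 2) * o1 x r) * (1 / 4)) * (2 * r)
          * (φ.w x r * φ.wr x r)
        + (a / 2 * o x r - (x ^ 2 + r ^ 2) * o x r * (1 / 4)) * φ.wr x r ^ 2
        - a / 2 * (2 * φ.w x r * φ.wr x r * o1 x r * r + φ.w x r ^ 2 * (o2 x r * (2 * r)) * r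
          + φ.w x r ^ 2 * o1 x r))
      + ((o x r * (x * φ.wx x r + r * φ.wr x r)
        + (a / 2 * o x r - (x ^ 2 + r ^ 2) * o x r * (1 / 4)) * φ.w x r) * φ.wrr x r
        + o x r * (x * φ.wr x r - φ.wx x r * r) * φ.wxr x r))
    ?_ ?_ ?_ ?_ hd ?_ ?_ ?_ ?_
  · repeat' first
        | assumption | exact PolyB.fst | exact PolyB.snd | exact PolyB.const _
        | apply PolyB.sub | apply PolyB.add | apply PolyB.neg | apply PolyB.mul
  · refine PolyS.add (PolyB.polyS ?_) (PolyS.add (PolyB.mulS ?_ h.polyXX) (PolyB.mulS ?_ h.polyXR))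
    all_goals repeat' first
          | assumption | exact PolyB.fst | exact PolyB.snd | exact PolyB.const _
          | apply PolyB.sub | apply PolyB.add | apply PolyB.neg | apply PolyB.mul
  · refine PolyS.congr (f := fun x r =>
      (o x r * (x * φ.wx x r + r * φ.wr x r)
        + (a / 2 * o x r - (x ^ 2 + r ^ 2) * o x r * (1 / 4)) * φ.w x r) * (φ.wr x r / r)
      + (-(o x r * (1 / 2 * (φ.wx x r ^ 2 + φ.wr x r ^ 2))) - a / 2 * (φ.w x r ^ 2 * o1 x r)))
      (PolyS.add (PolyB.mulS ?_ h.polyRr) (PolyB.polyS ?_)) fun x _ r hr => by field_simp; ring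
    all_goals repeat' first
          | assumption | exact PolyB.fst | exact PolyB.snd | exact PolyB.const _
          | apply PolyB.sub | apply PolyB.add | apply PolyB.neg | apply PolyB.mul
  · refine PolyS.add (PolyB.polyS ?_) (PolyS.add (PolyB.mulS ?_ h.polyRR) (PolyB.mulS ?_ h.polyXR))
    all_goals repeat' first
          | assumption | exact PolyB.fst | exact PolyB.snd | exact PolyB.const _
          | apply PolyB.sub | apply PolyB.add | apply PolyB.neg | apply PolyB.mul
  · intro x hx r hr
    have a1 := dox x hx r hr
    have a2 := do1x x hx r hr
    have a3 := h.derivX x hx r hr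
    have a4 := h.derivXX x hx r hr
    have a5 := h.derivRX x hx r hr
    have a6 := dI x
    refine (((a1.mul ((((a6.mul a4).add (a5.const_mul r)).mul a4).sub
      ((((a4.pow 2).add (a5.pow 2)).mul a6).const_mul (1 / 2)))).add
      (((a1.const_mul (a / 2 : ℝ)).sub ((((a6.pow 2).add_const (r ^ 2)).mul a1).mul_const
        (1 / 4))).mul (a3.mul a4))).sub ((((a3.pow 2).mul a2).mul a6).const_mul (a / 2 : ℝ))
        ).congr_deriv ?_
    simp only [Nat.cast_ofNat, Pi.mul_apply, Pi.pow_apply, Pi.add_apply, Pi.sub_apply]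
    ring
  · intro x hx r hr
    have a1 := dor x hx r hr
    have a2 := do1r x hx r hr
    have a3 := h.derivR x hx r hr
    have a4 := h.derivRR x hx r hr
    have a5 := h.derivXR x hx r hr
    have a6 := dI r
    refine (((a1.mul ((((a5.const_mul x).add (a6.mul a4)).mul a4).sub
      ((((a5.pow 2).add (a4.pow 2)).mul a6).const_mul (1 / 2)))).add
      (((a1.const_mul (a / 2 : ℝ)).sub ((((a6.pow 2).const_add (x ^ 2)).mul a1).mul_const
        (1 / 4))).mul (a3.mul a4))).sub ((((a3.pow 2).mul a2).mul a6).const_mul (a / 2 : ℝ))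
        ).congr_deriv ?_
    simp only [Nat.cast_ofNat, Pi.mul_apply, Pi.pow_apply, Pi.add_apply, Pi.sub_apply]
    ring
  · intro x hx r hr
    simp only [h.eqG x hx r hr]
    field_simp
    ring
  · intro r hr
    have l0 : Tendsto (fun x : ℝ => x) (𝓝[>] 0) (𝓝 0) := nhdsWithin_le_nhds
    have l1 := lo r hr
    obtain ⟨l, l2⟩ := lo1 r hr
    have l3 := h.limW r hr
    have l4 := h.limX r hr
    have l5 := h.limR r hr
    have := ((l1.mul ((((l0.mul l4).add (l5.const_mul r)).mul l4).sub
      ((((l4.pow 2).add (l5.pow 2)).mul l0).const_mul (1 / 2)))).add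
      (((l1.const_mul (a / 2 : ℝ)).sub ((((l0.pow 2).add_const (r ^ 2)).mul l1).mul_const
        (1 / 4))).mul (l3.mul l4))).sub ((((l3.pow 2).mul l2).mul l0).const_mul (a / 2 : ℝ))
    refine this.trans_eq ?_
    congr 1
    ring

end Snap
end Profile

/-- The weight appearing on the boundary in the Morawetz identity. -/
noncomputable def morW (a : ℕ) (q ε r : ℝ) : ℝ :=
  ((a + 1) / (q + 1) - a / 2) * om (r ^ 2 + ε) + 2 / (q + 1) * (r ^ 2 * om1 (r ^ 2 + ε))
    + (q - 1) / (4 * (q + 1)) * (r ^ 2 * om (r ^ 2 + ε))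

theorem neg_morawetz_density_le {a : ℕ} {x r G W X R O O1 O2 : ℝ} (hO : 0 < O) (hO1 : O1 < 0)
    (h1 : (x ^ 2 + r ^ 2) * O ^ 2 ≤ 1) (h2 : -((x ^ 2 + r ^ 2) * O1) ≤ 1 / 2)
    (h3 : -((x ^ 2 + r ^ 2) * O1) ≤ O) (h4 : 2 * (x ^ 2 + r ^ 2) * O2 + 3 * O1 ≤ 0) :
    -(G * (O * (x * X + r * R) + (a / 2 * O - (x ^ 2 + r ^ 2) * O * (1 / 4)) * W)
      + 2 * O1 * (x * X + r * R) ^ 2 - (x ^ 2 + r ^ 2) * O1 * (X ^ 2 + R ^ 2)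
      - 1 / 2 * (O + (x ^ 2 + r ^ 2) * O1) * W * (x * X + r * R)
      - a / 2 * W ^ 2 * ((a + 2) * O1 + 2 * (x ^ 2 + r ^ 2) * O2
        - (x ^ 2 + r ^ 2) * O1 * (1 / 2)))
    ≤ 3 / 2 * G ^ 2 + 7 / 4 * (X ^ 2 + R ^ 2) + (1 / 4 + a / 8) * W ^ 2
      + a ^ 2 / 8 * (W ^ 2 * O ^ 2) + 1 / 32 * ((x ^ 2 + r ^ 2) * W ^ 2) := by
  have hY : (x * X + r * R) ^ 2 ≤ (x ^ 2 + r ^ 2) * (X ^ 2 + R ^ 2) := by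
    nlinarith [sq_nonneg (x * R - r * X)]
  have hS : 0 ≤ x ^ 2 + r ^ 2 := by positivity
  have hD : 0 ≤ X ^ 2 + R ^ 2 := by positivity
  generalize x ^ 2 + r ^ 2 = S at *
  generalize X ^ 2 + R ^ 2 = D at *
  generalize x * X + r * R = Y at *
  have hOY : O ^ 2 * Y ^ 2 ≤ D := by
    calc O ^ 2 * Y ^ 2 ≤ O ^ 2 * (S * D) := by gcongr
      _ = (S * O ^ 2) * D := by ring
      _ ≤ 1 * D := by gcongr
      _ = D := one_mul _
  have t1 : -(G * (O * Y)) ≤ 1 / 2 * G ^ 2 + 1 / 2 * D := by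
    nlinarith [sq_nonneg (G + O * Y)]
  have t2 : -(G * (a / 2 * O * W)) ≤ 1 / 2 * G ^ 2 + a ^ 2 / 8 * (W ^ 2 * O ^ 2) := by
    nlinarith [sq_nonneg (G + a / 2 * O * W)]
  have t3 : G * (S * O * (1 / 4) * W) ≤ 1 / 2 * G ^ 2 + 1 / 32 * (S * W ^ 2) := by
    have : S ^ 2 * O ^ 2 * W ^ 2 ≤ S * W ^ 2 := by
      calc S ^ 2 * O ^ 2 * W ^ 2 = (S * O ^ 2) * (S * W ^ 2) := by ring
        _ ≤ 1 * (S * W ^ 2) := by gcongr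
        _ = _ := one_mul _
    nlinarith [sq_nonneg (G - S * O * (1 / 4) * W)]
  have t4 : -(2 * O1 * Y ^ 2) ≤ D := by
    calc -(2 * O1 * Y ^ 2) = 2 * (-O1) * Y ^ 2 := by ring
      _ ≤ 2 * (-O1) * (S * D) := by gcongr; linarith
      _ = 2 * -(S * O1) * D := by ring
      _ ≤ 2 * (1 / 2) * D := by gcongr
      _ = D := by ring
  have t5 : S * O1 * D ≤ 0 :=
    mul_nonpos_of_nonpos_of_nonneg (mul_nonpos_of_nonneg_of_nonpos hS hO1.le) hD
  have t6 : 1 / 2 * (O + S * O1) * W * Y ≤ 1 / 4 * W ^ 2 + 1 / 4 * D := by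
    have c1 : 0 ≤ O + S * O1 := by linarith
    have c2 : O + S * O1 ≤ O := by linarith [mul_nonpos_of_nonneg_of_nonpos hS hO1.le]
    have c3 : (O + S * O1) ^ 2 * Y ^ 2 ≤ D := by
      refine le_trans ?_ hOY
      gcongr
    nlinarith [sq_nonneg (W - (O + S * O1) * Y)]
  have t7 : (a : ℝ) / 2 * W ^ 2 * ((a + 2) * O1 + 2 * S * O2 - S * O1 * (1 / 2))
      ≤ a / 8 * W ^ 2 := by
    rcases Nat.eq_zero_or_pos a with ha | ha
    · simp [ha]
    · have ha1 : (1 : ℝ) ≤ a := by exact_mod_cast ha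
      have c1 : (a + 2) * O1 + 2 * S * O2 - S * O1 * (1 / 2) ≤ 1 / 4 := by nlinarith
      calc (a : ℝ) / 2 * W ^ 2 * ((a + 2) * O1 + 2 * S * O2 - S * O1 * (1 / 2))
          ≤ a / 2 * W ^ 2 * (1 / 4) := by gcongr
        _ = _ := by ring
  linarith

theorem polyZ_om {ε : ℝ} (hε : 0 < ε) : PolyZ (fun r => om (r ^ 2 + ε)) := by
  refine ⟨ContinuousOn.comp (g := om) (t := Ici ε) (fun A hA =>
    (hasDerivAt_om (hε.trans_le hA)).continuousAt.continuousWithinAt)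
    (f := fun r : ℝ => r ^ 2 + ε) (by fun_prop) fun r _ => by
      simp only [mem_Ici]; nlinarith [sq_nonneg r], 1 / √ε, 0, by positivity, fun r _ => ?_⟩
  have hA : 0 < r ^ 2 + ε := by positivity
  have h1 := om_mul_sqrt_le hA
  have h2 := om_pos hA
  have h3 : √ε ≤ √(r ^ 2 + ε) := Real.sqrt_le_sqrt (by nlinarith [sq_nonneg r])
  rw [abs_of_pos h2, pow_zero, mul_one, le_div_iff₀ (Real.sqrt_pos.2 hε)]
  nlinarith

theorem polyZ_sq_mul_om1 {ε : ℝ} (hε : 0 < ε) : PolyZ (fun r => r ^ 2 * om1 (r ^ 2 + ε)) := by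
  refine ⟨ContinuousOn.mul (by fun_prop) (ContinuousOn.comp (g := om1) (t := Ici ε)
    (fun A hA => (hasDerivAt_om1 (hε.trans_le hA)).continuousAt.continuousWithinAt)
    (f := fun r : ℝ => r ^ 2 + ε) (by fun_prop) fun r _ => by
      simp only [mem_Ici]; nlinarith [sq_nonneg r]), 1, 0, zero_le_one, fun r _ => ?_⟩
  have hA : 0 < r ^ 2 + ε := by positivity
  have h1 := (neg_mul_om1_le (s := r ^ 2) hA (sq_nonneg r) (by linarith)).1
  have h2 : r ^ 2 * om1 (r ^ 2 + ε) ≤ 0 :=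
    mul_nonpos_of_nonneg_of_nonpos (sq_nonneg r) (om1_neg hA).le
  rw [abs_of_nonpos h2]
  linarith

theorem polyZ_morW {a : ℕ} {q ε : ℝ} (hε : 0 < ε) : PolyZ (morW a q ε) :=
  (((polyZ_om hε).const_mul _).add ((polyZ_sq_mul_om1 hε).const_mul _)).add
    (((PolyZ.id.pow 2).mul (polyZ_om hε)).const_mul _)

namespace Profile
namespace Snap

variable {φ : Profile} {a : ℕ} {q : ℝ}

/-- The Morawetz estimate. -/
theorem bint_morW_le (h : φ.Snap a q) (hq : 0 < q) {ε : ℝ} (hε : 0 < ε) :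
    bint a (fun r => φ.w0 r ^ (q + 1) * morW a q ε r)
      ≤ (4 + a + a ^ 2) * (φ.lapSq a + φ.dir a + φ.mass a) := by
  have hA : ∀ x r : ℝ, 0 < x ^ 2 + r ^ 2 + ε := fun x r => by positivity
  have lim : ∀ {g : ℝ → ℝ} {r g' : ℝ}, HasDerivAt g g' (0 ^ 2 + r ^ 2 + ε) →
      Tendsto (fun x : ℝ => g (x ^ 2 + r ^ 2 + ε)) (𝓝[>] 0) (𝓝 (g (r ^ 2 + ε))) := by
    intro g r g' hg
    have := ((hasDerivAt_sq_left hg).continuousAt.tendsto).mono_left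
      (nhdsWithin_le_nhds (s := Ioi 0))
    simpa using this
  obtain ⟨hd, e⟩ := h.wint_morawetz (polyB_om hε) (polyB_om1 hε) (polyB_om2 hε)
    (fun x _ r _ => hasDerivAt_sq_left (hasDerivAt_om (hA x r)))
    (fun x _ r _ => hasDerivAt_sq_right (hasDerivAt_om (hA x r)))
    (fun x _ r _ => hasDerivAt_sq_left (hasDerivAt_om1 (hA x r)))
    (fun x _ r _ => hasDerivAt_sq_right (hasDerivAt_om1 (hA x r)))
    (o0 := fun r => om (r ^ 2 + ε))
    (fun r _ => lim (hasDerivAt_om (hA 0 r)))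
    (fun r _ => ⟨_, lim (hasDerivAt_om1 (hA 0 r))⟩)
  have pw := h.polyW
  have p1 : PolyB (fun x r => 3 / 2 * φ.G x r ^ 2) := (h.polyG.pow 2).const_mul _
  have p2 : PolyB (fun x r => 7 / 4 * (φ.wx x r ^ 2 + φ.wr x r ^ 2)) := h.polyDir.const_mul _
  have p3 : PolyB (fun x r => (1 / 4 + a / 8 : ℝ) * φ.w x r ^ 2) := (pw.pow 2).const_mul _
  have p4 : PolyB (fun x r => (a ^ 2 / 8 : ℝ) * (φ.w x r ^ 2 * om (x ^ 2 + r ^ 2 + ε) ^ 2)) :=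
    ((pw.pow 2).mul ((polyB_om hε).pow 2)).const_mul _
  have p5 : PolyB (fun x r => (1 / 32 : ℝ) * ((x ^ 2 + r ^ 2) * φ.w x r ^ 2)) :=
    (((PolyB.fst.pow 2).add (PolyB.snd.pow 2)).mul (pw.pow 2)).const_mul _
  have hle := wint_mono a hd.neg ((((p1.add p2).add p3).add p4).add p5) fun x hx r hr => by
    have n1 := neg_mul_om1_le (s := x ^ 2 + r ^ 2) (hA x r) (by positivity) (by linarith)
    exact neg_morawetz_density_le (om_pos (hA x r)) (om1_neg (hA x r))
      (mul_sq_om_le (hA x r) (by linarith)) n1.1 n1.2 (mul_om2_le (hA x r) (by linarith))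
  rw [wint_add a (((p1.add p2).add p3).add p4) p5, wint_add a ((p1.add p2).add p3) p4,
    wint_add a (p1.add p2) p3, wint_add a p1 p2, wint_const_mul, wint_const_mul, wint_const_mul,
    wint_const_mul, wint_const_mul] at hle
  have hneg : ∀ f : ℝ → ℝ → ℝ, wint a (fun x r => -f x r) = -wint a f := fun f => by
    rw [← neg_one_mul, ← wint_const_mul]; exact wint_congr a fun x _ r _ => by ring
  rw [hneg, e, neg_neg] at hle
  have m1 := h.wint_om_sq_le hε
  have m2 := h.moment_le
  -- radial integration by parts on the boundary
  have pΩ := polyZ_morW (a := a) (q := q) hε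
  have po0 := polyZ_om hε
  have po1 := polyZ_sq_mul_om1 hε
  have pq := h.polyPow (p := q) hq.le
  have pq1 := h.polyPow (p := q + 1) (by linarith)
  have ph : PolyZ (fun r => om (r ^ 2 + ε) * φ.w0 r ^ (q + 1)
      + (2 * (r ^ 2 * om1 (r ^ 2 + ε)) * φ.w0 r ^ (q + 1)
        + (q + 1) * (om (r ^ 2 + ε) * (r * φ.w0r r) * φ.w0 r ^ q))) :=
    (po0.mul pq1).add (((po1.const_mul 2).mul pq1).add
      (((po0.mul (PolyZ.id.mul h.polyW0r)).mul pq).const_mul _))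
  have ib := bint_div a (po0.mul pq1) ph fun r hr => by
    have d1 : HasDerivAt (fun y : ℝ => om (y ^ 2 + ε)) (om1 (r ^ 2 + ε) * (2 * r)) r := by
      have := hasDerivAt_sq_right (x := 0) (r := r) (ε := ε) (g := om)
        (hasDerivAt_om (hA 0 r))
      simpa using this
    have d2 := (h.deriv0 r hr).rpow_const (p := q + 1) (Or.inl (h.pos0 r hr).ne')
    refine ((hasDerivAt_id r).mul (d1.mul d2)).congr_deriv ?_
    rw [add_sub_cancel_right]
    simp only [id, Pi.mul_apply]
    ring
  have hfin : bint a (fun r => φ.w0 r ^ (q + 1) * morW a q ε r)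
      = bint a (fun r => om (r ^ 2 + ε) * (r * φ.w0r r) * -(φ.w0 r ^ q)
        + (a / 2 * om (r ^ 2 + ε) - r ^ 2 * om (r ^ 2 + ε) * (1 / 4)) * φ.w0 r * -(φ.w0 r ^ q))
      := by
    rw [← sub_eq_zero]
    have hq1 : q + 1 ≠ 0 := by linarith
    have pB : PolyZ (fun r => om (r ^ 2 + ε) * (r * φ.w0r r) * -(φ.w0 r ^ q)
        + (a / 2 * om (r ^ 2 + ε) - r ^ 2 * om (r ^ 2 + ε) * (1 / 4)) * φ.w0 r
          * -(φ.w0 r ^ q)) :=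
      ((po0.mul (PolyZ.id.mul h.polyW0r)).mul pq.neg).add
        ((((po0.const_mul (a / 2)).sub (((PolyZ.id.pow 2).mul po0).mul (PolyZ.const _))).mul
          h.polyW0).mul pq.neg)
    rw [← bint_sub a (pq1.mul pΩ) pB]
    have := congrArg (fun t => 1 / (q + 1) * t) ib
    simp only [mul_zero] at this
    rw [← bint_const_mul] at this
    rw [← this]
    refine bint_congr a fun r hr => ?_
    rw [Real.rpow_add_one (h.pos0 r hr).ne']
    unfold morW
    field_simp
    ring
  rw [hfin]
  refine hle.trans ?_
  have n1 := lapSq_nonneg φ a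
  have n2 := dir_nonneg φ a
  have n3 := mass_nonneg φ a
  have m1' := mul_le_mul_of_nonneg_left m1 (by positivity : (0 : ℝ) ≤ a ^ 2 / 8)
  have m2' := mul_le_mul_of_nonneg_left m2 (by norm_num : (0 : ℝ) ≤ 1 / 32)
  have ha : (0 : ℝ) ≤ a := by positivity
  have s1 : 0 ≤ (a : ℝ) ^ 2 * φ.lapSq a := by positivity
  have s2 : 0 ≤ (a : ℝ) ^ 2 * φ.dir a := by positivity
  have s3 : 0 ≤ (a : ℝ) ^ 2 * φ.mass a := by positivity
  have s4 : 0 ≤ (a : ℝ) * φ.lapSq a := by positivity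
  have s5 : 0 ≤ (a : ℝ) * φ.dir a := by positivity
  have s6 : 0 ≤ (a : ℝ) * φ.mass a := by positivity
  change 3 / 2 * φ.lapSq a + 7 / 4 * φ.dir a + (1 / 4 + a / 8) * φ.mass a + a ^ 2 / 8 * _
    + 1 / 32 * _ ≤ _
  nlinarith

end Snap
end Profile

/-- The boundary weight is large off a compact subset of `(0, ∞)`. -/
theorem exists_morW_ge {a : ℕ} {q : ℝ} (hq : 1 < q) (ha : a * q < a + 2) (K : ℝ) (hK : 0 < K) :
    ∃ ε η R : ℝ, 0 < ε ∧ 0 < η ∧ η < R ∧ (∀ r, 0 < r → -1 ≤ morW a q ε r) ∧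
      ∀ r, 0 < r → r ∉ Icc η R → K ≤ morW a q ε r := by
  set δ : ℝ := (a + 1) / (q + 1) - a / 2 with hδ
  have hδ0 : 0 < δ := by
    rw [hδ, sub_pos, div_lt_div_iff₀ (by norm_num) (by linarith)]; linarith
  set c : ℝ := (q - 1) / (4 * (q + 1)) with hc
  have hc0 : 0 < c := div_pos (by linarith) (by linarith)
  set T : ℝ := Real.exp ((K + 1) / δ) with hT
  have hT1 : 1 < T := by
    rw [hT]; exact Real.one_lt_exp_iff.2 (by positivity)
  -- `om A ≥ (K + 1) / δ` when `A ≤ 1 / T ^ 2`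
  have low : ∀ ε r, 0 < ε → 0 < r → δ * om (r ^ 2 + ε) + c * (r ^ 2 * om (r ^ 2 + ε)) - 1
      ≤ morW a q ε r := by
    intro ε r hε hr
    have h1 := (neg_mul_om1_le (A := r ^ 2 + ε) (s := r ^ 2) (by positivity) (by positivity)
      (by linarith)).1
    have h2 : -1 ≤ 2 / (q + 1) * (r ^ 2 * om1 (r ^ 2 + ε)) := by
      have h3 : 0 < 2 / (q + 1) := by positivity
      have h4 : 2 / (q + 1) ≤ 2 := by rw [div_le_iff₀ (by linarith)]; linarith
      nlinarith
    unfold morW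
    rw [← hδ, ← hc]
    linarith
  have hT0 : 0 < T := by linarith
  have hTT : 1 / T ≤ 1 := by rw [div_le_one hT0]; exact hT1.le
  refine ⟨1 / (2 * T ^ 2), 1 / (2 * T), max 1 (3 * (K + 1) / c), by positivity, by positivity,
    lt_max_of_lt_left ?_, ?_, ?_⟩
  · rw [div_lt_one (by positivity)]; linarith
  · intro r hr
    refine le_trans ?_ (low _ r (by positivity) hr)
    have := om_pos (A := r ^ 2 + 1 / (2 * T ^ 2)) (by positivity)
    have : 0 ≤ δ * om (r ^ 2 + 1 / (2 * T ^ 2)) := by positivity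
    have : 0 ≤ c * (r ^ 2 * om (r ^ 2 + 1 / (2 * T ^ 2))) := by positivity
    linarith
  · intro r hr hr'
    refine le_trans ?_ (low _ r (by positivity) hr)
    have hom := om_pos (A := r ^ 2 + 1 / (2 * T ^ 2)) (by positivity)
    rw [mem_Icc, not_and_or, not_le, not_le] at hr'
    rcases hr' with hr' | hr'
    · have hA : r ^ 2 + 1 / (2 * T ^ 2) ≤ (1 / T) ^ 2 := by
        have : r ^ 2 ≤ (1 / (2 * T)) ^ 2 := by gcongr
        have e1 : (1 / (2 * T)) ^ 2 = 1 / 4 * (1 / T) ^ 2 := by field_simp; norm_num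
        have e2 : 1 / (2 * T ^ 2) = 1 / 2 * (1 / T) ^ 2 := by field_simp
        rw [e2]; nlinarith [sq_nonneg (1 / T)]
      have hs : √(r ^ 2 + 1 / (2 * T ^ 2)) ≤ 1 / T :=
        (Real.sqrt_le_sqrt hA).trans (Real.sqrt_sq (by positivity)).le
      have hs0 : 0 < √(r ^ 2 + 1 / (2 * T ^ 2)) := Real.sqrt_pos.2 (by positivity)
      have h1 : (K + 1) / δ ≤ om (r ^ 2 + 1 / (2 * T ^ 2)) := by
        unfold om
        rw [Real.le_log_iff_exp_le (by positivity), ← hT]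
        have : T ≤ 1 / √(r ^ 2 + 1 / (2 * T ^ 2)) := by
          rw [le_div_iff₀ hs0]
          calc T * √(r ^ 2 + 1 / (2 * T ^ 2)) ≤ T * (1 / T) := by gcongr
            _ = 1 := by field_simp
        linarith
      have h2 : K + 1 ≤ δ * om (r ^ 2 + 1 / (2 * T ^ 2)) := by
        rw [div_le_iff₀ hδ0] at h1; linarith
      have : 0 ≤ c * (r ^ 2 * om (r ^ 2 + 1 / (2 * T ^ 2))) := by positivity
      linarith
    · have hr1 : 1 < r := (le_max_left _ _).trans_lt hr'
      have hr2 : 3 * (K + 1) / c < r := (le_max_right _ _).trans_lt hr'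
      have h1 := inv_le_om (A := r ^ 2 + 1 / (2 * T ^ 2)) (by positivity)
      have hs : √(r ^ 2 + 1 / (2 * T ^ 2)) ≤ r + 1 := by
        rw [Real.sqrt_le_left (by positivity)]
        have : 1 / (2 * T ^ 2) ≤ 1 := by
          rw [div_le_one (by positivity)]; nlinarith
        nlinarith
      have h2 : r / 3 ≤ r ^ 2 * om (r ^ 2 + 1 / (2 * T ^ 2)) := by
        have h3 : 1 / (3 * r) ≤ om (r ^ 2 + 1 / (2 * T ^ 2)) := by
          refine le_trans ?_ h1
          apply one_div_le_one_div_of_le (by positivity)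
          linarith
        calc r / 3 = r ^ 2 * (1 / (3 * r)) := by field_simp
          _ ≤ _ := by gcongr
      rw [div_lt_iff₀ hc0] at hr2
      have h4 : K + 1 ≤ c * (r ^ 2 * om (r ^ 2 + 1 / (2 * T ^ 2))) := by nlinarith
      have : 0 ≤ δ * om (r ^ 2 + 1 / (2 * T ^ 2)) := by positivity
      linarith

namespace Profile

/-- Concentration of the critical boundary integral is controlled by interior quantities. -/
theorem exists_bdry_le_mid {a : ℕ} {q : ℝ} (hq : 1 < q) (ha : a * q < a + 2) {θ : ℝ}
    (hθ : 0 < θ) : ∃ η R : ℝ, 0 < η ∧ η < R ∧ ∀ φ : Profile, φ.Snap a q →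
      φ.bdry a (q + 1) ≤ θ * (φ.lapSq a + φ.dir a + φ.mass a)
        + 2 * ∫ r in Icc η R, kap0 a r * φ.w0 r ^ (q + 1) := by
  set Ca : ℝ := 4 + a + a ^ 2 with hCa
  have hCa0 : 0 < Ca := by positivity
  set K : ℝ := Ca / θ + 1 with hK
  have hK0 : 0 < K := by positivity
  have hK1 : 1 ≤ K := by rw [hK]; linarith [div_pos hCa0 hθ]
  obtain ⟨ε, η, R, hε, hη, hR, h1, h2⟩ := exists_morW_ge hq ha K hK0
  refine ⟨η, R, hη, hR, fun φ h => ?_⟩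
  have hm := h.bint_morW_le (by linarith : 0 < q) hε
  have pq1 := h.polyPow (p := q + 1) (by linarith)
  have i1 := (pq1.const_mul K).integrableOn a
  have i2 := (pq1.integrableOn a).indicator (measurableSet_Icc (a := η) (b := R))
  have i3 := (pq1.mul (polyZ_morW (a := a) (q := q) hε)).integrableOn a
  have hle : bint a (fun r => K * φ.w0 r ^ (q + 1)) ≤
      bint a (fun r => φ.w0 r ^ (q + 1) * morW a q ε r)
      + (K + 1) * ∫ r in Icc η R, kap0 a r * φ.w0 r ^ (q + 1) := by
    have e : ∫ r in Icc η R, kap0 a r * φ.w0 r ^ (q + 1)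
        = ∫ r in Ioi 0, (Icc η R).indicator (fun r => kap0 a r * φ.w0 r ^ (q + 1)) r := by
      rw [setIntegral_indicator measurableSet_Icc]
      congr 2
      ext r; simp only [mem_Icc, mem_inter_iff, mem_Ioi]
      constructor
      · intro h; exact ⟨hη.trans_le h.1, h⟩
      · exact fun h => h.2
    rw [e, ← integral_const_mul]
    unfold bint
    rw [← integral_add i3 (i2.const_mul _)]
    refine setIntegral_mono_on i1 (i3.add (i2.const_mul _)) measurableSet_Ioi fun r hr => ?_
    have hr0 : 0 < r := hr
    have hk := kap0_pos a hr0
    have hw : 0 < φ.w0 r ^ (q + 1) := Real.rpow_pos_of_pos (h.pos0 r hr0) _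
    have hkw := mul_pos hk hw
    by_cases hmem : r ∈ Icc η R
    · simp only [indicator_of_mem hmem]
      nlinarith [h1 r hr0]
    · simp only [indicator_of_notMem hmem, mul_zero, add_zero]
      nlinarith [h2 r hr0 hmem]
  rw [bint_const_mul] at hle
  change K * φ.bdry a (q + 1) ≤ _ at hle
  have hmid : 0 ≤ ∫ r in Icc η R, kap0 a r * φ.w0 r ^ (q + 1) :=
    setIntegral_nonneg measurableSet_Icc fun r hr => by
      have hr0 := hη.trans_le hr.1
      have := kap0_pos a hr0
      have := h.pos0 r hr0
      positivity
  have hI : 0 ≤ φ.lapSq a + φ.dir a + φ.mass a := by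
    linarith [Snap.lapSq_nonneg φ a, Snap.dir_nonneg φ a, Snap.mass_nonneg φ a]
  have h3 : K * φ.bdry a (q + 1) ≤ K * (θ * (φ.lapSq a + φ.dir a + φ.mass a)
        + 2 * ∫ r in Icc η R, kap0 a r * φ.w0 r ^ (q + 1)) := by
    have : Ca ≤ K * θ := by rw [hK, add_mul, div_mul_cancel₀ _ hθ.ne']; linarith
    nlinarith
  exact le_of_mul_le_mul_left h3 hK0

end Profile

/-- The Cauchy-Schwarz inequality for integrals. -/
theorem sq_integral_mul_le {α : Type*} [MeasurableSpace α] {μ : Measure α} {f g : α → ℝ}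
    (hf : Integrable (fun x => f x ^ 2) μ) (hg : Integrable (fun x => g x ^ 2) μ)
    (hfg : Integrable (fun x => f x * g x) μ) :
    (∫ x, f x * g x ∂μ) ^ 2 ≤ (∫ x, f x ^ 2 ∂μ) * ∫ x, g x ^ 2 ∂μ := by
  have key : ∀ t : ℝ, 0 ≤ (∫ x, f x ^ 2 ∂μ) * (t * t) + (2 * ∫ x, f x * g x ∂μ) * t
      + ∫ x, g x ^ 2 ∂μ := by
    intro t
    have h0 : 0 ≤ ∫ x, (t * f x + g x) ^ 2 ∂μ := integral_nonneg fun x => sq_nonneg _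
    have e : ∫ x, (t * f x + g x) ^ 2 ∂μ
        = ∫ x, (t * t * f x ^ 2 + 2 * t * (f x * g x) + g x ^ 2) ∂μ :=
      integral_congr_ae (Eventually.of_forall fun x => by ring)
    have i1 : Integrable (fun x => t * t * f x ^ 2) μ := hf.const_mul _
    have i2 : Integrable (fun x => 2 * t * (f x * g x)) μ := hfg.const_mul _
    have i3 : Integrable (fun x => t * t * f x ^ 2 + 2 * t * (f x * g x)) μ := i1.add i2
    rw [e, integral_add i3 hg, integral_add i1 i2, integral_const_mul,
      integral_const_mul] at h0
    linarith
  have := discrim_le_zero key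
  unfold discrim at this
  nlinarith

/-- A one-dimensional trace inequality. -/
theorem abs_mul_le_integral {f f' : ℝ → ℝ} {α β x : ℝ} (hx : x ∈ Ioo α β)
    (hd : ∀ y ∈ Ioo α β, HasDerivAt f (f' y) y) (hf : IntegrableOn f (Ioo α β))
    (hf' : IntegrableOn f' (Ioo α β)) :
    (β - α) * |f x| ≤ (∫ y in Ioo α β, |f y|) + (β - α) * ∫ y in Ioo α β, |f' y| := by
  have hαβ : α < β := hx.1.trans hx.2
  have key : ∀ y ∈ Ioo α β, |f x| ≤ |f y| + ∫ y in Ioo α β, |f' y| := by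
    intro y hy
    have hsub : uIcc y x ⊆ Ioo α β := ordConnected_Ioo.uIcc_subset hy hx
    have hsub' : uIoc y x ⊆ Ioo α β := uIoc_subset_uIcc.trans hsub
    have h1 := intervalIntegral.integral_eq_sub_of_hasDerivAt
      (fun z hz => hd z (hsub hz)) (intervalIntegrable_iff.2 (hf'.mono_set hsub'))
    have h2 : |f x - f y| ≤ ∫ z in uIoc y x, |f' z| := by
      rw [← h1]
      exact intervalIntegral.norm_integral_le_integral_norm_uIoc (f := f') (μ := volume)
    have h3 : ∫ z in uIoc y x, |f' z| ≤ ∫ z in Ioo α β, |f' z| :=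
      setIntegral_mono_set hf'.abs (Eventually.of_forall fun z => abs_nonneg _)
        hsub'.eventuallyLE
    have := abs_sub_abs_le_abs_sub (f x) (f y)
    linarith
  have ic : ∀ c : ℝ, IntegrableOn (fun _ : ℝ => c) (Ioo α β) := fun c =>
    integrableOn_const (by simp) (by simp)
  have h : ∫ _ in Ioo α β, |f x| ≤ ∫ y in Ioo α β, (|f y| + ∫ y in Ioo α β, |f' y|) :=
    setIntegral_mono_on (ic _) (hf.abs.add (ic _)) measurableSet_Ioo key
  rw [integral_add hf.abs (ic _)] at h
  simpa [hαβ.le] using h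

theorem PolyB.abs {h : ℝ → ℝ → ℝ} (hh : PolyB h) : PolyB (fun x r => |h x r|) := by
  obtain ⟨hc, C, N, hC, hb⟩ := hh
  exact ⟨hc.abs, C, N, hC, fun x hx r hr => by rw [abs_abs]; exact hb x hx r hr⟩

/-- The measure on the box used in the local estimates. -/
noncomputable def boxM (η R : ℝ) : Measure (ℝ × ℝ) :=
  (volume.restrict (Ioo (0 : ℝ) 1)).prod (volume.restrict (Ioo η R))

theorem boxM_eq (η R : ℝ) : boxM η R = volume.restrict (Ioo (0 : ℝ) 1 ×ˢ Ioo η R) := by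
  rw [boxM, Measure.prod_restrict, Measure.volume_eq_prod]

theorem PolyB.integrable_box {h : ℝ → ℝ → ℝ} (hh : PolyB h) {η R : ℝ} (hη : 0 < η) :
    Integrable (fun p : ℝ × ℝ => h p.1 p.2) (boxM η R) := by
  obtain ⟨hc, C, N, hC, hb⟩ := hh
  rw [boxM_eq]
  have hsub : Ioo (0 : ℝ) 1 ×ˢ Ioo η R ⊆ quarter :=
    fun p hp => ⟨hp.1.1, hη.trans hp.2.1⟩
  have hm : MeasurableSet (Ioo (0 : ℝ) 1 ×ˢ Ioo η R) := measurableSet_Ioo.prod measurableSet_Ioo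
  refine IntegrableOn.of_bound ?_ ((hc.mono hsub).aestronglyMeasurable hm) (C * (1 + 1 + R) ^ N) ?_
  · rw [Measure.volume_eq_prod, Measure.prod_prod]
    exact ENNReal.mul_lt_top (by simp) (by simp)
  · refine (ae_restrict_iff' hm).2 (Eventually.of_forall fun p hp => ?_)
    refine (hb p.1 hp.1.1 p.2 (hη.trans hp.2.1)).trans ?_
    have h1 := hp.1.1; have h2 := hp.1.2; have h3 := hη.trans hp.2.1; have h4 := hp.2.2
    gcongr

theorem PolyB.integrableOn_fst {h : ℝ → ℝ → ℝ} (hh : PolyB h) {r : ℝ} (hr : 0 < r) :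
    IntegrableOn (fun x => h x r) (Ioo 0 1) := by
  obtain ⟨hc, C, N, hC, hb⟩ := hh
  refine IntegrableOn.of_bound (by simp)
    (ContinuousOn.aestronglyMeasurable (hc.comp (f := fun x : ℝ => (x, r)) (by fun_prop)
      fun x hx => ⟨hx.1, hr⟩) measurableSet_Ioo) (C * (1 + 1 + r) ^ N) ?_
  refine (ae_restrict_iff' measurableSet_Ioo).2 (Eventually.of_forall fun x hx => ?_)
  refine (hb x hx.1 r hr).trans ?_
  have h1 := hx.1; have h2 := hx.2
  gcongr

theorem PolyB.integrableOn_snd {h : ℝ → ℝ → ℝ} (hh : PolyB h) {x η R : ℝ} (hx : 0 < x)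
    (hη : 0 < η) : IntegrableOn (fun r => h x r) (Ioo η R) := by
  obtain ⟨hc, C, N, hC, hb⟩ := hh
  refine IntegrableOn.of_bound (by simp)
    (ContinuousOn.aestronglyMeasurable (hc.comp (f := fun r : ℝ => (x, r)) (by fun_prop)
      fun r hr => ⟨hx, hη.trans hr.1⟩) measurableSet_Ioo) (C * (1 + x + R) ^ N) ?_
  refine (ae_restrict_iff' measurableSet_Ioo).2 (Eventually.of_forall fun r hr => ?_)
  have h1 := hη.trans hr.1
  refine (hb x hx r h1).trans ?_
  have h2 := hr.2
  gcongr

/-- The two-dimensional embedding of `W^{1,1}` into `L²` on a box. -/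
theorem integral_box_sq_le {h hx hr : ℝ → ℝ → ℝ} (ph : PolyB h) (phx : PolyB hx) (phr : PolyB hr)
    (dx : ∀ x, 0 < x → ∀ r, 0 < r → HasDerivAt (fun y => h y r) (hx x r) x)
    (dr : ∀ x, 0 < x → ∀ r, 0 < r → HasDerivAt (fun y => h x y) (hr x r) r)
    {η R : ℝ} (hη : 0 < η) (hR : η < R) :
    ∫ p, h p.1 p.2 ^ 2 ∂boxM η R ≤ (1 / (R - η) + 1) *
      (∫ p, (|h p.1 p.2| + (|hx p.1 p.2| + |hr p.1 p.2|)) ∂boxM η R) ^ 2 := by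
  have hRη : 0 < R - η := sub_pos.2 hR
  set c := 1 / (R - η) with hc
  have hc0 : 0 < c := by positivity
  have pβ : PolyB (fun x r => |h x r| + |hx x r|) := ph.abs.add phx.abs
  have pα : PolyB (fun x r => c * |h x r| + |hr x r|) := (ph.abs.const_mul c).add phr.abs
  have iβ := pβ.integrable_box (R := R) hη
  have iα := pα.integrable_box (R := R) hη
  set α : ℝ → ℝ := fun x => ∫ r in Ioo η R, (c * |h x r| + |hr x r|) with hα
  set β : ℝ → ℝ := fun r => ∫ x in Ioo (0 : ℝ) 1, (|h x r| + |hx x r|) with hβ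
  have jα : Integrable α (volume.restrict (Ioo (0 : ℝ) 1)) := iα.integral_prod_left
  have jβ : Integrable β (volume.restrict (Ioo η R)) := iβ.integral_prod_right
  have eα : ∫ x in Ioo (0 : ℝ) 1, α x = ∫ p, (c * |h p.1 p.2| + |hr p.1 p.2|) ∂boxM η R :=
    (integral_prod _ iα).symm
  have eβ : ∫ r in Ioo η R, β r = ∫ p, (|h p.1 p.2| + |hx p.1 p.2|) ∂boxM η R :=
    (integral_prod_symm _ iβ).symm
  have bα : ∀ x ∈ Ioo (0 : ℝ) 1, ∀ r ∈ Ioo η R, |h x r| ≤ α x := by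
    intro x hx0 r hr0
    have i1 := ph.integrableOn_snd (R := R) hx0.1 hη
    have i2 := phr.integrableOn_snd (R := R) hx0.1 hη
    have := abs_mul_le_integral hr0 (fun y hy => dr x hx0.1 y (hη.trans hy.1)) i1 i2
    have e : α x = c * (∫ y in Ioo η R, |h x y|) + ∫ y in Ioo η R, |hr x y| := by
      rw [hα]
      simp only
      rw [integral_add (i1.abs.const_mul c) i2.abs, integral_const_mul]
    rw [e, hc]
    have h3 : |h x r| = 1 / (R - η) * ((R - η) * |h x r|) := by field_simp
    rw [h3]
    refine (mul_le_mul_of_nonneg_left this (by positivity)).trans_eq ?_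
    field_simp
  have bβ : ∀ x ∈ Ioo (0 : ℝ) 1, ∀ r ∈ Ioo η R, |h x r| ≤ β r := by
    intro x hx0 r hr0
    have hr1 := hη.trans hr0.1
    have i1 := ph.integrableOn_fst hr1
    have i2 := phx.integrableOn_fst hr1
    have := abs_mul_le_integral hx0 (fun y hy => dx y hy.1 r hr1) i1 i2
    have e : β r = (∫ y in Ioo (0 : ℝ) 1, |h y r|) + ∫ y in Ioo (0 : ℝ) 1, |hx y r| := by
      rw [hβ]
      simp only
      rw [integral_add i1.abs i2.abs]
    rw [e]
    linarith
  have hsq : ∫ p, h p.1 p.2 ^ 2 ∂boxM η R ≤ ∫ p : ℝ × ℝ, α p.1 * β p.2 ∂boxM η R := by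
    refine integral_mono_ae ((ph.pow 2).integrable_box hη) (jα.mul_prod jβ) ?_
    rw [boxM_eq]
    refine (ae_restrict_iff' (measurableSet_Ioo.prod measurableSet_Ioo)).2
      (Eventually.of_forall fun p hp => ?_)
    have h1 := bα p.1 hp.1 p.2 hp.2
    have h2 := bβ p.1 hp.1 p.2 hp.2
    change h p.1 p.2 ^ 2 ≤ α p.1 * β p.2
    rw [← sq_abs, sq]
    exact mul_le_mul h1 h2 (abs_nonneg _) ((abs_nonneg _).trans h1)
  have hprod : ∫ p : ℝ × ℝ, α p.1 * β p.2 ∂boxM η R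
      = (∫ x in Ioo (0 : ℝ) 1, α x) * ∫ r in Ioo η R, β r := integral_prod_mul _ _
  have pI : PolyB (fun x r => |h x r| + (|hx x r| + |hr x r|)) :=
    ph.abs.add (phx.abs.add phr.abs)
  have iI := pI.integrable_box (R := R) hη
  set I := ∫ p, (|h p.1 p.2| + (|hx p.1 p.2| + |hr p.1 p.2|)) ∂boxM η R with hI
  have l1 : ∫ p, (c * |h p.1 p.2| + |hr p.1 p.2|) ∂boxM η R ≤ (c + 1) * I := by
    rw [hI, ← integral_const_mul]
    refine integral_mono iα (iI.const_mul _) fun p => ?_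
    have h1 := abs_nonneg (h p.1 p.2); have h2 := abs_nonneg (hx p.1 p.2)
    have h3 := abs_nonneg (hr p.1 p.2)
    simp only
    nlinarith [mul_nonneg hc0.le h2, mul_nonneg hc0.le h3]
  have l2 : ∫ p, (|h p.1 p.2| + |hx p.1 p.2|) ∂boxM η R ≤ I := by
    rw [hI]
    refine integral_mono iβ iI fun p => ?_
    have h3 := abs_nonneg (hr p.1 p.2)
    simp only
    linarith
  have n2 : 0 ≤ ∫ p, (|h p.1 p.2| + |hx p.1 p.2|) ∂boxM η R :=
    integral_nonneg fun p => by positivity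
  have nI : 0 ≤ I := n2.trans l2
  calc ∫ p, h p.1 p.2 ^ 2 ∂boxM η R ≤ _ := hsq
    _ = _ := hprod
    _ ≤ ((c + 1) * I) * I := by rw [eα, eβ]; gcongr
    _ = _ := by ring

theorem rpow_interpolation {t K q p : ℝ} (ht : 0 < t) (hK : 0 < K) (hp : q + 1 ≤ p) :
    t ^ (q + 1) ≤ K * t ^ q + K ^ (-(p - q - 1)) * t ^ p := by
  have h1 : 0 < t ^ q := Real.rpow_pos_of_pos ht q
  have h2 : 0 < K ^ (-(p - q - 1)) * t ^ p :=
    mul_pos (Real.rpow_pos_of_pos hK _) (Real.rpow_pos_of_pos ht _)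
  rcases le_total t K with h | h
  · rw [Real.rpow_add_one ht.ne']; nlinarith
  · have e : t ^ (q + 1) = t ^ (-(p - q - 1)) * t ^ p := by
      rw [← Real.rpow_add ht]; congr 1; ring
    have h3 : t ^ (-(p - q - 1)) ≤ K ^ (-(p - q - 1)) :=
      Real.rpow_le_rpow_of_nonpos hK h (by linarith)
    have h4 : t ^ (q + 1) ≤ K ^ (-(p - q - 1)) * t ^ p := by
      rw [e]; gcongr
    have : 0 < K * t ^ q := by positivity
    linarith

namespace Profile

/-- The Sobolev norm squared on a box. -/
noncomputable def boxD (φ : Profile) (η R : ℝ) : ℝ :=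
  ∫ p, (φ.w p.1 p.2 ^ 2 + (φ.wx p.1 p.2 ^ 2 + φ.wr p.1 p.2 ^ 2)) ∂boxM η R

/-- The `W^{1,1}` norm of a power on a box. -/
noncomputable def boxI (φ : Profile) (η R : ℝ) (m : ℕ) : ℝ :=
  ∫ p, (|φ.w p.1 p.2 ^ (m + 1)| + (|(m + 1) * (φ.w p.1 p.2 ^ m * φ.wx p.1 p.2)|
    + |(m + 1) * (φ.w p.1 p.2 ^ m * φ.wr p.1 p.2)|)) ∂boxM η R

namespace Snap

variable {φ : Profile} {a : ℕ} {q : ℝ}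

theorem polyBoxI (h : φ.Snap a q) (m : ℕ) : PolyB (fun x r => |φ.w x r ^ (m + 1)|
    + (|((m : ℝ) + 1) * (φ.w x r ^ m * φ.wx x r)| + |((m : ℝ) + 1) * (φ.w x r ^ m * φ.wr x r)|)) :=
  (h.polyW.pow _).abs.add ((((h.polyW.pow m).mul h.polyX).const_mul _).abs.add
    (((h.polyW.pow m).mul h.polyR).const_mul _).abs)

theorem boxD_nonneg (φ : Profile) (η R : ℝ) : 0 ≤ φ.boxD η R :=
  integral_nonneg fun p => by positivity

theorem boxI_sq_le (h : φ.Snap a q) {η R : ℝ} (hη : 0 < η) (m : ℕ) :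
    φ.boxI η R m ^ 2 ≤ (∫ p, (φ.w p.1 p.2 ^ m) ^ 2 ∂boxM η R) * (3 * (m + 1) ^ 2 * φ.boxD η R) := by
  have pT : PolyB (fun x r => |φ.w x r| + (m + 1) * (|φ.wx x r| + |φ.wr x r|)) :=
    h.polyW.abs.add ((h.polyX.abs.add h.polyR.abs).const_mul _)
  have pW : PolyB (fun x r => |φ.w x r| ^ m) := h.polyW.abs.pow m
  have e : φ.boxI η R m = ∫ p, |φ.w p.1 p.2| ^ m * (|φ.w p.1 p.2| + (m + 1) *
      (|φ.wx p.1 p.2| + |φ.wr p.1 p.2|)) ∂boxM η R := by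
    unfold boxI
    congr 1; ext p
    have : (0 : ℝ) ≤ m + 1 := by positivity
    rw [abs_mul, abs_mul, abs_mul, abs_mul, abs_pow, abs_pow, abs_of_nonneg this, pow_succ]
    ring
  rw [e]
  refine (sq_integral_mul_le ((pW.pow 2).integrable_box hη) ((pT.pow 2).integrable_box hη)
    ((pW.mul pT).integrable_box hη)).trans ?_
  have e2 : ∫ p, (|φ.w p.1 p.2| ^ m) ^ 2 ∂boxM η R = ∫ p, (φ.w p.1 p.2 ^ m) ^ 2 ∂boxM η R := by
    congr 1; ext p; rw [← abs_pow, sq_abs]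
  rw [e2]
  refine mul_le_mul_of_nonneg_left ?_ (integral_nonneg fun p => by positivity)
  unfold boxD
  rw [← integral_const_mul]
  refine integral_mono ((pT.pow 2).integrable_box hη)
    ((((h.polyW.pow 2).add h.polyDir).const_mul _).integrable_box hη) fun p => ?_
  simp only
  rw [← sq_abs (φ.w p.1 p.2), ← sq_abs (φ.wx p.1 p.2), ← sq_abs (φ.wr p.1 p.2)]
  generalize |φ.w p.1 p.2| = A
  generalize |φ.wx p.1 p.2| = B
  generalize |φ.wr p.1 p.2| = C
  have hm : (1 : ℝ) ≤ (m + 1) ^ 2 := by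
    have : (0 : ℝ) ≤ m := by positivity
    nlinarith
  have h1 : (A + (m + 1) * (B + C)) ^ 2 ≤ 3 * A ^ 2 + 3 * (m + 1) ^ 2 * (B ^ 2 + C ^ 2) := by
    nlinarith [sq_nonneg (A - (m + 1) * B), sq_nonneg (A - (m + 1) * C),
      sq_nonneg ((m + 1) * (B - C) : ℝ)]
  nlinarith [sq_nonneg A]

theorem integral_box_pow_le (h : φ.Snap a q) {η R : ℝ} (hη : 0 < η) (hR : η < R) (m : ℕ) :
    ∫ p, (φ.w p.1 p.2 ^ (m + 1)) ^ 2 ∂boxM η R ≤ (1 / (R - η) + 1) * φ.boxI η R m ^ 2 := by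
  refine integral_box_sq_le (h.polyW.pow (m + 1))
    (((h.polyW.pow m).mul h.polyX).const_mul ((m : ℝ) + 1))
    (((h.polyW.pow m).mul h.polyR).const_mul ((m : ℝ) + 1)) (fun x hx r hr => ?_)
    (fun x hx r hr => ?_) hη hR
  · refine ((h.derivX x hx r hr).pow (m + 1)).congr_deriv ?_
    push_cast; ring
  · refine ((h.derivR x hx r hr).pow (m + 1)).congr_deriv ?_
    push_cast; ring

theorem integral_trace_le (h : φ.Snap a q) {η R : ℝ} (hη : 0 < η) (m : ℕ) :
    ∫ r in Ioo η R, φ.w0 r ^ (m + 1) ≤ φ.boxI η R m := by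
  have pβ : PolyB (fun x r => |φ.w x r ^ (m + 1)| + |((m : ℝ) + 1) * (φ.w x r ^ m * φ.wx x r)|) :=
    (h.polyW.pow _).abs.add (((h.polyW.pow m).mul h.polyX).const_mul _).abs
  have iβ := pβ.integrable_box (R := R) hη
  have jβ := iβ.integral_prod_right
  have eβ := integral_prod_symm _ iβ
  have hle : ∀ r ∈ Ioo η R, φ.w0 r ^ (m + 1) ≤ ∫ x in Ioo (0 : ℝ) 1,
      (|φ.w x r ^ (m + 1)| + |((m : ℝ) + 1) * (φ.w x r ^ m * φ.wx x r)|) := by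
    intro r hr
    have hr0 := hη.trans hr.1
    have i1 := (h.polyW.pow (m + 1)).integrableOn_fst hr0
    have i2 := (((h.polyW.pow m).mul h.polyX).const_mul ((m : ℝ) + 1)).integrableOn_fst hr0
    rw [integral_add i1.abs i2.abs]
    refine le_of_tendsto ((h.limW r hr0).pow (m + 1)) ?_
    have : Ioo (0 : ℝ) 1 ∈ 𝓝[>] (0 : ℝ) := Ioo_mem_nhdsGT one_pos
    filter_upwards [this] with x hx
    have := abs_mul_le_integral hx (f := fun y => φ.w y r ^ (m + 1))
      (f' := fun y => ((m : ℝ) + 1) * (φ.w y r ^ m * φ.wx y r)) (fun y hy => by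
        refine ((h.derivX y hy.1 r hr0).pow (m + 1)).congr_deriv ?_
        push_cast; ring) i1 i2
    have h1 := le_abs_self (φ.w x r ^ (m + 1))
    linarith
  have hint : IntegrableOn (fun r => φ.w0 r ^ (m + 1)) (Ioo η R) := by
    have p0 : PolyB (fun _ r => φ.w0 r ^ (m + 1)) := .of_snd (h.polyW0.pow _)
    exact p0.integrableOn_snd one_pos hη
  refine (setIntegral_mono_on hint jβ measurableSet_Ioo hle).trans ?_
  refine eβ.symm.le.trans ?_
  refine integral_mono iβ ((h.polyBoxI m).integrable_box hη) fun p => ?_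
  have := abs_nonneg (((m : ℝ) + 1) * (φ.w p.1 p.2 ^ m * φ.wr p.1 p.2))
  simp only
  linarith

theorem exists_boxI_le (a : ℕ) (q : ℝ) {η R : ℝ} (hη : 0 < η) (hR : η < R) (m : ℕ) : ∃ C : ℝ, 0 ≤ C ∧
    ∀ φ : Profile, φ.Snap a q → φ.boxI η R (m + 1) ^ 2 ≤ C * φ.boxD η R ^ (m + 2) := by
  have key : ∀ m : ℕ, ∃ C : ℝ, 0 ≤ C ∧ ∀ φ : Profile, φ.Snap a q →
      ∫ p, (φ.w p.1 p.2 ^ (m + 1)) ^ 2 ∂boxM η R ≤ C * φ.boxD η R ^ (m + 1) := by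
    intro m
    induction m with
    | zero =>
      refine ⟨1, zero_le_one, fun φ h => ?_⟩
      simp only [zero_add, pow_one, one_mul]
      refine integral_mono ((h.polyW.pow 2).integrable_box hη)
        (((h.polyW.pow 2).add h.polyDir).integrable_box hη) fun p => ?_
      simp only
      nlinarith [sq_nonneg (φ.wx p.1 p.2), sq_nonneg (φ.wr p.1 p.2)]
    | succ m ih =>
      obtain ⟨C, hC, hb⟩ := ih
      have hRη : 0 < R - η := sub_pos.2 hR
      refine ⟨(1 / (R - η) + 1) * (C * (3 * ((m + 1 : ℕ) + 1) ^ 2)), by positivity,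
        fun φ h => ?_⟩
      have h1 := h.integral_box_pow_le hη hR (m + 1)
      have h2 := h.boxI_sq_le (R := R) hη (m + 1)
      have h3 := hb φ h
      have hD := boxD_nonneg φ η R
      calc _ ≤ _ := h1
        _ ≤ (1 / (R - η) + 1) * ((C * φ.boxD η R ^ (m + 1)) *
          (3 * ((m + 1 : ℕ) + 1) ^ 2 * φ.boxD η R)) := by
            refine mul_le_mul_of_nonneg_left (h2.trans ?_) (by positivity)
            gcongr
        _ = _ := by ring
  obtain ⟨C, hC, hb⟩ := key m
  refine ⟨C * (3 * ((m + 1 : ℕ) + 1) ^ 2), by positivity, fun φ h => ?_⟩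
  have h2 := h.boxI_sq_le (R := R) hη (m + 1)
  have h3 := hb φ h
  have hD := boxD_nonneg φ η R
  calc _ ≤ _ := h2
    _ ≤ (C * φ.boxD η R ^ (m + 1)) * (3 * ((m + 1 : ℕ) + 1) ^ 2 * φ.boxD η R) := by gcongr
    _ = _ := by ring

theorem exists_boxD_le (a : ℕ) (q : ℝ) {η R : ℝ} (hη : 0 < η) (hR : η < R) : ∃ C : ℝ, 0 ≤ C ∧
    ∀ φ : Profile, φ.Snap a q → φ.boxD η R ≤ C * (φ.dir a + φ.mass a) := by
  have hR0 : 0 < R := hη.trans hR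
  set c : ℝ := Real.exp (-1 / 4) * (Real.exp (-(R ^ 2) / 4) * η ^ a) with hc
  have hc0 : 0 < c := by positivity
  refine ⟨1 / c, by positivity, fun φ h => ?_⟩
  have pT : PolyB (fun x r => φ.w x r ^ 2 + (φ.wx x r ^ 2 + φ.wr x r ^ 2)) :=
    (h.polyW.pow 2).add h.polyDir
  have hsub : Ioo (0 : ℝ) 1 ×ˢ Ioo η R ⊆ quarter := fun p hp => ⟨hp.1.1, hη.trans hp.2.1⟩
  have hm : MeasurableSet (Ioo (0 : ℝ) 1 ×ˢ Ioo η R) := measurableSet_Ioo.prod measurableSet_Ioo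
  have i1 := pT.integrable_box (R := R) hη
  rw [boxM_eq] at i1
  have h1 : c * φ.boxD η R ≤ ∫ p in Ioo (0 : ℝ) 1 ×ˢ Ioo η R, kap a p.1 p.2 *
      (φ.w p.1 p.2 ^ 2 + (φ.wx p.1 p.2 ^ 2 + φ.wr p.1 p.2 ^ 2)) := by
    unfold boxD
    rw [boxM_eq, ← integral_const_mul]
    refine setIntegral_mono_on (i1.const_mul c) ((pT.integrableOn a).mono_set hsub) hm
      fun p hp => ?_
    refine mul_le_mul_of_nonneg_right ?_ (by positivity)
    have h1 := hp.1.1; have h2 := hp.1.2; have h3 := hp.2.1; have h4 := hp.2.2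
    have h5 := hη.trans h3
    unfold kap kap0
    rw [hc]
    gcongr
    nlinarith
  have h2 : ∫ p in Ioo (0 : ℝ) 1 ×ˢ Ioo η R, kap a p.1 p.2 *
      (φ.w p.1 p.2 ^ 2 + (φ.wx p.1 p.2 ^ 2 + φ.wr p.1 p.2 ^ 2))
      ≤ wint a (fun x r => φ.w x r ^ 2 + (φ.wx x r ^ 2 + φ.wr x r ^ 2)) := by
    refine setIntegral_mono_set (pT.integrableOn a) ?_ hsub.eventuallyLE
    refine (ae_restrict_iff' measurableSet_quarter).2 (Eventually.of_forall fun p hp => ?_)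
    have := kap_pos a p.1 hp.2
    simp only [Pi.zero_apply]
    positivity
  rw [wint_add a (h.polyW.pow 2) h.polyDir] at h2
  change _ ≤ φ.mass a + φ.dir a at h2
  rw [div_mul_eq_mul_div, le_div_iff₀ hc0]
  linarith

end Snap

/-- The energy. -/
noncomputable def energy (φ : Profile) (a : ℕ) (q β : ℝ) : ℝ :=
  φ.dir a / 2 + β * φ.mass a / 2 - φ.bdry a (q + 1) / (q + 1)

/-- The square integral of the self-similar time derivative. -/
noncomputable def speedSq (φ : Profile) (a : ℕ) (β : ℝ) : ℝ :=
  wint a (fun x r => (φ.G x r - β * φ.w x r) ^ 2)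

/-- The local estimate of the boundary integral. -/
theorem exists_mid_le {a : ℕ} {q : ℝ} (hq : 1 < q) {η R : ℝ} (hη : 0 < η) (hR : η < R) :
    ∃ C : ℝ, 0 ≤ C ∧ ∀ φ : Profile, φ.Snap a q → ∀ Λ : ℝ, 1 ≤ Λ → φ.dir a + φ.mass a ≤ 3 * Λ →
      ∫ r in Icc η R, kap0 a r * φ.w0 r ^ (q + 1) ≤ Λ ^ (3 / 4 : ℝ) * φ.bdry a q + C := by
  obtain ⟨m, hm⟩ := exists_nat_ge (3 * (q + 1))
  obtain ⟨C1, hC1, hb1⟩ := Snap.exists_boxI_le a q hη hR m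
  obtain ⟨C2, hC2, hb2⟩ := Snap.exists_boxD_le a q hη hR
  set p : ℝ := ((m + 2 : ℕ) : ℝ) with hp
  have hp3 : 3 * (q + 1) ≤ p := by rw [hp]; push_cast; linarith
  have hR0 : 0 < R := hη.trans hR
  refine ⟨R ^ a * √(C1 * (3 * C2) ^ (m + 2)), by positivity, fun φ h Λ hΛ hD => ?_⟩
  have hΛ0 : 0 < Λ := by linarith
  set K : ℝ := Λ ^ (3 / 4 : ℝ) with hK
  have hK0 : 0 < K := Real.rpow_pos_of_pos hΛ0 _
  have pq := h.polyPow (p := q) (by linarith)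
  have pq1 := h.polyPow (p := q + 1) (by linarith)
  have p0 : PolyB (fun _ r => φ.w0 r ^ (m + 2)) := .of_snd (h.polyW0.pow _)
  have ip := p0.integrableOn_snd (R := R) one_pos hη
  have hsub : Ioo η R ⊆ Ioi 0 := fun r hr => hη.trans hr.1
  set Kp := K ^ (-(p - q - 1)) with hKp
  have hKp0 : 0 < Kp := Real.rpow_pos_of_pos hK0 _
  have h1 : ∫ r in Icc η R, kap0 a r * φ.w0 r ^ (q + 1) ≤
      K * φ.bdry a q + Kp * R ^ a * ∫ r in Ioo η R, φ.w0 r ^ (m + 2) := by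
    rw [integral_Icc_eq_integral_Ioo]
    have e1 : ∫ r in Ioo η R, kap0 a r * φ.w0 r ^ q ≤ φ.bdry a q := by
      refine setIntegral_mono_set (pq.integrableOn a) ?_ hsub.eventuallyLE
      refine (ae_restrict_iff' measurableSet_Ioi).2 (Eventually.of_forall fun r hr => ?_)
      have := kap0_pos a hr
      have := Real.rpow_pos_of_pos (h.pos0 r hr) q
      simp only [Pi.zero_apply]
      positivity
    have iq := (pq.integrableOn a).mono_set hsub
    refine le_trans ?_ (add_le_add_left (mul_le_mul_of_nonneg_left e1 hK0.le) _)
    rw [← integral_const_mul, ← integral_const_mul, ← integral_add (iq.const_mul _)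
      (ip.const_mul _)]
    refine setIntegral_mono_on ((pq1.integrableOn a).mono_set hsub)
      ((iq.const_mul _).add (ip.const_mul _)) measurableSet_Ioo fun r hr => ?_
    have hr0 : 0 < r := hsub hr
    have hk := kap0_pos a hr0
    have hw := h.pos0 r hr0
    have hi := rpow_interpolation (q := q) (p := p) hw hK0 (by linarith)
    have hkR : kap0 a r ≤ R ^ a := by
      unfold kap0
      calc Real.exp (-(r ^ 2) / 4) * r ^ a ≤ 1 * R ^ a := by
            gcongr
            · exact Real.exp_le_one_iff.2 (by nlinarith [sq_nonneg r])
            · exact hr.2.le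
        _ = R ^ a := one_mul _
    rw [hp, Real.rpow_natCast] at hi
    have h3 : 0 ≤ Kp * φ.w0 r ^ (m + 2) := by positivity
    calc kap0 a r * φ.w0 r ^ (q + 1) ≤ kap0 a r * (K * φ.w0 r ^ q + Kp * φ.w0 r ^ (m + 2)) := by
          gcongr
      _ = K * (kap0 a r * φ.w0 r ^ q) + kap0 a r * (Kp * φ.w0 r ^ (m + 2)) := by ring
      _ ≤ K * (kap0 a r * φ.w0 r ^ q) + R ^ a * (Kp * φ.w0 r ^ (m + 2)) := by gcongr
      _ = _ := by ring
  refine h1.trans (add_le_add_right ?_ _)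
  have hI := h.integral_trace_le (R := R) hη (m + 1)
  have hbD : φ.boxD η R ≤ 3 * C2 * Λ := by
    refine (hb2 φ h).trans ?_
    nlinarith
  have hI2 : φ.boxI η R (m + 1) ^ 2 ≤ C1 * (3 * C2) ^ (m + 2) * Λ ^ (m + 2) := by
    refine (hb1 φ h).trans ?_
    have := Snap.boxD_nonneg φ η R
    calc C1 * φ.boxD η R ^ (m + 2) ≤ C1 * (3 * C2 * Λ) ^ (m + 2) := by gcongr
      _ = _ := by rw [mul_pow]; ring
  have hΛp : √(Λ ^ (m + 2)) = Λ ^ (p / 2) := by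
    rw [Real.sqrt_eq_rpow, ← Real.rpow_natCast, ← Real.rpow_mul hΛ0.le, hp]
    congr 1; ring
  have hI3 : ∫ r in Ioo η R, φ.w0 r ^ (m + 2) ≤ √(C1 * (3 * C2) ^ (m + 2)) * Λ ^ (p / 2) := by
    refine hI.trans ((Real.le_sqrt_of_sq_le hI2).trans_eq ?_)
    rw [Real.sqrt_mul (by positivity), hΛp]
  have hpow : Kp * Λ ^ (p / 2) ≤ 1 := by
    rw [hKp, hK, ← Real.rpow_mul hΛ0.le, ← Real.rpow_add hΛ0]
    exact Real.rpow_le_one_of_one_le_of_nonpos hΛ (by linarith)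
  have hs : 0 ≤ R ^ a * √(C1 * (3 * C2) ^ (m + 2)) := by positivity
  calc Kp * R ^ a * ∫ r in Ioo η R, φ.w0 r ^ (m + 2)
      ≤ Kp * R ^ a * (√(C1 * (3 * C2) ^ (m + 2)) * Λ ^ (p / 2)) := by gcongr
    _ = (Kp * Λ ^ (p / 2)) * (R ^ a * √(C1 * (3 * C2) ^ (m + 2))) := by ring
    _ ≤ 1 * (R ^ a * √(C1 * (3 * C2) ^ (m + 2))) := by gcongr
    _ = _ := one_mul _

/-- The snapshot estimate: the critical boundary integral is controlled by the energy
dissipation, up to a lower order term. -/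
theorem exists_bdry_le_speedSq {a : ℕ} {q β : ℝ} (hq : 1 < q) (ha : a * q < a + 2) (hβ : 0 ≤ β)
    {θ : ℝ} (hθ : 0 < θ) : ∃ C : ℝ, 0 ≤ C ∧ ∀ φ : Profile, φ.Snap a q → ∀ Λ : ℝ, 1 ≤ Λ →
      φ.energy a q β + φ.bdry a (q + 1) + φ.mass a ≤ Λ →
      φ.bdry a (q + 1) ≤ θ * (φ.speedSq a β + Λ) + C * (Λ ^ (3 / 4 : ℝ) * φ.bdry a q + 1) := by
  set T : ℝ := 5 + 2 * β ^ 2 with hT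
  have hT0 : 0 < T := by positivity
  obtain ⟨η, R, hη, hR, hb⟩ := exists_bdry_le_mid hq ha (θ := θ / T) (by positivity)
  obtain ⟨C, hC, hb2⟩ := exists_mid_le (a := a) hq hη hR
  refine ⟨2 * (1 + C), by positivity, fun φ h Λ hΛ hE => ?_⟩
  have nd := Snap.dir_nonneg φ a
  have nm := Snap.mass_nonneg φ a
  have nf := h.bdry_nonneg (q + 1)
  have ng := h.bdry_nonneg q
  have hf1 : φ.bdry a (q + 1) / (q + 1) ≤ φ.bdry a (q + 1) := div_le_self nf (by linarith)
  have hβm : 0 ≤ β * φ.mass a := by positivity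
  unfold energy at hE
  have hdm : φ.dir a + φ.mass a ≤ 3 * Λ := by linarith
  have hm : φ.mass a ≤ Λ := by linarith
  have hG : φ.lapSq a ≤ 2 * φ.speedSq a β + 2 * β ^ 2 * φ.mass a := by
    have p1 : PolyB (fun x r => 2 * (φ.G x r - β * φ.w x r) ^ 2) :=
      ((h.polyG.sub (h.polyW.const_mul β)).pow 2).const_mul 2
    have p2 : PolyB (fun x r => 2 * β ^ 2 * φ.w x r ^ 2) := (h.polyW.pow 2).const_mul _
    have := wint_mono a (h.polyG.pow 2) (p1.add p2) fun x _ r _ => by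
      nlinarith [sq_nonneg (φ.G x r - 2 * (β * φ.w x r))]
    rwa [wint_add a p1 p2, wint_const_mul, wint_const_mul] at this
  have nP : 0 ≤ φ.speedSq a β := wint_nonneg a fun x _ r _ => by positivity
  have h1 := hb φ h
  have h2 := hb2 φ h Λ hΛ hdm
  have hx : 0 ≤ Λ ^ (3 / 4 : ℝ) * φ.bdry a q := mul_nonneg (by positivity) ng
  have hβ2 : β ^ 2 * φ.mass a ≤ β ^ 2 * Λ := by gcongr
  have h3 : φ.lapSq a + φ.dir a + φ.mass a ≤ T * (φ.speedSq a β + Λ) := by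
    rw [hT]; nlinarith [sq_nonneg β, mul_nonneg (sq_nonneg β) nP]
  have h4 : θ / T * (φ.lapSq a + φ.dir a + φ.mass a) ≤ θ * (φ.speedSq a β + Λ) := by
    calc _ ≤ θ / T * (T * (φ.speedSq a β + Λ)) := by gcongr
      _ = _ := by field_simp
  nlinarith [mul_nonneg hC hx]

end Profile

/-- A function with `y' ≥ c y - K` which is bounded in the future is at most `K / c`. -/
theorem le_div_of_deriv_ge {y y' : ℝ → ℝ} {c K B s₀ : ℝ} (hc : 0 < c)
    (hd : ∀ s, s₀ ≤ s → HasDerivAt y (y' s) s) (hy : ∀ s, s₀ ≤ s → c * y s - K ≤ y' s)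
    (hB : ∀ s, s₀ ≤ s → y s ≤ B) : ∀ s, s₀ ≤ s → y s ≤ K / c := by
  intro s₁ hs₁
  by_contra! hlt
  have hd0 : 0 < y s₁ - K / c := by linarith
  have hmono : MonotoneOn (fun s => Real.exp (-(c * s)) * (y s - K / c)) (Ici s₁) := by
    have hder : ∀ s, s₁ ≤ s → HasDerivAt (fun s => Real.exp (-(c * s)) * (y s - K / c))
        (Real.exp (-(c * s)) * (y' s - (c * y s - K))) s := by
      intro s hs
      have h1 : HasDerivAt (fun s => Real.exp (-(c * s))) (Real.exp (-(c * s)) * (-(c * 1))) s :=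
        (((hasDerivAt_id s).const_mul c).neg).exp
      refine (h1.mul ((hd s (hs₁.trans hs)).sub_const (K / c))).congr_deriv ?_
      field_simp; ring
    refine monotoneOn_of_deriv_nonneg (convex_Ici _)
      (fun s hs => (hder s hs).continuousAt.continuousWithinAt)
      (fun s hs => (hder s (interior_subset hs)).differentiableAt.differentiableWithinAt)
      fun s hs => ?_
    rw [(hder s (interior_subset hs)).deriv]
    have := hy s (hs₁.trans (interior_subset hs))
    exact mul_nonneg (Real.exp_pos _).le (by linarith)
  set d := y s₁ - K / c
  set t := (|B - K / c| + 1) / (d * c)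
  have ht : 0 ≤ t := by positivity
  have h1 := hmono (mem_Ici.2 le_rfl) (mem_Ici.2 (by linarith : s₁ ≤ s₁ + t))
    (by linarith : s₁ ≤ s₁ + t)
  have h2 := hB (s₁ + t) (by linarith)
  simp only at h1
  have e : Real.exp (-(c * s₁)) = Real.exp (-(c * (s₁ + t))) * Real.exp (c * t) := by
    rw [← Real.exp_add]; congr 1; ring
  rw [e, mul_assoc] at h1
  have h3 := le_of_mul_le_mul_left h1 (Real.exp_pos _)
  have h4 : c * t + 1 ≤ Real.exp (c * t) := Real.add_one_le_exp _
  have h5 : (c * t + 1) * d ≤ Real.exp (c * t) * d := by gcongr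
  have h6 : c * t * d = |B - K / c| + 1 := by
    simp only [t]; field_simp
  have h7 := le_abs_self (B - K / c)
  nlinarith

theorem sub_le_of_deriv_le {y y' : ℝ → ℝ} {a b C : ℝ} (hab : a ≤ b)
    (hd : ∀ s, HasDerivAt y (y' s) s) (h : ∀ s ∈ Icc a b, y' s ≤ C) :
    y b - y a ≤ C * (b - a) := by
  refine Convex.image_sub_le_mul_sub_of_deriv_le (convex_Icc a b)
    (fun s _ => (hd s).continuousAt.continuousWithinAt)
    (fun s _ => (hd s).differentiableAt.differentiableWithinAt)
    (fun s hs => ?_) a (left_mem_Icc.2 hab) b (right_mem_Icc.2 hab) hab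
  rw [(hd s).deriv]
  exact h s (interior_subset hs)

/-- The differential inequalities satisfied by the energy `E`, the mass `z`, the boundary
integrals `f`, `g` and the exponential moment `N` of a rescaled solution. -/
structure FlowData (β c₀ p K : ℝ) (Kθ : ℝ → ℝ) (E z f g N H P : ℝ → ℝ) : Prop where
  dE : ∀ s, HasDerivAt E (-P s) s
  dz : ∀ s, HasDerivAt z (2 * (f s - H s - β * z s)) s
  dN : ∃ N' : ℝ → ℝ, ∀ s, HasDerivAt N (N' s) s ∧ N s + g s / 2 - K ≤ N' s
  cf : Continuous f
  cg : Continuous g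
  f0 : ∀ s, 0 ≤ f s
  g0 : ∀ s, 0 ≤ g s
  H0 : ∀ s, 0 ≤ H s
  P0 : ∀ s, 0 ≤ P s
  z0 : ∀ s, 0 ≤ z s
  N0 : ∀ s, 0 ≤ N s
  eE : ∀ s, 2 * (f s - H s - β * z s) = -4 * E s + 2 * c₀ * f s
  mass : ∀ s, z s ≤ K * (1 + f s + E s)
  cs : ∀ s, (c₀ * f s - 2 * E s) ^ 2 ≤ z s * P s
  snap : ∀ θ, 0 < θ → ∀ s Λ, 1 ≤ Λ → E s + f s + z s ≤ Λ →
    f s ≤ θ * (P s + Λ) + Kθ θ * (Λ ^ (3 / 4 : ℝ) * g s + 1)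
  fg : ∀ s, f s ≤ K * Real.exp (-(β * s)) * g s
  zN : ∀ s, z s ^ 2 ≤ K * Real.exp (-(3 * β * s)) * N s
  zle : ∀ s, z s ≤ p * Real.exp (-(2 * β * s))
  Nle : ∀ s, N s ≤ p * Real.exp (-(β * s))

namespace FlowData

variable {β c₀ p K : ℝ} {Kθ E z f g N H P : ℝ → ℝ}

theorem N_le (h : FlowData β c₀ p K Kθ E z f g N H P) (hβ : 0 < β) (s : ℝ) : N s ≤ K := by
  obtain ⟨N', hN'⟩ := h.dN
  have hp : 0 ≤ p := by
    have := (h.N0 0).trans (h.Nle 0)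
    simpa using this
  have := le_div_of_deriv_ge (y := N) (y' := N') (c := 1) (K := K) (s₀ := s)
    (B := p * Real.exp (-(β * s))) one_pos (fun t _ => (hN' t).1)
    (fun t _ => by have := (hN' t).2; have := h.g0 t; linarith)
    (fun t ht => (h.Nle t).trans (by gcongr)) s le_rfl
  simpa using this

theorem K_nonneg (h : FlowData β c₀ p K Kθ E z f g N H P) (hβ : 0 < β) : 0 ≤ K :=
  (h.N0 0).trans (h.N_le hβ 0)

theorem integral_g_le (h : FlowData β c₀ p K Kθ E z f g N H P) (hβ : 0 < β) (s : ℝ) :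
    ∫ t in s..(s + 1), g t ≤ 4 * K := by
  obtain ⟨N', hN'⟩ := h.dN
  have := sub_le_of_deriv_le (y := fun t => (∫ τ in s..t, g τ) - 2 * N t)
    (y' := fun t => g t - 2 * N' t) (a := s) (b := s + 1) (C := 2 * K) (by linarith)
    (fun t => (h.cg.integral_hasStrictDerivAt s t).hasDerivAt.sub ((hN' t).1.const_mul 2))
    (fun t _ => by have := (hN' t).2; have := h.N0 t; linarith)
  have h1 := h.N_le hβ (s + 1)
  have h2 := h.N0 s
  simp at this
  linarith

theorem antitone_E (h : FlowData β c₀ p K Kθ E z f g N H P) : Antitone E :=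
  antitone_of_deriv_nonpos (fun s => (h.dE s).differentiableAt) fun s => by
    rw [(h.dE s).deriv]; have := h.P0 s; linarith

theorem E_nonneg (h : FlowData β c₀ p K Kθ E z f g N H P) (hβ : 0 < β) (hc : 0 < c₀) (s : ℝ) :
    0 ≤ E s := by
  by_contra! hE
  have hp : 0 ≤ p := by
    have := (h.z0 0).trans (h.zle 0)
    simpa using this
  set B := p * Real.exp (-(2 * β * s))
  have hB : 0 ≤ B := by positivity
  set t := s + (B + 1) / (-4 * E s)
  have ht : s ≤ t := by
    have : 0 ≤ (B + 1) / (-4 * E s) := div_nonneg (by linarith) (by linarith)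
    linarith
  have := sub_le_of_deriv_le (y := fun t => -z t) (a := s) (b := t) (C := 4 * E s) ht
    (fun t => (h.dz t).neg) (fun t ht => by
      have h1 := h.antitone_E ht.1
      have h2 := h.eE t
      have h3 := mul_nonneg hc.le (h.f0 t)
      linarith)
  have e : 4 * E s * (t - s) = -(B + 1) := by
    simp only [t]; have : E s ≠ 0 := hE.ne; field_simp; ring
  have h1 : z t ≤ B := (h.zle t).trans (by simp only [B]; gcongr)
  have h2 := h.z0 s
  linarith

/-- Beyond the time `σ` the mass is controlled by the energy at time `σ`. -/
theorem z_le (h : FlowData β c₀ p K Kθ E z f g N H P) (hβ : 0 < β) (hc : 0 < c₀) (σ s : ℝ)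
    (hs : σ ≤ s) : z s ≤ (K + 1) * (2 / c₀ + 2) * max (E σ) 1 := by
  have hK := h.K_nonneg hβ
  set e := max (E σ) 1
  have he : 1 ≤ e := le_max_right _ _
  have hp : 0 ≤ p := by
    have := (h.z0 0).trans (h.zle 0)
    simpa using this
  have := le_div_of_deriv_ge (y := z) (y' := fun s => 2 * (f s - H s - β * z s))
    (c := 2 * c₀ / (K + 1)) (K := (4 + 4 * c₀) * e) (s₀ := σ)
    (B := p * Real.exp (-(2 * β * σ))) (by positivity)
    (fun t _ => h.dz t) (fun t ht => by
      rw [h.eE]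
      have h1 : E t ≤ e := (h.antitone_E ht).trans (le_max_left _ _)
      have hE := h.E_nonneg hβ hc t
      have h2 : z t / (K + 1) ≤ 1 + f t + E t := by
        rw [div_le_iff₀ (by positivity)]
        have := h.mass t
        have := h.f0 t
        nlinarith
      have h3 : 2 * c₀ / (K + 1) * z t = 2 * c₀ * (z t / (K + 1)) := by ring
      rw [h3]
      have h4 := mul_le_mul_of_nonneg_left h2 (by positivity : 0 ≤ 2 * c₀)
      have h5 : c₀ * (1 + E t) ≤ c₀ * (e + e) := by gcongr
      nlinarith)
    (fun t ht => (h.zle t).trans (by gcongr)) s hs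
  refine this.trans (le_of_eq ?_)
  field_simp; ring

/-- A bound for `f` in terms of the dissipation. -/
theorem f_le (h : FlowData β c₀ p K Kθ E z f g N H P) (hβ : 0 < β) (hc : 0 < c₀) (σ s : ℝ)
    (hs : σ ≤ s) : f s ^ 2 ≤ 2 / c₀ ^ 2 * (4 + (K + 1) * (2 / c₀ + 2)) *
      (max (E σ) 1 * (max (E σ) 1 + P s)) := by
  have hK := h.K_nonneg hβ
  have hz := h.z_le hβ hc σ s hs
  have hE := h.E_nonneg hβ hc s
  have hE1 : E s ≤ max (E σ) 1 := (h.antitone_E hs).trans (le_max_left _ _)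
  have hcs := h.cs s
  have hP := h.P0 s
  set e := max (E σ) 1
  have he : 1 ≤ e := le_max_right _ _
  set A := (K + 1) * (2 / c₀ + 2)
  have hA : 0 ≤ A := by positivity
  have h1 : (c₀ * f s) ^ 2 ≤ 2 * (c₀ * f s - 2 * E s) ^ 2 + 2 * (2 * E s) ^ 2 := by
    nlinarith [sq_nonneg (c₀ * f s - 2 * E s - 2 * E s)]
  have h2 : z s * P s ≤ A * e * P s := by gcongr
  have h3 : E s ^ 2 ≤ e ^ 2 := by gcongr
  have h4 : (c₀ * f s) ^ 2 ≤ 2 * (4 + A) * (e * (e + P s)) := by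
    have : 0 ≤ e * P s := by positivity
    have : 0 ≤ A * e ^ 2 := by positivity
    nlinarith
  have h5 : f s ^ 2 = (c₀ * f s) ^ 2 / c₀ ^ 2 := by field_simp
  rw [h5, div_le_iff₀ (by positivity)]
  refine h4.trans (le_of_eq ?_)
  field_simp

end FlowData

theorem rpow_three_quarters_le {ε : ℝ} (hε : 0 < ε) :
    ∃ C, 0 ≤ C ∧ ∀ e : ℝ, 0 ≤ e → e ^ (3 / 4 : ℝ) ≤ ε * e + C := by
  set R := (1 / ε) ^ (4 : ℕ)
  refine ⟨R ^ (3 / 4 : ℝ), by positivity, fun e he => ?_⟩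
  rcases le_total e R with h | h
  · have := Real.rpow_le_rpow he h (by norm_num : (0 : ℝ) ≤ 3 / 4)
    nlinarith [mul_nonneg hε.le he]
  · have hR : 0 < R := by positivity
    have he0 : 0 < e := hR.trans_le h
    have h1 : (1 / ε) ≤ e ^ (1 / 4 : ℝ) := by
      have := Real.rpow_le_rpow hR.le h (by norm_num : (0 : ℝ) ≤ 1 / 4)
      refine le_trans (le_of_eq ?_) this
      simp only [R]
      rw [← Real.rpow_natCast, ← Real.rpow_mul (by positivity)]
      norm_num
    have h2 : e ^ (3 / 4 : ℝ) * e ^ (1 / 4 : ℝ) = e := by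
      rw [← Real.rpow_add he0]; norm_num
    have h3 : 0 < e ^ (3 / 4 : ℝ) := by positivity
    have h4 : e ^ (3 / 4 : ℝ) * (1 / ε) ≤ e := by
      conv_rhs => rw [← h2]
      gcongr
    have h5 : e ^ (3 / 4 : ℝ) ≤ ε * e := by
      have := mul_le_mul_of_nonneg_left h4 hε.le
      field_simp at this
      linarith
    have : (0:ℝ) ≤ R ^ (3 / 4 : ℝ) := by positivity
    linarith

/-- Unit time averages of `f` grow sublinearly in the energy. -/
theorem FlowData.exists_integral_f_le {β c₀ K : ℝ} {Kθ : ℝ → ℝ} (hβ : 0 < β) (hc : 0 < c₀)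
    (hK : 0 ≤ K) (hKθ : ∀ θ, 0 ≤ Kθ θ) {η : ℝ} (hη : 0 < η) : ∃ C, 0 ≤ C ∧
    ∀ p E z f g N H P, FlowData β c₀ p K Kθ E z f g N H P → ∀ σ,
      ∫ t in σ..(σ + 1), f t ≤ η * max (E σ) 1 + C := by
  set A := (K + 1) * (2 / c₀ + 2)
  have hA : 0 ≤ A := by positivity
  set D := 2 / c₀ ^ 2 * (4 + A)
  have hD : 0 < D := by positivity
  set θ₁ := η / 3
  have hθ₁ : 0 < θ₁ := by positivity
  set K' := D / θ₁
  have hK' : 0 < K' := by positivity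
  set B := 1 + K' + A
  have hB : 1 ≤ B := by simp only [B]; linarith
  set θ := θ₁ / B
  have hθ : 0 < θ := by positivity
  have hθB : θ * B = θ₁ := by simp only [θ]; field_simp
  have hθθ : θ ≤ θ₁ := by nlinarith
  set D₂ := Kθ θ * B ^ (3 / 4 : ℝ)
  have hD₂ : 0 ≤ D₂ := mul_nonneg (hKθ θ) (by positivity)
  obtain ⟨C₁, hC₁, hle⟩ := rpow_three_quarters_le (ε := θ₁ / (D₂ * (4 * K) + 1)) (by positivity)
  refine ⟨D₂ * (4 * K) * C₁ + Kθ θ, add_nonneg (by positivity) (hKθ θ), ?_⟩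
  intro p E z f g N H P h σ
  set e := max (E σ) 1
  have he : 1 ≤ e := le_max_right _ _
  have he0 : 0 ≤ e := by linarith
  have hEe : E σ ≤ e := le_max_left _ _
  have key : ∀ s ∈ Icc σ (σ + 1), f s ≤ θ₁ * (P s + e) + (D₂ * e ^ (3 / 4 : ℝ) * g s + Kθ θ) := by
    intro s hs
    have hz := h.z_le hβ hc σ s hs.1
    have hf := h.f_le hβ hc σ s hs.1
    have hE1 : E s ≤ e := (h.antitone_E hs.1).trans (le_max_left _ _)
    have hP := h.P0 s
    have hg := h.g0 s
    rcases le_total (f s) (K' * e) with hc1 | hc1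
    · have := h.snap θ hθ s (B * e) (by nlinarith) (by simp only [B]; nlinarith)
      refine this.trans ?_
      rw [Real.mul_rpow (by positivity) he0]
      have h1 : θ * (P s + B * e) ≤ θ₁ * (P s + e) := by
        have : θ * P s ≤ θ₁ * P s := by gcongr
        nlinarith
      have h2 : Kθ θ * (B ^ (3 / 4 : ℝ) * e ^ (3 / 4 : ℝ) * g s + 1)
        = D₂ * e ^ (3 / 4 : ℝ) * g s + Kθ θ := by simp only [D₂]; ring
      linarith
    · have h1 : f s * (K' * e) ≤ f s ^ 2 := by
        rw [sq]; exact mul_le_mul_of_nonneg_left hc1 (h.f0 s)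
      have h2 : f s * (K' * e) ≤ D * (e * (e + P s)) := h1.trans hf
      have h3 : D = θ₁ * K' := by simp only [K']; field_simp
      have h4 : (K' * e) * f s ≤ (K' * e) * (θ₁ * (P s + e)) := by
        rw [h3] at h2; linarith
      have h5 := le_of_mul_le_mul_left h4 (by positivity)
      have : 0 ≤ D₂ * e ^ (3 / 4 : ℝ) * g s + Kθ θ := add_nonneg (by positivity) (hKθ θ)
      linarith
  have := sub_le_of_deriv_le
    (y := fun t => (∫ τ in σ..t, f τ) + θ₁ * E t - D₂ * e ^ (3 / 4 : ℝ) * ∫ τ in σ..t, g τ)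
    (y' := fun t => f t + θ₁ * (-P t) - D₂ * e ^ (3 / 4 : ℝ) * g t) (a := σ) (b := σ + 1)
    (C := θ₁ * e + Kθ θ) (by linarith)
    (fun t => ((h.cf.integral_hasStrictDerivAt σ t).hasDerivAt.add ((h.dE t).const_mul θ₁)).sub
      ((h.cg.integral_hasStrictDerivAt σ t).hasDerivAt.const_mul _))
    (fun t ht => by have := key t ht; linarith)
  simp only [intervalIntegral.integral_same, mul_zero] at this
  have h1 := h.E_nonneg hβ hc (σ + 1)
  have h2 : D₂ * e ^ (3 / 4 : ℝ) * ∫ τ in σ..(σ + 1), g τ ≤ D₂ * e ^ (3 / 4 : ℝ) * (4 * K) :=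
    mul_le_mul_of_nonneg_left (h.integral_g_le hβ σ) (by positivity)
  have h3 : D₂ * e ^ (3 / 4 : ℝ) * (4 * K) ≤ θ₁ * e + D₂ * (4 * K) * C₁ := by
    have h4 : D₂ * (4 * K) * e ^ (3 / 4 : ℝ) ≤ D₂ * (4 * K) * (θ₁ / (D₂ * (4 * K) + 1) * e + C₁) :=
      mul_le_mul_of_nonneg_left (hle e he0) (by positivity)
    have h5 : D₂ * (4 * K) * (θ₁ / (D₂ * (4 * K) + 1)) ≤ θ₁ := by
      rw [mul_div_assoc', div_le_iff₀ (by positivity)]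
      nlinarith [mul_nonneg hD₂ hK]
    nlinarith
  have h6 : θ₁ * E σ ≤ θ₁ * e := by gcongr
  have h7 : 0 ≤ θ₁ * E (σ + 1) := by positivity
  have h8 : η = 3 * θ₁ := by simp only [θ₁]; ring
  rw [h8]
  linarith

/-- The energy and the unit time averages of `f` are universally bounded. -/
theorem FlowData.exists_bound {β c₀ K : ℝ} {Kθ : ℝ → ℝ} (hβ : 0 < β) (hc : 0 < c₀) (hc1 : c₀ ≤ 1)
    (hK : 0 ≤ K) (hKθ : ∀ θ, 0 ≤ Kθ θ) : ∃ C, 0 ≤ C ∧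
    ∀ p E z f g N H P, FlowData β c₀ p K Kθ E z f g N H P → ∀ σ,
      0 ≤ E σ ∧ E σ ≤ C ∧ ∫ t in σ..(σ + 1), f t ≤ C := by
  set ρ := Real.exp (-(7 / 4 * β))
  have hρ : 0 < ρ := Real.exp_pos _
  have hρ1 : ρ < 1 := by
    rw [← Real.exp_zero]; exact Real.exp_lt_exp.2 (by linarith)
  set ρ₂ := Real.exp (-(2 * β))
  have hρ₂ : 0 < ρ₂ := Real.exp_pos _
  have hρρ : ρ₂ < ρ := Real.exp_lt_exp.2 (by linarith)
  set b := 1 / (4 * (ρ - ρ₂))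
  have hρs : 0 < ρ - ρ₂ := by linarith
  have hb : 0 < b := by positivity
  have hbe : 1 / 4 + b * ρ₂ = b * ρ := by
    have : b * (ρ - ρ₂) = 1 / 4 := by simp only [b]; field_simp
    linarith
  obtain ⟨C₁, hC₁, hF⟩ := FlowData.exists_integral_f_le hβ hc hK hKθ
    (η := ρ / (1 / 2 + 2 * b)) (by positivity)
  set C₂ := (1 / 2 + 2 * b) * C₁ + 1
  have hC₂ : 0 ≤ C₂ := by positivity
  set C₃ := C₂ / (1 - ρ)
  have h1ρ : 0 < 1 - ρ := by linarith
  have hC₃ : 0 ≤ C₃ := by positivity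
  refine ⟨C₃ + (ρ / (1 / 2 + 2 * b) * C₃ + C₁), by positivity, ?_⟩
  intro p E z f g N H P h
  set Q := fun s => max (E s) 1 + b * z s
  have hfi : ∀ σ, 0 ≤ ∫ t in σ..(σ + 1), f t := fun σ =>
    intervalIntegral.integral_nonneg (by linarith) fun t _ => h.f0 t
  have hE1 : ∀ σ, E (σ + 1) ≤ z σ / 4 + 1 / 2 * ∫ t in σ..(σ + 1), f t := by
    intro σ
    have := sub_le_of_deriv_le (y := fun t => z t - 2 * c₀ * ∫ τ in σ..t, f τ)
      (y' := fun t => (2 * (f t - H t - β * z t)) - 2 * c₀ * f t) (a := σ) (b := σ + 1)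
      (C := -4 * E (σ + 1)) (by linarith) (fun t => (h.dz t).sub
        ((h.cf.integral_hasStrictDerivAt σ t).hasDerivAt.const_mul _))
      (fun t ht => by rw [h.eE]; have := h.antitone_E ht.2; linarith)
    simp only [intervalIntegral.integral_same, mul_zero] at this
    have h1 := h.z0 (σ + 1)
    have h2 : c₀ * ∫ t in σ..(σ + 1), f t ≤ 1 * ∫ t in σ..(σ + 1), f t :=
      mul_le_mul_of_nonneg_right hc1 (hfi σ)
    linarith
  have hz1 : ∀ σ, z (σ + 1) ≤ ρ₂ * z σ + 2 * ∫ t in σ..(σ + 1), f t := by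
    intro σ
    have := sub_le_of_deriv_le
      (y := fun t => Real.exp (2 * β * t) * z t
        - 2 * Real.exp (2 * β * (σ + 1)) * ∫ τ in σ..t, f τ)
      (y' := fun t => Real.exp (2 * β * t) * (2 * β * 1) * z t
        + Real.exp (2 * β * t) * (2 * (f t - H t - β * z t))
        - 2 * Real.exp (2 * β * (σ + 1)) * f t) (a := σ) (b := σ + 1)
      (C := 0) (by linarith) (fun t =>
        ((((hasDerivAt_id t).const_mul (2 * β)).exp).mul (h.dz t)).sub
        ((h.cf.integral_hasStrictDerivAt σ t).hasDerivAt.const_mul _))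
      (fun t ht => by
        have h1 : Real.exp (2 * β * t) * f t ≤ Real.exp (2 * β * (σ + 1)) * f t := by
          have := h.f0 t
          have := ht.2
          gcongr
        have h2 : 0 ≤ Real.exp (2 * β * t) * H t := mul_nonneg (Real.exp_pos _).le (h.H0 t)
        nlinarith)
    simp only [intervalIntegral.integral_same, mul_zero, zero_mul, sub_zero] at this
    have e : Real.exp (2 * β * σ) = Real.exp (2 * β * (σ + 1)) * ρ₂ := by
      rw [← Real.exp_add]; congr 1; ring
    rw [e] at this
    have h3 : Real.exp (2 * β * (σ + 1)) * z (σ + 1) ≤ Real.exp (2 * β * (σ + 1)) *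
      (ρ₂ * z σ + 2 * ∫ t in σ..(σ + 1), f t) := by linarith
    exact le_of_mul_le_mul_left h3 (Real.exp_pos _)
  have hQ1 : ∀ σ, Q (σ + 1) ≤ ρ * Q σ + C₂ := by
    intro σ
    have h1 : max (E (σ + 1)) 1 ≤ z σ / 4 + 1 / 2 * (∫ t in σ..(σ + 1), f t) + 1 := by
      refine max_le (by linarith [hE1 σ]) ?_
      have := h.z0 σ; have := hfi σ; linarith
    have h2 := hz1 σ
    have h3 := hF p E z f g N H P h σ
    have h4 : (1 / 2 + 2 * b) * (∫ t in σ..(σ + 1), f t) ≤ ρ * max (E σ) 1 + (1 / 2 + 2 * b) * C₁ := by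
      refine (mul_le_mul_of_nonneg_left h3 (by positivity)).trans (le_of_eq ?_)
      field_simp
    have h5 := mul_le_mul_of_nonneg_left h2 hb.le
    have h6 : (1 / 4 + b * ρ₂) * z σ = b * ρ * z σ := by rw [hbe]
    simp only [Q, C₂]
    linarith
  have hzneg : ∀ s, z s ≤ K * Real.exp (-(3 / 2 * β * s)) := by
    intro s
    refine le_of_sq_le_sq ?_ (by positivity)
    have h1 := h.zN s
    have h2 : (K * Real.exp (-(3 / 2 * β * s))) ^ 2 = K * Real.exp (-(3 * β * s)) * K := by
      rw [mul_pow, ← Real.exp_nat_mul]; push_cast; rw [show 2 * -(3 / 2 * β * s) = -(3 * β * s) by ring]; ring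
    rw [h2]
    exact h1.trans (mul_le_mul_of_nonneg_left (h.N_le hβ s) (by positivity))
  have hfneg : ∀ σ, ∫ t in σ..(σ + 1), f t ≤ K * Real.exp (-(β * σ)) * (4 * K) := by
    intro σ
    have h1 : ∫ t in σ..(σ + 1), f t ≤ ∫ t in σ..(σ + 1), K * Real.exp (-(β * σ)) * g t := by
      refine intervalIntegral.integral_mono_on (by linarith) (h.cf.intervalIntegrable _ _)
        ((continuous_const.mul h.cg).intervalIntegrable _ _) fun t ht => ?_
      have := h.g0 t
      have := ht.1
      refine (h.fg t).trans ?_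
      gcongr
    refine h1.trans ?_
    rw [intervalIntegral.integral_const_mul]
    exact mul_le_mul_of_nonneg_left (h.integral_g_le hβ σ) (by positivity)
  set A := K / 4 + 2 * K ^ 2 + 1 + b * K
  have hQneg : ∀ σ, σ ≤ -1 → Q (σ + 1) ≤ A * Real.exp (-(3 / 2 * β * σ)) := by
    intro σ hσ
    have hx : 1 ≤ Real.exp (-(3 / 2 * β * σ)) := by
      rw [← Real.exp_zero]; exact Real.exp_le_exp.2 (by nlinarith)
    have hy : Real.exp (-(β * σ)) ≤ Real.exp (-(3 / 2 * β * σ)) :=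
      Real.exp_le_exp.2 (by nlinarith)
    have h1 := hE1 σ
    have h2 := hzneg σ
    have h3 := hfneg σ
    have h4 : z (σ + 1) ≤ K * Real.exp (-(3 / 2 * β * σ)) := (hzneg _).trans (by gcongr; linarith)
    have h5 : K * Real.exp (-(β * σ)) * (4 * K) ≤ K * Real.exp (-(3 / 2 * β * σ)) * (4 * K) := by
      gcongr
    have h6 : max (E (σ + 1)) 1 ≤ (K / 4 + 2 * K ^ 2 + 1) * Real.exp (-(3 / 2 * β * σ)) := by
      refine max_le ?_ ?_
      · nlinarith
      · have : 0 ≤ K / 4 + 2 * K ^ 2 := by positivity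
        nlinarith
    have h7 := mul_le_mul_of_nonneg_left h4 hb.le
    simp only [Q, A]
    linarith
  have hQ : ∀ σ, Q σ ≤ C₃ := by
    intro σ
    have hk : ∀ k : ℕ, Q σ - C₃ ≤ ρ ^ k * (Q (σ - k) - C₃) := by
      intro k
      induction k with
      | zero => simp
      | succ k ih =>
        refine ih.trans ?_
        rw [pow_succ, mul_assoc]
        refine mul_le_mul_of_nonneg_left ?_ (by positivity)
        have := hQ1 (σ - (k + 1 : ℕ))
        rw [show σ - ((k + 1 : ℕ) : ℝ) + 1 = σ - k by push_cast; ring] at this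
        have hC : C₃ = ρ * C₃ + C₂ := by
          have : C₃ * (1 - ρ) = C₂ := by simp only [C₃]; field_simp
          linarith
        linarith
    set r := Real.exp (-(1 / 4 * β))
    have hr1 : r < 1 := by rw [← Real.exp_zero]; exact Real.exp_lt_exp.2 (by linarith)
    have hr0 : 0 < r := Real.exp_pos _
    have hlim : Tendsto (fun k : ℕ => r ^ k * (A * Real.exp (-(3 / 2 * β * (σ - 1))))) atTop (𝓝 0) := by
      simpa using (tendsto_pow_atTop_nhds_zero_of_lt_one hr0.le hr1).mul_const
        (A * Real.exp (-(3 / 2 * β * (σ - 1))))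
    have hev : ∀ᶠ k : ℕ in atTop, Q σ - C₃ ≤ r ^ k * (A * Real.exp (-(3 / 2 * β * (σ - 1)))) := by
      filter_upwards [eventually_ge_atTop ⌈σ⌉₊] with k hkσ
      refine (hk k).trans ?_
      have hσk : σ ≤ k := (Nat.le_ceil σ).trans (by exact_mod_cast hkσ)
      have h1 := hQneg (σ - k - 1) (by linarith)
      rw [sub_add_cancel] at h1
      have h2 : ρ ^ k * (Q (σ - k) - C₃) ≤ ρ ^ k * (A * Real.exp (-(3 / 2 * β * (σ - k - 1)))) := by
        gcongr; linarith
      refine h2.trans (le_of_eq ?_)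
      simp only [ρ, r]
      rw [← Real.exp_nat_mul, ← Real.exp_nat_mul, mul_left_comm, mul_left_comm (Real.exp _) A, ← Real.exp_add,
        ← Real.exp_add]
      congr 2; ring
    have := ge_of_tendsto hlim hev
    linarith
  intro σ
  have h0 : max (E σ) 1 ≤ C₃ := by
    have := hQ σ
    have := mul_nonneg hb.le (h.z0 σ)
    simp only [Q] at *
    linarith
  have h2 : 0 ≤ ρ / (1 / 2 + 2 * b) := by positivity
  refine ⟨h.E_nonneg hβ hc σ, (le_max_left _ _).trans (h0.trans ?_), ?_⟩
  · have := mul_nonneg h2 hC₃; linarith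
  · have := hF p E z f g N H P h σ
    have := mul_le_mul_of_nonneg_left h0 h2
    linarith

theorem sq_wint_mul_le (a : ℕ) {f g : ℝ → ℝ → ℝ} (hf : PolyB f) (hg : PolyB g) :
    wint a (fun x r => f x r * g x r) ^ 2
      ≤ wint a (fun x r => f x r ^ 2) * wint a (fun x r => g x r ^ 2) := by
  have e : ∀ (F : ℝ → ℝ → ℝ) (G : ℝ → ℝ → ℝ), ∀ p ∈ quarter,
      (√(kap a p.1 p.2) * F p.1 p.2) * (√(kap a p.1 p.2) * G p.1 p.2)
        = kap a p.1 p.2 * (F p.1 p.2 * G p.1 p.2) := by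
    intro F G p hp
    have := Real.mul_self_sqrt (kap_pos a p.1 hp.2).le
    linear_combination F p.1 p.2 * G p.1 p.2 * this
  have i : ∀ {F G : ℝ → ℝ → ℝ}, PolyB F → PolyB G → Integrable (fun p : ℝ × ℝ =>
      (√(kap a p.1 p.2) * F p.1 p.2) * (√(kap a p.1 p.2) * G p.1 p.2))
      (volume.restrict quarter) := fun {F G} hF hG =>
    IntegrableOn.congr_fun ((hF.mul hG).integrableOn a) (fun p hp => (e F G p hp).symm)
      measurableSet_quarter
  have w : ∀ (F : ℝ → ℝ → ℝ) (G : ℝ → ℝ → ℝ), wint a (fun x r => F x r * G x r)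
      = ∫ p in quarter, (√(kap a p.1 p.2) * F p.1 p.2) * (√(kap a p.1 p.2) * G p.1 p.2) :=
    fun F G => setIntegral_congr_fun measurableSet_quarter fun p hp => (e F G p hp).symm
  simp only [sq (f _ _), sq (g _ _)]
  rw [w, w, w]
  have := sq_integral_mul_le (μ := volume.restrict quarter)
    (f := fun p : ℝ × ℝ => √(kap a p.1 p.2) * f p.1 p.2)
    (g := fun p : ℝ × ℝ => √(kap a p.1 p.2) * g p.1 p.2)
    (by simpa only [sq] using i hf hf) (by simpa only [sq] using i hg hg) (i hf hg)
  simpa only [sq (_ * _ : ℝ)] using this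

theorem wint_polynomial_pos_bound (a N : ℕ) (C : ℝ) :
    IntegrableOn (fun p : ℝ × ℝ => kap a p.1 p.2 * (C * (1 + p.1 + p.2) ^ N)) quarter :=
  PolyB.integrableOn (h := fun x r => C * (1 + x + r) ^ N)
    (PolyB.const_mul C ((((PolyB.const 1).add PolyB.fst).add PolyB.snd).pow N)) a

/-- Differentiation under the weighted integral. -/
theorem hasDerivAt_wint (a : ℕ) {F F' : ℝ → ℝ → ℝ → ℝ} {s : ℝ} {C : ℝ} {N : ℕ}
    (hF : ∀ t, PolyB (F t)) (hF' : PolyB (F' s))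
    (hb : ∀ t ∈ Icc (s - 1) (s + 1), ∀ x, 0 < x → ∀ r, 0 < r → |F' t x r| ≤ C * (1 + x + r) ^ N)
    (hd : ∀ t, ∀ x, 0 < x → ∀ r, 0 < r → HasDerivAt (fun t => F t x r) (F' t x r) t) :
    HasDerivAt (fun t => wint a (F t)) (wint a (F' s)) s := by
  refine (hasDerivAt_integral_of_dominated_loc_of_deriv_le
    (μ := volume.restrict quarter)
    (F := fun t (p : ℝ × ℝ) => kap a p.1 p.2 * F t p.1 p.2)
    (F' := fun t (p : ℝ × ℝ) => kap a p.1 p.2 * F' t p.1 p.2)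
    (bound := fun p => kap a p.1 p.2 * (C * (1 + p.1 + p.2) ^ N))
    (s := Icc (s - 1) (s + 1)) (Icc_mem_nhds (by linarith) (by linarith))
    (Eventually.of_forall fun t => ((hF t).integrableOn a).aestronglyMeasurable)
    ((hF s).integrableOn a) (hF'.integrableOn a).aestronglyMeasurable ?_
    (wint_polynomial_pos_bound a N C) ?_).2
  · refine (ae_restrict_iff' measurableSet_quarter).2 (Eventually.of_forall fun p hp t ht => ?_)
    rw [Real.norm_eq_abs, abs_mul, abs_of_pos (kap_pos a p.1 hp.2)]
    exact mul_le_mul_of_nonneg_left (hb t ht p.1 hp.1 p.2 hp.2) (kap_pos a p.1 hp.2).le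
  · refine (ae_restrict_iff' measurableSet_quarter).2 (Eventually.of_forall fun p hp t _ => ?_)
    exact (hd t p.1 hp.1 p.2 hp.2).const_mul _

/-- A family of profiles evolving by the rescaled heat equation. -/
structure ProfileFlow (φ : ℝ → Profile) (a : ℕ) (q β : ℝ) : Prop where
  snap : ∀ s, (φ s).Snap a q
  dW : ∀ s x, 0 < x → ∀ r, 0 < r → HasDerivAt (fun t => (φ t).w x r)
    ((φ s).G x r - β * (φ s).w x r) s
  cT : ∀ s x, 0 < x → ∀ r, 0 < r → ContinuousAt (fun t => (φ t).G x r - β * (φ t).w x r) s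
  bT : ∀ s, ∃ C, 0 ≤ C ∧ ∀ t ∈ Icc (s - 1) (s + 1), ∀ x, 0 < x → ∀ r, 0 < r →
    |(φ t).G x r - β * (φ t).w x r| ≤ C * (1 + x + r) ∧ (φ t).w x r ≤ C ∧ (φ t).w0 r ≤ C

namespace ProfileFlow

variable {φ : ℝ → Profile} {a : ℕ} {q β : ℝ}

theorem polyT (h : ProfileFlow φ a q β) (s : ℝ) :
    PolyB (fun x r => (φ s).G x r - β * (φ s).w x r) :=
  (h.snap s).polyG.sub ((h.snap s).polyW.const_mul β)

theorem wint_T_mul (h : ProfileFlow φ a q β) (s : ℝ) :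
    wint a (fun x r => ((φ s).G x r - β * (φ s).w x r) * (φ s).w x r)
      = (φ s).bdry a (q + 1) - (φ s).dir a - β * (φ s).mass a := by
  have hs := h.snap s
  have := hs.green hs.polyW hs.polyX hs.polyR hs.derivX hs.derivR hs.limW
  have e : (φ s).bdry a (q + 1) = bint a (fun r => (φ s).w0 r ^ q * (φ s).w0 r) :=
    bint_congr a fun r hr => Real.rpow_add_one (hs.pos0 r hr).ne' q
  rw [e, ← this, Profile.dir, Profile.mass, ← wint_const_mul,
    ← wint_sub a ((hs.polyG.mul hs.polyW).add ((hs.polyX.mul hs.polyX).add (hs.polyR.mul hs.polyR)))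
      hs.polyDir,
    ← wint_sub a (((hs.polyG.mul hs.polyW).add
      ((hs.polyX.mul hs.polyX).add (hs.polyR.mul hs.polyR))).sub hs.polyDir)
      ((hs.polyW.pow 2).const_mul β)]
  exact wint_congr a fun x _ r _ => by ring

theorem hasDerivAt_mass (h : ProfileFlow φ a q β) (s : ℝ) :
    HasDerivAt (fun t => (φ t).mass a)
      (2 * ((φ s).bdry a (q + 1) - (φ s).dir a - β * (φ s).mass a)) s := by
  obtain ⟨C, hC, hb⟩ := h.bT s
  have := hasDerivAt_wint a (F := fun t x r => (φ t).w x r ^ 2)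
    (F' := fun t x r => 2 * (((φ t).G x r - β * (φ t).w x r) * (φ t).w x r)) (s := s)
    (C := 2 * (C * C)) (N := 1)
    (fun t => (h.snap t).polyW.pow 2) (((h.polyT s).mul (h.snap s).polyW).const_mul 2)
    (fun t ht x hx r hr => by
      obtain ⟨h1, h2, -⟩ := hb t ht x hx r hr
      have hw := (h.snap t).pos x hx r hr
      rw [abs_mul, abs_mul, abs_of_pos hw, abs_two, pow_one]
      calc _ ≤ 2 * (C * (1 + x + r) * C) := by gcongr
        _ = _ := by ring)
    (fun t x hx r hr => ((h.dW t x hx r hr).pow 2).congr_deriv (by push_cast; ring))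
  refine this.congr_deriv ?_
  rw [← h.wint_T_mul, wint_const_mul]

theorem abs_w_sub_le (h : ProfileFlow φ a q β) (s : ℝ) : ∃ C, 0 ≤ C ∧
    ∀ t ∈ Icc (s - 1) (s + 1), (∀ x, 0 < x → ∀ r, 0 < r →
      |(φ t).G x r - β * (φ t).w x r| ≤ C * (1 + x + r) ∧ (φ t).w x r ≤ C ∧ (φ t).w0 r ≤ C ∧
      |(φ t).w x r - (φ s).w x r| ≤ C * (1 + x + r) * |t - s|) ∧
      ∀ r, 0 < r → |(φ t).w0 r - (φ s).w0 r| ≤ C * (1 + r) * |t - s| := by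
  obtain ⟨C, hC, hb⟩ := h.bT s
  have hw : ∀ t ∈ Icc (s - 1) (s + 1), ∀ x, 0 < x → ∀ r, 0 < r →
      |(φ t).w x r - (φ s).w x r| ≤ C * (1 + x + r) * |t - s| := by
    intro t ht x hx r hr
    have := Convex.norm_image_sub_le_of_norm_hasDerivWithin_le
      (f := fun t => (φ t).w x r) (f' := fun t => (φ t).G x r - β * (φ t).w x r)
      (C := C * (1 + x + r)) (s := Icc (s - 1) (s + 1)) (x := s) (y := t)
      (fun τ _ => (h.dW τ x hx r hr).hasDerivWithinAt)
      (fun τ hτ => (hb τ hτ x hx r hr).1) (convex_Icc _ _) ⟨by linarith, by linarith⟩ ht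
    simpa only [Real.norm_eq_abs] using this
  refine ⟨C, hC, fun t ht => ⟨fun x hx r hr => ⟨(hb t ht x hx r hr).1, (hb t ht x hx r hr).2.1,
    (hb t ht x hx r hr).2.2, hw t ht x hx r hr⟩, fun r hr => ?_⟩⟩
  have l1 := (((h.snap t).limW r hr).sub ((h.snap s).limW r hr)).abs
  have l2 : Tendsto (fun x : ℝ => C * (1 + x + r) * |t - s|) (𝓝[>] 0)
      (𝓝 (C * (1 + 0 + r) * |t - s|)) := by
    have : Continuous (fun x : ℝ => C * (1 + x + r) * |t - s|) := by fun_prop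
    exact (this.tendsto 0).mono_left nhdsWithin_le_nhds
  rw [add_zero] at l2
  exact le_of_tendsto_of_tendsto l1 l2
    (eventually_mem_nhdsWithin.mono fun x hx => hw t ht x hx r hr)

theorem continuousAt_w0 (h : ProfileFlow φ a q β) (s : ℝ) {r : ℝ} (hr : 0 < r) :
    ContinuousAt (fun t => (φ t).w0 r) s := by
  obtain ⟨C, hC, hb⟩ := h.abs_w_sub_le s
  rw [ContinuousAt, tendsto_iff_norm_sub_tendsto_zero]
  have l : Tendsto (fun t : ℝ => C * (1 + r) * |t - s|) (𝓝 s) (𝓝 0) := by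
    have : Continuous (fun t : ℝ => C * (1 + r) * |t - s|) := by fun_prop
    simpa using this.tendsto s
  refine squeeze_zero' (Eventually.of_forall fun t => norm_nonneg _) ?_ l
  filter_upwards [Icc_mem_nhds (by linarith : s - 1 < s) (by linarith : s < s + 1)] with t ht
  exact (hb t ht).2 r hr

theorem continuous_bdry (h : ProfileFlow φ a q β) {p : ℝ} (hp : 0 ≤ p) :
    Continuous (fun t => (φ t).bdry a p) := by
  refine continuous_iff_continuousAt.2 fun s => ?_
  obtain ⟨C, hC, hb⟩ := h.abs_w_sub_le s
  have hn := Icc_mem_nhds (by linarith : s - 1 < s) (by linarith : s < s + 1)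
  refine continuousAt_of_dominated (μ := volume.restrict (Ioi (0 : ℝ)))
    (F := fun t r => kap0 a r * (φ t).w0 r ^ p) (bound := fun r => kap0 a r * C ^ p)
    (Eventually.of_forall fun t =>
      (((h.snap t).polyPow hp).integrableOn a).aestronglyMeasurable)
    ?_ ((PolyZ.const (C ^ p)).integrableOn a) ?_
  · filter_upwards [hn] with t ht
    refine (ae_restrict_iff' measurableSet_Ioi).2 (Eventually.of_forall fun r hr => ?_)
    have hr : 0 < r := hr
    have h0 := (h.snap t).pos0 r hr
    have hk := kap0_pos a hr
    rw [Real.norm_eq_abs, abs_of_pos (by positivity)]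
    exact mul_le_mul_of_nonneg_left (Real.rpow_le_rpow h0.le ((hb t ht).1 1 one_pos r hr).2.2.1 hp)
      hk.le
  · refine (ae_restrict_iff' measurableSet_Ioi).2 (Eventually.of_forall fun r hr => ?_)
    exact ((h.continuousAt_w0 s hr).rpow_const (Or.inl ((h.snap s).pos0 r hr).ne')).const_mul _

end ProfileFlow

theorem abs_rpow_sub_rpow_le {q C x y : ℝ} (hq : 1 < q) (hx : 0 < x) (hy : 0 < y)
    (hxC : x ≤ C) (hyC : y ≤ C) : |y ^ q - x ^ q| ≤ q * C ^ (q - 1) * |y - x| := by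
  have := Convex.norm_image_sub_le_of_norm_hasDerivWithin_le
    (f := fun t : ℝ => t ^ q) (f' := fun t => q * t ^ (q - 1))
    (C := q * C ^ (q - 1)) (s := Ioc 0 C) (x := x) (y := y)
    (fun t ht => (Real.hasDerivAt_rpow_const (Or.inl ht.1.ne')).hasDerivWithinAt)
    (fun t ht => by
      have h0 : 0 < t := ht.1
      rw [Real.norm_eq_abs, abs_of_pos (by positivity)]
      have := Real.rpow_le_rpow h0.le ht.2 (by linarith : 0 ≤ q - 1)
      gcongr) (convex_Ioc 0 C) ⟨hx, hxC⟩ ⟨hy, hyC⟩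
  simpa only [Real.norm_eq_abs] using this

/-- The trapezoidal rule for the primitive of a monotone power. -/
theorem abs_trapezoid_le {q x y : ℝ} (hq : 1 < q) (hx : 0 < x) (hy : 0 < y) :
    |(y ^ q + x ^ q) * (y - x) / 2 - (y ^ (q + 1) - x ^ (q + 1)) / (q + 1)|
      ≤ |y ^ q - x ^ q| * |y - x| := by
  wlog hxy : x ≤ y generalizing x y
  · have := this hy hx (le_of_not_ge hxy)
    rw [abs_sub_comm (y ^ q), abs_sub_comm y]
    refine le_trans (le_of_eq ?_) this
    rw [← abs_neg]
    congr 1; ring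
  have hm : x ^ q ≤ y ^ q := Real.rpow_le_rpow hx.le hxy (by linarith)
  have key : x ^ q * (y - x) ≤ (y ^ (q + 1) - x ^ (q + 1)) / (q + 1) ∧
      (y ^ (q + 1) - x ^ (q + 1)) / (q + 1) ≤ y ^ q * (y - x) := by
    have hd : ∀ t ∈ Icc x y, HasDerivAt (fun t : ℝ => t ^ (q + 1) / (q + 1)) (t ^ q) t := by
      intro t ht
      have ht0 : 0 < t := hx.trans_le ht.1
      refine ((Real.hasDerivAt_rpow_const (p := q + 1) (Or.inl ht0.ne')).div_const
        (q + 1)).congr_deriv ?_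
      rw [add_sub_cancel_right]
      field_simp
    have hc : ContinuousOn (fun t : ℝ => t ^ (q + 1) / (q + 1)) (Icc x y) :=
      fun t ht => (hd t ht).continuousAt.continuousWithinAt
    have hdf : DifferentiableOn ℝ (fun t : ℝ => t ^ (q + 1) / (q + 1)) (interior (Icc x y)) :=
      fun t ht => (hd t (interior_subset ht)).differentiableAt.differentiableWithinAt
    constructor
    · have := Convex.mul_sub_le_image_sub_of_le_deriv (convex_Icc x y) hc hdf (C := x ^ q)
        (fun t ht => by
          rw [(hd t (interior_subset ht)).deriv]
          exact Real.rpow_le_rpow hx.le (interior_subset ht).1 (by linarith))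
        x (left_mem_Icc.2 hxy) y (right_mem_Icc.2 hxy) hxy
      rw [sub_div]; exact this
    · have := Convex.image_sub_le_mul_sub_of_deriv_le (convex_Icc x y) hc hdf (C := y ^ q)
        (fun t ht => by
          have ht' := interior_subset ht
          rw [(hd t ht').deriv]
          exact Real.rpow_le_rpow (hx.trans_le ht'.1).le ht'.2 (by linarith))
        x (left_mem_Icc.2 hxy) y (right_mem_Icc.2 hxy) hxy
      rw [sub_div]; exact this
  rw [abs_of_nonneg (sub_nonneg.2 hm), abs_of_nonneg (sub_nonneg.2 hxy), abs_le]
  have : 0 ≤ (y ^ q - x ^ q) * (y - x) := mul_nonneg (sub_nonneg.2 hm) (sub_nonneg.2 hxy)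
  constructor <;> nlinarith [key.1, key.2]

namespace ProfileFlow

variable {φ : ℝ → Profile} {a : ℕ} {q β : ℝ}

theorem energy_sub (h : ProfileFlow φ a q β) (hq : 1 < q) (s t : ℝ) :
    (φ t).energy a q β - (φ s).energy a q β
      = -(1 / 2) * wint a (fun x r => (((φ t).G x r - β * (φ t).w x r)
          + ((φ s).G x r - β * (φ s).w x r)) * ((φ t).w x r - (φ s).w x r))
        + bint a (fun r => ((φ t).w0 r ^ q + (φ s).w0 r ^ q) * ((φ t).w0 r - (φ s).w0 r) / 2
          - ((φ t).w0 r ^ (q + 1) - (φ s).w0 r ^ (q + 1)) / (q + 1)) := by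
  have hs := h.snap s
  have ht := h.snap t
  have pD := ht.polyW.sub hs.polyW
  have pDx := ht.polyX.sub hs.polyX
  have pDr := ht.polyR.sub hs.polyR
  have dx := fun x (hx : 0 < x) r (hr : 0 < r) =>
    (ht.derivX x hx r hr).sub (hs.derivX x hx r hr)
  have dr := fun x (hx : 0 < x) r (hr : 0 < r) =>
    (ht.derivR x hx r hr).sub (hs.derivR x hx r hr)
  have l0 := fun r (hr : 0 < r) => (ht.limW r hr).sub (hs.limW r hr)
  have g1 := ht.green pD pDx pDr dx dr l0
  have g2 := hs.green pD pDx pDr dx dr l0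
  have q0 : (0 : ℝ) ≤ q := by linarith
  have q1 : (0 : ℝ) ≤ q + 1 := by linarith
  have zt := ht.polyPow q0
  have zs := hs.polyPow q0
  have zt1 := ht.polyPow q1
  have zs1 := hs.polyPow q1
  have z0 := ht.polyW0.sub hs.polyW0
  have e0 : bint a (fun r => ((φ t).w0 r ^ q + (φ s).w0 r ^ q) * ((φ t).w0 r - (φ s).w0 r) / 2
          - ((φ t).w0 r ^ (q + 1) - (φ s).w0 r ^ (q + 1)) / (q + 1))
      = 1 / 2 * (bint a (fun r => (φ t).w0 r ^ q * ((φ t).w0 r - (φ s).w0 r))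
        + bint a (fun r => (φ s).w0 r ^ q * ((φ t).w0 r - (φ s).w0 r)))
        - 1 / (q + 1) * ((φ t).bdry a (q + 1) - (φ s).bdry a (q + 1)) := by
    rw [Profile.bdry, Profile.bdry, ← bint_sub a zt1 zs1, ← bint_add a (zt.mul z0) (zs.mul z0),
      ← bint_const_mul, ← bint_const_mul,
      ← bint_sub a (((zt.mul z0).add (zs.mul z0)).const_mul _) ((zt1.sub zs1).const_mul _)]
    exact bint_congr a fun r _ => by ring
  rw [e0, ← g1, ← g2, Profile.energy, Profile.energy, Profile.dir, Profile.dir, Profile.mass,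
    Profile.mass]
  have c1 : PolyB (fun x r => (φ t).G x r * ((φ t).w x r - (φ s).w x r)
      + ((φ t).wx x r * ((φ t).wx x r - (φ s).wx x r)
      + (φ t).wr x r * ((φ t).wr x r - (φ s).wr x r))) :=
    (ht.polyG.mul pD).add ((ht.polyX.mul pDx).add (ht.polyR.mul pDr))
  have c2 : PolyB (fun x r => (φ s).G x r * ((φ t).w x r - (φ s).w x r)
      + ((φ s).wx x r * ((φ t).wx x r - (φ s).wx x r)
      + (φ s).wr x r * ((φ t).wr x r - (φ s).wr x r))) :=
    (hs.polyG.mul pD).add ((hs.polyX.mul pDx).add (hs.polyR.mul pDr))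
  have c3 := ((h.polyT t).add (h.polyT s)).mul pD
  have c4 := (ht.polyW.pow 2).sub (hs.polyW.pow 2)
  have e1 : wint a (fun x r => (φ t).wx x r ^ 2 + (φ t).wr x r ^ 2)
      - wint a (fun x r => (φ s).wx x r ^ 2 + (φ s).wr x r ^ 2)
      + β * (wint a (fun x r => (φ t).w x r ^ 2) - wint a (fun x r => (φ s).w x r ^ 2))
      = -wint a (fun x r => (((φ t).G x r - β * (φ t).w x r)
          + ((φ s).G x r - β * (φ s).w x r)) * ((φ t).w x r - (φ s).w x r))
        + (wint a (fun x r => (φ t).G x r * ((φ t).w x r - (φ s).w x r)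
      + ((φ t).wx x r * ((φ t).wx x r - (φ s).wx x r)
      + (φ t).wr x r * ((φ t).wr x r - (φ s).wr x r)))
      + wint a (fun x r => (φ s).G x r * ((φ t).w x r - (φ s).w x r)
      + ((φ s).wx x r * ((φ t).wx x r - (φ s).wx x r)
      + (φ s).wr x r * ((φ t).wr x r - (φ s).wr x r)))) := by
    rw [← wint_sub a ht.polyDir hs.polyDir, ← wint_sub a (ht.polyW.pow 2) (hs.polyW.pow 2),
      ← wint_const_mul, ← wint_add a (ht.polyDir.sub hs.polyDir) (c4.const_mul β),
      ← wint_add a c1 c2, ← neg_one_mul, ← wint_const_mul, ← wint_add a (c3.const_mul _) (c1.add c2)]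
    exact wint_congr a fun x _ r _ => by ring
  linear_combination 1 / 2 * e1

theorem hasDerivAt_energy (h : ProfileFlow φ a q β) (hq : 1 < q) (s : ℝ) :
    HasDerivAt (fun t => (φ t).energy a q β) (-(φ s).speedSq a β) s := by
  obtain ⟨C, hC, hb⟩ := h.abs_w_sub_le s
  have hs := h.snap s
  have hn : Icc (s - 1) (s + 1) ∈ 𝓝[≠] s :=
    mem_nhdsWithin_of_mem_nhds (Icc_mem_nhds (by linarith) (by linarith))
  rw [hasDerivAt_iff_tendsto_slope]
  have main : Tendsto (fun t => wint a (fun x r => (((φ t).G x r - β * (φ t).w x r)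
      + ((φ s).G x r - β * (φ s).w x r)) * ((t - s)⁻¹ * ((φ t).w x r - (φ s).w x r)))) (𝓝[≠] s)
      (𝓝 (wint a (fun x r => 2 * ((φ s).G x r - β * (φ s).w x r) ^ 2))) := by
    refine tendsto_integral_filter_of_dominated_convergence (μ := volume.restrict quarter)
      (bound := fun p => kap a p.1 p.2 * (2 * C ^ 2 * (1 + p.1 + p.2) ^ 2))
      (Eventually.of_forall fun t => ?_) ?_ (wint_polynomial_pos_bound a 2 _) ?_
    · exact ((((h.polyT t).add (h.polyT s)).mul
        (((h.snap t).polyW.sub hs.polyW).const_mul _)).integrableOn a).aestronglyMeasurable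
    · filter_upwards [hn, self_mem_nhdsWithin] with t ht hts
      refine (ae_restrict_iff' measurableSet_quarter).2 (Eventually.of_forall fun p hp => ?_)
      have hp1 : 0 < p.1 := hp.1
      have hp2 : 0 < p.2 := hp.2
      rw [Real.norm_eq_abs, abs_mul, abs_of_pos (kap_pos a p.1 hp.2)]
      refine mul_le_mul_of_nonneg_left ?_ (kap_pos a p.1 hp.2).le
      have h1 := (hb t ht).1 p.1 hp.1 p.2 hp.2
      have h2 := (hb s ⟨by linarith, by linarith⟩).1 p.1 hp.1 p.2 hp.2
      have hts' : 0 < |t - s| := abs_pos.2 (sub_ne_zero.2 hts)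
      have h3 : |(t - s)⁻¹ * ((φ t).w p.1 p.2 - (φ s).w p.1 p.2)| ≤ C * (1 + p.1 + p.2) := by
        rw [abs_mul, abs_inv, inv_mul_le_iff₀ hts', mul_comm]
        exact h1.2.2.2
      rw [abs_mul]
      calc _ ≤ (C * (1 + p.1 + p.2) + C * (1 + p.1 + p.2)) * (C * (1 + p.1 + p.2)) := by
            gcongr
            exact (abs_add_le _ _).trans (add_le_add h1.1 h2.1)
        _ = _ := by ring
    · refine (ae_restrict_iff' measurableSet_quarter).2 (Eventually.of_forall fun p hp => ?_)
      refine Tendsto.const_mul _ ?_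
      have h1 := (h.cT s p.1 hp.1 p.2 hp.2).tendsto.mono_left (nhdsWithin_le_nhds (s := {s}ᶜ))
      have h2 := hasDerivAt_iff_tendsto_slope.1 (h.dW s p.1 hp.1 p.2 hp.2)
      have := (h1.add_const ((φ s).G p.1 p.2 - β * (φ s).w p.1 p.2)).mul h2
      refine (this.congr fun t => ?_).trans (le_of_eq ?_)
      · rw [slope_def_field]; ring
      · congr 1; ring
  set B := bint a (fun r => q * C ^ (q - 1) * (C ^ 2 * (1 + r) ^ 2))
  have pB : PolyZ (fun r => q * C ^ (q - 1) * (C ^ 2 * (1 + r) ^ 2)) :=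
    (((((PolyZ.const 1).add PolyZ.id).pow 2).const_mul _).const_mul _)
  have rem : Tendsto (fun t => (t - s)⁻¹ * bint a (fun r =>
      ((φ t).w0 r ^ q + (φ s).w0 r ^ q) * ((φ t).w0 r - (φ s).w0 r) / 2
          - ((φ t).w0 r ^ (q + 1) - (φ s).w0 r ^ (q + 1)) / (q + 1))) (𝓝[≠] s) (𝓝 0) := by
    have l : Tendsto (fun t : ℝ => B * |t - s|) (𝓝[≠] s) (𝓝 0) := by
      have : Continuous (fun t : ℝ => B * |t - s|) := by fun_prop
      have := this.tendsto s
      simp only [sub_self, abs_zero, mul_zero] at this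
      exact this.mono_left nhdsWithin_le_nhds
    refine squeeze_zero_norm' ?_ l
    filter_upwards [hn, self_mem_nhdsWithin] with t ht hts
    have hts' : 0 < |t - s| := abs_pos.2 (sub_ne_zero.2 hts)
    rw [Real.norm_eq_abs, abs_mul, abs_inv, inv_mul_le_iff₀ hts']
    have pt : ∀ r ∈ Ioi (0 : ℝ), ‖kap0 a r * (((φ t).w0 r ^ q + (φ s).w0 r ^ q)
        * ((φ t).w0 r - (φ s).w0 r) / 2
        - ((φ t).w0 r ^ (q + 1) - (φ s).w0 r ^ (q + 1)) / (q + 1))‖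
        ≤ |t - s| ^ 2 * (kap0 a r * (q * C ^ (q - 1) * (C ^ 2 * (1 + r) ^ 2))) := by
      intro r hr
      have hr : 0 < r := hr
      have hk := kap0_pos a hr
      rw [Real.norm_eq_abs, abs_mul, abs_of_pos hk, mul_left_comm]
      refine mul_le_mul_of_nonneg_left ?_ hk.le
      have p1 := (h.snap t).pos0 r hr
      have p2 := hs.pos0 r hr
      have b1 := ((hb t ht).1 1 one_pos r hr).2.2.1
      have b2 := ((hb s ⟨by linarith, by linarith⟩).1 1 one_pos r hr).2.2.1
      have b3 := (hb t ht).2 r hr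
      refine (abs_trapezoid_le hq p2 p1).trans ?_
      have h1 := abs_rpow_sub_rpow_le hq p2 p1 b2 b1
      have hqC : 0 ≤ q * C ^ (q - 1) := by positivity
      calc _ ≤ q * C ^ (q - 1) * |(φ t).w0 r - (φ s).w0 r| * |(φ t).w0 r - (φ s).w0 r| := by gcongr
        _ ≤ q * C ^ (q - 1) * (C * (1 + r) * |t - s|) * (C * (1 + r) * |t - s|) := by gcongr
        _ = _ := by ring
    have := norm_integral_le_of_norm_le ((pB.integrableOn a).const_mul (|t - s| ^ 2))
      ((ae_restrict_iff' measurableSet_Ioi).2 (Eventually.of_forall pt))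
    rw [integral_const_mul, Real.norm_eq_abs] at this
    calc _ ≤ |t - s| ^ 2 * B := this
      _ = _ := by ring
  have tot := (main.const_mul (-(1 / 2))).add rem
  refine (tot.congr' ?_).trans (le_of_eq ?_)
  · filter_upwards [self_mem_nhdsWithin] with t hts
    rw [slope_def_field, h.energy_sub hq s t]
    have e : wint a (fun x r => (((φ t).G x r - β * (φ t).w x r)
      + ((φ s).G x r - β * (φ s).w x r)) * ((t - s)⁻¹ * ((φ t).w x r - (φ s).w x r)))
      = (t - s)⁻¹ * wint a (fun x r => (((φ t).G x r - β * (φ t).w x r)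
      + ((φ s).G x r - β * (φ s).w x r)) * ((φ t).w x r - (φ s).w x r)) := by
      rw [← wint_const_mul]; exact wint_congr a fun x _ r _ => by ring
    rw [e, div_eq_inv_mul]; ring
  · rw [wint_const_mul, Profile.speedSq]; congr 1; ring

end ProfileFlow

/-- The exponential moment used in Kaplan's argument. -/
noncomputable def Profile.moment (φ : Profile) (a : ℕ) (l : ℝ) : ℝ :=
  wint a (fun x r => φ.w x r * Real.exp (-(l * x)))

theorem polyB_exp_neg {l : ℝ} (hl : 0 ≤ l) : PolyB (fun x _ => Real.exp (-(l * x))) := by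
  refine ⟨by fun_prop, 1, 0, zero_le_one, fun x hx r hr => ?_⟩
  rw [abs_of_pos (Real.exp_pos _), pow_zero, mul_one, ← Real.exp_zero]
  exact Real.exp_le_exp.2 (by nlinarith)

theorem exists_mul_le_half_rpow (l : ℝ) {q : ℝ} (hq : 1 < q) :
    ∃ C, 0 ≤ C ∧ ∀ t : ℝ, 0 < t → l * t ≤ t ^ q / 2 + C := by
  set T := (2 * |l| + 1) ^ (1 / (q - 1))
  have hT : 0 < T := by positivity
  refine ⟨|l| * T, by positivity, fun t ht => ?_⟩
  have hl := le_abs_self l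
  have h0 : 0 < t ^ q := Real.rpow_pos_of_pos ht q
  rcases le_total t T with h | h
  · have : l * t ≤ |l| * T := by
      have := abs_nonneg l
      calc l * t ≤ |l| * t := by gcongr
        _ ≤ _ := by gcongr
    linarith
  · have h1 : T ^ (q - 1) ≤ t ^ (q - 1) := Real.rpow_le_rpow hT.le h (by linarith)
    have h2 : T ^ (q - 1) = 2 * |l| + 1 := by
      simp only [T]
      rw [← Real.rpow_mul (by positivity), one_div_mul_cancel (by linarith), Real.rpow_one]
    have h3 : t ^ q = t ^ (q - 1) * t := by
      rw [← Real.rpow_add_one ht.ne', sub_add_cancel]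
    have : 0 ≤ |l| * T := by positivity
    rw [h2] at h1
    have h4 : (2 * |l| + 1) * t ≤ t ^ q := by rw [h3]; gcongr
    nlinarith

namespace ProfileFlow

variable {φ : ℝ → Profile} {a : ℕ} {q β : ℝ}

theorem hasDerivAt_moment (h : ProfileFlow φ a q β) {l : ℝ} (hl : 0 ≤ l) (s : ℝ) :
    HasDerivAt (fun t => (φ t).moment a l)
      (wint a (fun x r => ((φ s).G x r - β * (φ s).w x r) * Real.exp (-(l * x)))) s := by
  obtain ⟨C, hC, hb⟩ := h.bT s
  have pe := polyB_exp_neg hl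
  refine hasDerivAt_wint a (F := fun t x r => (φ t).w x r * Real.exp (-(l * x)))
    (F' := fun t x r => ((φ t).G x r - β * (φ t).w x r) * Real.exp (-(l * x))) (s := s)
    (C := C) (N := 1) (fun t => (h.snap t).polyW.mul pe) ((h.polyT s).mul pe)
    (fun t ht x hx r hr => ?_) (fun t x hx r hr => (h.dW t x hx r hr).mul_const _)
  have h1 : Real.exp (-(l * x)) ≤ 1 := by
    rw [← Real.exp_zero]; exact Real.exp_le_exp.2 (by nlinarith)
  rw [abs_mul, abs_of_pos (Real.exp_pos _), pow_one]
  have := (hb t ht x hx r hr).1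
  calc _ ≤ C * (1 + x + r) * 1 := by gcongr
    _ = _ := mul_one _

end ProfileFlow

namespace Profile.Snap

variable {φ : Profile} {a : ℕ} {q β : ℝ}

theorem moment_growth (h : φ.Snap a q) (hq : 1 < q) (hβ : 0 < β) {C : ℝ}
    (hC : ∀ t : ℝ, 0 < t → √(β + 1) * t ≤ t ^ q / 2 + C) :
    φ.moment a √(β + 1) + φ.bdry a q / 2 - C * bint a (fun _ => 1)
      ≤ wint a (fun x r => (φ.G x r - β * φ.w x r) * Real.exp (-(√(β + 1) * x))) := by
  set l := √(β + 1)
  have hl : 0 < l := Real.sqrt_pos.2 (by linarith)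
  have hl2 : l ^ 2 = β + 1 := Real.sq_sqrt (by linarith)
  have pe := polyB_exp_neg hl.le
  have k := h.kaplan l hl
  have p0 := h.polyPow (by linarith : (0 : ℝ) ≤ q)
  have p1 : PolyB (fun x r => φ.G x r * Real.exp (-(l * x))
      - φ.w x r * (l ^ 2 + l * x / 2) * Real.exp (-(l * x))) := by
    refine (h.polyG.mul pe).sub ((h.polyW.mul ((PolyB.const _).add ?_)).mul pe)
    exact (PolyB.fst.const_mul (l / 2)).congr fun x _ r _ => by ring
  have b1 : φ.bdry a q / 2 - C * bint a (fun _ => 1)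
      ≤ bint a (fun r => φ.w0 r ^ q - l * φ.w0 r) := by
    rw [div_eq_inv_mul, Profile.bdry, ← bint_const_mul, ← bint_const_mul,
      ← bint_sub a (p0.const_mul _) ((PolyZ.const 1).const_mul C)]
    refine bint_mono a ((p0.const_mul _).sub ((PolyZ.const 1).const_mul C))
      (p0.sub (h.polyW0.const_mul l)) fun r hr => ?_
    have := hC _ (h.pos0 r hr)
    linarith
  have b2 : φ.moment a l + wint a (fun x r => φ.G x r * Real.exp (-(l * x))
      - φ.w x r * (l ^ 2 + l * x / 2) * Real.exp (-(l * x)))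
      ≤ wint a (fun x r => (φ.G x r - β * φ.w x r) * Real.exp (-(l * x))) := by
    rw [Profile.moment, ← wint_add a (h.polyW.mul pe) p1]
    refine wint_mono a ((h.polyW.mul pe).add p1)
      ((h.polyG.sub (h.polyW.const_mul β)).mul pe) fun x hx r hr => ?_
    have h1 : 0 ≤ φ.w x r * (l * x / 2) * Real.exp (-(l * x)) := by
      have := h.pos x hx r hr
      positivity
    rw [hl2]
    linarith
  rw [k] at b2
  linarith

theorem mass_le_energy (h : φ.Snap a q) (hq : 1 < q) (hβ : 0 < β) :
    φ.mass a ≤ 128 * (bint a (fun _ => 1) + 1) *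
      (1 + φ.bdry a (q + 1) + φ.energy a q β) := by
  have h1 := h.mass_le
  have hc : 0 ≤ bint a (fun _ => 1) := bint_nonneg a fun r _ => zero_le_one
  have p0 := h.polyPow (by linarith : (0 : ℝ) ≤ q + 1)
  have h2 : bint a (fun r => φ.w0 r ^ 2) ≤ bint a (fun _ => 1) + φ.bdry a (q + 1) := by
    rw [Profile.bdry, ← bint_add a (PolyZ.const 1) p0]
    refine bint_mono a (h.polyW0.pow 2) ((PolyZ.const 1).add p0) fun r hr => ?_
    have hr0 := h.pos0 r hr
    have := Real.rpow_pos_of_pos hr0 (q + 1)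
    rcases le_total (φ.w0 r) 1 with hle | hle
    · nlinarith
    · have := Real.rpow_le_rpow_of_exponent_le hle (by linarith : (2 : ℝ) ≤ q + 1)
      rw [Real.rpow_two] at this
      linarith
  have hf := h.bdry_nonneg (q + 1)
  have hd := dir_nonneg φ a
  have hm := mass_nonneg φ a
  have he : φ.energy a q β = φ.dir a / 2 + β * φ.mass a / 2 - φ.bdry a (q + 1) / (q + 1) := rfl
  set f := φ.bdry a (q + 1)
  have hf2 : f / (q + 1) ≤ f / 2 := by gcongr; linarith
  have hbm : 0 ≤ β * φ.mass a := by positivity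
  set c := bint a (fun _ => 1)
  set e := φ.energy a q β
  have hX : φ.dir a ≤ 2 * e + f := by linarith
  have : 0 ≤ c * (f + e) := mul_nonneg hc (by linarith)
  nlinarith

theorem moment_nonneg (h : φ.Snap a q) (l : ℝ) : 0 ≤ φ.moment a l :=
  wint_nonneg a fun x hx r hr => mul_nonneg (h.pos x hx r hr).le (Real.exp_pos _).le

end Profile.Snap

/-- The weight `exp (l x)` is integrable against the Gaussian weight. -/
theorem integrableOn_kap_exp (a : ℕ) (l : ℝ) :
    IntegrableOn (fun p : ℝ × ℝ => kap a p.1 p.2 * Real.exp (l * p.1)) quarter := by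
  have hle : ∀ x : ℝ, Real.exp (-(x ^ 2) / 4) * Real.exp (l * x)
      ≤ Real.exp ((|l| + 1) ^ 2) * Real.exp (-|x|) := by
    intro x
    rw [← Real.exp_add, ← Real.exp_add]
    refine Real.exp_le_exp.2 ?_
    have h1 : l * x ≤ |l| * |x| := by rw [← abs_mul]; exact le_abs_self _
    have h2 : x ^ 2 = |x| ^ 2 := (sq_abs x).symm
    rw [h2]
    nlinarith [sq_nonneg (|x| / 2 - (|l| + 1))]
  obtain ⟨K, hK, hk⟩ := pow_mul_kap0_le a 0
  refine Integrable.mono' (integrableOn_exp_prod.const_mul (Real.exp ((|l| + 1) ^ 2) * K)) ?_ ?_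
  · exact ((continuous_kap a).mul (by fun_prop)).continuousOn.aestronglyMeasurable
      measurableSet_quarter
  · refine (ae_restrict_iff' measurableSet_quarter).2 (Eventually.of_forall fun p hp => ?_)
    have hp1 : 0 < p.1 := hp.1
    have hp2 : 0 < p.2 := hp.2
    have h0 := kap0_pos a hp2
    have h1 := hle p.1
    have h2 := hk p.2 hp2.le
    rw [pow_zero, one_mul] at h2
    rw [Real.norm_eq_abs, kap, abs_of_pos (by positivity)]
    rw [abs_of_pos hp1] at h1
    calc _ = (Real.exp (-(p.1 ^ 2) / 4) * Real.exp (l * p.1)) * kap0 a p.2 := by ring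
      _ ≤ (Real.exp ((|l| + 1) ^ 2) * Real.exp (-p.1)) * (K * Real.exp (-p.2)) := by gcongr
      _ = _ := by ring

namespace Profile.Snap

variable {φ : Profile} {a : ℕ} {q β : ℝ}

theorem sq_mass_le (h : φ.Snap a q) {l B : ℝ} (hl : 0 ≤ l)
    (hw : ∀ x, 0 < x → ∀ r, 0 < r → φ.w x r ≤ B) :
    φ.mass a ^ 2 ≤ B ^ 3 * wint a (fun x _ => Real.exp (l * x)) * φ.moment a l := by
  have hB : 0 ≤ B := (h.pos 1 one_pos 1 one_pos).le.trans (hw 1 one_pos 1 one_pos)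
  have pe := polyB_exp_neg hl
  set W := wint a (fun x r => φ.w x r)
  set X := wint a (fun x _ => Real.exp (l * x))
  have hW : 0 ≤ W := wint_nonneg a fun x hx r hr => (h.pos x hx r hr).le
  have hX : 0 ≤ X := wint_nonneg a fun x hx r hr => (Real.exp_pos _).le
  have h1 : φ.mass a ≤ B * W := by
    rw [Profile.mass, ← wint_const_mul]
    refine wint_mono a (h.polyW.pow 2) (h.polyW.const_mul B) fun x hx r hr => ?_
    have := hw x hx r hr
    have := h.pos x hx r hr
    nlinarith
  have hN := h.moment_nonneg l
  have key : ∀ t : ℝ, 0 ≤ φ.moment a l * (t * t) + (-(2 * W)) * t + B * X := by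
    intro t
    rcases le_total t 0 with ht | ht
    · have : 0 ≤ φ.moment a l * (t * t) := mul_nonneg hN (mul_self_nonneg t)
      have : 0 ≤ B * X := by positivity
      nlinarith
    · have i1 := (h.polyW.const_mul (2 * t)).integrableOn a
      have i2 := ((h.polyW.mul pe).const_mul (t * t)).integrableOn a
      have i3 : IntegrableOn (fun p : ℝ × ℝ => B * (kap a p.1 p.2 * Real.exp (l * p.1))) quarter :=
        (integrableOn_kap_exp a l).const_mul B
      have h2 : wint a (fun x r => 2 * t * φ.w x r)
          ≤ wint a (fun x r => t * t * (φ.w x r * Real.exp (-(l * x)))) + B * X := by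
        have e : B * X = ∫ p in quarter, B * (kap a p.1 p.2 * Real.exp (l * p.1)) := by
          rw [integral_const_mul]; rfl
        rw [e, wint, wint, ← integral_add i2 i3]
        refine setIntegral_mono_on i1 (i2.add i3) measurableSet_quarter fun p hp => ?_
        have hk := kap_pos a p.1 hp.2
        have h3 := h.pos p.1 hp.1 p.2 hp.2
        have h4 := hw p.1 hp.1 p.2 hp.2
        have h5 : Real.exp (-(l * p.1)) * Real.exp (l * p.1) = 1 := by
          rw [← Real.exp_add]; simp
        have h6 : 2 * t ≤ t * t * Real.exp (-(l * p.1)) + Real.exp (l * p.1) := by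
          have e1 := Real.exp_pos (-(l * p.1))
          have e2 := Real.exp_pos (l * p.1)
          nlinarith [mul_nonneg e2.le (sq_nonneg (t * Real.exp (-(l * p.1)) - 1))]
        have h7 : 2 * t * φ.w p.1 p.2 ≤ t * t * (φ.w p.1 p.2 * Real.exp (-(l * p.1)))
            + B * Real.exp (l * p.1) := by
          have := mul_le_mul_of_nonneg_left h6 h3.le
          have := mul_le_mul_of_nonneg_right h4 (Real.exp_pos (l * p.1)).le
          linarith
        have := mul_le_mul_of_nonneg_left h7 hk.le
        linarith
      rw [wint_const_mul, wint_const_mul] at h2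
      change 2 * t * W ≤ t * t * φ.moment a l + B * X at h2
      linarith
  have hd := discrim_le_zero key
  rw [discrim] at hd
  have h3 := mass_nonneg φ a
  calc φ.mass a ^ 2 ≤ (B * W) ^ 2 := by gcongr
    _ = B ^ 2 * W ^ 2 := by ring
    _ ≤ B ^ 2 * (φ.moment a l * (B * X)) := by gcongr; linarith
    _ = _ := by ring

end Profile.Snap

/-- A rescaled flow satisfies the differential inequalities of `FlowData`, with constants
depending only on the growth bound. -/
theorem exists_flowData {a : ℕ} {q β : ℝ} (hq : 1 < q) (ha : a * q < a + 2) (hβ : 0 < β) (M : ℝ)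
    (hM : 0 ≤ M) : ∃ K : ℝ, ∃ Kθ : ℝ → ℝ, 0 ≤ K ∧ (∀ θ, 0 ≤ Kθ θ) ∧
    ∀ φ : ℝ → Profile, ProfileFlow φ a q β →
      (∀ s x, 0 < x → ∀ r, 0 < r → (φ s).w x r ≤ M * Real.exp (-(β * s))) →
      (∀ s r, 0 < r → (φ s).w0 r ≤ M * Real.exp (-(β * s))) →
      ∃ p, FlowData β ((q - 1) / (q + 1)) p K Kθ (fun s => (φ s).energy a q β)
        (fun s => (φ s).mass a) (fun s => (φ s).bdry a (q + 1)) (fun s => (φ s).bdry a q)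
        (fun s => (φ s).moment a √(β + 1)) (fun s => (φ s).dir a)
        (fun s => (φ s).speedSq a β) := by
  set l := √(β + 1)
  have hl : 0 ≤ l := Real.sqrt_nonneg _
  obtain ⟨C, hC, hCt⟩ := exists_mul_le_half_rpow l hq
  have hsn : ∀ θ : ℝ, ∃ C : ℝ, 0 ≤ C ∧ (0 < θ → ∀ φ : Profile, φ.Snap a q → ∀ Λ : ℝ, 1 ≤ Λ →
      φ.energy a q β + φ.bdry a (q + 1) + φ.mass a ≤ Λ →
      φ.bdry a (q + 1) ≤ θ * (φ.speedSq a β + Λ) + C * (Λ ^ (3 / 4 : ℝ) * φ.bdry a q + 1)) := by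
    intro θ
    by_cases hθ : 0 < θ
    · obtain ⟨C, h1, h2⟩ := Profile.exists_bdry_le_speedSq hq ha hβ.le hθ
      exact ⟨C, h1, fun _ => h2⟩
    · exact ⟨0, le_rfl, fun h => absurd h hθ⟩
  choose Kθ hKθ hsnap using hsn
  set c := bint a (fun _ => 1)
  have hc : 0 ≤ c := bint_nonneg a fun r _ => zero_le_one
  set X := wint a (fun x _ => Real.exp (l * x))
  have hX : 0 ≤ X := wint_nonneg a fun x hx r hr => (Real.exp_pos _).le
  set V := wint a (fun _ _ => 1)
  have hV : 0 ≤ V := wint_nonneg a fun x hx r hr => zero_le_one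
  have h3 : 0 ≤ M ^ 3 * X := by positivity
  refine ⟨C * c + 128 * (c + 1) + M + M ^ 3 * X, Kθ, by positivity, hKθ, ?_⟩
  intro φ h hw hw0
  have q1 : (0 : ℝ) < q + 1 := by linarith
  have hE : ∀ s, (q - 1) / (q + 1) * (φ s).bdry a (q + 1) - 2 * (φ s).energy a q β
      = (φ s).bdry a (q + 1) - (φ s).dir a - β * (φ s).mass a := fun s => by
    rw [Profile.energy]; field_simp; ring
  have pe := polyB_exp_neg hl
  refine ⟨M ^ 2 * V + M * V, ⟨h.hasDerivAt_energy hq, h.hasDerivAt_mass,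
    ⟨_, fun s => ⟨h.hasDerivAt_moment hl s, ?_⟩⟩, h.continuous_bdry q1.le,
    h.continuous_bdry (by linarith), fun s => (h.snap s).bdry_nonneg _,
    fun s => (h.snap s).bdry_nonneg _, fun s => Profile.Snap.dir_nonneg _ _,
    fun s => wint_nonneg a fun x _ r _ => sq_nonneg _, fun s => Profile.Snap.mass_nonneg _ _,
    fun s => (h.snap s).moment_nonneg _, fun s => by rw [← hE]; ring, fun s => ?_, fun s => ?_,
    fun θ hθ s Λ hΛ hle => hsnap θ hθ _ (h.snap s) Λ hΛ hle, fun s => ?_, fun s => ?_,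
    fun s => ?_, fun s => ?_⟩⟩
  · have := (h.snap s).moment_growth hq hβ hCt
    refine le_trans ?_ this
    have : 0 ≤ 128 * (c + 1) := by positivity
    simp only [c] at *
    linarith
  · have h1 := (h.snap s).mass_le_energy hq hβ
    refine h1.trans (mul_le_mul_of_nonneg_right ?_ ?_)
    · have : 0 ≤ C * c := by positivity
      linarith
    · have := Profile.Snap.mass_nonneg (φ s) a
      by_contra! hneg
      have : 128 * (c + 1) * (1 + (φ s).bdry a (q + 1) + (φ s).energy a q β) < 0 :=
        mul_neg_of_pos_of_neg (by positivity) hneg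
      linarith
  · rw [hE, ← h.wint_T_mul, mul_comm ((φ s).mass a)]
    exact sq_wint_mul_le a (h.polyT s) (h.snap s).polyW
  · have p0 := (h.snap s).polyPow (by linarith : (0 : ℝ) ≤ q)
    have p1 := (h.snap s).polyPow q1.le
    have h1 : (φ s).bdry a (q + 1) ≤ M * Real.exp (-(β * s)) * (φ s).bdry a q := by
      rw [Profile.bdry, Profile.bdry, ← bint_const_mul]
      refine bint_mono a p1 (p0.const_mul _) fun r hr => ?_
      have h0 := (h.snap s).pos0 r hr
      rw [Real.rpow_add_one h0.ne', mul_comm]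
      exact mul_le_mul_of_nonneg_right (hw0 s r hr) (Real.rpow_pos_of_pos h0 q).le
    refine h1.trans ?_
    have := (h.snap s).bdry_nonneg q
    gcongr
    have : 0 ≤ C * c := by positivity
    linarith
  · have h1 := (h.snap s).sq_mass_le hl (hw s)
    refine h1.trans (mul_le_mul_of_nonneg_right ?_ ((h.snap s).moment_nonneg _))
    rw [mul_pow, ← Real.exp_nat_mul]
    rw [show ((3 : ℕ) : ℝ) * -(β * s) = -(3 * β * s) by push_cast; ring]
    have : M ^ 3 * X ≤ C * c + 128 * (c + 1) + M + M ^ 3 * X := by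
      have : 0 ≤ C * c + 128 * (c + 1) + M := by positivity
      linarith
    have := mul_le_mul_of_nonneg_right this (Real.exp_pos (-(3 * β * s))).le
    linarith
  · have h1 : (φ s).mass a ≤ (M * Real.exp (-(β * s))) ^ 2 * V := by
      rw [Profile.mass, ← wint_const_mul]
      refine wint_mono a ((h.snap s).polyW.pow 2) ((PolyB.const 1).const_mul _) fun x hx r hr => ?_
      rw [mul_one]
      have := (h.snap s).pos x hx r hr
      exact pow_le_pow_left₀ this.le (hw s x hx r hr) 2
    refine h1.trans ?_
    rw [mul_pow, ← Real.exp_nat_mul]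
    rw [show ((2 : ℕ) : ℝ) * -(β * s) = -(2 * β * s) by push_cast; ring]
    have : 0 ≤ M * V * Real.exp (-(2 * β * s)) := by positivity
    linarith
  · have h1 : (φ s).moment a l ≤ M * Real.exp (-(β * s)) * V := by
      rw [Profile.moment, ← wint_const_mul]
      refine wint_mono a ((h.snap s).polyW.mul pe) ((PolyB.const 1).const_mul _)
        fun x hx r hr => ?_
      have h2 : Real.exp (-(l * x)) ≤ 1 := by
        rw [← Real.exp_zero]; exact Real.exp_le_exp.2 (by nlinarith)
      have := (h.snap s).pos x hx r hr
      exact mul_le_mul (hw s x hx r hr) h2 (Real.exp_pos _).le (by positivity)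
    have : 0 ≤ M ^ 2 * V * Real.exp (-(β * s)) := by positivity
    refine h1.trans ?_
    linarith

/-- The region on which axially symmetric functions are considered. -/
def quarterTime : Set (ℝ × ℝ × ℝ) := {p | 0 < p.1 ∧ 0 < p.2.1}

/-- A positive bounded solution in the variables `(x, r, t)`, with its derivatives, their
bounds, and its boundary values `V` on `x = 0`. -/
structure RedSol (a : ℕ) (q M L : ℝ) (U Ux Ur Uxx Uxr Urr Ut : ℝ → ℝ → ℝ → ℝ)
    (V Vr : ℝ → ℝ → ℝ) : Prop where
  pos : ∀ x, 0 < x → ∀ r, 0 < r → ∀ t, 0 < U x r t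
  pos0 : ∀ r, 0 < r → ∀ t, 0 < V r t
  le : ∀ x, 0 < x → ∀ r, 0 < r → ∀ t, U x r t ≤ M
  contU : ContinuousOn (fun p : ℝ × ℝ × ℝ => U p.1 p.2.1 p.2.2) quarterTime
  contX : ContinuousOn (fun p : ℝ × ℝ × ℝ => Ux p.1 p.2.1 p.2.2) quarterTime
  contR : ContinuousOn (fun p : ℝ × ℝ × ℝ => Ur p.1 p.2.1 p.2.2) quarterTime
  contT : ContinuousOn (fun p : ℝ × ℝ × ℝ => Ut p.1 p.2.1 p.2.2) quarterTime
  contXX : ∀ t, ContinuousOn (fun p : ℝ × ℝ => Uxx p.1 p.2 t) quarter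
  contXR : ∀ t, ContinuousOn (fun p : ℝ × ℝ => Uxr p.1 p.2 t) quarter
  contRR : ∀ t, ContinuousOn (fun p : ℝ × ℝ => Urr p.1 p.2 t) quarter
  chain : ∀ (X R S : ℝ → ℝ) (X' R' S' s : ℝ), 0 < X s → 0 < R s → HasDerivAt X X' s →
    HasDerivAt R R' s → HasDerivAt S S' s → HasDerivAt (fun τ => U (X τ) (R τ) (S τ))
      (Ux (X s) (R s) (S s) * X' + Ur (X s) (R s) (S s) * R' + Ut (X s) (R s) (S s) * S') s
  derivXX : ∀ x, 0 < x → ∀ r, 0 < r → ∀ t, HasDerivAt (fun y => Ux y r t) (Uxx x r t) x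
  derivXR : ∀ x, 0 < x → ∀ r, 0 < r → ∀ t, HasDerivAt (fun y => Ux x y t) (Uxr x r t) r
  derivRX : ∀ x, 0 < x → ∀ r, 0 < r → ∀ t, HasDerivAt (fun y => Ur y r t) (Uxr x r t) x
  derivRR : ∀ x, 0 < x → ∀ r, 0 < r → ∀ t, HasDerivAt (fun y => Ur x y t) (Urr x r t) r
  heat : ∀ x, 0 < x → ∀ r, 0 < r → ∀ t,
    Ut x r t = Uxx x r t + Urr x r t + a / r * Ur x r t
  boundX : ∀ x, 0 < x → ∀ r, 0 < r → ∀ t, |Ux x r t| ≤ L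
  boundR : ∀ x, 0 < x → ∀ r, 0 < r → ∀ t, |Ur x r t| ≤ L
  boundT : ∀ x, 0 < x → ∀ r, 0 < r → ∀ t, |Ut x r t| ≤ L
  boundXX : ∀ x, 0 < x → ∀ r, 0 < r → ∀ t, |Uxx x r t| ≤ L / x
  boundXR : ∀ x, 0 < x → ∀ r, 0 < r → ∀ t, |Uxr x r t| ≤ L / x
  boundRR : ∀ x, 0 < x → ∀ r, 0 < r → ∀ t, |Urr x r t| ≤ L / x
  boundRr : ∀ x, 0 < x → ∀ r, 0 < r → ∀ t, |Ur x r t / r| ≤ L / x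
  limU : ∀ r, 0 < r → ∀ t, Tendsto (fun x => U x r t) (𝓝[>] 0) (𝓝 (V r t))
  limX : ∀ r, 0 < r → ∀ t, Tendsto (fun x => Ux x r t) (𝓝[>] 0) (𝓝 (-(V r t ^ q)))
  limR : ∀ r, 0 < r → ∀ t, Tendsto (fun x => Ur x r t) (𝓝[>] 0) (𝓝 (Vr r t))
  derivV : ∀ r, 0 < r → ∀ t, HasDerivAt (fun y => V y t) (Vr r t) r
  contVr : ∀ t, ContinuousOn (fun r => Vr r t) (Ioi 0)

theorem PolyB.of_scale {F : ℝ → ℝ → ℝ} {L e : ℝ} (he : 0 < e) (hL : 0 ≤ L) (c : ℝ)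
    (hc : ContinuousOn (fun p : ℝ × ℝ => F p.1 p.2) quarter)
    (hb : ∀ x, 0 < x → ∀ r, 0 < r → |F x r| ≤ L) :
    PolyB (fun x r => c * F (e * x) (e * r)) := by
  refine PolyB.const_mul c ⟨?_, L, 0, hL, fun x hx r hr => ?_⟩
  · refine hc.comp (f := fun p : ℝ × ℝ => (e * p.1, e * p.2)) (by fun_prop) fun p hp => ?_
    exact ⟨mul_pos he hp.1, mul_pos he hp.2⟩
  · simpa using hb _ (mul_pos he hx) _ (mul_pos he hr)

theorem PolyS.of_scale {F : ℝ → ℝ → ℝ} {L e : ℝ} (he : 0 < e) (hL : 0 ≤ L) (c : ℝ)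
    (hc : ContinuousOn (fun p : ℝ × ℝ => F p.1 p.2) quarter)
    (hb : ∀ x, 0 < x → ∀ r, 0 < r → |F x r| ≤ L / x) :
    PolyS (fun x r => c * F (e * x) (e * r)) := by
  refine PolyS.const_mul c ⟨?_, L / e, 0, by positivity, fun x hx r hr => ?_⟩
  · refine polyB_ratio.1.mul
      (hc.comp (f := fun p : ℝ × ℝ => (e * p.1, e * p.2)) (by fun_prop) fun p hp => ?_)
    exact ⟨mul_pos he hp.1, mul_pos he hp.2⟩
  · rw [abs_mul, abs_of_pos (by positivity : 0 < x / (1 + x)), pow_zero, mul_one]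
    calc x / (1 + x) * |F (e * x) (e * r)| ≤ x / 1 * (L / (e * x)) := by
          gcongr
          · linarith
          · exact hb _ (mul_pos he hx) _ (mul_pos he hr)
      _ = L / e := by field_simp

/-- The profile of a solution in similarity variables centred at time `T`. -/
noncomputable def similarity (β : ℝ) (U Ux Ur Uxx Uxr Urr Ut : ℝ → ℝ → ℝ → ℝ)
    (V Vr : ℝ → ℝ → ℝ) (T s : ℝ) : Profile :=
  let e := Real.exp (-(s / 2))
  let b := Real.exp (-(β * s))
  let t := T - Real.exp (-s)
  { w := fun x r => b * U (e * x) (e * r) t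
    wx := fun x r => b * e * Ux (e * x) (e * r) t
    wr := fun x r => b * e * Ur (e * x) (e * r) t
    wxx := fun x r => b * e ^ 2 * Uxx (e * x) (e * r) t
    wxr := fun x r => b * e ^ 2 * Uxr (e * x) (e * r) t
    wrr := fun x r => b * e ^ 2 * Urr (e * x) (e * r) t
    G := fun x r => b * e ^ 2 * Ut (e * x) (e * r) t
      - b * e / 2 * (x * Ux (e * x) (e * r) t + r * Ur (e * x) (e * r) t)
    w0 := fun r => b * V (e * r) t
    w0r := fun r => b * e * Vr (e * r) t }

namespace RedSol

variable {a : ℕ} {q M L : ℝ} {U Ux Ur Uxx Uxr Urr Ut : ℝ → ℝ → ℝ → ℝ} {V Vr : ℝ → ℝ → ℝ}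

theorem nonneg_L (h : RedSol a q M L U Ux Ur Uxx Uxr Urr Ut V Vr) : 0 ≤ L :=
  (abs_nonneg _).trans (h.boundT 1 one_pos 1 one_pos 0)

theorem nonneg_M (h : RedSol a q M L U Ux Ur Uxx Uxr Urr Ut V Vr) : 0 ≤ M :=
  (h.pos 1 one_pos 1 one_pos 0).le.trans (h.le 1 one_pos 1 one_pos 0)

theorem le0 (h : RedSol a q M L U Ux Ur Uxx Uxr Urr Ut V Vr) {r : ℝ} (hr : 0 < r) (t : ℝ) :
    V r t ≤ M :=
  le_of_tendsto (h.limU r hr t) (by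
    filter_upwards [self_mem_nhdsWithin] with x hx using h.le x hx r hr t)

theorem cont_slice {F : ℝ → ℝ → ℝ → ℝ}
    (hF : ContinuousOn (fun p : ℝ × ℝ × ℝ => F p.1 p.2.1 p.2.2) quarterTime) (t : ℝ) :
    ContinuousOn (fun p : ℝ × ℝ => F p.1 p.2 t) quarter :=
  hF.comp (f := fun p : ℝ × ℝ => (p.1, p.2, t)) (by fun_prop) fun _ hp => ⟨hp.1, hp.2⟩

theorem cont_path {F : ℝ → ℝ → ℝ → ℝ}
    (hF : ContinuousOn (fun p : ℝ × ℝ × ℝ => F p.1 p.2.1 p.2.2) quarterTime)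
    {X R S : ℝ → ℝ} {s : ℝ} (hX : ContinuousAt X s) (hR : ContinuousAt R s)
    (hS : ContinuousAt S s) (hx : 0 < X s) (hr : 0 < R s) :
    ContinuousAt (fun τ => F (X τ) (R τ) (S τ)) s := by
  have ho : IsOpen quarterTime :=
    (isOpen_lt continuous_const continuous_fst).inter
      (isOpen_lt continuous_const (continuous_fst.comp continuous_snd))
  have := hF.continuousAt (x := (X s, R s, S s)) (ho.mem_nhds ⟨hx, hr⟩)
  exact this.comp_of_eq (f := fun τ => (X τ, R τ, S τ)) (hX.prodMk (hR.prodMk hS)) rfl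

theorem snap (h : RedSol a q M L U Ux Ur Uxx Uxr Urr Ut V Vr) {β : ℝ} (hβ : β * q = β + 1 / 2)
    (T s : ℝ) : (similarity β U Ux Ur Uxx Uxr Urr Ut V Vr T s).Snap a q := by
  have hL := h.nonneg_L
  have he : 0 < Real.exp (-(s / 2)) := Real.exp_pos _
  have hb : 0 < Real.exp (-(β * s)) := Real.exp_pos _
  have hU : ∀ x, 0 < x → ∀ r, 0 < r → ∀ t, |U x r t| ≤ M := fun x hx r hr t => by
    rw [abs_of_pos (h.pos x hx r hr t)]; exact h.le x hx r hr t
  have hT := fun (x : ℝ) (hx : 0 < x) => mul_pos he hx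
  have dl : ∀ x : ℝ, HasDerivAt (fun y => Real.exp (-(s / 2)) * y) (Real.exp (-(s / 2))) x :=
    fun x => by simpa using (hasDerivAt_id x).const_mul (Real.exp (-(s / 2)))
  have tl : Tendsto (fun x => Real.exp (-(s / 2)) * x) (𝓝[>] 0) (𝓝[>] 0) := by
    refine tendsto_nhdsWithin_iff.2 ⟨?_, ?_⟩
    · have : Tendsto (fun x => Real.exp (-(s / 2)) * x) (𝓝 0) (𝓝 (Real.exp (-(s / 2)) * 0)) :=
        (continuous_const_mul _).tendsto _
      rw [mul_zero] at this
      exact this.mono_left nhdsWithin_le_nhds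
    · filter_upwards [self_mem_nhdsWithin] with x hx using hT x hx
  have pX := fun c => PolyB.of_scale he hL c (cont_slice h.contX (T - Real.exp (-s)))
    fun x hx r hr => h.boundX x hx r hr _
  have pR := fun c => PolyB.of_scale he hL c (cont_slice h.contR (T - Real.exp (-s)))
    fun x hx r hr => h.boundR x hx r hr _
  have pT := fun c => PolyB.of_scale he hL c (cont_slice h.contT (T - Real.exp (-s)))
    fun x hx r hr => h.boundT x hx r hr _
  exact {
    pos := fun x hx r hr => mul_pos hb (h.pos _ (hT x hx) _ (hT r hr) _)
    pos0 := fun r hr => mul_pos hb (h.pos0 _ (hT r hr) _)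
    bdd := ⟨Real.exp (-(β * s)) * M,
      fun x hx r hr => mul_le_mul_of_nonneg_left (h.le _ (hT x hx) _ (hT r hr) _) hb.le,
      fun r hr => mul_le_mul_of_nonneg_left (h.le0 (hT r hr) _) hb.le⟩
    polyW := PolyB.of_scale he h.nonneg_M _ (cont_slice h.contU _)
      fun x hx r hr => hU x hx r hr _
    polyX := pX _
    polyR := pR _
    polyRr := (PolyS.of_scale (F := fun x r => Ur x r (T - Real.exp (-s)) / r) he hL
      (Real.exp (-(β * s)) * Real.exp (-(s / 2)) ^ 2)
      ((cont_slice h.contR _).div continuousOn_snd fun p hp => (ne_of_gt hp.2))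
      fun x hx r hr => h.boundRr x hx r hr _).congr fun x hx r hr => by
        simp only [similarity]; field_simp
    polyXX := PolyS.of_scale he hL _ (h.contXX _) fun x hx r hr => h.boundXX x hx r hr _
    polyXR := PolyS.of_scale he hL _ (h.contXR _) fun x hx r hr => h.boundXR x hx r hr _
    polyRR := PolyS.of_scale he hL _ (h.contRR _) fun x hx r hr => h.boundRR x hx r hr _
    polyG := ((pT (Real.exp (-(β * s)) * Real.exp (-(s / 2)) ^ 2)).sub
      (PolyB.const_mul (Real.exp (-(β * s)) * Real.exp (-(s / 2)) / 2) ((PolyB.fst.mul (pX 1)).add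
      (PolyB.snd.mul (pR 1))))).congr fun x hx r hr => by
        simp only [similarity, one_mul]
    polyW0 := ⟨fun r hr => ((((h.derivV _ (hT r hr) _).comp r (dl r)).const_mul
        _).continuousAt).continuousWithinAt,
      Real.exp (-(β * s)) * M, 0, mul_nonneg hb.le h.nonneg_M, fun r hr => by
        simp only [similarity]
        rw [abs_of_pos (mul_pos hb (h.pos0 _ (hT r hr) _)), pow_zero, mul_one]
        exact mul_le_mul_of_nonneg_left (h.le0 (hT r hr) _) hb.le⟩
    polyW0r := by
      refine ⟨continuousOn_const.mul ((h.contVr _).comp (by fun_prop) fun r hr => hT r hr),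
        Real.exp (-(β * s)) * Real.exp (-(s / 2)) * L, 0, by positivity, fun r hr => ?_⟩
      simp only [similarity]
      rw [abs_mul, abs_of_pos (mul_pos hb he), pow_zero, mul_one]
      refine mul_le_mul_of_nonneg_left (le_of_tendsto (h.limR _ (hT r hr) _).abs ?_)
        (by positivity)
      filter_upwards [self_mem_nhdsWithin] with x hx using h.boundR x hx _ (hT r hr) _
    derivX := fun x hx r hr => by
      refine ((h.chain (fun y => Real.exp (-(s / 2)) * y) (fun _ => Real.exp (-(s / 2)) * r)
        (fun _ => T - Real.exp (-s)) _ 0 0 x (hT x hx) (hT r hr) (dl x) (hasDerivAt_const _ _)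
        (hasDerivAt_const _ _)).const_mul (Real.exp (-(β * s)))).congr_deriv ?_
      simp only [similarity]; ring
    derivR := fun x hx r hr => by
      refine ((h.chain (fun _ => Real.exp (-(s / 2)) * x) (fun y => Real.exp (-(s / 2)) * y)
        (fun _ => T - Real.exp (-s)) 0 _ 0 r (hT x hx) (hT r hr) (hasDerivAt_const _ _) (dl r)
        (hasDerivAt_const _ _)).const_mul (Real.exp (-(β * s)))).congr_deriv ?_
      simp only [similarity]; ring
    derivXX := fun x hx r hr => (((h.derivXX _ (hT x hx) _ (hT r hr) _).comp x (dl x)).const_mul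
      _).congr_deriv (by simp only [similarity]; ring)
    derivXR := fun x hx r hr => (((h.derivXR _ (hT x hx) _ (hT r hr) _).comp r (dl r)).const_mul
      _).congr_deriv (by simp only [similarity]; ring)
    derivRX := fun x hx r hr => (((h.derivRX _ (hT x hx) _ (hT r hr) _).comp x (dl x)).const_mul
      _).congr_deriv (by simp only [similarity]; ring)
    derivRR := fun x hx r hr => (((h.derivRR _ (hT x hx) _ (hT r hr) _).comp r (dl r)).const_mul
      _).congr_deriv (by simp only [similarity]; ring)
    eqG := fun x hx r hr => by
      simp only [similarity]
      rw [h.heat _ (hT x hx) _ (hT r hr)]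
      field_simp
    limW := fun r hr => ((h.limU _ (hT r hr) _).comp tl).const_mul _
    limX := fun r hr => by
      have := ((h.limX _ (hT r hr) (T - Real.exp (-s))).comp tl).const_mul
        (Real.exp (-(β * s)) * Real.exp (-(s / 2)))
      have e : (Real.exp (-(β * s)) * V (Real.exp (-(s / 2)) * r) (T - Real.exp (-s))) ^ q
          = Real.exp (-(β * s)) * Real.exp (-(s / 2))
            * V (Real.exp (-(s / 2)) * r) (T - Real.exp (-s)) ^ q := by
        rw [Real.mul_rpow hb.le (h.pos0 _ (hT r hr) _).le, ← Real.exp_mul, ← Real.exp_add]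
        congr 2
        linear_combination -s * hβ
      simpa only [similarity, e, mul_neg, Function.comp_def] using this
    limR := fun r hr => ((h.limR _ (hT r hr) _).comp tl).const_mul _
    deriv0 := fun r hr => (((h.derivV _ (hT r hr) _).comp r (dl r)).const_mul
      _).congr_deriv (by simp only [similarity]; ring) }

end RedSol

namespace RedSol

variable {a : ℕ} {q M L : ℝ} {U Ux Ur Uxx Uxr Urr Ut : ℝ → ℝ → ℝ → ℝ} {V Vr : ℝ → ℝ → ℝ}

theorem flow (h : RedSol a q M L U Ux Ur Uxx Uxr Urr Ut V Vr) {β : ℝ} (hβ0 : 0 < β)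
    (hβ : β * q = β + 1 / 2) (T : ℝ) :
    ProfileFlow (similarity β U Ux Ur Uxx Uxr Urr Ut V Vr T) a q β := by
  have hL := h.nonneg_L
  have hM := h.nonneg_M
  have de : ∀ s y : ℝ, HasDerivAt (fun τ => Real.exp (-(τ / 2)) * y)
      (-(1 / 2) * (Real.exp (-(s / 2)) * y)) s := fun s y => by
    refine ((((hasDerivAt_id s).div_const 2).neg.exp).mul_const y).congr_deriv ?_
    simp only [id, Pi.neg_apply]; ring
  have dt : ∀ s : ℝ, HasDerivAt (fun τ => T - Real.exp (-τ)) (Real.exp (-s)) s := fun s => by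
    refine (((hasDerivAt_id s).neg.exp).const_sub T).congr_deriv ?_
    simp
  have db : ∀ s : ℝ, HasDerivAt (fun τ => Real.exp (-(β * τ))) (-β * Real.exp (-(β * s))) s :=
    fun s => by
    refine (((hasDerivAt_id s).const_mul β).neg.exp).congr_deriv ?_
    simp only [id, Pi.neg_apply]; ring
  have sq : ∀ s : ℝ, Real.exp (-s) = Real.exp (-(s / 2)) ^ 2 := fun s => by
    rw [← Real.exp_nat_mul]; congr 1; push_cast; ring
  have hp : ∀ s x : ℝ, 0 < x → 0 < Real.exp (-(s / 2)) * x := fun s x hx =>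
    mul_pos (Real.exp_pos _) hx
  have dW : ∀ s x, 0 < x → ∀ r, 0 < r → HasDerivAt
      (fun t => (similarity β U Ux Ur Uxx Uxr Urr Ut V Vr T t).w x r)
      ((similarity β U Ux Ur Uxx Uxr Urr Ut V Vr T s).G x r
        - β * (similarity β U Ux Ur Uxx Uxr Urr Ut V Vr T s).w x r) s := by
    intro s x hx r hr
    refine ((db s).mul (h.chain (fun τ => Real.exp (-(τ / 2)) * x)
      (fun τ => Real.exp (-(τ / 2)) * r) (fun τ => T - Real.exp (-τ)) _ _ _ s (hp s x hx)
      (hp s r hr) (de s x) (de s r) (dt s))).congr_deriv ?_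
    simp only [similarity]
    rw [sq s]
    ring
  refine ⟨h.snap hβ T, dW, fun s x hx r hr => ?_, fun s => ?_⟩
  · have cp := fun {F : ℝ → ℝ → ℝ → ℝ}
        (hF : ContinuousOn (fun p : ℝ × ℝ × ℝ => F p.1 p.2.1 p.2.2) quarterTime) =>
      cont_path hF (de s x).continuousAt (de s r).continuousAt (dt s).continuousAt
        (hp s x hx) (hp s r hr)
    have ce : ContinuousAt (fun τ : ℝ => Real.exp (-(τ / 2))) s := by fun_prop
    have cb := (db s).continuousAt
    exact (((cb.mul (ce.pow 2)).mul (cp h.contT)).sub (((cb.mul ce).div_const 2).mul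
      ((continuousAt_const.mul (cp h.contX)).add (continuousAt_const.mul (cp h.contR))))).sub
      (continuousAt_const.mul (cb.mul (cp h.contU)))
  · set B := Real.exp (-(β * (s - 1)))
    set E := Real.exp (-((s - 1) / 2))
    have hB : 0 < B := Real.exp_pos _
    have hE : 0 < E := Real.exp_pos _
    have hBM : 0 ≤ B * M := by positivity
    have hBE : 0 ≤ B * E ^ 2 * L + B * E * L + β * (B * M) := by positivity
    refine ⟨B * E ^ 2 * L + B * E * L + β * (B * M) + B * M, by positivity,
      fun t ht x hx r hr => ?_⟩
    have hb0 := Real.exp_pos (-(β * t))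
    have he0 := Real.exp_pos (-(t / 2))
    have hb : Real.exp (-(β * t)) ≤ B := Real.exp_le_exp.2 (by nlinarith [ht.1])
    have he : Real.exp (-(t / 2)) ≤ E := Real.exp_le_exp.2 (by linarith [ht.1])
    have w1 : (similarity β U Ux Ur Uxx Uxr Urr Ut V Vr T t).w x r ≤ B * M :=
      mul_le_mul hb (h.le _ (hp t x hx) _ (hp t r hr) _)
        (h.pos _ (hp t x hx) _ (hp t r hr) _).le hB.le
    have w2 : 0 < (similarity β U Ux Ur Uxx Uxr Urr Ut V Vr T t).w x r :=
      mul_pos hb0 (h.pos _ (hp t x hx) _ (hp t r hr) _)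
    refine ⟨?_, by linarith, ?_⟩
    · have hX := abs_le.1 (h.boundX _ (hp t x hx) _ (hp t r hr) (T - Real.exp (-t)))
      have hR := abs_le.1 (h.boundR _ (hp t x hx) _ (hp t r hr) (T - Real.exp (-t)))
      have hT := h.boundT _ (hp t x hx) _ (hp t r hr) (T - Real.exp (-t))
      have e1 : |Real.exp (-(β * t)) * Real.exp (-(t / 2)) ^ 2
          * Ut (Real.exp (-(t / 2)) * x) (Real.exp (-(t / 2)) * r) (T - Real.exp (-t))|
          ≤ B * E ^ 2 * L := by
        rw [abs_mul, abs_of_pos (by positivity : 0 < Real.exp (-(β * t)) * Real.exp (-(t / 2)) ^ 2)]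
        gcongr
      have e2 : |Real.exp (-(β * t)) * Real.exp (-(t / 2)) / 2
          * (x * Ux (Real.exp (-(t / 2)) * x) (Real.exp (-(t / 2)) * r) (T - Real.exp (-t))
          + r * Ur (Real.exp (-(t / 2)) * x) (Real.exp (-(t / 2)) * r) (T - Real.exp (-t)))|
          ≤ B * E * L * (x + r) := by
        have : |x * Ux (Real.exp (-(t / 2)) * x) (Real.exp (-(t / 2)) * r) (T - Real.exp (-t))
          + r * Ur (Real.exp (-(t / 2)) * x) (Real.exp (-(t / 2)) * r) (T - Real.exp (-t))|
          ≤ L * (x + r) := by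
          rw [abs_le]
          constructor <;> nlinarith
        rw [abs_mul, abs_of_pos (by positivity :
          0 < Real.exp (-(β * t)) * Real.exp (-(t / 2)) / 2)]
        calc _ ≤ B * E / 1 * (L * (x + r)) := by gcongr; norm_num
          _ = _ := by ring
      have e3 := abs_le.1 e1
      have e4 := abs_le.1 e2
      have hβw : β * (similarity β U Ux Ur Uxx Uxr Urr Ut V Vr T t).w x r ≤ β * (B * M) := by
        gcongr
      have hβw' := mul_pos hβ0 w2
      have f1 : B * E * L * (x + r) + (B * E ^ 2 * L + β * (B * M))
          ≤ (B * E ^ 2 * L + B * E * L + β * (B * M) + B * M) * (1 + x + r) := by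
        have : 0 ≤ B * E * L := by positivity
        have : 0 ≤ (B * E ^ 2 * L + β * (B * M) + B * M) * (x + r) := by positivity
        nlinarith
      refine le_trans ?_ f1
      have eG : (similarity β U Ux Ur Uxx Uxr Urr Ut V Vr T t).G x r
        = Real.exp (-(β * t)) * Real.exp (-(t / 2)) ^ 2
          * Ut (Real.exp (-(t / 2)) * x) (Real.exp (-(t / 2)) * r) (T - Real.exp (-t))
        - Real.exp (-(β * t)) * Real.exp (-(t / 2)) / 2
          * (x * Ux (Real.exp (-(t / 2)) * x) (Real.exp (-(t / 2)) * r) (T - Real.exp (-t))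
          + r * Ur (Real.exp (-(t / 2)) * x) (Real.exp (-(t / 2)) * r) (T - Real.exp (-t))) := rfl
      rw [eG, abs_le]
      constructor <;> linarith [e3.1, e3.2, e4.1, e4.2]
    · exact (mul_le_mul hb (h.le0 (hp t r hr) _) (h.pos0 _ (hp t r hr) _).le hB.le).trans
        (by linarith)

/-- Universal bounds for the rescaled energies. -/
theorem exists_universal_bound (h : RedSol a q M L U Ux Ur Uxx Uxr Urr Ut V Vr) (hq : 1 < q)
    (ha : a * q < a + 2) {β : ℝ} (hβ0 : 0 < β) (hβ : β * q = β + 1 / 2) :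
    ∃ C, 0 ≤ C ∧ ∀ T : ℝ, ∃ E : ℝ → ℝ,
      (∀ s, HasDerivAt E (-(similarity β U Ux Ur Uxx Uxr Urr Ut V Vr T s).speedSq a β) s) ∧
      (∀ s, 0 ≤ E s ∧ E s ≤ C) ∧
      Continuous (fun s => (similarity β U Ux Ur Uxx Uxr Urr Ut V Vr T s).bdry a (q + 1)) ∧
      ∀ σ, ∫ t in σ..(σ + 1), (similarity β U Ux Ur Uxx Uxr Urr Ut V Vr T t).bdry a (q + 1)
        ≤ C := by
  obtain ⟨K, Kθ, hK, hKθ, hF⟩ := exists_flowData hq ha hβ0 M h.nonneg_M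
  obtain ⟨C, hC, hb⟩ := FlowData.exists_bound (c₀ := (q - 1) / (q + 1)) hβ0
    (div_pos (by linarith) (by linarith)) ((div_le_one (by linarith)).2 (by linarith)) hK hKθ
  refine ⟨C, hC, fun T => ?_⟩
  have hp : ∀ s x : ℝ, 0 < x → 0 < Real.exp (-(s / 2)) * x := fun s x hx =>
    mul_pos (Real.exp_pos _) hx
  obtain ⟨p, hp⟩ := hF _ (h.flow hβ0 hβ T)
    (fun s x hx r hr => by
      rw [mul_comm M]
      exact mul_le_mul_of_nonneg_left (h.le _ (hp s x hx) _ (hp s r hr) _) (Real.exp_pos _).le)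
    (fun s r hr => by
      rw [mul_comm M]
      exact mul_le_mul_of_nonneg_left (h.le0 (hp s r hr) _) (Real.exp_pos _).le)
  have := hb p _ _ _ _ _ _ _ hp
  exact ⟨_, hp.dE, fun s => ⟨(this s).1, (this s).2.1⟩, hp.cf, fun σ => (this σ).2.2⟩

end RedSol

theorem le_wint_of_box (a : ℕ) {h : ℝ → ℝ → ℝ} (hh : PolyB h)
    (h0 : ∀ x, 0 < x → ∀ r, 0 < r → 0 ≤ h x r) {x₁ x₂ r₁ r₂ m : ℝ} (hx : 0 < x₁) (hx' : x₁ ≤ x₂)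
    (hr : 0 < r₁) (hr' : r₁ ≤ r₂)
    (hm : ∀ x ∈ Icc x₁ x₂, ∀ r ∈ Icc r₁ r₂, m ≤ kap a x r * h x r) :
    m * ((x₂ - x₁) * (r₂ - r₁)) ≤ wint a h := by
  have hs : Icc x₁ x₂ ×ˢ Icc r₁ r₂ ⊆ quarter := fun p hp =>
    ⟨hx.trans_le hp.1.1, hr.trans_le hp.2.1⟩
  have hms : MeasurableSet (Icc x₁ x₂ ×ˢ Icc r₁ r₂) := measurableSet_Icc.prod measurableSet_Icc
  have hv : volume.real (Icc x₁ x₂ ×ˢ Icc r₁ r₂) = (x₂ - x₁) * (r₂ - r₁) := by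
    rw [Measure.volume_eq_prod, measureReal_prod_prod, Real.volume_real_Icc_of_le hx',
      Real.volume_real_Icc_of_le hr']
  rw [← hv]
  refine (setIntegral_ge_of_const_le_real hms ?_ (fun p hp => hm p.1 hp.1 p.2 hp.2)
    ((hh.integrableOn a).mono_set hs)).trans ?_
  · exact ((isCompact_Icc.prod isCompact_Icc).measure_lt_top).ne
  · refine setIntegral_mono_set (hh.integrableOn a) ?_ hs.eventuallyLE
    exact (ae_restrict_iff' measurableSet_quarter).2 (Eventually.of_forall fun p hp =>
      mul_nonneg (kap_pos a p.1 hp.2).le (h0 p.1 hp.1 p.2 hp.2))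

theorem le_bint_of_Icc (a : ℕ) {h : ℝ → ℝ} (hh : PolyZ h) (h0 : ∀ r, 0 < r → 0 ≤ h r)
    {r₁ r₂ m : ℝ} (hr : 0 < r₁) (hr' : r₁ ≤ r₂)
    (hm : ∀ r ∈ Icc r₁ r₂, m ≤ kap0 a r * h r) : m * (r₂ - r₁) ≤ bint a h := by
  have hs : Icc r₁ r₂ ⊆ Ioi 0 := fun r h => hr.trans_le h.1
  rw [← Real.volume_real_Icc_of_le hr']
  refine (setIntegral_ge_of_const_le_real measurableSet_Icc ?_ hm
    ((hh.integrableOn a).mono_set hs)).trans ?_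
  · exact isCompact_Icc.measure_lt_top.ne
  · refine setIntegral_mono_set (hh.integrableOn a) ?_ hs.eventuallyLE
    exact (ae_restrict_iff' measurableSet_Ioi).2 (Eventually.of_forall fun r hr =>
      mul_nonneg (kap0_pos a hr).le (h0 r hr))

theorem exp_mul_pow_le_kap0 (a : ℕ) {r₁ r : ℝ} (h1 : 0 < r₁) (h2 : r₁ ≤ r) (h3 : r ≤ 1) :
    Real.exp (-(1 / 4)) * r₁ ^ a ≤ kap0 a r := by
  unfold kap0
  gcongr
  nlinarith

theorem exp_mul_pow_le_kap (a : ℕ) {x r₁ r : ℝ} (hx : 0 ≤ x) (hx1 : x ≤ 1) (h1 : 0 < r₁)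
    (h2 : r₁ ≤ r) (h3 : r ≤ 1) : Real.exp (-(1 / 2)) * r₁ ^ a ≤ kap a x r := by
  have := exp_mul_pow_le_kap0 a h1 h2 h3
  have e : Real.exp (-(1 / 2)) = Real.exp (-(1 / 4)) * Real.exp (-(1 / 4)) := by
    rw [← Real.exp_add]; norm_num
  rw [kap, e, mul_assoc]
  gcongr
  nlinarith

namespace RedSol

variable {a : ℕ} {q M L : ℝ} {U Ux Ur Uxx Uxr Urr Ut : ℝ → ℝ → ℝ → ℝ} {V Vr : ℝ → ℝ → ℝ}

/-- A lower bound for the squared speed in the similarity variables. -/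
theorem speedSq_ge (h : RedSol a q M L U Ux Ur Uxx Uxr Urr Ut V Vr) {β : ℝ} (hβ0 : 0 < β)
    (hβ : β * q = β + 1 / 2) {x₀ r₀ δ c T s : ℝ} (hx : 0 < x₀) (hr : 0 < r₀) (hδ : 0 < δ)
    (hc : 0 < c) (hUt : ∀ x ∈ Icc x₀ (x₀ + δ), ∀ r ∈ Icc r₀ (r₀ + δ),
      c ≤ |Ut x r (T - Real.exp (-s))|)
    (he1 : (x₀ + δ) + (r₀ + δ) ≤ Real.exp (-(s / 2)))
    (he2 : 2 * (L * ((x₀ + δ) + (r₀ + δ)) + β * M) ≤ Real.exp (-(s / 2)) ^ 2 * c) :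
    Real.exp (-(1 / 2)) * r₀ ^ a * (c / 2) ^ 2 * δ ^ 2 * (Real.exp (-(β * s)) ^ 2
      * Real.exp (-(s / 2)) ^ 2 / Real.exp (-(s / 2)) ^ a)
      ≤ (similarity β U Ux Ur Uxx Uxr Urr Ut V Vr T s).speedSq a β := by
  set e := Real.exp (-(s / 2)) with he
  set b := Real.exp (-(β * s)) with hb
  have he0 : 0 < e := Real.exp_pos _
  have hb0 : 0 < b := Real.exp_pos _
  have hL := h.nonneg_L
  have hs := h.snap hβ T s
  have key := le_wint_of_box a (h := fun x r =>
      ((similarity β U Ux Ur Uxx Uxr Urr Ut V Vr T s).G x r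
        - β * (similarity β U Ux Ur Uxx Uxr Urr Ut V Vr T s).w x r) ^ 2)
    ((hs.polyG.sub (hs.polyW.const_mul β)).pow 2) (fun x _ r _ => sq_nonneg _)
    (x₁ := x₀ / e) (x₂ := (x₀ + δ) / e) (r₁ := r₀ / e) (r₂ := (r₀ + δ) / e)
    (m := Real.exp (-(1 / 2)) * (r₀ / e) ^ a * (b * (e ^ 2 * (c / 2))) ^ 2)
    (by positivity) (by gcongr; linarith) (by positivity) (by gcongr; linarith) ?_
  · refine le_trans (le_of_eq ?_) key
    rw [← sub_div, ← sub_div, add_sub_cancel_left, add_sub_cancel_left]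
    field_simp
    rw [← mul_pow]
    congr 1
    field_simp
  · intro x hxI r hrI
    have hx1 := (div_le_iff₀ he0).1 hxI.1
    have hx2 := (le_div_iff₀ he0).1 hxI.2
    have hr1 := (div_le_iff₀ he0).1 hrI.1
    have hr2 := (le_div_iff₀ he0).1 hrI.2
    have hxp : 0 < x := (div_pos hx he0).trans_le hxI.1
    have hrp : 0 < r := (div_pos hr he0).trans_le hrI.1
    have hX : 0 < e * x := mul_pos he0 hxp
    have hR : 0 < e * r := mul_pos he0 hrp
    have k := exp_mul_pow_le_kap a (x := x) (r₁ := r₀ / e) (r := r) hxp.le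
      (hxI.2.trans ((div_le_one he0).2 (by linarith))) (by positivity) hrI.1
      (hrI.2.trans ((div_le_one he0).2 (by linarith)))
    refine mul_le_mul k ?_ (by positivity) (kap_pos a x hrp).le
    rw [← sq_abs (_ - _)]
    refine pow_le_pow_left₀ (by positivity) ?_ 2
    have bX := abs_le.1 (h.boundX _ hX _ hR (T - Real.exp (-s)))
    have bR := abs_le.1 (h.boundR _ hX _ hR (T - Real.exp (-s)))
    have bU := h.le _ hX _ hR (T - Real.exp (-s))
    have pU := h.pos _ hX _ hR (T - Real.exp (-s))
    have bT := hUt (e * x) ⟨by linarith, by linarith⟩ (e * r) ⟨by linarith, by linarith⟩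
    have eq : (similarity β U Ux Ur Uxx Uxr Urr Ut V Vr T s).G x r
        - β * (similarity β U Ux Ur Uxx Uxr Urr Ut V Vr T s).w x r
        = b * (e ^ 2 * Ut (e * x) (e * r) (T - Real.exp (-s))
          - ((e * x * Ux (e * x) (e * r) (T - Real.exp (-s))
          + e * r * Ur (e * x) (e * r) (T - Real.exp (-s))) / 2
          + β * U (e * x) (e * r) (T - Real.exp (-s)))) := by
      simp only [similarity]; ring
    rw [eq, abs_mul, abs_of_pos hb0]
    refine mul_le_mul_of_nonneg_left ?_ hb0.le
    have a1 : |(e * x * Ux (e * x) (e * r) (T - Real.exp (-s))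
          + e * r * Ur (e * x) (e * r) (T - Real.exp (-s))) / 2
          + β * U (e * x) (e * r) (T - Real.exp (-s))|
        ≤ L * ((x₀ + δ) + (r₀ + δ)) + β * M := by
      have b1 : |e * x * Ux (e * x) (e * r) (T - Real.exp (-s))| ≤ (x₀ + δ) * L := by
        rw [abs_mul, abs_of_pos hX]
        exact mul_le_mul (by linarith) (abs_le.2 bX) (abs_nonneg _) (by linarith)
      have b2 : |e * r * Ur (e * x) (e * r) (T - Real.exp (-s))| ≤ (r₀ + δ) * L := by
        rw [abs_mul, abs_of_pos hR]
        exact mul_le_mul (by linarith) (abs_le.2 bR) (abs_nonneg _) (by linarith)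
      have b3 := mul_le_mul_of_nonneg_left bU hβ0.le
      have b4 := mul_pos hβ0 pU
      have b5 : 0 ≤ L * ((x₀ + δ) + (r₀ + δ)) := by positivity
      rw [abs_le] at *
      constructor <;> linarith [b1.1, b1.2, b2.1, b2.2]
    have a2 := abs_sub_abs_le_abs_sub (e ^ 2 * Ut (e * x) (e * r) (T - Real.exp (-s)))
      ((e * x * Ux (e * x) (e * r) (T - Real.exp (-s))
          + e * r * Ur (e * x) (e * r) (T - Real.exp (-s))) / 2
          + β * U (e * x) (e * r) (T - Real.exp (-s)))
    have a3 : e ^ 2 * c ≤ |e ^ 2 * Ut (e * x) (e * r) (T - Real.exp (-s))| := by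
      rw [abs_mul, abs_of_pos (by positivity : 0 < e ^ 2)]
      gcongr
    linarith

theorem eventually_le_exp_atBot {γ : ℝ} (hγ : 0 < γ) (C : ℝ) :
    ∀ᶠ s in atBot, C ≤ Real.exp (-(γ * s)) := by
  have : Tendsto (fun s : ℝ => -(γ * s)) atBot atTop :=
    tendsto_neg_atBot_atTop.comp (tendsto_id.const_mul_atBot hγ)
  exact (Real.tendsto_exp_atTop.comp this).eventually_ge_atTop C

theorem exponent_pos (hq : 1 < q) (ha : a * q < a + 2) {β : ℝ} (hβ : β * q = β + 1 / 2) :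
    0 < 2 * β - a / 2 := by
  have h1 : 2 * β * (q - 1) = 1 := by linarith
  have h2 : (a : ℝ) / 2 * (q - 1) < 1 := by linarith
  by_contra hn
  nlinarith

/-- Solutions are steady. -/
theorem steady (h : RedSol a q M L U Ux Ur Uxx Uxr Urr Ut V Vr) (hq : 1 < q)
    (ha : a * q < a + 2) {β : ℝ} (hβ0 : 0 < β) (hβ : β * q = β + 1 / 2) {x₀ r₀ t₀ : ℝ}
    (hx : 0 < x₀) (hr : 0 < r₀) : Ut x₀ r₀ t₀ = 0 := by
  by_contra hne
  have hγ := exponent_pos hq ha hβ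
  set γ := 2 * β - a / 2
  obtain ⟨C, hC, hE⟩ := h.exists_universal_bound hq ha hβ0 hβ
  have ho : IsOpen quarterTime :=
    (isOpen_lt continuous_const continuous_fst).inter
      (isOpen_lt continuous_const (continuous_fst.comp continuous_snd))
  have hcont := (h.contT.continuousAt (x := (x₀, r₀, t₀)) (ho.mem_nhds ⟨hx, hr⟩)).abs
  have hc : 0 < |Ut x₀ r₀ t₀| / 2 := by positivity
  obtain ⟨ε, hε, hb⟩ := Metric.eventually_nhds_iff.1
    (hcont.eventually (lt_mem_nhds (half_lt_self (abs_pos.2 hne))))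
  set c := |Ut x₀ r₀ t₀| / 2
  set δ := ε / 2 with hδ'
  have hδ : 0 < δ := by positivity
  have hUt : ∀ x ∈ Icc x₀ (x₀ + δ), ∀ r ∈ Icc r₀ (r₀ + δ), ∀ t ∈ Icc t₀ (t₀ + δ),
      c ≤ |Ut x r t| := by
    intro x hx r hr t ht
    refine (hb (y := (x, r, t)) ?_).le
    simp only [Prod.dist_eq, Real.dist_eq, max_lt_iff]
    refine ⟨?_, ?_, ?_⟩ <;> rw [abs_lt] <;>
      constructor <;> linarith [hx.1, hx.2, hr.1, hr.2, ht.1, ht.2]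
  set κ := Real.exp (-(1 / 2)) * r₀ ^ a * (c / 2) ^ 2 * δ ^ 2
  have hκ : 0 < κ := by positivity
  set D := κ * δ * (Real.exp (-β) ^ 2 * Real.exp (-(1 / 2)) ^ 2)
  have hD : 0 < D := by positivity
  have c1 : ∀ᶠ s : ℝ in atBot, δ * Real.exp s ≤ 1 := by
    filter_upwards [eventually_le_exp_atBot one_pos δ] with s hs
    rw [one_mul] at hs
    calc δ * Real.exp s ≤ Real.exp (-s) * Real.exp s := by gcongr
      _ = 1 := by rw [← Real.exp_add]; simp
  set A := Real.exp (1 / 2) * (((x₀ + δ) + (r₀ + δ)) + 1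
    + 2 * (L * ((x₀ + δ) + (r₀ + δ)) + β * M) / c)
  obtain ⟨s₀, h1, h2, h3⟩ := (c1.and ((eventually_le_exp_atBot (γ := 1 / 2) (by norm_num)
    A).and (eventually_le_exp_atBot hγ ((C + 1) / D)))).exists
  have hL := h.nonneg_L
  have hM := h.nonneg_M
  have hK : 0 ≤ L * ((x₀ + δ) + (r₀ + δ)) + β * M := by positivity
  have hlow : ∀ s ∈ Icc s₀ (s₀ + δ * Real.exp s₀),
      ((x₀ + δ) + (r₀ + δ)) + 1 + 2 * (L * ((x₀ + δ) + (r₀ + δ)) + β * M) / c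
        ≤ Real.exp (-(s / 2)) := by
    intro s hs
    have : Real.exp (1 / 2) * Real.exp (-(s / 2)) ≥ Real.exp (-(1 / 2 * s₀)) := by
      rw [← Real.exp_add]
      exact Real.exp_le_exp.2 (by linarith [hs.2])
    exact le_of_mul_le_mul_left (h2.trans this) (Real.exp_pos _)
  obtain ⟨E, dE, bE, -, -⟩ := hE (t₀ + Real.exp (-s₀))
  have hP : ∀ s ∈ Icc s₀ (s₀ + δ * Real.exp s₀),
      -(similarity β U Ux Ur Uxx Uxr Urr Ut V Vr (t₀ + Real.exp (-s₀)) s).speedSq a β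
        ≤ -(D / δ * (Real.exp (-(γ * s₀)) * Real.exp (-s₀))) := by
    intro s hs
    have hl := hlow s hs
    have hdiv : 0 ≤ 2 * (L * ((x₀ + δ) + (r₀ + δ)) + β * M) / c := by positivity
    have hsp := h.speedSq_ge hβ0 hβ hx hr hδ hc (T := t₀ + Real.exp (-s₀)) (s := s) ?_
      (by linarith) ?_
    · refine neg_le_neg (le_trans ?_ hsp)
      have : D / δ * (Real.exp (-(γ * s₀)) * Real.exp (-s₀))
          = κ * ((Real.exp (-(β * (s₀ + 1)))) ^ 2 * Real.exp (-((s₀ + 1) / 2)) ^ 2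
            / Real.exp (-(s₀ / 2)) ^ a) := by
        simp only [D, γ]
        rw [mul_right_comm, mul_div_assoc, div_self hδ.ne', mul_one, mul_assoc]
        congr 1
        rw [eq_div_iff (by positivity)]
        simp only [← Real.exp_nat_mul, ← Real.exp_add]
        congr 1
        push_cast
        ring
      rw [this]
      have hs2 := hs.2
      gcongr
      · linarith
      · linarith
      · linarith [hs.1]
    · intro x hx r hr
      refine hUt x hx r hr _ ⟨?_, ?_⟩
      · have : Real.exp (-s) ≤ Real.exp (-s₀) := Real.exp_le_exp.2 (by linarith [hs.1])
        linarith
      · have e1 : Real.exp (-s) = Real.exp (-s₀) * Real.exp (-(s - s₀)) := by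
          rw [← Real.exp_add]; ring_nf
        have e2 := Real.add_one_le_exp (-(s - s₀))
        have e3 : Real.exp (-s₀) * (1 - (s - s₀)) ≤ Real.exp (-s) := by
          rw [e1]; gcongr; linarith
        have e4 : Real.exp (-s₀) * (s - s₀) ≤ Real.exp (-s₀) * (δ * Real.exp s₀) := by
          gcongr; linarith [hs.2]
        have e5 : Real.exp (-s₀) * (δ * Real.exp s₀) = δ := by
          rw [mul_left_comm, ← Real.exp_add]; simp
        linarith
    · have := (div_le_iff₀ hc).1 (show 2 * (L * ((x₀ + δ) + (r₀ + δ)) + β * M) / c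
        ≤ Real.exp (-(s / 2)) by linarith)
      refine this.trans ?_
      have h1 : 1 ≤ Real.exp (-(s / 2)) := by linarith
      gcongr
      nlinarith
  have := sub_le_of_deriv_le (by have := Real.exp_pos s₀; nlinarith) (fun s => dE s) hP
  have e5 : Real.exp (-s₀) * (δ * Real.exp s₀) = δ := by
    rw [mul_left_comm, ← Real.exp_add]; simp
  have e6 : -(D / δ * (Real.exp (-(γ * s₀)) * Real.exp (-s₀))) * (s₀ + δ * Real.exp s₀ - s₀)
      = -(D * Real.exp (-(γ * s₀))) := by
    have : D / δ * δ = D := div_mul_cancel₀ _ hδ.ne'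
    linear_combination -(D / δ * Real.exp (-(γ * s₀))) * e5 - Real.exp (-(γ * s₀)) * this
  have e7 := (div_le_iff₀ hD).1 h3
  linarith [(bE s₀).2, (bE (s₀ + δ * Real.exp s₀)).1]

/-- The nonexistence of axially symmetric solutions. -/
theorem not_exists (h : RedSol a q M L U Ux Ur Uxx Uxr Urr Ut V Vr) (hq : 1 < q)
    (ha : a * q < a + 2) : False := by
  obtain ⟨β, hβ0, hβ⟩ : ∃ β : ℝ, 0 < β ∧ β * q = β + 1 / 2 := by
    have : q - 1 ≠ 0 := by linarith
    refine ⟨1 / (2 * (q - 1)), div_pos one_pos (by linarith), ?_⟩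
    field_simp
    ring
  have hγ := exponent_pos hq ha hβ
  set γ := 2 * β - a / 2
  obtain ⟨C, hC, hE⟩ := h.exists_universal_bound hq ha hβ0 hβ
  have hU : ∀ x, 0 < x → ∀ r, 0 < r → ∀ t t', U x r t = U x r t' := by
    intro x hx r hr
    have : ∀ t, HasDerivAt (fun t => U x r t) 0 t := fun t => by
      refine (h.chain (fun _ => x) (fun _ => r) id 0 0 1 t hx hr (hasDerivAt_const _ _)
        (hasDerivAt_const _ _) (hasDerivAt_id t)).congr_deriv ?_
      have : Ut x r (id t) = 0 := h.steady hq ha hβ0 hβ hx hr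
      rw [this]; ring
    exact is_const_of_deriv_eq_zero (fun t => (this t).differentiableAt) fun t => (this t).deriv
  have hV : ∀ r, 0 < r → ∀ t, V r t = V r 0 := fun r hr t =>
    tendsto_nhds_unique ((h.limU r hr t).congr' (by
      filter_upwards [self_mem_nhdsWithin] with x hx using hU x hx r hr t 0)) (h.limU r hr 0)
  obtain ⟨m, hm, hVm⟩ : ∃ m, 0 < m ∧ ∀ r ∈ Icc (1 : ℝ) 2, m ≤ V r 0 := by
    obtain ⟨r, hr, hmin⟩ := isCompact_Icc.exists_isMinOn (nonempty_Icc.2 (one_le_two (α := ℝ)))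
      (f := fun r => V r 0) fun r hr =>
        (h.derivV r (by linarith [hr.1]) 0).continuousAt.continuousWithinAt
    exact ⟨V r 0, h.pos0 r (by linarith [hr.1]) 0, fun r' hr' => hmin hr'⟩
  obtain ⟨E, -, -, hcf, hf⟩ := hE 0
  have hlow : ∀ s ≤ -2, Real.exp (-(1 / 4)) * m ^ (q + 1) * Real.exp (-(γ * s))
      ≤ (similarity β U Ux Ur Uxx Uxr Urr Ut V Vr 0 s).bdry a (q + 1) := by
    intro s hs
    have hsn := h.snap hβ 0 s
    have he0 := Real.exp_pos (-(s / 2))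
    have he2 : 2 ≤ Real.exp (-(s / 2)) := by
      linarith [Real.add_one_le_exp (-(s / 2))]
    refine le_trans (le_of_eq ?_) (le_bint_of_Icc a
      (h := fun r => (similarity β U Ux Ur Uxx Uxr Urr Ut V Vr 0 s).w0 r ^ (q + 1))
      (hsn.polyPow (by linarith))
      (fun r hr => (Real.rpow_pos_of_pos (hsn.pos0 r hr) _).le) (r₁ := 1 / Real.exp (-(s / 2)))
      (r₂ := 2 / Real.exp (-(s / 2)))
      (m := Real.exp (-(1 / 4)) * (1 / Real.exp (-(s / 2))) ^ a
        * (Real.exp (-(β * s)) * m) ^ (q + 1))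
      (by positivity) (by gcongr; norm_num) ?_)
    · rw [Real.mul_rpow (Real.exp_pos _).le hm.le, ← Real.exp_mul, div_sub_div_same, one_div_pow]
      have : Real.exp (-(γ * s)) * (Real.exp (-(s / 2)) ^ a * Real.exp (-(s / 2)))
          = Real.exp (-(β * s) * (q + 1)) := by
        rw [← Real.exp_nat_mul, ← Real.exp_add, ← Real.exp_add]
        congr 1
        simp only [γ]
        linear_combination s * hβ
      rw [← this]
      field_simp
      norm_num
    · intro r hr
      have hr0 : 0 < r := (div_pos one_pos he0).trans_le hr.1
      have h1 := (div_le_iff₀ he0).1 hr.1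
      have h2 := (le_div_iff₀ he0).1 hr.2
      refine mul_le_mul (exp_mul_pow_le_kap0 a (by positivity) hr.1
        (hr.2.trans ((div_le_one he0).2 he2))) ?_ (by positivity) (kap0_pos a hr0).le
      refine Real.rpow_le_rpow (by positivity) ?_ (by linarith)
      refine mul_le_mul_of_nonneg_left ?_ (Real.exp_pos _).le
      rw [hV _ (mul_pos he0 hr0)]
      exact hVm _ ⟨by linarith, by linarith⟩
  set κ := Real.exp (-(1 / 4)) * m ^ (q + 1)
  have hκ : 0 < κ := by positivity
  obtain ⟨σ, h1, h2⟩ := ((eventually_le_atBot (-3 : ℝ)).and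
    (eventually_le_exp_atBot hγ ((C + 1) / (κ * Real.exp (-γ))))).exists
  have e7 := (div_le_iff₀ (by positivity)).1 h2
  have hi : κ * Real.exp (-γ) * Real.exp (-(γ * σ)) ≤ ∫ t in σ..(σ + 1),
      (similarity β U Ux Ur Uxx Uxr Urr Ut V Vr 0 t).bdry a (q + 1) := by
    have := intervalIntegral.integral_mono_on (by linarith : σ ≤ σ + 1)
      (_root_.intervalIntegrable_const (μ := volume) (c := κ * Real.exp (-γ) * Real.exp (-(γ * σ))))
      (hcf.intervalIntegrable σ (σ + 1)) (fun t ht => by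
        refine le_trans ?_ (hlow t (by linarith [ht.2]))
        rw [mul_assoc, ← Real.exp_add]
        gcongr
        nlinarith [ht.2])
    simpa using this
  linarith [hf σ]

end RedSol

/-- Translation by `τ` in the `i`-th coordinate direction. -/
def slide {N : ℕ} (i : Fin N) (τ : ℝ) (x : Fin N → ℝ) : Fin N → ℝ := x + Pi.single i τ

section slide

variable {N : ℕ}

@[simp] theorem slide_self (i : Fin N) (τ : ℝ) (x : Fin N → ℝ) : slide i τ x i = x i + τ := by
  simp [slide]

theorem slide_ne {i k : Fin N} (h : k ≠ i) (τ : ℝ) (x : Fin N → ℝ) : slide i τ x k = x k := by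
  simp [slide, h]

theorem slide_apply (i k : Fin N) (τ : ℝ) (x : Fin N → ℝ) :
    slide i τ x k = x k + if k = i then τ else 0 := by
  by_cases h : k = i
  · subst h; simp
  · simp [slide_ne h, h]

@[simp] theorem slide_zero (i : Fin N) (x : Fin N → ℝ) : slide i 0 x = x := by simp [slide]

theorem slide_slide (i : Fin N) (σ τ : ℝ) (x : Fin N → ℝ) :
    slide i σ (slide i τ x) = slide i (τ + σ) x := by
  simp only [slide, Pi.single_add]; abel

theorem slide_comm (i k : Fin N) (σ τ : ℝ) (x : Fin N → ℝ) :
    slide i σ (slide k τ x) = slide k τ (slide i σ x) := by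
  simp only [slide]; abel

theorem Continuous.slide {P : Type*} [TopologicalSpace P] (i : Fin N) {f : P → ℝ}
    {g : P → Fin N → ℝ} (hf : Continuous f) (hg : Continuous g) :
    Continuous fun p => slide i (f p) (g p) := by
  refine hg.add (continuous_pi fun k => ?_)
  by_cases h : k = i
  · subst h; simpa using hf
  · simpa [h] using continuous_const

/-- The squared Euclidean distance of `x` from `y`. -/
def sqDist (y x : Fin N → ℝ) : ℝ := ∑ k, (x k - y k) ^ 2

theorem sqDist_slide (i : Fin N) (τ : ℝ) (y x : Fin N → ℝ) :
    sqDist y (slide i τ x) = sqDist y x + 2 * (x i - y i) * τ + τ ^ 2 := by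
  have : ∀ k, (slide i τ x k - y k) ^ 2
      = (x k - y k) ^ 2 + if k = i then 2 * (x i - y i) * τ + τ ^ 2 else 0 := fun k => by
    by_cases h : k = i
    · subst h; simp; ring
    · simp [slide_ne h, h]
  simp only [sqDist, this, Finset.sum_add_distrib, Finset.sum_ite_eq', Finset.mem_univ, if_true]
  ring

theorem sqDist_nonneg (y x : Fin N → ℝ) : 0 ≤ sqDist y x :=
  Finset.sum_nonneg fun _ _ => sq_nonneg _

@[simp] theorem sqDist_self (y : Fin N → ℝ) : sqDist y y = 0 := by simp [sqDist]

theorem sq_le_sqDist (k : Fin N) (y x : Fin N → ℝ) : (x k - y k) ^ 2 ≤ sqDist y x :=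
  Finset.single_le_sum (f := fun k => (x k - y k) ^ 2) (fun _ _ => sq_nonneg _)
    (Finset.mem_univ k)

theorem continuous_sqDist (y : Fin N → ℝ) : Continuous (sqDist y) := by
  unfold sqDist; fun_prop

end slide

/-- `g` is differentiable near `0` and its derivative has derivative `c` at `0`. -/
def HasD2 (g : ℝ → ℝ) (c : ℝ) : Prop :=
  ∃ g' : ℝ → ℝ, (∀ᶠ τ in 𝓝 0, HasDerivAt g (g' τ) τ) ∧ HasDerivAt g' c 0

namespace HasD2

variable {g h : ℝ → ℝ} {c e : ℝ}

theorem sub (hg : HasD2 g c) (hh : HasD2 h e) : HasD2 (fun τ => g τ - h τ) (c - e) := by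
  obtain ⟨g', hg1, hg2⟩ := hg
  obtain ⟨h', hh1, hh2⟩ := hh
  refine ⟨fun τ => g' τ - h' τ, ?_, hg2.sub hh2⟩
  filter_upwards [hg1, hh1] with τ h1 h2 using h1.sub h2

theorem const_mul (a : ℝ) (hg : HasD2 g c) : HasD2 (fun τ => a * g τ) (a * c) := by
  obtain ⟨g', hg1, hg2⟩ := hg
  refine ⟨fun τ => a * g' τ, ?_, hg2.const_mul a⟩
  filter_upwards [hg1] with τ h1 using h1.const_mul a

theorem comp_neg (hg : HasD2 g c) : HasD2 (fun τ => g (-τ)) c := by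
  obtain ⟨g', hg1, hg2⟩ := hg
  refine ⟨fun τ => -g' (-τ), ?_, ?_⟩
  · have : Tendsto (fun τ : ℝ => -τ) (𝓝 0) (𝓝 0) := by simpa using (continuous_neg.tendsto (0 : ℝ))
    filter_upwards [this.eventually hg1] with τ h1
    refine (h1.comp τ (hasDerivAt_neg τ)).congr_deriv ?_
    simp
  · have h0 : HasDerivAt g' c (-0) := by simpa using hg2
    refine (h0.comp (0 : ℝ) (hasDerivAt_neg 0)).neg.congr_deriv ?_
    simp

theorem quadratic (A b c : ℝ) : HasD2 (fun τ => A + b * τ + c * τ ^ 2) (2 * c) := by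
  refine ⟨fun τ => b + 2 * c * τ, Eventually.of_forall fun τ => ?_, ?_⟩
  · have := (((hasDerivAt_id τ).const_mul b).const_add A).add (((hasDerivAt_id τ).pow 2).const_mul c)
    refine this.congr_deriv ?_
    simp; ring
  · simpa using ((hasDerivAt_id (0 : ℝ)).const_mul (2 * c)).const_add b

theorem nonpos_of_isLocalMax (hg : HasD2 g c) (hm : IsLocalMax g 0) : c ≤ 0 := by
  obtain ⟨g', hg1, hg2⟩ := hg
  by_contra! hc
  have h0 : g' 0 = 0 := hm.hasDerivAt_eq_zero hg1.self_of_nhds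
  have hpos : ∀ᶠ τ in 𝓝[>] (0 : ℝ), 0 < g' τ := by
    have := (hasDerivAt_iff_tendsto_slope.1 hg2).mono_left
      (nhdsWithin_mono 0 (fun x (hx : 0 < x) => (hx.ne' : x ≠ 0)))
    filter_upwards [this.eventually (lt_mem_nhds hc), self_mem_nhdsWithin] with τ h1 h2
    rw [slope_def_field, h0, sub_zero, sub_zero] at h1
    exact (div_pos_iff_of_pos_right h2).1 h1
  obtain ⟨δ, hδ, hs⟩ := Metric.eventually_nhds_iff.1 (hg1.and hm)
  obtain ⟨δ', hδ', hs'⟩ := (mem_nhdsGT_iff_exists_Ioo_subset).1 hpos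
  have hδ'0 : (0 : ℝ) < δ' := hδ'
  set m := min δ δ' / 2 with hm'
  have hm0 : 0 < m := by have := lt_min hδ hδ'0; positivity
  have hmδ : m < δ := by have := min_le_left δ δ'; linarith [lt_min hδ hδ'0]
  have hmδ' : m < δ' := by have := min_le_right δ δ'; linarith [lt_min hδ hδ'0]
  have hd : ∀ τ ∈ Icc 0 m, HasDerivAt g (g' τ) τ := fun τ h =>
    (hs (by rw [Real.dist_eq, sub_zero, abs_of_nonneg h.1]; linarith [h.2])).1
  have : StrictMonoOn g (Icc 0 m) := by
    refine strictMonoOn_of_deriv_pos (convex_Icc 0 m)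
      (fun τ h => (hd τ h).continuousAt.continuousWithinAt) fun τ h => ?_
    rw [interior_Icc] at h
    rw [(hd τ ⟨h.1.le, h.2.le⟩).deriv]
    exact hs' ⟨h.1, h.2.trans hmδ'⟩
  have h1 := this ⟨le_rfl, hm0.le⟩ ⟨hm0.le, le_rfl⟩ hm0
  have h2 := (hs (y := m) (by rw [Real.dist_eq, sub_zero, abs_of_pos hm0]; exact hmδ)).2
  linarith

end HasD2

theorem nonneg_of_le_left {g : ℝ → ℝ} {c : ℝ} (hg : HasDerivAt g c 0)
    (h : ∀ᶠ τ in 𝓝[<] (0 : ℝ), g τ ≤ g 0) : 0 ≤ c := by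
  have hs : Tendsto (slope g 0) (𝓝[<] 0) (𝓝 c) := (hasDerivAt_iff_tendsto_slope.1 hg).mono_left
    (nhdsWithin_mono 0 (fun x (hx : x < 0) => (hx.ne : x ≠ 0)))
  refine ge_of_tendsto hs ?_
  filter_upwards [h, self_mem_nhdsWithin] with τ h1 h2
  rw [slope_def_field]
  exact div_nonneg_of_nonpos (by linarith) (by simpa using (mem_Iio.1 h2).le)

theorem nonpos_of_le_right {g : ℝ → ℝ} {c : ℝ} (hg : HasDerivWithinAt g c (Ici 0) 0)
    (h : ∀ᶠ τ in 𝓝[>] (0 : ℝ), g τ ≤ g 0) : c ≤ 0 := by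
  have := hasDerivWithinAt_iff_tendsto_slope.1 hg
  rw [Ici_sdiff_left] at this
  refine le_of_tendsto this ?_
  filter_upwards [h, self_mem_nhdsWithin] with τ h1 h2
  rw [slope_def_field]
  exact div_nonpos_of_nonpos_of_nonneg (by linarith) (by simpa using (mem_Ioi.1 h2).le)

theorem le_zero_of_not_isMaxOn {P : Type*} [TopologicalSpace P] {K : Set P} {F : P → ℝ}
    (hK : IsCompact K) (hF : ContinuousOn F K)
    (h : ∀ p ∈ K, 0 < F p → ¬IsMaxOn F K p) : ∀ p ∈ K, F p ≤ 0 := by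
  intro p hp
  obtain ⟨m, hm, hmax⟩ := hK.exists_isMaxOn ⟨p, hp⟩ hF
  by_contra! hlt
  exact h m hm (hlt.trans_le (hmax hp)) hmax

theorem not_isMaxOn_of_lt_sum {P ι : Type*} [Fintype ι] {K : Set P} {F : P → ℝ} {p : P}
    {γ : ι → ℝ → P} {c : ι → ℝ} {θ : ℝ → P} {e : ℝ}
    (hγ0 : ∀ i, γ i 0 = p) (hγ : ∀ i, ∀ᶠ τ in 𝓝 0, γ i τ ∈ K)
    (hc : ∀ i, HasD2 (fun τ => F (γ i τ)) (c i)) (hθ0 : θ 0 = p)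
    (hθ : ∀ᶠ τ in 𝓝[<] 0, θ τ ∈ K) (he : HasDerivAt (fun τ => F (θ τ)) e 0)
    (hlt : e < ∑ i, c i) : ¬IsMaxOn F K p := by
  intro hmax
  have h1 : ∀ i, c i ≤ 0 := fun i => (hc i).nonpos_of_isLocalMax (by
    filter_upwards [hγ i] with τ hτ
    rw [hγ0]; exact hmax hτ)
  have h2 : 0 ≤ e := nonneg_of_le_left he (by
    filter_upwards [hθ] with τ hτ
    rw [hθ0]; exact hmax hτ)
  linarith [Finset.sum_nonpos fun i (_ : i ∈ Finset.univ) => h1 i]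

theorem not_isMaxOn_of_pos_deriv {P : Type*} {K : Set P} {F : P → ℝ} {p : P} {θ : ℝ → P} {e : ℝ}
    (hθ0 : θ 0 = p) (hθ : ∀ᶠ τ in 𝓝[>] 0, θ τ ∈ K)
    (he : HasDerivWithinAt (fun τ => F (θ τ)) e (Ici 0) 0) (hpos : 0 < e) : ¬IsMaxOn F K p := by
  intro hmax
  refine hpos.not_ge (nonpos_of_le_right he ?_)
  filter_upwards [hθ] with τ hτ
  rw [hθ0]; exact hmax hτ

/-- Classical solutions of the heat equation in the half-space `0 < x 0`. -/
def Caloric {d : ℕ} (z : (Fin (d + 1) → ℝ) → ℝ → ℝ) : Prop :=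
  ∀ x, 0 < x 0 → ∀ t, ∃ c : Fin (d + 1) → ℝ,
    (∀ i, HasD2 (fun τ => z (slide i τ x) t) (c i)) ∧ HasDerivAt (z x) (∑ i, c i) t

namespace Caloric

variable {d : ℕ} {z w : (Fin (d + 1) → ℝ) → ℝ → ℝ}

theorem sub (hz : Caloric z) (hw : Caloric w) : Caloric fun x t => z x t - w x t := by
  intro x hx t
  obtain ⟨c, h1, h2⟩ := hz x hx t
  obtain ⟨e, h3, h4⟩ := hw x hx t
  refine ⟨fun i => c i - e i, fun i => (h1 i).sub (h3 i), ?_⟩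
  rw [Finset.sum_sub_distrib]
  exact h2.sub h4

theorem const_mul (a : ℝ) (hz : Caloric z) : Caloric fun x t => a * z x t := by
  intro x hx t
  obtain ⟨c, h1, h2⟩ := hz x hx t
  refine ⟨fun i => a * c i, fun i => (h1 i).const_mul a, ?_⟩
  rw [← Finset.mul_sum]
  exact h2.const_mul a

theorem slide (j : Fin (d + 1)) {h : ℝ} (hh : 0 ≤ h) (hz : Caloric z) :
    Caloric fun x t => z (slide j h x) t := by
  intro x hx t
  obtain ⟨c, h1, h2⟩ := hz (_root_.slide j h x) (by
    rw [slide_apply]; split_ifs <;> linarith) t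
  exact ⟨c, fun i => by simpa only [slide_comm j i] using h1 i, h2⟩

theorem delay (h : ℝ) (hz : Caloric z) : Caloric fun x t => z x (t + h) := by
  intro x hx t
  obtain ⟨c, h1, h2⟩ := hz x hx (t + h)
  exact ⟨c, h1, h2.comp_add_const t h⟩

end Caloric

section twoPoint

variable {d : ℕ}

/-- Triples `(x, ξ, t)` near `(x₀, 0, t₀)` for which `x` stays in the half-space after moving by
`ξ`. -/
def twoPointBox (y : Fin (d + 1) → ℝ) (s R : ℝ) : Set ((Fin (d + 1) → ℝ) × ℝ × ℝ) :=
  {p | (∀ i, |p.1 i - y i| ≤ R) ∧ 0 ≤ p.2.1 ∧ p.2.1 ≤ R ∧ p.2.1 ≤ p.1 0 ∧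
    s - R ^ 2 ≤ p.2.2 ∧ p.2.2 ≤ s}

/-- The relative interior of `twoPointBox`. -/
def twoPointCore (y : Fin (d + 1) → ℝ) (s R : ℝ) : Set ((Fin (d + 1) → ℝ) × ℝ × ℝ) :=
  {p | (∀ i, |p.1 i - y i| < R) ∧ 0 < p.2.1 ∧ p.2.1 < R ∧ s - R ^ 2 < p.2.2}

/-- The difference of `z` at two points symmetric about `x`, minus a barrier. -/
def twoPoint (z : (Fin (d + 1) → ℝ) → ℝ → ℝ) (j : Fin (d + 1)) (y : Fin (d + 1) → ℝ)
    (s α B : ℝ) (p : (Fin (d + 1) → ℝ) × ℝ × ℝ) : ℝ :=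
  z (slide j p.2.1 p.1) p.2.2 - z (slide j (-p.2.1) p.1) p.2.2
    - (α * p.2.1 - B * (d + 1) * p.2.1 ^ 2 + B * (s - p.2.2) + B * sqDist y p.1)

theorem isCompact_twoPointBox (y : Fin (d + 1) → ℝ) (s R : ℝ) :
    IsCompact (twoPointBox y s R) := by
  refine ((isCompact_Icc (a := fun i => y i - R) (b := fun i => y i + R)).prod
    ((isCompact_Icc (a := (0 : ℝ)) (b := R)).prod
      (isCompact_Icc (a := s - R ^ 2) (b := s)))).of_isClosed_subset ?_ ?_
  · simp only [twoPointBox, ofPred_and, ofPred_forall]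
    refine (isClosed_iInter fun i => isClosed_le (by fun_prop) (by fun_prop)).inter
      ((isClosed_le (by fun_prop) (by fun_prop)).inter
      ((isClosed_le (by fun_prop) (by fun_prop)).inter
      ((isClosed_le (by fun_prop) (by fun_prop)).inter
      ((isClosed_le (by fun_prop) (by fun_prop)).inter
        (isClosed_le (by fun_prop) (by fun_prop))))))
  · rintro p ⟨h1, h2, h3, -, h5, h6⟩
    refine ⟨⟨fun i => ?_, fun i => ?_⟩, ⟨h2, h3⟩, ⟨h5, h6⟩⟩
    · have := (abs_le.1 (h1 i)).1; dsimp only; linarith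
    · have := (abs_le.1 (h1 i)).2; dsimp only; linarith

theorem isOpen_twoPointCore (y : Fin (d + 1) → ℝ) (s R : ℝ) : IsOpen (twoPointCore y s R) := by
  simp only [twoPointCore, ofPred_and, ofPred_forall]
  exact (isOpen_iInter_of_finite fun i => isOpen_lt (by fun_prop) (by fun_prop)).inter
    ((isOpen_lt (by fun_prop) (by fun_prop)).inter
    ((isOpen_lt (by fun_prop) (by fun_prop)).inter
    (isOpen_lt (by fun_prop) (by fun_prop))))

theorem slide_nonneg {j : Fin (d + 1)} {ξ : ℝ} {x : Fin (d + 1) → ℝ} (h0 : 0 ≤ ξ)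
    (h : ξ ≤ x 0) : 0 ≤ slide j ξ x 0 ∧ 0 ≤ slide j (-ξ) x 0 := by
  rw [slide_apply, slide_apply]
  split_ifs <;> constructor <;> linarith

theorem slide_pos {j : Fin (d + 1)} {ξ : ℝ} {x : Fin (d + 1) → ℝ} (h0 : 0 ≤ ξ)
    (h : ξ < x 0) : 0 < slide j ξ x 0 ∧ 0 < slide j (-ξ) x 0 := by
  rw [slide_apply, slide_apply]
  split_ifs <;> constructor <;> linarith

variable {z : (Fin (d + 1) → ℝ) → ℝ → ℝ} {j : Fin (d + 1)} {y : Fin (d + 1) → ℝ}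
  {s R S B α : ℝ}

theorem continuousOn_twoPoint
    (hc : ContinuousOn (fun p : (Fin (d + 1) → ℝ) × ℝ => z p.1 p.2) {p | 0 ≤ p.1 0}) :
    ContinuousOn (twoPoint z j y s α B) (twoPointBox y s R) := by
  have hq := continuous_sqDist y
  have h1 : Continuous fun p : (Fin (d + 1) → ℝ) × ℝ × ℝ => (slide j p.2.1 p.1, p.2.2) :=
    (Continuous.slide j (by fun_prop) continuous_fst).prodMk (by fun_prop)
  have h2 : Continuous fun p : (Fin (d + 1) → ℝ) × ℝ × ℝ => (slide j (-p.2.1) p.1, p.2.2) :=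
    (Continuous.slide j (by fun_prop) continuous_fst).prodMk (by fun_prop)
  refine ((hc.comp h1.continuousOn fun p hp => ?_).sub
    (hc.comp h2.continuousOn fun p hp => ?_)).sub (Continuous.continuousOn (by fun_prop))
  · exact (slide_nonneg hp.2.1 hp.2.2.2.1).1
  · exact (slide_nonneg hp.2.1 hp.2.2.2.1).2

theorem not_isMaxOn_twoPoint (hz : Caloric z) (hB : 0 < B)
    {p : (Fin (d + 1) → ℝ) × ℝ × ℝ} (hp : p ∈ twoPointCore y s R) (hx : p.2.1 < p.1 0)
    (hs : p.2.2 ≤ s) : ¬IsMaxOn (twoPoint z j y s α B) (twoPointBox y s R) p := by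
  obtain ⟨x, ξ, t⟩ := p
  have hξ : 0 < ξ := hp.2.1
  dsimp only at hx hs
  obtain ⟨c, hc, hct⟩ := hz _ (slide_pos (j := j) hξ.le hx).1 t
  obtain ⟨e, he, het⟩ := hz _ (slide_pos (j := j) hξ.le hx).2 t
  have hO : IsOpen (twoPointCore y s R ∩ {p | p.2.1 < p.1 0}) :=
    (isOpen_twoPointCore y s R).inter (isOpen_lt (by fun_prop) (by fun_prop))
  have hev : ∀ {γ : ℝ → (Fin (d + 1) → ℝ) × ℝ × ℝ}, Continuous γ → γ 0 = (x, ξ, t) →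
      ∀ᶠ τ in 𝓝 0, (γ τ).2.2 ≤ s → γ τ ∈ twoPointBox y s R := fun {γ} hγ h0 => by
    filter_upwards [hγ.continuousAt.preimage_mem_nhds (hO.mem_nhds (by rw [h0]; exact ⟨hp, hx⟩))]
      with τ hτ hle
    exact ⟨fun i => (hτ.1.1 i).le, hτ.1.2.1.le, hτ.1.2.2.1.le, hτ.2.le, hτ.1.2.2.2.le, hle⟩
  refine not_isMaxOn_of_lt_sum
    (γ := fun i τ => if i = j then (x, ξ + τ, t) else (slide i τ x, ξ, t))
    (c := fun i => c i - e i - 2 * B + if i = j then 2 * B + 2 * (B * (d + 1)) else 0)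
    (θ := fun τ => (x, ξ, t + τ)) (e := (∑ i, c i) - (∑ i, e i) + B)
    (fun i => by split_ifs <;> simp) (fun i => ?_) (fun i => ?_) (by simp) ?_ ?_ ?_
  · by_cases h : i = j
    · simp only [h, if_true]
      filter_upwards [hev (γ := fun τ => (x, ξ + τ, t)) (by fun_prop) (by simp)] with τ hτ
      exact hτ hs
    · simp only [h, if_false]
      filter_upwards [hev (γ := fun τ => (slide i τ x, ξ, t))
        ((Continuous.slide i continuous_id continuous_const).prodMk continuous_const)
        (by simp)] with τ hτ
      exact hτ hs
  · by_cases h : i = j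
    · subst h
      simp only [if_true, twoPoint]
      have h3 := HasD2.quadratic (α * ξ - B * (d + 1) * ξ ^ 2 + B * (s - t) + B * sqDist y x)
        (α - 2 * B * (d + 1) * ξ) (-(B * (d + 1)))
      convert (((hc i).sub (he i).comp_neg).sub h3) using 1
      · funext τ
        rw [slide_slide, slide_slide, neg_add]
        ring
      · ring
    · simp only [h, if_false, twoPoint]
      have h3 := HasD2.quadratic (α * ξ - B * (d + 1) * ξ ^ 2 + B * (s - t) + B * sqDist y x)
        (B * (2 * (x i - y i))) B
      convert (((hc i).sub (he i)).sub h3) using 1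
      · funext τ
        rw [slide_comm j i, slide_comm j i, sqDist_slide]
        ring
      · ring
  · have := hev (γ := fun τ => (x, ξ, t + τ)) (by fun_prop) (by simp)
    filter_upwards [this.filter_mono nhdsWithin_le_nhds, self_mem_nhdsWithin] with τ h1 h2
    exact h1 (by have := mem_Iio.1 h2; linarith)
  · simp only [twoPoint]
    have h1 : HasDerivAt (fun τ => z (slide j ξ x) (t + τ)) (∑ i, c i) 0 :=
      HasDerivAt.comp_const_add t 0 (by simpa using hct)
    have h2 : HasDerivAt (fun τ => z (slide j (-ξ) x) (t + τ)) (∑ i, e i) 0 :=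
      HasDerivAt.comp_const_add t 0 (by simpa using het)
    have h3 : HasDerivAt (fun τ => α * ξ - B * (d + 1) * ξ ^ 2 + B * (s - (t + τ)) +
        B * sqDist y x) (-B) 0 := by
      refine ((((((hasDerivAt_id (0 : ℝ)).const_add t).const_sub s).const_mul B).const_add _).add_const
        _).congr_deriv ?_
      ring
    exact ((h1.sub h2).sub h3).congr_deriv (by ring)
  · simp only [Finset.sum_add_distrib, Finset.sum_sub_distrib, Finset.sum_ite_eq',
      Finset.mem_univ, if_true, Finset.sum_const, Finset.card_univ, Fintype.card_fin, nsmul_eq_mul]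
    push_cast
    linarith

theorem twoPoint_nonpos (hz : Caloric z)
    (hc : ContinuousOn (fun p : (Fin (d + 1) → ℝ) × ℝ => z p.1 p.2) {p | 0 ≤ p.1 0})
    (hS : ∀ x, 0 ≤ x 0 → ∀ t, |z x t| ≤ S) (hR : 0 < R) (hB : 0 < B)
    (hBS : 2 * S ≤ B * R ^ 2) (hα : 2 * (B * (d + 1)) * R ≤ α)
    (hob : ∀ p ∈ twoPointBox y s R, p ∈ twoPointCore y s R → p.2.1 = p.1 0 →
      ¬IsMaxOn (twoPoint z j y s α B) (twoPointBox y s R) p) :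
    ∀ p ∈ twoPointBox y s R, twoPoint z j y s α B p ≤ 0 := by
  refine le_zero_of_not_isMaxOn (isCompact_twoPointBox y s R) (continuousOn_twoPoint hc) ?_
  rintro ⟨x, ξ, t⟩ hp hpos
  have hbox := hp
  obtain ⟨h1, h2, h3, h4, h5, h6⟩ := hp
  dsimp only at h1 h2 h3 h4 h5 h6
  have hq := sqDist_nonneg y x
  have hd : (0 : ℝ) ≤ d := d.cast_nonneg
  have hα0 : B * (d + 1) * ξ ^ 2 ≤ α * ξ - B * (d + 1) * ξ ^ 2 := by
    nlinarith [mul_le_mul_of_nonneg_right hα h2,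
      mul_nonneg (mul_nonneg (mul_pos hB (by linarith : (0 : ℝ) < d + 1)).le h2) (sub_nonneg.2 h3)]
  have hα1 : 0 ≤ B * (d + 1) * ξ ^ 2 := by positivity
  have ht0 : 0 ≤ B * (s - t) := mul_nonneg hB.le (by linarith)
  have hq0 : 0 ≤ B * sqDist y x := by positivity
  have hb1 := (abs_le.1 (hS _ (slide_nonneg (j := j) h2 h4).1 t)).2
  have hb2 := (abs_le.1 (hS _ (slide_nonneg (j := j) h2 h4).2 t)).1
  simp only [twoPoint] at hpos
  have hcore : (x, ξ, t) ∈ twoPointCore y s R := by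
    refine ⟨fun i => (h1 i).lt_of_ne fun h => ?_, h2.lt_of_ne fun h => ?_,
      h3.lt_of_ne fun h => ?_, h5.lt_of_ne fun h => ?_⟩
    · have h7 := sq_le_sqDist i y x
      rw [← sq_abs, h] at h7
      have := mul_le_mul_of_nonneg_left h7 hB.le
      linarith
    · rw [← h] at hpos hα0 hα1
      simp only [neg_zero, slide_zero] at hpos
      linarith
    · have : B * R ^ 2 ≤ B * (d + 1) * ξ ^ 2 := by
        rw [h]; nlinarith [mul_nonneg (mul_nonneg hB.le hd) (sq_nonneg R)]
      linarith
    · have : B * (s - t) = B * R ^ 2 := by rw [← h]; ring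
      linarith
  rcases h4.eq_or_lt with h | h
  · exact hob _ hbox hcore h
  · exact not_isMaxOn_twoPoint hz hB hcore h h6

theorem two_point_le (hz : Caloric z)
    (hc : ContinuousOn (fun p : (Fin (d + 1) → ℝ) × ℝ => z p.1 p.2) {p | 0 ≤ p.1 0})
    (hS0 : 0 < S) (hS : ∀ x, 0 ≤ x 0 → ∀ t, |z x t| ≤ S) {x : Fin (d + 1) → ℝ} (hR : 0 < R)
    (hx : 3 * R ≤ x 0) {ξ : ℝ} (h0 : 0 ≤ ξ) (hξ : ξ ≤ R) (j : Fin (d + 1)) (t : ℝ) :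
    z (slide j ξ x) t - z (slide j (-ξ) x) t ≤ 4 * S * (d + 1) / R * ξ := by
  have hd : (0 : ℝ) ≤ d := d.cast_nonneg
  have := twoPoint_nonpos (j := j) (y := x) (s := t) (B := 2 * S / R ^ 2)
    (α := 4 * S * (d + 1) / R) hz hc hS hR (by positivity) (by field_simp; rfl)
    (by apply le_of_eq; field_simp; ring) (fun p hp hp' h => by
      have h1 := (abs_le.1 (hp.1 0)).1
      have h2 := hp.2.2.1
      linarith) (x, ξ, t)
    ⟨fun i => by simpa using hR.le, h0, hξ, by dsimp only; linarith, by dsimp only; nlinarith, le_rfl⟩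
  simp only [twoPoint, sub_self, mul_zero, add_zero, sqDist_self] at this
  have h3 : 0 ≤ 2 * S / R ^ 2 * (d + 1) * ξ ^ 2 := by positivity
  linarith

theorem abs_two_point_le (hz : Caloric z)
    (hc : ContinuousOn (fun p : (Fin (d + 1) → ℝ) × ℝ => z p.1 p.2) {p | 0 ≤ p.1 0})
    (hS0 : 0 < S) (hS : ∀ x, 0 ≤ x 0 → ∀ t, |z x t| ≤ S) {x : Fin (d + 1) → ℝ} (hR : 0 < R)
    (hx : 3 * R ≤ x 0) {ξ : ℝ} (h0 : 0 ≤ ξ) (hξ : ξ ≤ R) (j : Fin (d + 1)) (t : ℝ) :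
    |z (slide j ξ x) t - z (slide j (-ξ) x) t| ≤ 4 * S * (d + 1) / R * ξ := by
  have h1 := two_point_le hz hc hS0 hS hR hx h0 hξ j t
  have h2 := two_point_le (hz.const_mul (-1)) (hc.const_mul (-1)) hS0
    (fun x hx t => by simpa using hS x hx t) hR hx h0 hξ j t
  rw [abs_le]; constructor <;> linarith

end twoPoint

theorem abs_le_of_abs_symm_sub_le {g : ℝ → ℝ} {D C : ℝ} (hg : HasDerivAt g D 0)
    (h : ∀ᶠ ξ in 𝓝[>] (0 : ℝ), |g ξ - g (-ξ)| ≤ C * ξ) : |D| ≤ C := by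
  have h2 : HasDerivAt (fun ξ => g ξ - g (-ξ)) (2 * D) 0 := by
    have h0 : HasDerivAt g D (-0) := by simpa using hg
    refine (hg.sub (h0.comp (0 : ℝ) (hasDerivAt_neg 0))).congr_deriv ?_
    ring
  have hs : Tendsto (slope (fun ξ => g ξ - g (-ξ)) 0) (𝓝[>] 0) (𝓝 (2 * D)) :=
    (hasDerivAt_iff_tendsto_slope.1 h2).mono_left
      (nhdsWithin_mono 0 (fun x (hx : 0 < x) => (hx.ne' : x ≠ 0)))
  have : |2 * D| ≤ C := by
    refine le_of_tendsto hs.abs ?_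
    filter_upwards [h, self_mem_nhdsWithin] with ξ h1 h2
    have h3 : (0 : ℝ) < ξ := h2
    simp only [slope_def_field, neg_zero, sub_self, sub_zero, abs_div, abs_of_pos h3]
    rwa [div_le_iff₀ h3]
  rw [abs_mul, abs_two] at this
  linarith [abs_nonneg D]

theorem abs_le_of_abs_sub_le {g : ℝ → ℝ} {D C : ℝ} (hg : HasDerivAt g D 0)
    (h : ∀ᶠ ξ in 𝓝[>] (0 : ℝ), |g ξ - g 0| ≤ C * ξ) : |D| ≤ C := by
  have hs : Tendsto (slope g 0) (𝓝[>] 0) (𝓝 D) :=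
    (hasDerivAt_iff_tendsto_slope.1 hg).mono_left
      (nhdsWithin_mono 0 (fun x (hx : 0 < x) => (hx.ne' : x ≠ 0)))
  refine le_of_tendsto hs.abs ?_
  filter_upwards [h, self_mem_nhdsWithin] with ξ h1 h2
  have h3 : (0 : ℝ) < ξ := h2
  simp only [slope_def_field, sub_zero, abs_div, abs_of_pos h3]
  rwa [div_le_iff₀ h3]

section comparison

variable {d : ℕ} {z : (Fin (d + 1) → ℝ) → ℝ → ℝ}

theorem oblique_two_point_le {S b : ℝ} (hz : Caloric z)
    (hc : ContinuousOn (fun p : (Fin (d + 1) → ℝ) × ℝ => z p.1 p.2) {p | 0 ≤ p.1 0})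
    (hS0 : 0 < S) (hS : ∀ x, 0 ≤ x 0 → ∀ t, |z x t| ≤ S)
    (hb : ∀ x, x 0 = 0 → ∀ t, ∃ e,
      HasDerivWithinAt (fun τ => z (slide 0 τ x) t) e (Ici 0) 0 ∧ |e| ≤ b)
    {x : Fin (d + 1) → ℝ} {ξ : ℝ} (h0 : 0 ≤ ξ) (h1 : ξ ≤ 1) (hξ : ξ ≤ x 0) (t : ℝ) :
    z (slide 0 ξ x) t - z (slide 0 (-ξ) x) t ≤ (4 * S * (d + 1) + 4 * S + 2 * b + 1) * ξ := by
  have hb0 : 0 ≤ b := by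
    obtain ⟨e, -, he⟩ := hb 0 rfl 0
    exact (abs_nonneg e).trans he
  have hd : (0 : ℝ) ≤ d := d.cast_nonneg
  have := twoPoint_nonpos (j := 0) (y := x) (s := t) (R := 1) (B := 2 * S)
    (α := 4 * S * (d + 1) + 4 * S + 2 * b + 1) hz hc hS one_pos (by positivity) (by simp)
    (by nlinarith) ?_ (x, ξ, t)
    ⟨fun i => by simp, h0, h1, hξ, by simp, le_rfl⟩
  · simp only [twoPoint, sub_self, mul_zero, add_zero, sqDist_self] at this
    have h3 : 0 ≤ 2 * S * (d + 1) * ξ ^ 2 := by positivity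
    linarith
  · rintro ⟨y, η, s⟩ hp hcore hη
    dsimp only at hη
    obtain ⟨e, he, heb⟩ := hb (slide 0 (-η) y) (by simp [hη]) s
    have hη0 : 0 < η := hcore.2.1
    have hη1 : η < 1 := hcore.2.2.1
    have hy := abs_lt.1 (hcore.1 0)
    dsimp only at hy
    refine not_isMaxOn_of_pos_deriv (θ := fun τ => (slide 0 τ y, η - τ, s))
      (e := 0 - e * 2 - (-(4 * S * (d + 1) + 4 * S + 2 * b + 1) + 2 * (2 * S * (d + 1)) * η +
        2 * S * (2 * (y 0 - x 0)))) (by simp) ?_ ?_ ?_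
    · have hcont : Continuous fun τ : ℝ => (slide 0 τ y, η - τ, s) :=
        (Continuous.slide 0 continuous_id continuous_const).prodMk (by fun_prop)
      have := hcont.continuousAt.preimage_mem_nhds (x := 0)
        ((isOpen_twoPointCore x t 1).mem_nhds (by simpa using hcore))
      filter_upwards [nhdsWithin_le_nhds this, self_mem_nhdsWithin] with τ h1 h2
      have h3 := mem_Ioi.1 h2
      exact ⟨fun i => (h1.1 i).le, h1.2.1.le, h1.2.2.1.le, by simp only [slide_self]; linarith,
        h1.2.2.2.le, hp.2.2.2.2.2⟩
    · simp only [twoPoint]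
      have e1 : ∀ τ, slide 0 (η - τ) (slide 0 τ y) = slide 0 η y := fun τ => by
        rw [slide_slide]; congr 1; ring
      have e2 : ∀ τ, slide 0 (-(η - τ)) (slide 0 τ y) = slide 0 (τ * 2) (slide 0 (-η) y) :=
        fun τ => by rw [slide_slide, slide_slide]; congr 1; ring
      simp only [e1, e2, sqDist_slide]
      have he' : HasDerivWithinAt (fun τ => z (slide 0 τ (slide 0 (-η) y)) s) e (Ici 0) (0 * 2) := by
        simpa using he
      have h3 := he'.comp 0 (((hasDerivAt_id (0 : ℝ)).mul_const 2).hasDerivWithinAt (s := Ici 0))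
        (fun τ hτ => by simpa using hτ)
      refine ((hasDerivWithinAt_const _ _ _).sub (h3.congr_deriv (by simp))).sub ?_
      have hid := hasDerivAt_id (0 : ℝ)
      have h4 := ((((hid.const_sub η).const_mul (4 * S * (d + 1) + 4 * S + 2 * b + 1)).sub
        (((hid.const_sub η).pow 2).const_mul (2 * S * (d + 1)))).add_const
        (2 * S * (t - s))).add ((((hid.const_mul (2 * (y 0 - x 0))).const_add (sqDist x y)).add
        (hid.pow 2)).const_mul (2 * S))
      refine (h4.congr_deriv ?_).hasDerivWithinAt
      simp; ring
    · have h3 := abs_le.1 heb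
      have h4 : 2 * (2 * S * (d + 1)) * η ≤ 2 * (2 * S * (d + 1)) :=
        mul_le_of_le_one_right (by positivity) hη1.le
      have h5 : 2 * S * (2 * (y 0 - x 0)) ≤ 2 * S * 2 :=
        mul_le_mul_of_nonneg_left (by linarith) (by positivity)
      linarith

theorem strip_le {L Z A ε : ℝ} (hz : Caloric z)
    (hc : ContinuousOn (fun p : (Fin (d + 1) → ℝ) × ℝ => z p.1 p.2) {p | 0 ≤ p.1 0})
    (hε : 0 < ε) (hL : 0 < L) (hLε : 4 * L * ε ≤ 1) (hZ : 0 < Z) (hA0 : 0 ≤ A)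
    (hzZ : ∀ x, 0 ≤ x 0 → x 0 ≤ ε → ∀ t, z x t ≤ Z)
    (hb : ∀ x, x 0 = 0 → ∀ t, ∃ e,
      HasDerivWithinAt (fun τ => z (slide 0 τ x) t) e (Ici 0) 0 ∧ -(L * Z) ≤ e)
    (hA : ∀ x, x 0 = ε → ∀ t, z x t ≤ A) {x : Fin (d + 1) → ℝ} (hx : 0 ≤ x 0) (hxε : x 0 ≤ ε)
    (t : ℝ) : z x t ≤ A + 3 / 4 * Z := by
  have hd : (0 : ℝ) ≤ d := d.cast_nonneg
  set R := 2 * ε * (d + 3) with hR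
  have hR0 : 0 < R := by positivity
  have hRε : ε < R := by nlinarith
  set B := Z / R ^ 2 with hB
  have hB0 : 0 < B := by positivity
  have hBR : B * R ^ 2 = Z := by rw [hB]; field_simp
  have hBε : B * (d + 3) * ε ^ 2 ≤ Z / 4 := by
    rw [hB, hR]
    have : Z / (2 * ε * (d + 3)) ^ 2 * (d + 3) * ε ^ 2 = Z / 4 / (d + 3) := by field_simp; ring
    rw [this]
    exact div_le_self (by positivity) (by linarith)
  set y := slide 0 (-x 0) x with hy
  have hy0 : y 0 = 0 := by simp [hy]
  have hyx : slide 0 (x 0) y = x := by rw [hy, slide_slide]; simp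
  let K : Set ((Fin (d + 1) → ℝ) × ℝ) :=
    {p | (∀ i, |p.1 i - y i| ≤ R) ∧ 0 ≤ p.1 0 ∧ p.1 0 ≤ ε ∧ t - R ^ 2 ≤ p.2 ∧ p.2 ≤ t}
  let F : (Fin (d + 1) → ℝ) × ℝ → ℝ := fun p => z p.1 p.2 - (A + 2 * L * Z * (ε - p.1 0) +
    B * (d + 2) * (ε ^ 2 - p.1 0 ^ 2) + B * (t - p.2) + B * sqDist y p.1)
  have hK : IsCompact K := by
    refine ((isCompact_Icc (a := fun i => y i - R) (b := fun i => y i + R)).prod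
      (isCompact_Icc (a := t - R ^ 2) (b := t))).of_isClosed_subset ?_ ?_
    · simp only [K, ofPred_and, ofPred_forall]
      exact (isClosed_iInter fun i => isClosed_le (by fun_prop) (by fun_prop)).inter
        ((isClosed_le (by fun_prop) (by fun_prop)).inter
        ((isClosed_le (by fun_prop) (by fun_prop)).inter
        ((isClosed_le (by fun_prop) (by fun_prop)).inter
          (isClosed_le (by fun_prop) (by fun_prop)))))
    · rintro p ⟨h1, -, -, h5, h6⟩
      refine ⟨⟨fun i => ?_, fun i => ?_⟩, ⟨h5, h6⟩⟩
      · have := (abs_le.1 (h1 i)).1; dsimp only; linarith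
      · have := (abs_le.1 (h1 i)).2; dsimp only; linarith
  have hF : ContinuousOn F K := by
    have hq := continuous_sqDist y
    exact (hc.mono fun p hp => hp.2.1).sub (Continuous.continuousOn (by fun_prop))
  have key : ∀ p ∈ K, F p ≤ 0 := by
    refine le_zero_of_not_isMaxOn hK hF ?_
    rintro ⟨w, s⟩ ⟨h1, h2, h3, h4, h5⟩ hpos
    dsimp only at h1 h2 h3 h4 h5
    simp only [F] at hpos
    have t1 : 0 ≤ 2 * L * Z * (ε - w 0) := mul_nonneg (by positivity) (by linarith)
    have t2 : 0 ≤ B * (d + 2) * (ε ^ 2 - w 0 ^ 2) := mul_nonneg (by positivity) (by nlinarith)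
    have t3 : 0 ≤ B * (t - s) := mul_nonneg hB0.le (by linarith)
    have t4 : 0 ≤ B * sqDist y w := mul_nonneg hB0.le (sqDist_nonneg _ _)
    have h7 := hzZ w h2 h3 s
    have h1' : ∀ i, |w i - y i| < R := fun i => (h1 i).lt_of_ne fun h => by
      have h8 := sq_le_sqDist i y w
      rw [← sq_abs, h] at h8
      have := mul_le_mul_of_nonneg_left h8 hB0.le
      linarith
    have h3' : w 0 < ε := h3.lt_of_ne fun h => by
      have := hA w h s
      linarith
    have h4' : t - R ^ 2 < s := h4.lt_of_ne fun h => by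
      have : B * (t - s) = B * R ^ 2 := by rw [← h]; ring
      linarith
    have hO : IsOpen {p : (Fin (d + 1) → ℝ) × ℝ |
        (∀ i, |p.1 i - y i| < R) ∧ p.1 0 < ε ∧ t - R ^ 2 < p.2} := by
      simp only [ofPred_and, ofPred_forall]
      exact (isOpen_iInter_of_finite fun i => isOpen_lt (by fun_prop) (by fun_prop)).inter
        ((isOpen_lt (by fun_prop) (by fun_prop)).inter (isOpen_lt (by fun_prop) (by fun_prop)))
    have hev : ∀ {γ : ℝ → (Fin (d + 1) → ℝ) × ℝ}, Continuous γ → γ 0 = (w, s) →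
        ∀ᶠ τ in 𝓝 0, 0 ≤ (γ τ).1 0 → (γ τ).2 ≤ t → γ τ ∈ K := fun {γ} hγ h0 => by
      filter_upwards [hγ.continuousAt.preimage_mem_nhds
        (hO.mem_nhds (by rw [h0]; exact ⟨h1', h3', h4'⟩))] with τ hτ hle hle'
      exact ⟨fun i => (hτ.1 i).le, hle, hτ.2.1.le, hτ.2.2.le, hle'⟩
    rcases h2.eq_or_lt with h0 | h0
    · obtain ⟨e, he, heb⟩ := hb w h0.symm s
      refine not_isMaxOn_of_pos_deriv (θ := fun τ => (slide 0 τ w, s)) (e := e + 2 * L * Z)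
        (by simp) ?_ ?_ (by nlinarith [mul_pos hL hZ])
      · filter_upwards [nhdsWithin_le_nhds (hev (γ := fun τ => (slide 0 τ w, s))
          ((Continuous.slide 0 continuous_id continuous_const).prodMk continuous_const) (by simp)),
          self_mem_nhdsWithin] with τ h8 h9
        have := mem_Ioi.1 h9
        exact h8 (by simp only [slide_self]; linarith) h5
      · simp only [F, slide_self, sqDist_slide, ← h0, hy0, zero_add, sub_self, mul_zero, zero_mul,
          add_zero]
        have hid := hasDerivAt_id (0 : ℝ)
        have h8 := (((((hid.const_sub ε).const_mul (2 * L * Z)).const_add A).add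
          (((hid.pow 2).const_sub (ε ^ 2)).const_mul (B * (d + 2)))).add_const
          (B * (t - s))).add (((hid.pow 2).const_add (sqDist y w)).const_mul B)
        refine (he.sub h8.hasDerivWithinAt).congr_deriv ?_
        simp
    · obtain ⟨e, he, het⟩ := hz w h0 s
      have hpos' : ∀ {γ : ℝ → (Fin (d + 1) → ℝ) × ℝ}, Continuous γ → γ 0 = (w, s) →
          ∀ᶠ τ in 𝓝 0, (γ τ).2 ≤ t → γ τ ∈ K := fun {γ} hγ h8 => by
        have hO' : IsOpen {p : (Fin (d + 1) → ℝ) × ℝ | 0 < p.1 0} :=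
          isOpen_lt (by fun_prop) (by fun_prop)
        filter_upwards [hev hγ h8, hγ.continuousAt.preimage_mem_nhds
          (hO'.mem_nhds (by rw [h8]; exact h0))] with τ hτ hτ'
        exact hτ (le_of_lt hτ')
      refine not_isMaxOn_of_lt_sum (γ := fun i τ => (slide i τ w, s))
        (c := fun i => e i - 2 * B + if i = 0 then 2 * (B * (d + 2)) else 0)
        (θ := fun τ => (w, s + τ)) (e := (∑ i, e i) + B)
        (fun i => by simp) (fun i => ?_) (fun i => ?_) (by simp) ?_ ?_ ?_
      · filter_upwards [hpos' (γ := fun τ => (slide i τ w, s))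
          ((Continuous.slide i continuous_id continuous_const).prodMk continuous_const)
          (by simp)] with τ hτ
        exact hτ h5
      · simp only [F, sqDist_slide]
        by_cases h : i = 0
        · subst h
          have h8 := HasD2.quadratic (A + 2 * L * Z * (ε - w 0) + B * (d + 2) * (ε ^ 2 - w 0 ^ 2) +
            B * (t - s) + B * sqDist y w) (-(2 * L * Z) - 2 * (B * (d + 2)) * w 0 +
            B * (2 * (w 0 - y 0))) (B - B * (d + 2))
          convert (he 0).sub h8 using 1
          · funext τ
            simp only [slide_self]
            ring
          · simp only [if_true]; ring
        · have h8 := HasD2.quadratic (A + 2 * L * Z * (ε - w 0) + B * (d + 2) * (ε ^ 2 - w 0 ^ 2) +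
            B * (t - s) + B * sqDist y w) (B * (2 * (w i - y i))) B
          convert (he i).sub h8 using 1
          · funext τ
            rw [slide_ne (Ne.symm h)]
            ring
          · simp only [if_neg h]; ring
      · filter_upwards [nhdsWithin_le_nhds (hpos' (γ := fun τ => (w, s + τ)) (by fun_prop)
          (by simp)), self_mem_nhdsWithin] with τ h8 h9
        have := mem_Iio.1 h9
        exact h8 (by linarith)
      · simp only [F]
        have h8 : HasDerivAt (fun τ => z w (s + τ)) (∑ i, e i) 0 :=
          HasDerivAt.comp_const_add s 0 (by simpa using het)
        have h9 := (((((hasDerivAt_id (0 : ℝ)).const_add s).const_sub t).const_mul B).const_add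
          (A + 2 * L * Z * (ε - w 0) + B * (d + 2) * (ε ^ 2 - w 0 ^ 2))).add_const (B * sqDist y w)
        exact (h8.sub h9).congr_deriv (by ring)
      · simp only [Finset.sum_add_distrib, Finset.sum_sub_distrib, Finset.sum_ite_eq',
          Finset.mem_univ, if_true, Finset.sum_const, Finset.card_univ, Fintype.card_fin,
          nsmul_eq_mul]
        push_cast
        linarith
  have h1 := key (x, t) ⟨fun i => ?_, hx, hxε, by simp only; nlinarith [sq_nonneg R], le_rfl⟩
  · have h2 : sqDist y x = x 0 ^ 2 := by
      conv_lhs => rw [← hyx, sqDist_slide]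
      simp [sub_self]
    simp only [F, h2, sub_self, mul_zero, add_zero] at h1
    have h3 : 2 * L * Z * (ε - x 0) ≤ Z / 2 := by
      have := mul_le_mul_of_nonneg_right hLε hZ.le
      nlinarith [mul_nonneg (mul_pos hL hZ).le hx]
    have h4 : B * (d + 2) * (ε ^ 2 - x 0 ^ 2) + B * x 0 ^ 2 ≤ B * (d + 3) * ε ^ 2 := by
      have h5 : x 0 ^ 2 ≤ ε ^ 2 := by gcongr
      nlinarith [mul_le_mul_of_nonneg_left h5 hB0.le, mul_nonneg hB0.le (sq_nonneg (x 0)),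
        mul_nonneg (mul_nonneg hB0.le hd) (sq_nonneg (x 0)), mul_nonneg hB0.le (sq_nonneg ε)]
    linarith
  · dsimp only
    by_cases h : i = 0
    · subst h; rw [hy0, sub_zero, abs_of_nonneg hx]; linarith
    · rw [hy, slide_ne h, sub_self, abs_zero]; exact hR0.le

theorem abs_strip_le {L Z A ε : ℝ} (hz : Caloric z)
    (hc : ContinuousOn (fun p : (Fin (d + 1) → ℝ) × ℝ => z p.1 p.2) {p | 0 ≤ p.1 0})
    (hε : 0 < ε) (hL : 0 < L) (hLε : 4 * L * ε ≤ 1) (hZ : 0 < Z) (hA0 : 0 ≤ A)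
    (hzZ : ∀ x, 0 ≤ x 0 → x 0 ≤ ε → ∀ t, |z x t| ≤ Z)
    (hb : ∀ x, x 0 = 0 → ∀ t, ∃ e,
      HasDerivWithinAt (fun τ => z (slide 0 τ x) t) e (Ici 0) 0 ∧ |e| ≤ L * |z x t|)
    (hA : ∀ x, x 0 = ε → ∀ t, |z x t| ≤ A) {x : Fin (d + 1) → ℝ} (hx : 0 ≤ x 0) (hxε : x 0 ≤ ε)
    (t : ℝ) : |z x t| ≤ 4 * A := by
  have key : ∀ k : ℕ, ∀ x : Fin (d + 1) → ℝ, 0 ≤ x 0 → x 0 ≤ ε → ∀ t,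
      |z x t| ≤ 4 * A + (3 / 4) ^ k * Z := by
    intro k
    induction k with
    | zero => intro x h1 h2 t; have := hzZ x h1 h2 t; rw [pow_zero]; linarith
    | succ k ih =>
      intro x h1 h2 t
      have hZ' : 0 < 4 * A + (3 / 4) ^ k * Z := by positivity
      have u1 := strip_le hz hc hε hL hLε hZ' hA0
        (fun x h1 h2 t => (abs_le.1 (ih x h1 h2 t)).2)
        (fun x h0 t => by
          obtain ⟨e, he, hl⟩ := hb x h0 t
          refine ⟨e, he, ?_⟩
          have := mul_le_mul_of_nonneg_left (ih x h0.ge (h0.le.trans hε.le) t) hL.le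
          linarith [(abs_le.1 hl).1])
        (fun x h0 t => (abs_le.1 (hA x h0 t)).2) h1 h2 t
      have u2 := strip_le (hz.const_mul (-1)) (hc.const_mul (-1)) hε hL hLε hZ' hA0
        (fun x h1 h2 t => by have := (abs_le.1 (ih x h1 h2 t)).1; linarith)
        (fun x h0 t => by
          obtain ⟨e, he, hl⟩ := hb x h0 t
          refine ⟨-1 * e, he.const_mul (-1), ?_⟩
          have := mul_le_mul_of_nonneg_left (ih x h0.ge (h0.le.trans hε.le) t) hL.le
          linarith [(abs_le.1 hl).2])
        (fun x h0 t => by have := (abs_le.1 (hA x h0 t)).1; linarith) h1 h2 t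
      rw [abs_le, pow_succ]
      constructor <;> linarith
  have hl : Tendsto (fun k : ℕ => 4 * A + (3 / 4 : ℝ) ^ k * Z) atTop (𝓝 (4 * A + 0 * Z)) :=
    ((tendsto_pow_atTop_nhds_zero_of_lt_one (by norm_num) (by norm_num)).mul_const Z).const_add _
  rw [zero_mul, add_zero] at hl
  exact ge_of_tendsto hl (Eventually.of_forall fun k => key k x hx hxε t)

end comparison

/-- A positive bounded solution of the half-space problem together with its derivatives along
the coordinate directions. -/
structure HalfSol (d : ℕ) (q M : ℝ) (u : (Fin (d + 1) → ℝ) → ℝ → ℝ)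
    (D : Fin (d + 1) → (Fin (d + 1) → ℝ) → ℝ → ℝ)
    (DD : Fin (d + 1) → Fin (d + 1) → (Fin (d + 1) → ℝ) → ℝ → ℝ)
    (ut : (Fin (d + 1) → ℝ) → ℝ → ℝ) : Prop where
  cont : ContinuousOn (fun p : (Fin (d + 1) → ℝ) × ℝ => u p.1 p.2) {p | 0 ≤ p.1 0}
  pos : ∀ x, 0 ≤ x 0 → ∀ t, 0 < u x t
  le : ∀ x, 0 ≤ x 0 → ∀ t, u x t ≤ M
  dD : ∀ x, 0 < x 0 → ∀ t i, HasDerivAt (fun τ => u (slide i τ x) t) (D i x t) 0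
  dDD : ∀ x, 0 < x 0 → ∀ t i j, HasDerivAt (fun τ => D i (slide j τ x) t) (DD i j x t) 0
  symm : ∀ x, 0 < x 0 → ∀ t i j, DD i j x t = DD j i x t
  contD : ∀ t i, ContinuousOn (fun x => D i x t) {x | 0 ≤ x 0}
  contDD : ∀ t i j, ContinuousOn (fun x => DD i j x t) {x | 0 < x 0}
  dT : ∀ x, 0 < x 0 → ∀ t, HasDerivAt (u x) (ut x t) t
  contT : ∀ x, 0 < x 0 → Continuous (ut x)
  heat : ∀ x, 0 < x 0 → ∀ t, ut x t = ∑ i, DD i i x t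
  bdry : ∀ x, x 0 = 0 → ∀ t,
    HasDerivWithinAt (fun τ => u (slide 0 τ x) t) (D 0 x t) (Ici 0) 0
  normal : ∀ x, x 0 = 0 → ∀ t, D 0 x t = -(u x t ^ q)
  tang : ∀ x, x 0 = 0 → ∀ t i, i ≠ 0 → HasDerivAt (fun τ => u (slide i τ x) t) (D i x t) 0

theorem hasDerivAt_slide {N : ℕ} {f : (Fin N → ℝ) → ℝ} {i : Fin N} {τ D : ℝ} {x : Fin N → ℝ}
    (h : HasDerivAt (fun σ => f (slide i σ (slide i τ x))) D 0) :
    HasDerivAt (fun τ => f (slide i τ x)) D τ := by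
  simp only [slide_slide] at h
  have h' : HasDerivAt (fun σ => f (slide i (τ + σ) x)) D (τ - τ) := by simpa using h
  have := HasDerivAt.comp_sub_const (f := fun σ => f (slide i (τ + σ) x)) τ τ h'
  simpa using this

namespace HalfSol

variable {d : ℕ} {q M : ℝ} {u ut : (Fin (d + 1) → ℝ) → ℝ → ℝ}
  {D : Fin (d + 1) → (Fin (d + 1) → ℝ) → ℝ → ℝ}
  {DD : Fin (d + 1) → Fin (d + 1) → (Fin (d + 1) → ℝ) → ℝ → ℝ}

theorem caloric (h : HalfSol d q M u D DD ut) : Caloric u := by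
  intro x hx t
  refine ⟨fun i => DD i i x t, fun i => ⟨fun τ => D i (slide i τ x) t, ?_, h.dDD x hx t i i⟩, ?_⟩
  · have hc : ContinuousAt (fun τ => slide i τ x 0) 0 :=
      ((continuous_apply 0).comp (Continuous.slide i continuous_id continuous_const)).continuousAt
    filter_upwards [hc.preimage_mem_nhds (lt_mem_nhds (by simpa using hx))] with τ hτ
    exact hasDerivAt_slide (f := fun y => u y t) (h.dD _ hτ t i)
  · rw [← h.heat x hx t]; exact h.dT x hx t

theorem pos_M (h : HalfSol d q M u D DD ut) : 0 < M :=
  (h.pos 0 le_rfl 0).trans_le (h.le 0 le_rfl 0)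

theorem abs_le (h : HalfSol d q M u D DD ut) (x : Fin (d + 1) → ℝ) (hx : 0 ≤ x 0) (t : ℝ) :
    |u x t| ≤ M := by
  rw [abs_of_pos (h.pos x hx t)]; exact h.le x hx t

theorem rpow_le (h : HalfSol d q M u D DD ut) (hq : 1 < q) (x : Fin (d + 1) → ℝ) (hx : 0 ≤ x 0)
    (t : ℝ) : |u x t ^ q| ≤ M ^ q := by
  rw [abs_of_pos (Real.rpow_pos_of_pos (h.pos x hx t) q)]
  exact Real.rpow_le_rpow (h.pos x hx t).le (h.le x hx t) (by linarith)

theorem abs_deriv_le_of_two_point {z : (Fin (d + 1) → ℝ) → ℝ → ℝ} {S E t : ℝ} (hz : Caloric z)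
    (hc : ContinuousOn (fun p : (Fin (d + 1) → ℝ) × ℝ => z p.1 p.2) {p | 0 ≤ p.1 0})
    (hS0 : 0 < S) (hS : ∀ x, 0 ≤ x 0 → ∀ t, |z x t| ≤ S) {x : Fin (d + 1) → ℝ} (hx : 0 < x 0)
    {j : Fin (d + 1)} (hE : HasDerivAt (fun τ => z (slide j τ x) t) E 0) :
    |E| ≤ 12 * S * (d + 1) / x 0 := by
  refine abs_le_of_abs_symm_sub_le hE ?_
  have hx3 : 0 < x 0 / 3 := by linarith
  filter_upwards [Ioo_mem_nhdsGT hx3] with ξ hξ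
  refine (abs_two_point_le hz hc hS0 hS hx3 (by linarith) hξ.1.le hξ.2.le j t).trans_eq ?_
  field_simp; ring

theorem abs_normal_le (h : HalfSol d q M u D DD ut) (hq : 1 < q) (x : Fin (d + 1) → ℝ)
    (hx : 0 < x 0) (t : ℝ) : |D 0 x t| ≤ 4 * M * (d + 1) + 4 * M + 2 * M ^ q + 1 := by
  refine abs_le_of_abs_symm_sub_le (h.dD x hx t 0) ?_
  filter_upwards [Ioo_mem_nhdsGT (lt_min one_pos hx)] with ξ hξ
  have h1 : ξ ≤ 1 := hξ.2.le.trans (min_le_left _ _)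
  have h2 : ξ ≤ x 0 := hξ.2.le.trans (min_le_right _ _)
  have h3 := oblique_two_point_le h.caloric h.cont h.pos_M h.abs_le
    (fun x hx t => ⟨_, h.bdry x hx t, by
      rw [h.normal x hx t, abs_neg]; exact h.rpow_le hq x hx.ge t⟩) hξ.1.le h1 h2 t
  have h4 := oblique_two_point_le (h.caloric.const_mul (-1)) (h.cont.const_mul (-1)) h.pos_M
    (fun x hx t => by simpa using h.abs_le x hx t)
    (fun x hx t => ⟨_, (h.bdry x hx t).const_mul (-1), by
      rw [h.normal x hx t, neg_one_mul, neg_neg]; exact h.rpow_le hq x hx.ge t⟩) hξ.1.le h1 h2 t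
  exact _root_.abs_le.2 ⟨by linarith, by linarith⟩

theorem continuousOn_slide {z : (Fin (d + 1) → ℝ) → ℝ → ℝ}
    (hc : ContinuousOn (fun p : (Fin (d + 1) → ℝ) × ℝ => z p.1 p.2) {p | 0 ≤ p.1 0})
    (i : Fin (d + 1)) {k : ℝ} (hk : 0 ≤ k) :
    ContinuousOn (fun p : (Fin (d + 1) → ℝ) × ℝ => z (slide i k p.1) p.2) {p | 0 ≤ p.1 0} := by
  refine hc.comp (f := fun p : (Fin (d + 1) → ℝ) × ℝ => (slide i k p.1, p.2))
    ((Continuous.slide i continuous_const continuous_fst).prodMk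
      continuous_snd).continuousOn fun p hp => ?_
  have hp' : 0 ≤ p.1 0 := hp
  change 0 ≤ slide i k p.1 0
  rw [slide_apply]; split_ifs <;> linarith

theorem continuousOn_delay {z : (Fin (d + 1) → ℝ) → ℝ → ℝ}
    (hc : ContinuousOn (fun p : (Fin (d + 1) → ℝ) × ℝ => z p.1 p.2) {p | 0 ≤ p.1 0}) (k : ℝ) :
    ContinuousOn (fun p : (Fin (d + 1) → ℝ) × ℝ => z p.1 (p.2 + k)) {p | 0 ≤ p.1 0} :=
  hc.comp (f := fun p : (Fin (d + 1) → ℝ) × ℝ => (p.1, p.2 + k)) (by fun_prop) fun _ hp => hp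

theorem abs_sub_le_of_strip (h : HalfSol d q M u D DD ut) (hq : 1 < q) {ε A : ℝ} (hε : 0 < ε)
    (hLε : 4 * (q * M ^ (q - 1)) * ε ≤ 1) (hA : 0 ≤ A) {v : (Fin (d + 1) → ℝ) → ℝ → ℝ}
    (hv : Caloric v)
    (hc : ContinuousOn (fun p : (Fin (d + 1) → ℝ) × ℝ => v p.1 p.2) {p | 0 ≤ p.1 0})
    (hv0 : ∀ x, 0 ≤ x 0 → ∀ t, 0 < v x t ∧ v x t ≤ M)
    (hvb : ∀ x, x 0 = 0 → ∀ t,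
      HasDerivWithinAt (fun τ => v (slide 0 τ x) t) (-(v x t ^ q)) (Ici 0) 0)
    (hvA : ∀ x, x 0 = ε → ∀ t, |v x t - u x t| ≤ A) {x : Fin (d + 1) → ℝ} (hx : 0 ≤ x 0)
    (hxε : x 0 ≤ ε) (t : ℝ) : |v x t - u x t| ≤ 4 * A := by
  refine abs_strip_le (hv.sub h.caloric) (hc.sub h.cont) hε
    (mul_pos (by linarith) (Real.rpow_pos_of_pos h.pos_M _)) hLε h.pos_M hA
    (fun x hx _ t => ?_) (fun x hx t => ?_) hvA hx hxε t
  · rw [_root_.abs_le]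
    have h1 := hv0 x hx t
    have h2 := h.pos x hx t
    have h3 := h.le x hx t
    constructor <;> linarith
  · refine ⟨_, (hvb x hx t).sub (h.bdry x hx t), ?_⟩
    rw [h.normal x hx t]
    have h1 := hv0 x hx.ge t
    have h2 := abs_rpow_sub_rpow_le hq (h.pos x hx.ge t) h1.1 (h.le x hx.ge t) h1.2
    rwa [show -(v x t ^ q) - -(u x t ^ q) = -(v x t ^ q - u x t ^ q) by ring, abs_neg]

theorem exists_width (h : HalfSol d q M u D DD ut) (hq : 1 < q) :
    ∃ ε, 0 < ε ∧ 4 * (q * M ^ (q - 1)) * ε ≤ 1 := by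
  have : 0 < q * M ^ (q - 1) := mul_pos (by linarith) (Real.rpow_pos_of_pos h.pos_M _)
  exact ⟨1 / (4 * (q * M ^ (q - 1))), by positivity, (mul_one_div_cancel (by positivity)).le⟩

theorem abs_tang_le (h : HalfSol d q M u D DD ut) (hq : 1 < q) {ε : ℝ} (hε : 0 < ε)
    (hLε : 4 * (q * M ^ (q - 1)) * ε ≤ 1) {i : Fin (d + 1)} (hi : i ≠ 0) {x : Fin (d + 1) → ℝ}
    (hx : 0 ≤ x 0) (t : ℝ) : |D i x t| ≤ 24 * M * (d + 1) / ε := by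
  have hM := h.pos_M
  rcases le_total ε (x 0) with hxε | hxε
  · refine (abs_deriv_le_of_two_point h.caloric h.cont hM h.abs_le (hε.trans_le hxε)
      (h.dD x (hε.trans_le hxε) t i)).trans ?_
    gcongr
    norm_num
  · have hder : HasDerivAt (fun τ => u (slide i τ x) t) (D i x t) 0 := by
      rcases hx.eq_or_lt with h0 | h0
      · exact h.tang x h0.symm t i hi
      · exact h.dD x h0 t i
    have hne : ∀ k (y : Fin (d + 1) → ℝ), slide i k y 0 = y 0 := fun k y => slide_ne hi.symm k y
    refine abs_le_of_abs_sub_le hder ?_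
    filter_upwards [Ioo_mem_nhdsGT (show 0 < 2 * ε / 3 by positivity)] with k hk
    have hk0 := hk.1
    have := h.abs_sub_le_of_strip hq hε hLε (A := 6 * M * (d + 1) / ε * k) (by positivity)
      (h.caloric.slide i hk.1.le) (continuousOn_slide h.cont i hk.1.le)
      (fun y hy s => ⟨h.pos _ (by rwa [hne]) s, h.le _ (by rwa [hne]) s⟩)
      (fun y hy s => ?_) (fun y hy s => ?_) hx hxε t
    · rw [slide_zero]
      refine this.trans_eq ?_
      ring
    · have h1 := h.bdry (slide i k y) (by rwa [hne]) s
      rw [h.normal _ (by rwa [hne]) s] at h1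
      simpa only [slide_comm i 0] using h1
    · have h1 := abs_two_point_le h.caloric h.cont hM h.abs_le (x := slide i (k / 2) y)
        (R := ε / 3) (ξ := k / 2) (by positivity) (by rw [hne, hy]; linarith) (by positivity)
        (by linarith [hk.2]) i s
      rw [slide_slide, slide_slide, add_halves, add_neg_cancel, slide_zero] at h1
      refine h1.trans_eq ?_
      field_simp; ring

theorem exists_gradient_bound (h : HalfSol d q M u D DD ut) (hq : 1 < q) :
    ∃ G, 0 < G ∧ ∀ x : Fin (d + 1) → ℝ, 0 ≤ x 0 → ∀ t i, |D i x t| ≤ G := by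
  obtain ⟨ε, hε, hLε⟩ := h.exists_width hq
  have hM := h.pos_M
  have hMq : 0 < M ^ q := Real.rpow_pos_of_pos hM q
  refine ⟨max (4 * M * (d + 1) + 4 * M + 2 * M ^ q + 1) (24 * M * (d + 1) / ε),
    lt_max_of_lt_left (by positivity), fun x hx t i => ?_⟩
  by_cases hi : i = 0
  · subst hi
    refine le_trans ?_ (le_max_left _ _)
    rcases hx.eq_or_lt with h0 | h0
    · rw [h.normal x h0.symm t, abs_neg]
      refine (h.rpow_le hq x hx t).trans ?_
      nlinarith [mul_nonneg hM.le (d.cast_nonneg : (0 : ℝ) ≤ d)]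
    · exact h.abs_normal_le hq x h0 t
  · exact (h.abs_tang_le hq hε hLε hi hx t).trans (le_max_right _ _)

theorem abs_slide_sub_le (h : HalfSol d q M u D DD ut) {G : ℝ}
    (hG : ∀ x : Fin (d + 1) → ℝ, 0 ≤ x 0 → ∀ t i, |D i x t| ≤ G) {x : Fin (d + 1) → ℝ}
    (hx : 0 ≤ x 0) {k : ℝ} (hk : 0 ≤ k) (i : Fin (d + 1)) (t : ℝ) :
    |u (slide i k x) t - u x t| ≤ G * k := by
  have hn : ∀ τ, 0 ≤ τ → 0 ≤ slide i τ x 0 := fun τ hτ => by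
    rw [slide_apply]; split_ifs <;> linarith
  have := norm_image_sub_le_of_norm_deriv_le_segment' (f := fun τ => u (slide i τ x) t)
    (f' := fun τ => D i (slide i τ x) t) (a := 0) (b := k) (C := G) (fun τ hτ => ?_)
    (fun τ hτ => hG _ (hn τ hτ.1) t i) k ⟨hk, le_rfl⟩
  · simpa [Real.norm_eq_abs] using this
  · rcases (hn τ hτ.1).eq_or_lt with h0 | h0
    · by_cases hi : i = 0
      · subst hi
        rw [slide_self] at h0
        have hτ0 : τ = 0 := by linarith [hτ.1]
        subst hτ0
        rw [slide_zero]
        exact (h.bdry x (by linarith) t).mono Icc_subset_Ici_self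
      · exact (hasDerivAt_slide (f := fun y => u y t)
          (h.tang _ h0.symm t i hi)).hasDerivWithinAt
    · exact (hasDerivAt_slide (f := fun y => u y t) (h.dD _ h0 t i)).hasDerivWithinAt

theorem abs_D_slide_sub_le (h : HalfSol d q M u D DD ut) {G : ℝ} (hG0 : 0 < G)
    (hG : ∀ x : Fin (d + 1) → ℝ, 0 ≤ x 0 → ∀ t i, |D i x t| ≤ G) {x : Fin (d + 1) → ℝ}
    (hx : 0 < x 0) {k : ℝ} (hk : 0 ≤ k) (i j : Fin (d + 1)) (t : ℝ) :
    |D j (slide i k x) t - D j x t| ≤ 12 * G * (d + 1) / x 0 * k := by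
  rcases hk.eq_or_lt with rfl | hk0
  · simp
  have hn : 0 < slide i k x 0 := by
    rw [slide_apply]; split_ifs <;> linarith
  have h1 := abs_deriv_le_of_two_point (z := fun x t => u (slide i k x) t - u x t)
    (S := G * k) (x := x) (t := t) (j := j) ((h.caloric.slide i hk).sub h.caloric)
    ((continuousOn_slide h.cont i hk).sub h.cont) (by positivity)
    (fun y hy s => h.abs_slide_sub_le hG hy hk i s) hx
    ((by simpa only [slide_comm i j] using h.dD _ hn t j : HasDerivAt _ _ _).sub (h.dD x hx t j))
  refine h1.trans_eq ?_
  ring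

theorem abs_DD_le (h : HalfSol d q M u D DD ut) {G : ℝ} (hG0 : 0 < G)
    (hG : ∀ x : Fin (d + 1) → ℝ, 0 ≤ x 0 → ∀ t i, |D i x t| ≤ G) {x : Fin (d + 1) → ℝ}
    (hx : 0 < x 0) (i j : Fin (d + 1)) (t : ℝ) :
    |DD j i x t| ≤ 12 * G * (d + 1) / x 0 := by
  refine abs_le_of_abs_sub_le (h.dDD x hx t j i) ?_
  filter_upwards [self_mem_nhdsWithin] with k hk
  rw [slide_zero]
  exact h.abs_D_slide_sub_le hG0 hG hx (le_of_lt hk) i j t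

theorem abs_time_sub_le_of_ge (h : HalfSol d q M u D DD ut) {G ε : ℝ} (hε : 0 < ε) (hG0 : 0 < G)
    (hG : ∀ x : Fin (d + 1) → ℝ, 0 ≤ x 0 → ∀ t i, |D i x t| ≤ G) {x : Fin (d + 1) → ℝ}
    (hx : ε ≤ x 0) {k : ℝ} (hk : 0 ≤ k) (t : ℝ) :
    |u x (t + k) - u x t| ≤ 12 * G * (d + 1) ^ 2 / ε * k := by
  have hx0 := hε.trans_le hx
  have hut : ∀ s, |ut x s| ≤ 12 * G * (d + 1) ^ 2 / ε := fun s => by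
    rw [h.heat x hx0 s]
    refine (Finset.abs_sum_le_sum_abs _ _).trans
      ((Finset.sum_le_sum fun i _ => h.abs_DD_le hG0 hG hx0 i i s).trans ?_)
    rw [Finset.sum_const, Finset.card_univ, Fintype.card_fin, nsmul_eq_mul]
    calc ((d + 1 : ℕ) : ℝ) * (12 * G * (d + 1) / x 0) = 12 * G * (d + 1) ^ 2 / x 0 := by
          push_cast; ring
      _ ≤ _ := by gcongr
  have := norm_image_sub_le_of_norm_deriv_le_segment' (f := u x) (f' := ut x) (a := t)
    (b := t + k) (fun s _ => (h.dT x hx0 s).hasDerivWithinAt) (fun s _ => hut s) (t + k)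
    ⟨by linarith, le_rfl⟩
  simpa [Real.norm_eq_abs] using this

theorem exists_time_lipschitz (h : HalfSol d q M u D DD ut) (hq : 1 < q) :
    ∃ T, 0 < T ∧ ∀ x : Fin (d + 1) → ℝ, 0 ≤ x 0 → ∀ t k, 0 ≤ k →
      |u x (t + k) - u x t| ≤ T * k := by
  obtain ⟨ε, hε, hLε⟩ := h.exists_width hq
  obtain ⟨G, hG0, hG⟩ := h.exists_gradient_bound hq
  refine ⟨4 * (12 * G * (d + 1) ^ 2 / ε), by positivity, fun x hx t k hk => ?_⟩
  have hA : 0 ≤ 12 * G * (d + 1) ^ 2 / ε * k := by positivity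
  rcases le_total ε (x 0) with hxε | hxε
  · have := h.abs_time_sub_le_of_ge hε hG0 hG hxε hk t
    linarith
  · have := h.abs_sub_le_of_strip hq hε hLε (A := 12 * G * (d + 1) ^ 2 / ε * k) hA
      (h.caloric.delay k) (continuousOn_delay h.cont k)
      (fun y hy s => ⟨h.pos _ hy _, h.le _ hy _⟩)
      (fun y hy s => by rw [← h.normal y hy (s + k)]; exact h.bdry y hy (s + k))
      (fun y hy s => h.abs_time_sub_le_of_ge hε hG0 hG hy.ge hk s) hx hxε t
    linarith

theorem abs_ut_le (h : HalfSol d q M u D DD ut) {T : ℝ}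
    (hT : ∀ x : Fin (d + 1) → ℝ, 0 ≤ x 0 → ∀ t k, 0 ≤ k → |u x (t + k) - u x t| ≤ T * k)
    {x : Fin (d + 1) → ℝ} (hx : 0 < x 0) (t : ℝ) : |ut x t| ≤ T := by
  have hd : HasDerivAt (fun k => u x (t + k)) (ut x t) 0 :=
    HasDerivAt.comp_const_add t 0 (by simpa using h.dT x hx t)
  refine abs_le_of_abs_sub_le hd ?_
  filter_upwards [self_mem_nhdsWithin] with k hk
  rw [add_zero]
  exact hT x hx.le t k (le_of_lt hk)

theorem abs_D_time_sub_le (h : HalfSol d q M u D DD ut) {T : ℝ} (hT0 : 0 < T)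
    (hT : ∀ x : Fin (d + 1) → ℝ, 0 ≤ x 0 → ∀ t k, 0 ≤ k → |u x (t + k) - u x t| ≤ T * k)
    {x : Fin (d + 1) → ℝ} (hx : 0 < x 0) (j : Fin (d + 1)) (t : ℝ) {k : ℝ} (hk : 0 ≤ k) :
    |D j x (t + k) - D j x t| ≤ 12 * T * (d + 1) / x 0 * k := by
  rcases hk.eq_or_lt with rfl | hk0
  · simp
  have h1 := abs_deriv_le_of_two_point (z := fun x t => u x (t + k) - u x t)
    (S := T * k) (x := x) (t := t) (j := j) ((h.caloric.delay k).sub h.caloric)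
    ((continuousOn_delay h.cont k).sub h.cont) (by positivity)
    (fun y hy s => hT y hy s k hk) hx ((h.dD x hx (t + k) j).sub (h.dD x hx t j))
  refine h1.trans_eq ?_
  ring

theorem abs_ut_two_point_le (h : HalfSol d q M u D DD ut) {T : ℝ} (hT0 : 0 < T)
    (hT : ∀ x : Fin (d + 1) → ℝ, 0 ≤ x 0 → ∀ t k, 0 ≤ k → |u x (t + k) - u x t| ≤ T * k)
    {x : Fin (d + 1) → ℝ} (hx : 0 < x 0) (j : Fin (d + 1)) (t : ℝ) {ξ : ℝ} (hξ : 0 ≤ ξ)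
    (hp : 0 < slide j ξ x 0) (hn : 0 < slide j (-ξ) x 0) :
    |ut (slide j ξ x) t - ut (slide j (-ξ) x) t| ≤ 12 * T * (d + 1) / x 0 * ξ := by
  rcases le_total ξ (x 0 / 3) with hs | hs
  · have hd : ∀ {y : Fin (d + 1) → ℝ}, 0 < y 0 →
        HasDerivAt (fun k => u y (t + k)) (ut y t) 0 := fun {y} hy =>
      HasDerivAt.comp_const_add t 0 (by simpa using h.dT y hy t)
    refine abs_le_of_abs_sub_le ((hd hp).sub (hd hn)) ?_
    filter_upwards [self_mem_nhdsWithin] with k hk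
    have hk0 : (0 : ℝ) < k := hk
    have h1 := abs_two_point_le (z := fun x t => u x (t + k) - u x t) (S := T * k) (x := x)
      (R := x 0 / 3) (ξ := ξ) ((h.caloric.delay k).sub h.caloric)
      ((continuousOn_delay h.cont k).sub h.cont) (by positivity)
      (fun y hy s => hT y hy s k hk0.le) (by positivity) (by linarith) hξ hs j t
    simp only [Pi.sub_apply, add_zero]
    refine (le_of_eq ?_).trans (h1.trans_eq ?_)
    · congr 1; ring
    · field_simp; ring
  · have h1 := h.abs_ut_le hT hp t
    have h2 := h.abs_ut_le hT hn t
    have h3 : 2 * T ≤ 12 * T * (d + 1) / x 0 * ξ := by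
      calc 2 * T ≤ 4 * T * (d + 1) := by nlinarith [mul_nonneg hT0.le (d.cast_nonneg : (0:ℝ) ≤ d)]
        _ = 12 * T * (d + 1) / x 0 * (x 0 / 3) := by field_simp; ring
        _ ≤ _ := by gcongr
    exact (abs_sub _ _).trans (by linarith)

end HalfSol

theorem continuous_of_forward_lipschitz {f : ℝ → ℝ} {C : ℝ}
    (h : ∀ t k, 0 ≤ k → |f (t + k) - f t| ≤ C * k) : Continuous f := by
  have : LipschitzWith C.toNNReal f := by
    refine LipschitzWith.of_le_add_mul' C fun s t => ?_
    rw [Real.dist_eq]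
    rcases le_total t s with hst | hst
    · have := (le_abs_self _).trans (h t (s - t) (by linarith))
      rw [add_sub_cancel] at this
      rw [abs_of_nonneg (sub_nonneg.2 hst)]; linarith
    · have := (neg_abs_le _).trans' (neg_le_neg (h s (t - s) (by linarith)))
      rw [add_sub_cancel] at this
      rw [abs_of_nonpos (sub_nonpos.2 hst)]; linarith
  exact this.continuous

section ThreeVariables

variable {F Fx Fr Ft : ℝ → ℝ → ℝ → ℝ} {C : ℝ}

theorem continuousOn_of_lipschitz
    (hX : ∀ x x' r t, 0 < x → x ≤ x' → |F x' r t - F x r t| ≤ C / x * (x' - x))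
    (hR : ∀ x r r' t, 0 < x → r ≤ r' → |F x r' t - F x r t| ≤ C / x * (r' - r))
    (hT : ∀ x r, 0 < x → Continuous (F x r)) :
    ContinuousOn (fun p : ℝ × ℝ × ℝ => F p.1 p.2.1 p.2.2) {p | 0 < p.1} := by
  rintro ⟨x₀, r₀, t₀⟩ (hx₀ : 0 < x₀)
  refine ContinuousAt.continuousWithinAt ?_
  rw [ContinuousAt, tendsto_iff_norm_sub_tendsto_zero]
  have hX' : ∀ x r t, 0 < x → |F x r t - F x₀ r t| ≤ C / min x x₀ * |x - x₀| := by
    intro x r t hx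
    rcases le_total x x₀ with h | h
    · rw [abs_sub_comm, min_eq_left h, abs_sub_comm x, abs_of_nonneg (sub_nonneg.2 h)]
      exact hX x x₀ r t hx h
    · rw [min_eq_right h, abs_of_nonneg (sub_nonneg.2 h)]
      exact hX x₀ x r t hx₀ h
  have hR' : ∀ r t, |F x₀ r t - F x₀ r₀ t| ≤ C / x₀ * |r - r₀| := by
    intro r t
    rcases le_total r r₀ with h | h
    · rw [abs_sub_comm, abs_sub_comm r, abs_of_nonneg (sub_nonneg.2 h)]
      exact hR x₀ r r₀ t hx₀ h
    · rw [abs_of_nonneg (sub_nonneg.2 h)]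
      exact hR x₀ r₀ r t hx₀ h
  have hlim : Tendsto (fun p : ℝ × ℝ × ℝ => C / min p.1 x₀ * |p.1 - x₀| + C / x₀ * |p.2.1 - r₀|
      + |F x₀ r₀ p.2.2 - F x₀ r₀ t₀|) (𝓝 (x₀, r₀, t₀)) (𝓝 0) := by
    have hc : ContinuousAt (fun p : ℝ × ℝ × ℝ => C / min p.1 x₀ * |p.1 - x₀|
        + C / x₀ * |p.2.1 - r₀| + |F x₀ r₀ p.2.2 - F x₀ r₀ t₀|) (x₀, r₀, t₀) := by
      have h1 : ContinuousAt (fun p : ℝ × ℝ × ℝ => C / min p.1 x₀) (x₀, r₀, t₀) :=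
        continuousAt_const.div (by fun_prop) (by simpa using hx₀.ne')
      have h2 : Continuous fun p : ℝ × ℝ × ℝ => F x₀ r₀ p.2.2 := (hT x₀ r₀ hx₀).comp (by fun_prop)
      exact ((h1.mul (by fun_prop)).add (by fun_prop)).add
        ((h2.sub continuous_const).abs.continuousAt)
    simpa [ContinuousAt] using hc
  refine squeeze_zero' (Eventually.of_forall fun _ => norm_nonneg _) ?_ hlim
  filter_upwards [continuous_fst.continuousAt.preimage_mem_nhds (lt_mem_nhds hx₀)] with p hp
  rw [Real.norm_eq_abs]
  have h1 := abs_le.1 (hX' p.1 p.2.1 p.2.2 hp)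
  have h2 := abs_le.1 (hR' p.2.1 p.2.2)
  have h3 := abs_le.1 (le_refl |F x₀ r₀ p.2.2 - F x₀ r₀ t₀|)
  exact abs_le.2 ⟨by linarith [h1.1, h2.1, h3.1], by linarith [h1.2, h2.2, h3.2]⟩

theorem hasDerivAt_of_partial
    (hx : ∀ x, 0 < x → ∀ r t, HasDerivAt (fun y => F y r t) (Fx x r t) x)
    (hr : ∀ x, 0 < x → ∀ r t, HasDerivAt (fun y => F x y t) (Fr x r t) r)
    (ht : ∀ x, 0 < x → ∀ r t, HasDerivAt (F x r) (Ft x r t) t)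
    (cx : ContinuousOn (fun p : ℝ × ℝ × ℝ => Fx p.1 p.2.1 p.2.2) {p | 0 < p.1})
    (cr : ContinuousOn (fun p : ℝ × ℝ × ℝ => Fr p.1 p.2.1 p.2.2) {p | 0 < p.1})
    (ct : ContinuousOn (fun p : ℝ × ℝ × ℝ => Ft p.1 p.2.1 p.2.2) {p | 0 < p.1})
    {X R S : ℝ → ℝ} {X' R' S' s : ℝ} (hs : 0 < X s) (hX : HasDerivAt X X' s)
    (hR : HasDerivAt R R' s) (hS : HasDerivAt S S' s) :
    HasDerivAt (fun τ => F (X τ) (R τ) (S τ))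
      (Fx (X s) (R s) (S s) * X' + Fr (X s) (R s) (S s) * R' + Ft (X s) (R s) (S s) * S') s := by
  have hcts : Continuous fun c : ℝ => ContinuousLinearMap.toSpanSingleton ℝ c :=
    (ContinuousLinearMap.toSpanSingletonCLE (𝕜 := ℝ) (E := ℝ)).continuous
  have hop : ∀ p : ℝ × ℝ × ℝ, 0 < p.1 → {p : ℝ × ℝ × ℝ | 0 < p.1} ∈ 𝓝 p := fun p hp =>
    (isOpen_lt continuous_const continuous_fst).mem_nhds hp
  have hsec : ∀ {H : ℝ → ℝ → ℝ → ℝ},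
      ContinuousOn (fun p : ℝ × ℝ × ℝ => H p.1 p.2.1 p.2.2) {p | 0 < p.1} →
      ∀ x, 0 < x → Continuous fun p : ℝ × ℝ => H x p.1 p.2 := fun hH x hx =>
    hH.comp_continuous (f := fun p : ℝ × ℝ => (x, p.1, p.2)) (by fun_prop) fun _ => hx
  let f₂ : ℝ → ℝ × ℝ → (ℝ × ℝ →L[ℝ] ℝ) := fun x p =>
    (ContinuousLinearMap.toSpanSingleton ℝ (Fr x p.1 p.2)).coprod
      (ContinuousLinearMap.toSpanSingleton ℝ (Ft x p.1 p.2))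
  have inner : ∀ x, 0 < x → ∀ p : ℝ × ℝ,
      HasFDerivAt (fun p : ℝ × ℝ => F x p.1 p.2) (f₂ x p) p := fun x h0 p =>
    (hasStrictFDerivAt_uncurry_coprod (f := F x)
      (f₁ := fun r t => ContinuousLinearMap.toSpanSingleton ℝ (Fr x r t))
      (f₂ := fun r t => ContinuousLinearMap.toSpanSingleton ℝ (Ft x r t)) (u := p)
      (Eventually.of_forall fun v => (hr x h0 v.1 v.2).hasFDerivAt)
      (Eventually.of_forall fun v => (ht x h0 v.1 v.2).hasFDerivAt)
      (hcts.comp (hsec cr x h0)).continuousAt (hcts.comp (hsec ct x h0)).continuousAt).hasFDerivAt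
  have outer := (hasStrictFDerivAt_uncurry_coprod (f := fun x (p : ℝ × ℝ) => F x p.1 p.2)
      (f₁ := fun x p => ContinuousLinearMap.toSpanSingleton ℝ (Fx x p.1 p.2))
      (f₂ := f₂) (u := (X s, R s, S s))
      (by filter_upwards [hop (X s, R s, S s) hs] with v hv using (hx v.1 hv v.2.1 v.2.2).hasFDerivAt)
      (by filter_upwards [hop (X s, R s, S s) hs] with v hv using inner v.1 hv v.2)
      (hcts.continuousAt.comp (cx.continuousAt (hop (X s, R s, S s) hs)))
      (by
        have e1 := hcts.continuousAt.comp (cr.continuousAt (hop (X s, R s, S s) hs))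
        have e2 := hcts.continuousAt.comp (ct.continuousAt (hop (X s, R s, S s) hs))
        exact (ContinuousLinearMap.coprodEquivL ℝ (𝕜 := ℝ) (E := ℝ) (F := ℝ)
          (G := ℝ)).continuous.continuousAt.comp (e1.prodMk e2))).hasFDerivAt
  refine (outer.comp_hasDerivAt s (hX.prodMk (hR.prodMk hS))).congr_deriv ?_
  change X' * Fx (X s) (R s) (S s) + (R' * Fr (X s) (R s) (S s) + S' * Ft (X s) (R s) (S s)) = _
  ring

end ThreeVariables

theorem HasDerivAt.of_comp_add {f : ℝ → ℝ} {D x : ℝ} (h : HasDerivAt (fun τ => f (x + τ)) D 0) :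
    HasDerivAt f D x := by
  have h' : HasDerivAt (fun τ => f (x + τ)) D (x - x) := by simpa using h
  simpa using HasDerivAt.comp_sub_const (f := fun τ => f (x + τ)) x x h'

namespace HalfSol

variable {d : ℕ} {q M G T : ℝ} {u ut : (Fin (d + 1) → ℝ) → ℝ → ℝ}
  {D : Fin (d + 1) → (Fin (d + 1) → ℝ) → ℝ → ℝ}
  {DD : Fin (d + 1) → Fin (d + 1) → (Fin (d + 1) → ℝ) → ℝ → ℝ}

theorem abs_ut_slide_sub_le (h : HalfSol d q M u D DD ut) (hT0 : 0 < T)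
    (hT : ∀ x : Fin (d + 1) → ℝ, 0 ≤ x 0 → ∀ t k, 0 ≤ k → |u x (t + k) - u x t| ≤ T * k)
    {x : Fin (d + 1) → ℝ} (hx : 0 < x 0) (j : Fin (d + 1)) (t : ℝ) {k : ℝ} (hk : 0 ≤ k) :
    |ut (slide j k x) t - ut x t| ≤ 12 * T * (d + 1) / x 0 * k := by
  have hn : ∀ τ, 0 ≤ τ → x 0 ≤ slide j τ x 0 := fun τ hτ => by
    rw [slide_apply]; split_ifs <;> linarith
  have hk2 : 0 ≤ k / 2 := by linarith
  have h1 := h.abs_ut_two_point_le hT0 hT (hx.trans_le (hn _ hk2)) j t hk2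
    (by rw [slide_slide, add_halves]; exact hx.trans_le (hn k hk))
    (by simpa [slide_slide] using hx)
  rw [slide_slide, slide_slide, add_halves, add_neg_cancel, slide_zero] at h1
  refine h1.trans ?_
  gcongr
  · exact hn _ hk2
  · linarith

theorem continuous_D_time (h : HalfSol d q M u D DD ut) (hT0 : 0 < T)
    (hT : ∀ x : Fin (d + 1) → ℝ, 0 ≤ x 0 → ∀ t k, 0 ≤ k → |u x (t + k) - u x t| ≤ T * k)
    {x : Fin (d + 1) → ℝ} (hx : 0 < x 0) (j : Fin (d + 1)) : Continuous (D j x) :=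
  continuous_of_forward_lipschitz fun t _ hk => h.abs_D_time_sub_le hT0 hT hx j t hk

/-- The one-dimensional problem is a reduced problem that does not depend on the radius. -/
theorem redSol_line {u ut : (Fin (0 + 1) → ℝ) → ℝ → ℝ} {D : Fin (0 + 1) → (Fin (0 + 1) → ℝ) → ℝ → ℝ}
    {DD : Fin (0 + 1) → Fin (0 + 1) → (Fin (0 + 1) → ℝ) → ℝ → ℝ}
    (h : HalfSol 0 q M u D DD ut) (hq : 1 < q) :
    ∃ L, RedSol 0 q M L (fun x _ t => u (slide 0 x 0) t) (fun x _ t => D 0 (slide 0 x 0) t)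
      (fun _ _ _ => 0) (fun x _ t => DD 0 0 (slide 0 x 0) t) (fun _ _ _ => 0) (fun _ _ _ => 0)
      (fun x _ t => ut (slide 0 x 0) t) (fun _ t => u 0 t) (fun _ _ => 0) := by
  obtain ⟨G, hG0, hG⟩ := h.exists_gradient_bound hq
  obtain ⟨T, hT0, hT⟩ := h.exists_time_lipschitz hq
  have hp : ∀ x : ℝ, slide (0 : Fin (0 + 1)) x 0 0 = x := fun x => by simp
  have hpc : Continuous fun x : ℝ => slide (0 : Fin (0 + 1)) x 0 :=
    Continuous.slide 0 continuous_id continuous_const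
  have hadd : ∀ x k : ℝ,
      slide (0 : Fin (0 + 1)) k (slide 0 x 0) = slide 0 (x + k) 0 := fun x k => slide_slide _ _ _ _
  have hsub : ∀ x x' : ℝ,
      slide (0 : Fin (0 + 1)) x' 0 = slide 0 (x' - x) (slide 0 x 0) := fun x x' => by
    rw [hadd, add_sub_cancel]
  have hd : ∀ x : ℝ, 0 < x → ∀ t,
      HasDerivAt (fun y => u (slide 0 y 0) t) (D 0 (slide 0 x 0) t) x := fun x hx t => by
    refine HasDerivAt.of_comp_add ?_
    simpa only [hadd] using h.dD (slide 0 x 0) (by rwa [hp]) t 0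
  have hcX : ContinuousOn (fun p : ℝ × ℝ × ℝ => D 0 (slide 0 p.1 0) p.2.2) {p | 0 < p.1} := by
    refine continuousOn_of_lipschitz (C := 12 * G * ((0 : ℕ) + 1))
      (F := fun x _ t => D 0 (slide 0 x 0) t) (fun x x' r t hx hxx => ?_)
      (fun x r r' t hx hr => ?_)
      fun x r hx => h.continuous_D_time hT0 hT (by rwa [hp]) 0
    · have := h.abs_D_slide_sub_le hG0 hG (x := slide 0 x 0) (by rwa [hp])
        (sub_nonneg.2 hxx) 0 0 t
      rwa [← hsub, hp] at this
    · rw [sub_self, abs_zero]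
      have := sub_nonneg.2 hr
      positivity
  have hcT : ContinuousOn (fun p : ℝ × ℝ × ℝ => ut (slide 0 p.1 0) p.2.2) {p | 0 < p.1} := by
    refine continuousOn_of_lipschitz (C := 12 * T * ((0 : ℕ) + 1))
      (F := fun x _ t => ut (slide 0 x 0) t) (fun x x' r t hx hxx => ?_)
      (fun x r r' t hx hr => ?_) fun x r hx => h.contT _ (by rwa [hp])
    · have := h.abs_ut_slide_sub_le hT0 hT (x := slide 0 x 0) (by rwa [hp]) 0 t
        (sub_nonneg.2 hxx)
      rwa [← hsub, hp] at this
    · rw [sub_self, abs_zero]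
      have := sub_nonneg.2 hr
      positivity
  have hquarter : quarterTime ⊆ {p : ℝ × ℝ × ℝ | 0 < p.1} := fun p hp => hp.1
  have hlim : Tendsto (fun x : ℝ => slide (0 : Fin (0 + 1)) x 0) (𝓝[>] 0)
      (𝓝[{x | 0 ≤ x 0}] 0) := by
    refine tendsto_nhdsWithin_iff.2 ⟨?_, ?_⟩
    · simpa using (hpc.tendsto 0).mono_left nhdsWithin_le_nhds
    · filter_upwards [self_mem_nhdsWithin] with x hx
      simpa using le_of_lt hx
  refine ⟨G + T + 12 * G, ?_⟩
  refine
    { pos := fun x hx r _ t => h.pos _ (by rw [hp]; exact hx.le) t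
      pos0 := fun r _ t => h.pos 0 le_rfl t
      le := fun x hx r _ t => h.le _ (by rw [hp]; exact hx.le) t
      contU := ?_
      contX := hcX.mono hquarter
      contR := continuousOn_const
      contT := hcT.mono hquarter
      contXX := fun t => (h.contDD t 0 0).comp (hpc.comp continuous_fst).continuousOn fun p hp' => by
        simpa using hp'.1
      contXR := fun t => continuousOn_const
      contRR := fun t => continuousOn_const
      chain := fun X R S X' R' S' s hX hR dX dR dS =>
        hasDerivAt_of_partial (F := fun x _ t => u (slide 0 x 0) t)
          (Fx := fun x _ t => D 0 (slide 0 x 0) t) (Fr := fun _ _ _ => 0)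
          (Ft := fun x _ t => ut (slide 0 x 0) t) (fun x hx _ t => hd x hx t)
          (fun x hx r t => hasDerivAt_const _ _)
          (fun x hx r t => h.dT _ (by rwa [hp]) t) hcX continuousOn_const hcT hX dX dR dS
      derivXX := fun x hx r _ t => HasDerivAt.of_comp_add (by
        simpa only [hadd] using h.dDD (slide 0 x 0) (by rwa [hp]) t 0 0)
      derivXR := fun x _ r _ t => hasDerivAt_const _ _
      derivRX := fun x _ r _ t => hasDerivAt_const _ _
      derivRR := fun x _ r _ t => hasDerivAt_const _ _
      heat := fun x hx r _ t => by
        rw [h.heat _ (by rwa [hp]) t]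
        simp
      boundX := fun x hx r _ t => (hG _ (by rw [hp]; exact hx.le) t 0).trans (by linarith)
      boundR := fun x _ r _ t => by rw [abs_zero]; positivity
      boundT := fun x hx r _ t => (h.abs_ut_le hT (by rwa [hp]) t).trans (by linarith)
      boundXX := fun x hx r _ t => by
        refine (h.abs_DD_le hG0 hG (x := slide 0 x 0) (by rwa [hp]) 0 0 t).trans ?_
        rw [hp]
        gcongr
        simp; linarith
      boundXR := fun x hx r _ t => by rw [abs_zero]; positivity
      boundRR := fun x hx r _ t => by rw [abs_zero]; positivity
      boundRr := fun x hx r _ t => by rw [zero_div, abs_zero]; positivity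
      limU := fun r _ t => ?_
      limX := fun r _ t => ?_
      limR := fun r _ t => tendsto_const_nhds
      derivV := fun r _ t => hasDerivAt_const _ _
      contVr := fun t => continuousOn_const }
  · refine h.cont.comp (f := fun p : ℝ × ℝ × ℝ => (slide (0 : Fin (0 + 1)) p.1 0, p.2.2))
      ((hpc.comp continuous_fst).prodMk (by fun_prop)).continuousOn fun p hp' => ?_
    simpa using le_of_lt hp'.1
  · have hc : ContinuousOn (fun x => u x t) {x | 0 ≤ x 0} :=
      h.cont.comp (f := fun x => (x, t)) (by fun_prop) fun x hx => hx
    exact (hc 0 (by simp)).tendsto.comp hlim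
  · rw [← h.normal 0 rfl t]
    exact (h.contD t 0 0 (by simp)).tendsto.comp hlim

end HalfSol

section MeridianPoint

variable {a : ℕ}

/-- The point of the meridian half-plane at height `x` and signed distance `r` from the axis. -/
def meridian (a : ℕ) (x r : ℝ) : Fin (a + 1 + 1) → ℝ := slide 0 x (slide 1 r 0)

@[simp] theorem meridian_height (x r : ℝ) : meridian a x r 0 = x := by
  rw [meridian, slide_self, slide_ne (by simp)]; simp

theorem meridian_eq_zero {i : Fin (a + 1 + 1)} (h0 : i ≠ 0) (h1 : i ≠ 1) (x r : ℝ) :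
    meridian a x r i = 0 := by
  rw [meridian, slide_ne h0, slide_ne h1]; simp

theorem slide_height_meridian (k x r : ℝ) :
    slide 0 k (meridian a x r) = meridian a (x + k) r := slide_slide _ _ _ _

theorem slide_radius_meridian (k x r : ℝ) :
    slide 1 k (meridian a x r) = meridian a x (r + k) := by
  rw [meridian, slide_comm, slide_slide, meridian]

theorem continuous_meridian : Continuous fun p : ℝ × ℝ => meridian a p.1 p.2 :=
  Continuous.slide 0 continuous_fst (Continuous.slide 1 continuous_snd continuous_const)

theorem sqDist_meridian (x r : ℝ) : sqDist 0 (meridian a x r) = r ^ 2 + x ^ 2 := by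
  rw [meridian, sqDist_slide, sqDist_slide, slide_ne (by simp)]
  simp

end MeridianPoint

namespace HalfSol

variable {a : ℕ} {q M G T : ℝ} {u ut : (Fin (a + 1 + 1) → ℝ) → ℝ → ℝ}
  {D : Fin (a + 1 + 1) → (Fin (a + 1 + 1) → ℝ) → ℝ → ℝ}
  {DD : Fin (a + 1 + 1) → Fin (a + 1 + 1) → (Fin (a + 1 + 1) → ℝ) → ℝ → ℝ}

theorem D_meridian_axis (h : HalfSol (a + 1) q M u D DD ut)
    (hs : ∀ x y : Fin (a + 1 + 1) → ℝ, x 0 = y 0 → sqDist 0 x = sqDist 0 y → ∀ t, u x t = u y t)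
    {x : ℝ} (hx : 0 < x) (t : ℝ) : D 1 (meridian a x 0) t = 0 := by
  have h1 := h.dD (meridian a x 0) (by simpa using hx) t 1
  simp only [slide_radius_meridian, zero_add] at h1
  refine abs_nonpos_iff.1 (abs_le_of_abs_symm_sub_le h1 (Eventually.of_forall fun ξ => ?_))
  rw [hs (meridian a x ξ) (meridian a x (-ξ)) (by simp) (by simp [sqDist_meridian])]
  simp

theorem DD_meridian (h : HalfSol (a + 1) q M u D DD ut)
    (hs : ∀ x y : Fin (a + 1 + 1) → ℝ, x 0 = y 0 → sqDist 0 x = sqDist 0 y → ∀ t, u x t = u y t)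
    {i : Fin (a + 1 + 1)} (h0 : i ≠ 0) (h1 : i ≠ 1) {x r : ℝ} (hx : 0 < x) (hr : 0 < r) (t : ℝ) :
    DD i i (meridian a x r) t = D 1 (meridian a x r) t / r := by
  have hpos : ∀ τ, 0 < r ^ 2 + τ ^ 2 := fun τ => by positivity
  have hρ : ∀ τ, HasDerivAt (fun τ => √(r ^ 2 + τ ^ 2)) (τ / √(r ^ 2 + τ ^ 2)) τ := fun τ => by
    refine (((hasDerivAt_pow 2 τ).const_add (r ^ 2)).sqrt (hpos τ).ne').congr_deriv ?_
    field_simp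
    simp
  have hρ0 : √(r ^ 2 + (0 : ℝ) ^ 2) = r := by simp [Real.sqrt_sq hr.le]
  have hrad : ∀ {f : (Fin (a + 1 + 1) → ℝ) → ℝ} {E s : ℝ},
      HasDerivAt (fun k => f (slide 1 k (meridian a x s))) E 0 →
      HasDerivAt (fun s => f (meridian a x s)) E s := fun hf => by
    simp only [slide_radius_meridian] at hf
    exact HasDerivAt.of_comp_add hf
  have hD : ∀ τ, D i (slide i τ (meridian a x r)) t
      = D 1 (meridian a x √(r ^ 2 + τ ^ 2)) t / √(r ^ 2 + τ ^ 2) * τ := fun τ => by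
    have e1 : HasDerivAt (fun τ => u (slide i τ (meridian a x r)) t)
        (D i (slide i τ (meridian a x r)) t) τ :=
      hasDerivAt_slide (f := fun y => u y t)
        (h.dD _ (by rw [slide_ne h0.symm]; simpa using hx) t i)
    have e2 : HasDerivAt (fun s => u (meridian a x s) t)
        (D 1 (meridian a x √(r ^ 2 + τ ^ 2)) t) √(r ^ 2 + τ ^ 2) :=
      hrad (f := fun y => u y t) (h.dD _ (by simpa using hx) t 1)
    have e3 := e2.comp τ (hρ τ)
    have e4 : (fun τ => u (slide i τ (meridian a x r)) t)
        = (fun s => u (meridian a x s) t) ∘ fun τ => √(r ^ 2 + τ ^ 2) := by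
      funext τ
      refine hs _ _ (by rw [slide_ne h0.symm]; simp) ?_ t
      rw [sqDist_slide, sqDist_meridian, sqDist_meridian, meridian_eq_zero h0 h1,
        Real.sq_sqrt (hpos τ).le]
      simp; ring
    rw [e4] at e1
    rw [e1.unique e3]; ring
  have hm : HasDerivAt (fun s => D 1 (meridian a x s) t) (DD 1 1 (meridian a x r) t) r :=
    hrad (f := fun y => D 1 y t) (h.dDD _ (by simpa using hx) t 1 1)
  have e5 := h.dDD (meridian a x r) (by simpa using hx) t i i
  simp only [hD] at e5
  have hρ' := hρ 0
  have e6 : HasDerivAt (fun τ => D 1 (meridian a x √(r ^ 2 + τ ^ 2)) t) _ 0 :=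
    HasDerivAt.comp (h₂ := fun s => D 1 (meridian a x s) t) 0 (by rw [hρ0]; exact hm) hρ'
  have e7 := (e6.div hρ' (by rw [hρ0]; exact hr.ne')).mul (hasDerivAt_id 0)
  rw [e5.unique e7]
  simp [Real.sqrt_sq hr.le]

/-- An axially symmetric solution solves the reduced problem in the meridian quarter-plane. -/
theorem redSol_meridian (h : HalfSol (a + 1) q M u D DD ut) (hq : 1 < q)
    (hs : ∀ x y : Fin (a + 1 + 1) → ℝ, x 0 = y 0 → sqDist 0 x = sqDist 0 y →
      ∀ t, u x t = u y t) :
    ∃ L, RedSol a q M L (fun x r t => u (meridian a x r) t) (fun x r t => D 0 (meridian a x r) t)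
      (fun x r t => D 1 (meridian a x r) t) (fun x r t => DD 0 0 (meridian a x r) t)
      (fun x r t => DD 0 1 (meridian a x r) t) (fun x r t => DD 1 1 (meridian a x r) t)
      (fun x r t => ut (meridian a x r) t) (fun r t => u (meridian a 0 r) t)
      (fun r t => D 1 (meridian a 0 r) t) := by
  obtain ⟨G, hG0, hG⟩ := h.exists_gradient_bound hq
  obtain ⟨T, hT0, hT⟩ := h.exists_time_lipschitz hq
  have hp : ∀ {x : ℝ}, 0 < x → ∀ r, 0 < meridian a x r 0 := fun hx r => by simpa using hx
  have hp' : ∀ {x : ℝ}, 0 < x → ∀ r, 0 ≤ meridian a x r 0 := fun hx r => (hp hx r).le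
  have hheight : ∀ {f : (Fin (a + 1 + 1) → ℝ) → ℝ} {E x r : ℝ},
      HasDerivAt (fun k => f (slide 0 k (meridian a x r))) E 0 →
      HasDerivAt (fun y => f (meridian a y r)) E x := fun hf => by
    simp only [slide_height_meridian] at hf
    exact HasDerivAt.of_comp_add hf
  have hrad : ∀ {f : (Fin (a + 1 + 1) → ℝ) → ℝ} {E x r : ℝ},
      HasDerivAt (fun k => f (slide 1 k (meridian a x r))) E 0 →
      HasDerivAt (fun y => f (meridian a x y)) E r := fun hf => by
    simp only [slide_radius_meridian] at hf
    exact HasDerivAt.of_comp_add hf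
  have hlip : ∀ {f : (Fin (a + 1 + 1) → ℝ) → ℝ → ℝ} {C : ℝ},
      (∀ x, 0 < x 0 → ∀ i t k, 0 ≤ k → |f (slide i k x) t - f x t| ≤ C / x 0 * k) →
      (∀ x, 0 < x 0 → Continuous (f x)) →
      ContinuousOn (fun p : ℝ × ℝ × ℝ => f (meridian a p.1 p.2.1) p.2.2) {p | 0 < p.1} := by
    intro f C h1 h2
    refine continuousOn_of_lipschitz (C := C) (F := fun x r t => f (meridian a x r) t)
      (fun x x' r t hx hxx => ?_) (fun x r r' t hx hr => ?_) fun x r hx => h2 _ (hp hx r)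
    · have := h1 _ (hp hx r) 0 t _ (sub_nonneg.2 hxx)
      rwa [slide_height_meridian, add_sub_cancel, meridian_height] at this
    · have := h1 _ (hp hx r) 1 t _ (sub_nonneg.2 hr)
      rwa [slide_radius_meridian, add_sub_cancel, meridian_height] at this
  have hcD : ∀ j, ContinuousOn (fun p : ℝ × ℝ × ℝ => D j (meridian a p.1 p.2.1) p.2.2)
      {p | 0 < p.1} := fun j =>
    hlip (fun x hx i t k hk => h.abs_D_slide_sub_le hG0 hG hx hk i j t)
      fun x hx => h.continuous_D_time hT0 hT hx j
  have hcT : ContinuousOn (fun p : ℝ × ℝ × ℝ => ut (meridian a p.1 p.2.1) p.2.2) {p | 0 < p.1} :=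
    hlip (fun x hx i t k hk => h.abs_ut_slide_sub_le hT0 hT hx i t hk) h.contT
  have hquarter : quarterTime ⊆ {p : ℝ × ℝ × ℝ | 0 < p.1} := fun p hp => hp.1
  have hlim : ∀ r, Tendsto (fun x : ℝ => meridian a x r) (𝓝[>] 0)
      (𝓝[{x | 0 ≤ x 0}] (meridian a 0 r)) := fun r => by
    refine tendsto_nhdsWithin_iff.2 ⟨?_, ?_⟩
    · exact ((continuous_meridian.comp (Continuous.prodMk_left r)).tendsto 0).mono_left
        nhdsWithin_le_nhds
    · filter_upwards [self_mem_nhdsWithin] with x hx using hp' hx r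
  have hDD : ∀ i j {x : ℝ}, 0 < x → ∀ r t,
      |DD j i (meridian a x r) t| ≤ (G + T + 12 * G * ((a + 1 : ℕ) + 1)) / x := by
    intro i j x hx r t
    refine (h.abs_DD_le hG0 hG (hp hx r) i j t).trans ?_
    rw [meridian_height]
    gcongr
    linarith
  have hDC : ∀ i j t, ContinuousOn (fun p : ℝ × ℝ => DD i j (meridian a p.1 p.2) t) quarter :=
    fun i j t => (h.contDD t i j).comp continuous_meridian.continuousOn fun p hp0 => hp hp0.1 _
  have hGL : G ≤ G + T + 12 * G * ((a + 1 : ℕ) + 1) := by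
    have : 0 ≤ 12 * G * ((a + 1 : ℕ) + 1) := by positivity
    linarith
  have hTL : T ≤ G + T + 12 * G * ((a + 1 : ℕ) + 1) := by
    have : 0 ≤ 12 * G * ((a + 1 : ℕ) + 1) := by positivity
    linarith
  have h10 : (1 : Fin (a + 1 + 1)) ≠ 0 := by simp
  refine ⟨G + T + 12 * G * ((a + 1 : ℕ) + 1), ?_⟩
  refine
    { pos := fun x hx r _ t => h.pos _ (hp' hx r) t
      pos0 := fun r _ t => h.pos _ (by simp) t
      le := fun x hx r _ t => h.le _ (hp' hx r) t
      contU := ?_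
      contX := (hcD 0).mono hquarter
      contR := (hcD 1).mono hquarter
      contT := hcT.mono hquarter
      contXX := hDC 0 0
      contXR := hDC 0 1
      contRR := hDC 1 1
      chain := fun X R S X' R' S' s hX _ dX dR dS =>
        hasDerivAt_of_partial (F := fun x r t => u (meridian a x r) t)
          (Fx := fun x r t => D 0 (meridian a x r) t) (Fr := fun x r t => D 1 (meridian a x r) t)
          (Ft := fun x r t => ut (meridian a x r) t)
          (fun x hx r t => hheight (f := fun y => u y t) (h.dD _ (hp hx r) t 0))
          (fun x hx r t => hrad (f := fun y => u y t) (h.dD _ (hp hx r) t 1))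
          (fun x hx r t => h.dT _ (hp hx r) t) (hcD 0) (hcD 1) hcT hX dX dR dS
      derivXX := fun x hx r _ t => hheight (f := fun y => D 0 y t) (h.dDD _ (hp hx r) t 0 0)
      derivXR := fun x hx r _ t => hrad (f := fun y => D 0 y t) (h.dDD _ (hp hx r) t 0 1)
      derivRX := fun x hx r _ t => by
        rw [h.symm _ (hp hx r) t 0 1]
        exact hheight (f := fun y => D 1 y t) (h.dDD _ (hp hx r) t 1 0)
      derivRR := fun x hx r _ t => hrad (f := fun y => D 1 y t) (h.dDD _ (hp hx r) t 1 1)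
      heat := fun x hx r hr t => ?_
      boundX := fun x hx r _ t => (hG _ (hp' hx r) t 0).trans hGL
      boundR := fun x hx r _ t => (hG _ (hp' hx r) t 1).trans hGL
      boundT := fun x hx r _ t => (h.abs_ut_le hT (hp hx r) t).trans hTL
      boundXX := fun x hx r _ t => hDD 0 0 hx r t
      boundXR := fun x hx r _ t => hDD 1 0 hx r t
      boundRR := fun x hx r _ t => hDD 1 1 hx r t
      boundRr := fun x hx r hr t => ?_
      limU := fun r _ t => ?_
      limX := fun r _ t => ?_
      limR := fun r _ t => (h.contD t 1 _ (by simp)).tendsto.comp (hlim r)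
      derivV := fun r _ t => hrad (f := fun y => u y t) (h.tang _ (by simp) t 1 h10)
      contVr := fun t => (h.contD t 1).comp
        (continuous_meridian.comp (Continuous.prodMk_right 0)).continuousOn fun r _ => by simp }
  · refine h.cont.comp (f := fun p : ℝ × ℝ × ℝ => (meridian a p.1 p.2.1, p.2.2))
      ((continuous_meridian.comp (by fun_prop : Continuous fun p : ℝ × ℝ × ℝ =>
        (p.1, p.2.1))).prodMk (by fun_prop)).continuousOn fun p hp0 => hp' hp0.1 _
  · rw [h.heat _ (hp hx r) t, Fin.sum_univ_succ, Fin.sum_univ_succ, Finset.sum_congr rfl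
      fun (k : Fin a) _ => h.DD_meridian hs (i := k.succ.succ) (Fin.succ_ne_zero _)
        (fun hk => Fin.succ_ne_zero k (Fin.succ_injective _ hk)) hx hr t]
    simp only [Fin.succ_zero_eq_one, Finset.sum_const, Finset.card_univ, Fintype.card_fin,
      nsmul_eq_mul]
    ring
  · have h1 := h.abs_D_slide_sub_le hG0 hG (hp hx 0) hr.le 1 1 t
    rw [slide_radius_meridian, zero_add, h.D_meridian_axis hs hx, sub_zero, meridian_height] at h1
    rw [abs_div, abs_of_pos hr, div_le_iff₀ hr]
    refine h1.trans ?_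
    gcongr
    linarith
  · have hc : ContinuousOn (fun x => u x t) {x | 0 ≤ x 0} :=
      h.cont.comp (f := fun x => (x, t)) (by fun_prop) fun x hx => hx
    exact (hc _ (by simp)).tendsto.comp (hlim r)
  · rw [← h.normal _ (meridian_height 0 r) t]
    exact (h.contD t 0 _ (by simp)).tendsto.comp (hlim r)

end HalfSol

theorem toLp_slide {N : ℕ} (i : Fin N) (τ : ℝ) (x : Fin N → ℝ) :
    WithLp.toLp 2 (slide i τ x) = WithLp.toLp 2 x + τ • EuclideanSpace.single i (1 : ℝ) := by
  ext k
  by_cases hk : k = i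
  · subst hk; simp
  · simp [slide_ne hk, hk]

theorem hasDerivAt_toLp_slide {N : ℕ} (i : Fin N) (x : Fin N → ℝ) :
    HasDerivAt (fun τ => WithLp.toLp 2 (slide i τ x)) (EuclideanSpace.single i (1 : ℝ)) 0 := by
  simp only [toLp_slide]
  simpa using ((hasDerivAt_id (0 : ℝ)).smul_const (EuclideanSpace.single i (1 : ℝ))).const_add
    (WithLp.toLp 2 x)

section HalfSpace

variable {d : ℕ} (hn : 0 < d + 1)

theorem isOpen_openHalf : IsOpen (openHalf (d + 1) hn) :=
  isOpen_lt continuous_const (by fun_prop)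

theorem openHalf_subset_closedHalf : openHalf (d + 1) hn ⊆ closedHalf (d + 1) hn :=
  fun x (hx : 0 < x ⟨0, hn⟩) => hx.le

theorem closedHalf_mem_nhds {x : EuclideanSpace ℝ (Fin (d + 1))} (hx : x ∈ openHalf (d + 1) hn) :
    closedHalf (d + 1) hn ∈ 𝓝 x :=
  mem_of_superset ((isOpen_openHalf hn).mem_nhds hx) (openHalf_subset_closedHalf hn)

theorem IsHalfSpaceSol.halfSol {q M : ℝ} {u : EuclideanSpace ℝ (Fin (d + 1)) × ℝ → ℝ}
    (h : IsHalfSpaceSol (d + 1) hn q u)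
    (hM : ∀ x ∈ closedHalf (d + 1) hn, ∀ t, u (x, t) ≤ M) :
    HalfSol d q M (fun x t => u (WithLp.toLp 2 x, t))
      (fun i x t => fderivWithin ℝ (fun y => u (y, t)) (closedHalf (d + 1) hn) (WithLp.toLp 2 x)
        (EuclideanSpace.single i 1))
      (fun i j x t => fderiv ℝ (fun y => fderiv ℝ (fun y => u (y, t)) y
        (EuclideanSpace.single i 1)) (WithLp.toLp 2 x) (EuclideanSpace.single j 1))
      (fun x t => deriv (fun s => u (WithLp.toLp 2 x, s)) t) := by
  obtain ⟨hcont, hC1, hgrad, hC2, htime, hheat, hbd, hpos⟩ := h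
  have hL : Continuous fun x : Fin (d + 1) → ℝ => (WithLp.toLp 2 x : EuclideanSpace ℝ _) :=
    PiLp.continuous_toLp 2 _
  have hopen : ∀ {x : Fin (d + 1) → ℝ}, 0 < x 0 → WithLp.toLp 2 x ∈ openHalf (d + 1) hn :=
    fun hx => hx
  have hclosed : ∀ {x : Fin (d + 1) → ℝ}, 0 ≤ x 0 → WithLp.toLp 2 x ∈ closedHalf (d + 1) hn :=
    fun hx => hx
  have hC2at : ∀ {x : Fin (d + 1) → ℝ}, 0 < x 0 → ∀ t,
      ContDiffAt ℝ 2 (fun y => u (y, t)) (WithLp.toLp 2 x) := fun hx t =>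
    (hC2 t).contDiffAt ((isOpen_openHalf hn).mem_nhds (hopen hx))
  have hfd : ∀ t, ContDiffOn ℝ 1 (fderiv ℝ fun y => u (y, t)) (openHalf (d + 1) hn) := fun t =>
    (hC2 t).fderiv_of_isOpen (isOpen_openHalf hn) (by norm_num)
  have hfdi : ∀ t (i : Fin (d + 1)), ContDiffOn ℝ 1
      (fun y => fderiv ℝ (fun y => u (y, t)) y (EuclideanSpace.single i 1))
      (openHalf (d + 1) hn) := fun t i => (hfd t).clm_apply contDiffOn_const
  have hdiff : ∀ {x : Fin (d + 1) → ℝ}, 0 ≤ x 0 → ∀ t,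
      HasFDerivWithinAt (fun y => u (y, t))
        (fderivWithin ℝ (fun y => u (y, t)) (closedHalf (d + 1) hn) (WithLp.toLp 2 x))
        (closedHalf (d + 1) hn) (WithLp.toLp 2 x) := fun hx t =>
    ((hC1 t).differentiableOn one_ne_zero _ (hclosed hx)).hasFDerivWithinAt
  have hnear : ∀ {x : Fin (d + 1) → ℝ}, 0 < x 0 → ∀ i : Fin (d + 1),
      ∀ᶠ τ in 𝓝 (0 : ℝ), 0 < slide i τ x 0 := fun {x} hx i => by
    have hc : ContinuousAt (fun τ => slide i τ x 0) 0 :=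
      ((continuous_apply 0).comp (Continuous.slide i continuous_id continuous_const)).continuousAt
    exact hc.preimage_mem_nhds (lt_mem_nhds (by simpa using hx))
  refine
    { cont := hcont.comp (f := fun p : (Fin (d + 1) → ℝ) × ℝ => (WithLp.toLp 2 p.1, p.2))
        ((hL.comp continuous_fst).prodMk continuous_snd).continuousOn fun p hp =>
          ⟨hclosed hp, mem_univ _⟩
      pos := fun x hx t => hpos _ (hclosed hx) t
      le := fun x hx t => hM _ (hclosed hx) t
      dD := fun x hx t i => ?_
      dDD := fun x hx t i j => ?_
      symm := fun x hx t i j => ?_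
      contD := fun t i => ?_
      contDD := fun t i j => ?_
      dT := fun x hx t => ((htime _ (hopen hx)).differentiable one_ne_zero t).hasDerivAt
      contT := fun x hx => (htime _ (hopen hx)).continuous_deriv le_rfl
      heat := fun x hx t => hheat _ (hopen hx) t
      bdry := fun x hx t => ?_
      normal := fun x hx t => by rw [← hbd _ hx t, neg_neg]; rfl
      tang := fun x hx t i hi => ?_ }
  · refine HasFDerivWithinAt.comp_hasDerivAt (f := fun τ => WithLp.toLp 2 (slide i τ x)) 0
      (by simpa only [slide_zero] using hdiff hx.le t) (hasDerivAt_toLp_slide i x) ?_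
    filter_upwards [hnear hx i] with τ hτ using hclosed hτ.le
  · have h1 : HasFDerivAt (fun y => fderiv ℝ (fun y => u (y, t)) y (EuclideanSpace.single i 1))
        _ (WithLp.toLp 2 (slide j 0 x)) :=
      (((hfdi t i).contDiffAt ((isOpen_openHalf hn).mem_nhds (hopen (x := slide j 0 x)
        (by simpa using hx)))).differentiableAt one_ne_zero).hasFDerivAt
    have h2 := h1.comp_hasDerivAt 0 (hasDerivAt_toLp_slide j x)
    rw [slide_zero] at h2
    refine h2.congr_of_eventuallyEq ?_
    filter_upwards [hnear hx j] with τ hτ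
    rw [fderivWithin_of_mem_nhds (closedHalf_mem_nhds hn (hopen hτ))]
    rfl
  · have hdf := ((hfd t).contDiffAt
      ((isOpen_openHalf hn).mem_nhds (hopen hx))).differentiableAt one_ne_zero
    have hsym := (hC2at hx t).isSymmSndFDerivAt (by simp)
    have key : ∀ i j : Fin (d + 1),
        fderiv ℝ (fun y => fderiv ℝ (fun y => u (y, t)) y (EuclideanSpace.single i 1))
          (WithLp.toLp 2 x) (EuclideanSpace.single j 1)
        = fderiv ℝ (fderiv ℝ fun y => u (y, t)) (WithLp.toLp 2 x) (EuclideanSpace.single j 1)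
          (EuclideanSpace.single i 1) := fun i j => by
      rw [fderiv_clm_apply hdf (differentiableAt_const _)]
      simp
    rw [key, key]
    exact hsym _ _
  · exact ((hgrad t).clm_apply continuousOn_const).comp hL.continuousOn fun x hx => hclosed hx
  · have := (hfdi t i).continuousOn_fderiv_of_isOpen (isOpen_openHalf hn) le_rfl
    exact (this.clm_apply continuousOn_const).comp hL.continuousOn fun x hx => hopen hx
  · refine HasFDerivWithinAt.comp_hasDerivWithinAt (f := fun τ => WithLp.toLp 2 (slide 0 τ x)) 0
      (by simpa only [slide_zero] using hdiff hx.ge t)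
      (hasDerivAt_toLp_slide 0 x).hasDerivWithinAt fun τ hτ => hclosed ?_
    rw [slide_self, hx, zero_add]
    exact hτ
  · refine HasFDerivWithinAt.comp_hasDerivAt (f := fun τ => WithLp.toLp 2 (slide i τ x)) 0
      (by simpa only [slide_zero] using hdiff hx.ge t) (hasDerivAt_toLp_slide i x) ?_
    refine Eventually.of_forall fun τ => hclosed ?_
    rw [slide_ne hi.symm]
    exact hx.ge

theorem AxiallySymmetric.eq_of_sqDist {u : EuclideanSpace ℝ (Fin (d + 1)) × ℝ → ℝ}
    (h : AxiallySymmetric (d + 1) hn u) (x y : Fin (d + 1) → ℝ) (h0 : x 0 = y 0)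
    (hd : sqDist 0 x = sqDist 0 y) (t : ℝ) :
    u (WithLp.toLp 2 x, t) = u (WithLp.toLp 2 y, t) := by
  refine h _ _ h0 ?_ t
  have key : ∀ x : Fin (d + 1) → ℝ,
      ∑ i ∈ Finset.univ.erase (⟨0, hn⟩ : Fin (d + 1)), x i ^ 2 = sqDist 0 x - x 0 ^ 2 := by
    intro x
    rw [eq_sub_iff_add_eq]
    simpa only [sqDist, Pi.zero_apply, sub_zero] using! Finset.sum_erase_add Finset.univ (fun i => x i ^ 2)
      (Finset.mem_univ (⟨0, hn⟩ : Fin (d + 1)))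
  have e := key x
  rw [hd, h0] at e
  exact e.trans (key y).symm

end HalfSpace

/-- Liouville theorem for axially symmetric solutions of the half-space problem
with nonlinear boundary condition: for `n ≥ 1`, `q > 1` with `(n-2)q < n`, there
is no positive bounded classical axially symmetric solution. -/
theorem no_positive_bounded_axisymmetric_halfspace_solution
    (n : ℕ) (hn : 0 < n) (q : ℝ) (hq : 1 < q)
    (hqn : ((n : ℝ) - 2) * q < (n : ℝ)) :
    ¬ ∃ u : EuclideanSpace ℝ (Fin n) × ℝ → ℝ,
        IsHalfSpaceSol n hn q u ∧
        AxiallySymmetric n hn u ∧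
        ∃ M : ℝ, ∀ x ∈ closedHalf n hn, ∀ t : ℝ, u (x, t) ≤ M := by
  rintro ⟨u, hu, hs, M, hM⟩
  obtain ⟨d, rfl⟩ := Nat.exists_eq_add_one_of_ne_zero hn.ne'
  have h := hu.halfSol hn hM
  rcases d with _ | a
  · obtain ⟨L, hL⟩ := h.redSol_line hq
    exact hL.not_exists hq (by norm_num)
  · obtain ⟨L, hL⟩ := h.redSol_meridian hq (hs.eq_of_sqDist hn)
    refine hL.not_exists hq ?_
    push_cast at hqn
    linarith
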